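/- Let d ≥ 3 and let A ⊂ ℝ^d be a compact set with dim_H A > d/2 + 5/12. Then the distance set D(A) := {|x − y| : x, y ∈ A} has positive one-dimensional Lebesgue measure. -/

import Mathlib

namespace Falconer

open MeasureTheory Metric Set Filter Topology
open scoped FourierTransform ENNReal NNReal Pointwise ComplexConjugate RealInnerProductSpace

set_option linter.unusedSectionVars false

section PaleyWiener

variable {E : Type*} [NormedAddCommGroup E] [InnerProductSpace ℝ E] [FiniteDimensional ℝ E]
  [MeasurableSpace E] [BorelSpace E]

/-- Continuous integrable functions whose Fourier transform vanishes outside `K`. -/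
structure PW (K : Set E) (u : E → ℂ) : Prop where
  cont : Continuous u
  int : Integrable u
  supp : ∀ ξ ∉ K, 𝓕 u ξ = 0

lemma fourier_add {u v : E → ℂ} (hu : Integrable u) (hv : Integrable v) (ξ : E) :
    𝓕 (u + v) ξ = 𝓕 u ξ + 𝓕 v ξ := by
  have := VectorFourier.fourierIntegral_add (e := Real.fourierChar) (μ := volume)
    (L := innerₗ E) Real.continuous_fourierChar continuous_inner hu hv
  exact (congrFun this ξ)

lemma fourier_const_mul (c : ℂ) (u : E → ℂ) (ξ : E) :
    𝓕 (fun x => c * u x) ξ = c * 𝓕 u ξ := by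
  have := VectorFourier.fourierIntegral_const_smul (Real.fourierChar) (volume : Measure E)
    (innerₗ E) u c
  exact congrFun this ξ

lemma fourier_conj (u : E → ℂ) (ξ : E) :
    𝓕 (fun x => conj (u x)) ξ = conj (𝓕 u (-ξ)) := by
  rw [Real.fourier_eq', Real.fourier_eq', ← integral_conj]
  congr 1; ext x
  simp only [smul_eq_mul, map_mul, ← Complex.exp_conj]
  congr 2
  simp [Complex.conj_ofReal, Complex.conj_ofNat]

lemma continuous_fourier {u : E → ℂ} (hu : Integrable u) : Continuous (𝓕 u) :=
  VectorFourier.fourierIntegral_continuous Real.continuous_fourierChar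
    continuous_inner hu

lemma integral_fourier_mul {u v : E → ℂ} (hu : Integrable u) (hv : Integrable v) :
    ∫ ξ, 𝓕 u ξ * v ξ = ∫ x, u x * 𝓕 v x := by
  have := VectorFourier.integral_fourierIntegral_smul_eq_flip (e := Real.fourierChar)
    (μ := (volume : Measure E)) (ν := volume) (L := innerₗ E)
    Real.continuous_fourierChar continuous_inner hu hv
  simp only [flip_innerₗ, smul_eq_mul] at this
  exact this

lemma fourier_zero (u : E → ℂ) : 𝓕 u 0 = ∫ x, u x := by
  rw [Real.fourier_eq']; simp

/-- Modulation by the character of frequency `ζ`. -/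
noncomputable def modul (ζ : E) (u : E → ℂ) : E → ℂ :=
  fun x => Complex.exp (2 * Real.pi * ⟪x, ζ⟫ * Complex.I) * u x

lemma norm_modul (ζ : E) (u : E → ℂ) (x : E) : ‖modul ζ u x‖ = ‖u x‖ := by
  have : (2 * Real.pi * ⟪x, ζ⟫ * Complex.I : ℂ) = ((2 * Real.pi * ⟪x, ζ⟫ : ℝ) : ℂ) * Complex.I := by
    push_cast; ring
  rw [modul, norm_mul, this, Complex.norm_exp_ofReal_mul_I, one_mul]

lemma continuous_modul {ζ : E} {u : E → ℂ} (hu : Continuous u) : Continuous (modul ζ u) := by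
  unfold modul; fun_prop

lemma integrable_modul {ζ : E} {u : E → ℂ} (hu : Integrable u) : Integrable (modul ζ u) := by
  refine hu.norm.mono' ?_ (Eventually.of_forall fun x => (norm_modul ζ u x).le)
  have : Continuous fun x : E => Complex.exp (2 * Real.pi * ⟪x, ζ⟫ * Complex.I) := by fun_prop
  exact this.aestronglyMeasurable.mul hu.aestronglyMeasurable

lemma fourier_modul (ζ : E) (u : E → ℂ) (ξ : E) : 𝓕 (modul ζ u) ξ = 𝓕 u (ξ - ζ) := by
  rw [Real.fourier_eq', Real.fourier_eq']
  congr 1; ext x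
  simp only [modul, smul_eq_mul, ← mul_assoc, ← Complex.exp_add, inner_sub_right]
  congr 2; push_cast; ring

namespace PW

variable {K K' : Set E} {u v : E → ℂ}

lemma mono (hu : PW K u) (h : K ⊆ K') : PW K' u :=
  ⟨hu.cont, hu.int, fun ξ hξ => hu.supp ξ fun h' => hξ (h h')⟩

lemma add (hu : PW K u) (hv : PW K v) : PW K (u + v) :=
  ⟨hu.cont.add hv.cont, hu.int.add hv.int, fun ξ hξ => by
    rw [fourier_add hu.int hv.int, hu.supp ξ hξ, hv.supp ξ hξ, add_zero]⟩

lemma const_mul (hu : PW K u) (c : ℂ) : PW K (fun x => c * u x) :=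
  ⟨continuous_const.mul hu.cont, hu.int.const_mul c, fun ξ hξ => by
    rw [fourier_const_mul, hu.supp ξ hξ, mul_zero]⟩

lemma zero : PW K (fun _ => (0 : ℂ)) :=
  ⟨continuous_const, integrable_zero _ _ _, fun ξ _ => by rw [Real.fourier_eq']; simp⟩

lemma sum {ι : Type*} (s : Finset ι) {u : ι → E → ℂ} (h : ∀ i ∈ s, PW K (u i)) :
    PW K (fun x => ∑ i ∈ s, u i x) := by
  classical
  induction s using Finset.induction_on with
  | empty => simpa using zero
  | insert i s hi ih =>
    simp only [Finset.sum_insert hi]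
    exact (h i (by simp)).add (ih fun j hj => h j (by simp [hj]))

lemma star (hu : PW K u) : PW (-K) (fun x => conj (u x)) :=
  ⟨Complex.continuous_conj.comp hu.cont, by
    have := hu.int.norm
    exact (Complex.conjLIE.toContinuousLinearEquiv.toContinuousLinearMap.integrable_comp hu.int),
   fun ξ hξ => by
    rw [fourier_conj, hu.supp (-ξ) (by simpa using hξ), map_zero]⟩

lemma modul (hu : PW K u) (ζ : E) : PW ((fun ξ => ξ + ζ) '' K) (modul ζ u) :=
  ⟨continuous_modul hu.cont, integrable_modul hu.int, fun ξ hξ => by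
    rw [fourier_modul]
    exact hu.supp _ fun h => hξ ⟨_, h, by simp⟩⟩

lemma fourier_integrable (hu : PW K u) (hK : Bornology.IsBounded K) : Integrable (𝓕 u) := by
  refine (continuous_fourier hu.int).integrable_of_hasCompactSupport ?_
  exact HasCompactSupport.intro hK.isCompact_closure fun x hx => hu.supp x
    fun h => hx (subset_closure h)

lemma inversion (hu : PW K u) (hK : Bornology.IsBounded K) : 𝓕⁻ (𝓕 u) = u :=
  hu.cont.fourierInv_fourier_eq hu.int (hu.fourier_integrable hK)

lemma ext_fourier (hu : PW K u) (hv : PW K' v) (hK : Bornology.IsBounded K)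
    (hK' : Bornology.IsBounded K') (h : ∀ ξ, 𝓕 u ξ = 𝓕 v ξ) : u = v := by
  rw [← hu.inversion hK, ← hv.inversion hK', funext h]

/-- A band-limited function is the Fourier transform of the reflection of its own transform. -/
lemma eq_fourier_neg (hu : PW K u) (hK : Bornology.IsBounded K) :
    u = 𝓕 (fun ζ => 𝓕 u (-ζ)) := by
  conv_lhs => rw [← hu.inversion hK, Real.fourierInv_eq_fourier_comp_neg]

lemma exists_bound (hu : PW K u) (hK : Bornology.IsBounded K) : ∃ C, ∀ x, ‖u x‖ ≤ C := by
  refine ⟨∫ ξ, ‖𝓕 u (-ξ)‖, fun x => ?_⟩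
  conv_lhs => rw [hu.eq_fourier_neg hK]
  exact VectorFourier.norm_fourierIntegral_le_integral_norm _ _ _ _ _

lemma mul (hu : PW K u) (hv : PW K' v) (hK : Bornology.IsBounded K) :
    PW (K + K') (fun x => u x * v x) := by
  obtain ⟨C, hC⟩ := hu.exists_bound hK
  refine ⟨hu.cont.mul hv.cont, ?_, fun ξ hξ => ?_⟩
  · exact hv.int.bdd_mul hu.cont.aestronglyMeasurable (c := C) (Eventually.of_forall hC)
  · have h1 : 𝓕 (fun x => u x * v x) ξ
        = ∫ x, 𝓕 (fun ζ => 𝓕 u (-ζ)) x * Falconer.modul (-ξ) v x := by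
      rw [Real.fourier_eq']
      congr 1; ext x
      rw [← congrFun (hu.eq_fourier_neg hK) x, Falconer.modul, smul_eq_mul, inner_neg_right]
      push_cast; ring_nf
    rw [h1, integral_fourier_mul (hu.fourier_integrable hK).comp_neg (integrable_modul hv.int)]
    refine integral_eq_zero_of_ae (Eventually.of_forall fun ζ => ?_)
    simp only [fourier_modul, Pi.zero_apply, mul_eq_zero]
    by_contra h
    push Not at h
    refine hξ ?_
    have h2 : -ζ ∈ K := by by_contra h'; exact h.1 (hu.supp _ h')
    have h3 : ζ - -ξ ∈ K' := by by_contra h'; exact h.2 (hv.supp _ h')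
    have := Set.add_mem_add h2 h3
    simpa using this

lemma translate (hu : PW K u) (a : E) : PW K (fun x => u (x + a)) :=
  ⟨hu.cont.comp (by fun_prop), hu.int.comp_add_right a, fun ξ hξ => by
    have := congrFun (VectorFourier.fourierIntegral_comp_add_right (Real.fourierChar)
      (volume : Measure E) (innerₗ E) u a) ξ
    refine Eq.trans this ?_
    have h0 := hu.supp ξ hξ
    change VectorFourier.fourierIntegral Real.fourierChar volume (innerₗ E) u ξ = 0 at h0
    rw [h0, smul_zero]⟩

lemma integral_eq_zero (hu : PW K u) (h : (0 : E) ∉ K) : ∫ x, u x = 0 := by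
  rw [← fourier_zero, hu.supp 0 h]

/-- Multiplication of the Fourier transform by a smooth compactly supported function. -/
lemma exists_cutoff (hu : PW K u) (χ : SchwartzMap E ℂ) :
    ∃ v, PW (K ∩ Function.support χ) v ∧ ∀ ξ, 𝓕 v ξ = χ ξ * 𝓕 u ξ := by
  set k : SchwartzMap E ℂ := 𝓕⁻ χ with hk
  have hkf : ∀ ξ, 𝓕 (k : E → ℂ) ξ = χ ξ := fun ξ => by
    rw [← SchwartzMap.fourier_coe, hk, FourierTransform.fourier_fourierInv_eq]
  have hf : ∀ ξ, 𝓕 (MeasureTheory.convolution (k : E → ℂ) u (ContinuousLinearMap.mul ℂ ℂ) volume) ξ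
      = χ ξ * 𝓕 u ξ := fun ξ => by
    rw [Real.fourier_mul_convolution_eq k.integrable hu.int, hkf]
  refine ⟨_, ⟨?_, k.integrable.integrable_convolution _ hu.int, fun ξ hξ => ?_⟩, hf⟩
  · obtain ⟨C, hC⟩ : ∃ C, ∀ x, ‖k x‖ ≤ C := ⟨_, k.norm_le_seminorm ℝ⟩
    refine BddAbove.continuous_convolution_left_of_integrable _ ⟨C, ?_⟩ k.continuous hu.int
    rintro _ ⟨x, rfl⟩; exact hC x
  · rw [hf]
    by_cases h : χ ξ = 0
    · rw [h, zero_mul]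
    · rw [hu.supp ξ fun h' => hξ ⟨h', h⟩, mul_zero]

end PW

/-- Plancherel for band-limited functions. -/
lemma PW.integral_normSq_fourier {K : Set E} {u : E → ℂ} (hu : PW K u)
    (hK : Bornology.IsBounded K) : ∫ ξ, ‖𝓕 u ξ‖ ^ 2 = ∫ x, ‖u x‖ ^ 2 := by
  have h := integral_fourier_mul hu.int (v := fun ξ => conj (𝓕 u ξ))
    (Complex.conjLIE.toContinuousLinearEquiv.toContinuousLinearMap.integrable_comp
      (hu.fourier_integrable hK))
  have h2 : ∀ x, 𝓕 (fun ξ => conj (𝓕 u ξ)) x = conj (u x) := fun x => by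
    rw [fourier_conj, ← Real.fourierInv_eq_fourier_neg, hu.inversion hK]
  simp only [h2, Complex.mul_conj, Complex.normSq_eq_norm_sq] at h
  rw [integral_complex_ofReal, integral_complex_ofReal] at h
  exact_mod_cast h

lemma PW.lintegral_fourier_sq {K : Set E} {u : E → ℂ} (hu : PW K u)
    (hK : Bornology.IsBounded K) : ∫⁻ ξ, ‖𝓕 u ξ‖ₑ ^ 2 = ∫⁻ x, ‖u x‖ₑ ^ 2 := by
  have aux : ∀ {f : E → ℂ}, Continuous f → Integrable f → (∃ C, ∀ x, ‖f x‖ ≤ C) →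
      ∫⁻ x, ‖f x‖ₑ ^ 2 = ENNReal.ofReal (∫ x, ‖f x‖ ^ 2) := by
    rintro f hc hi ⟨C, hC⟩
    rw [ofReal_integral_eq_lintegral_ofReal _ (Eventually.of_forall fun x => by positivity)]
    · congr 1; ext x
      rw [ENNReal.ofReal_pow (norm_nonneg _), ofReal_norm]
    · have := hi.norm.bdd_mul (c := C) hc.norm.aestronglyMeasurable
        (Eventually.of_forall fun x => by simpa using hC x)
      simpa [sq] using this
  rw [aux (continuous_fourier hu.int) (hu.fourier_integrable hK)
      ⟨_, fun x => VectorFourier.norm_fourierIntegral_le_integral_norm _ _ _ _ _⟩,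
    aux hu.cont hu.int (hu.exists_bound hK), hu.integral_normSq_fourier hK]

lemma PW.lintegral_sq_ne_top {K : Set E} {u : E → ℂ} (hu : PW K u)
    (hK : Bornology.IsBounded K) : ∫⁻ x, ‖u x‖ₑ ^ 2 ≠ ∞ := by
  obtain ⟨C, hC⟩ := hu.exists_bound hK
  have h := hu.int.norm.bdd_mul (c := C) hu.cont.norm.aestronglyMeasurable
        (Eventually.of_forall fun x => by simpa using hC x)
  have := h.hasFiniteIntegral
  rw [HasFiniteIntegral] at this
  refine ne_of_lt (lt_of_eq_of_lt ?_ this)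
  congr 1; ext x; simp [sq]

/-- Smoothing a bounded weight by a band-limited kernel and using it as a mask. -/
lemma PW.mask {K L : Set E} {u η : E → ℂ} (hu : PW K u) (hη : PW L η)
    (hL : Bornology.IsBounded L) {p : E → ℝ} (hp : Measurable p) (hpb : ∀ x, |p x| ≤ 1) :
    PW (L + K) (fun x => (∫ y, (p y : ℂ) * η (x - y)) * u x) := by
  have hpc : Measurable fun y => (p y : ℂ) := Complex.measurable_ofReal.comp hp
  have hcont : Continuous fun x => ∫ y, (p y : ℂ) * η (x - y) := by
    have hint : ∀ {g : E → ℂ}, Integrable g → ∀ x, Integrable fun y => (p y : ℂ) * g (x - y) :=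
      fun hg x => (hg.comp_sub_left x).bdd_mul (c := 1) hpc.aestronglyMeasurable
        (Eventually.of_forall fun q => by simpa using hpb q)
    refine continuous_of_uniform_approx_of_continuous fun U hU => ?_
    obtain ⟨ε, hε, hU'⟩ := Metric.mem_uniformity_dist.1 hU
    obtain ⟨g, hgc, hg, hgcont, hgi⟩ := hη.int.exists_hasCompactSupport_integral_sub_le
      (half_pos hε)
    refine ⟨fun x => ∫ y, (p y : ℂ) * g (x - y), ?_, fun x => ?_⟩
    · have h1 : (fun x => ∫ y, (p y : ℂ) * g (x - y))
          = MeasureTheory.convolution (fun y => (p y : ℂ)) g (ContinuousLinearMap.mul ℂ ℂ)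
            volume := rfl
      rw [h1]
      refine hgc.continuous_convolution_right _ ?_ hgcont
      refine (locallyIntegrable_const (1 : ℝ)).mono hpc.aestronglyMeasurable
        (Eventually.of_forall fun q => by simpa using hpb q)
    · refine hU' ?_
      rw [dist_eq_norm, ← integral_sub (hint hη.int x) (hint hgi x)]
      refine lt_of_le_of_lt ?_ (lt_of_le_of_lt hg (half_lt_self hε))
      rw [← integral_sub_left_eq_self (fun y => ‖η y - g y‖) volume x]
      refine norm_integral_le_of_norm_le ((hη.int.sub hgi).comp_sub_left x).norm
        (Eventually.of_forall fun y => ?_)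
      rw [← mul_sub, norm_mul, Complex.norm_real, Real.norm_eq_abs]
      exact mul_le_of_le_one_left (norm_nonneg _) (hpb y)
  have hb : ∀ x, ‖∫ y, (p y : ℂ) * η (x - y)‖ ≤ ∫ y, ‖η y‖ := fun x => by
    rw [← integral_sub_left_eq_self (fun y => ‖η y‖) volume x]
    refine norm_integral_le_of_norm_le (hη.int.comp_sub_left x).norm
      (Eventually.of_forall fun y => ?_)
    rw [norm_mul, Complex.norm_real, Real.norm_eq_abs]
    exact mul_le_of_le_one_left (norm_nonneg _) (hpb y)
  refine ⟨hcont.mul hu.cont, hu.int.bdd_mul hcont.aestronglyMeasurable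
    (Eventually.of_forall hb), fun ξ hξ => ?_⟩
  have h1 : ∀ x, Real.fourierChar (-⟪x, ξ⟫) • ((∫ y, (p y : ℂ) * η (x - y)) * u x)
      = ∫ y, (p y : ℂ) * (Real.fourierChar (-⟪x, ξ⟫) • (η (x - y) * u x)) := fun x => by
    rw [Circle.smul_def, smul_eq_mul, ← integral_mul_const, ← integral_const_mul]
    congr 1; ext y
    rw [Circle.smul_def, smul_eq_mul]; ring
  rw [Real.fourier_eq]
  simp only [h1]
  rw [integral_integral_swap]
  · refine integral_eq_zero_of_ae (Eventually.of_forall fun y => ?_)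
    simp only [Pi.zero_apply]
    rw [integral_const_mul]
    have h2 := ((hη.translate (-y)).mul hu hL).supp ξ hξ
    rw [Real.fourier_eq] at h2
    simp only [← sub_eq_add_neg] at h2
    rw [h2, mul_zero]
  · have h3 : Integrable (fun q : E × E => η (q.1 - q.2) * u q.1) (volume.prod volume) := by
      have := (hu.int.convolution_integrand (ContinuousLinearMap.mul ℂ ℂ) hη.int.comp_neg).swap
      simpa [mul_comm, Function.comp_def] using this
    have h4 : Continuous fun q : E × E => (Real.fourierChar (-⟪q.1, ξ⟫) : ℂ) := by
      have := Real.continuous_fourierChar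
      fun_prop
    have h5 := h3.bdd_mul (c := 1) h4.aestronglyMeasurable (Eventually.of_forall fun q => (Circle.norm_coe _).le)
    have h6 := h5.bdd_mul (c := 1) (f := fun q : E × E => (p q.2 : ℂ))
      (hpc.comp measurable_snd).aestronglyMeasurable
      (Eventually.of_forall fun q => by simpa using hpb q.2)
    simpa [Function.uncurry_def, Circle.smul_def] using h6

/-- Almost orthogonality: only pairs with overlapping Fourier supports interact. -/
lemma lintegral_sum_sq_le {ι : Type*} (s : Finset ι) {S : ι → Set E} {A : ι → E → ℂ}
    (hA : ∀ i ∈ s, PW (S i) (A i)) (hS : ∀ i ∈ s, Bornology.IsBounded (S i))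
    (r : ι → ι → Prop) [DecidableRel r]
    (hr : ∀ i ∈ s, ∀ j ∈ s, (S i ∩ S j).Nonempty → r i j) :
    ∫⁻ x, ‖∑ i ∈ s, A i x‖ₑ ^ 2 ≤
      ∑ i ∈ s, ∑ j ∈ s with r i j, ∫⁻ x, ‖A i x‖ₑ * ‖A j x‖ₑ := by
  have hPW : ∀ i ∈ s, ∀ j ∈ s, PW (S i + -S j) fun x => A i x * conj (A j x) :=
    fun i hi j hj => (hA i hi).mul (hA j hj).star (hS i hi)
  have hint : ∀ i ∈ s, ∀ j ∈ s, Integrable fun x => A i x * conj (A j x) :=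
    fun i hi j hj => (hPW i hi j hj).int
  have hsq : ∀ x, ((‖∑ i ∈ s, A i x‖ ^ 2 : ℝ) : ℂ) = ∑ i ∈ s, ∑ j ∈ s, A i x * conj (A j x) :=
    fun x => by
      rw [← Finset.sum_mul_sum, ← map_sum, Complex.mul_conj, Complex.normSq_eq_norm_sq]
  have hsqi : Integrable fun x => ‖∑ i ∈ s, A i x‖ ^ 2 := by
    have h : Integrable fun x => ((‖∑ i ∈ s, A i x‖ ^ 2 : ℝ) : ℂ) := by
      simp only [hsq]
      exact integrable_finsetSum _ fun i hi => integrable_finsetSum _ fun j hj => hint i hi j hj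
    have := h.re
    simp only [RCLike.re_to_complex, Complex.ofReal_re] at this
    exact this
  have h1 : ∫ x, ‖∑ i ∈ s, A i x‖ ^ 2 ≤
      ∑ i ∈ s, ∑ j ∈ s with r i j, ‖∫ x, A i x * conj (A j x)‖ := by
    have h2 : ((∫ x, ‖∑ i ∈ s, A i x‖ ^ 2 : ℝ) : ℂ)
        = ∑ i ∈ s, ∑ j ∈ s with r i j, ∫ x, A i x * conj (A j x) := by
      rw [← integral_complex_ofReal]
      simp only [hsq]
      rw [integral_finsetSum _ fun i hi => integrable_finsetSum _ fun j hj => hint i hi j hj]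
      refine Finset.sum_congr rfl fun i hi => ?_
      rw [integral_finsetSum _ fun j hj => hint i hi j hj, Finset.sum_filter]
      refine Finset.sum_congr rfl fun j hj => ?_
      split_ifs with h
      · rfl
      · refine (hPW i hi j hj).integral_eq_zero fun h0 => h (hr i hi j hj ?_)
        obtain ⟨a, ha, b, hb, hab⟩ := Set.mem_add.1 h0
        exact ⟨a, ha, by rwa [eq_neg_of_add_eq_zero_left hab]⟩
    have h3 : (0 : ℝ) ≤ ∫ x, ‖∑ i ∈ s, A i x‖ ^ 2 := integral_nonneg fun x => by positivity
    calc ∫ x, ‖∑ i ∈ s, A i x‖ ^ 2 = ‖((∫ x, ‖∑ i ∈ s, A i x‖ ^ 2 : ℝ) : ℂ)‖ := by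
          rw [Complex.norm_real, Real.norm_of_nonneg h3]
      _ ≤ _ := by
          rw [h2]
          refine (norm_sum_le _ _).trans (Finset.sum_le_sum fun i _ => norm_sum_le _ _)
  calc ∫⁻ x, ‖∑ i ∈ s, A i x‖ₑ ^ 2 = ENNReal.ofReal (∫ x, ‖∑ i ∈ s, A i x‖ ^ 2) := by
        rw [ofReal_integral_eq_lintegral_ofReal hsqi (Eventually.of_forall fun x => by positivity)]
        congr 1; ext x
        rw [ENNReal.ofReal_pow (norm_nonneg _), ofReal_norm]
    _ ≤ ENNReal.ofReal (∑ i ∈ s, ∑ j ∈ s with r i j, ‖∫ x, A i x * conj (A j x)‖) :=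
        ENNReal.ofReal_le_ofReal h1
    _ = ∑ i ∈ s, ∑ j ∈ s with r i j, ‖∫ x, A i x * conj (A j x)‖ₑ := by
        rw [ENNReal.ofReal_sum_of_nonneg fun i _ => Finset.sum_nonneg fun j _ => norm_nonneg _]
        refine Finset.sum_congr rfl fun i _ => ?_
        rw [ENNReal.ofReal_sum_of_nonneg fun j _ => norm_nonneg _]
        exact Finset.sum_congr rfl fun j _ => ofReal_norm _
    _ ≤ _ := by
        refine Finset.sum_le_sum fun i _ => Finset.sum_le_sum fun j _ => ?_
        refine (enorm_integral_le_lintegral_enorm _).trans (le_of_eq ?_)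
        congr 1; ext x
        rw [enorm_mul]; simp

end PaleyWiener

section CauchySchwarz

variable {X : Type*} [MeasurableSpace X] {μ : Measure X}

lemma lintegral_mul_sq_le {f g : X → ℝ≥0∞} (hf : AEMeasurable f μ) (hg : AEMeasurable g μ) :
    (∫⁻ x, f x * g x ∂μ) ^ 2 ≤ (∫⁻ x, f x ^ 2 ∂μ) * ∫⁻ x, g x ^ 2 ∂μ := by
  have h := ENNReal.lintegral_mul_le_Lp_mul_Lq μ Real.HolderConjugate.two_two hf hg
  calc (∫⁻ x, f x * g x ∂μ) ^ 2
      ≤ ((∫⁻ x, f x ^ (2 : ℝ) ∂μ) ^ (1 / 2 : ℝ) * (∫⁻ x, g x ^ (2 : ℝ) ∂μ) ^ (1 / 2 : ℝ)) ^ 2 := by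
        gcongr; exact h
    _ = _ := by
        rw [mul_pow, ← ENNReal.rpow_natCast, ← ENNReal.rpow_mul, ← ENNReal.rpow_natCast,
          ← ENNReal.rpow_mul]
        norm_num

lemma ennreal_mul_le_add_sq {l : ℝ≥0} (hl : l ≠ 0) (a b : ℝ≥0∞) :
    a * b ≤ l * a ^ 2 + (l⁻¹ : ℝ≥0) * b ^ 2 := by
  rcases eq_or_ne a ∞ with rfl | ha
  · simp [hl]
  rcases eq_or_ne b ∞ with rfl | hb
  · simp [hl]
  lift a to ℝ≥0 using ha
  lift b to ℝ≥0 using hb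
  norm_cast
  rw [← NNReal.coe_le_coe]
  have hl' : (0 : ℝ) < l := by positivity
  push_cast
  have h1 : (l : ℝ) * a ^ 2 + (l : ℝ)⁻¹ * b ^ 2 - a * b
      = (l : ℝ)⁻¹ * ((l * a - b / 2) ^ 2 + 3 / 4 * b ^ 2) := by field_simp; ring
  have h2 : 0 ≤ (l : ℝ)⁻¹ * ((l * a - b / 2) ^ 2 + 3 / 4 * (b : ℝ) ^ 2) := by positivity
  linarith

lemma lintegral_mul_le_add_sq {f g : X → ℝ≥0∞} (hf : AEMeasurable f μ) {l : ℝ≥0} (hl : l ≠ 0) :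
    ∫⁻ x, f x * g x ∂μ ≤ l * (∫⁻ x, f x ^ 2 ∂μ) + (l⁻¹ : ℝ≥0) * ∫⁻ x, g x ^ 2 ∂μ := by
  rw [← lintegral_const_mul' _ _ (by simp), ← lintegral_const_mul' _ _ (by simp),
    ← lintegral_add_left' ((hf.pow_const 2).const_mul _)]
  exact lintegral_mono fun x => ennreal_mul_le_add_sq hl _ _

lemma sum_enorm_sq_le {ι : Type*} (s : Finset ι) (f : ι → ℝ≥0∞) :
    (∑ i ∈ s, f i) ^ 2 ≤ s.card * ∑ i ∈ s, f i ^ 2 := by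
  have := ENNReal.rpow_sum_le_const_mul_sum_rpow s f (p := 2) (by norm_num)
  norm_num at this
  exact_mod_cast this

end CauchySchwarz

end Falconer

namespace Falconer

open MeasureTheory Metric Set Filter Topology Module
open scoped FourierTransform ENNReal NNReal Pointwise ComplexConjugate RealInnerProductSpace

set_option linter.unusedSectionVars false

section Stretch

variable {E : Type*} [NormedAddCommGroup E] [InnerProductSpace ℝ E]

/-- The self-adjoint map acting as `b` along the line spanned by `ω` and as `a` orthogonally. -/
noncomputable def stretch (a b : ℝ) (ω : E) : E →ₗ[ℝ] E :=
  a • LinearMap.id + (b - a) • (innerₗ E ω).smulRight ω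

lemma stretch_apply (a b : ℝ) (ω y : E) :
    stretch a b ω y = a • y + ((b - a) * ⟪ω, y⟫) • ω := by
  simp [stretch, mul_smul]

@[fun_prop] lemma continuous_stretch (a b : ℝ) (ω : E) : Continuous (stretch a b ω) := by
  have : ⇑(stretch a b ω) = fun y => a • y + ((b - a) * ⟪ω, y⟫) • ω :=
    funext (stretch_apply a b ω)
  rw [this]; fun_prop

lemma stretch_stretch {ω : E} (hω : ‖ω‖ = 1) (a b a' b' : ℝ) (y : E) :
    stretch a b ω (stretch a' b' ω y) = stretch (a * a') (b * b') ω y := by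
  simp only [stretch_apply, inner_add_right, inner_smul_right, real_inner_self_eq_norm_sq, hω]
  module

lemma stretch_one (ω y : E) : stretch 1 1 ω y = y := by simp [stretch_apply]

lemma stretch_self (a : ℝ) (ω y : E) : stretch a a ω y = a • y := by simp [stretch_apply]

lemma inner_stretch (a b : ℝ) (ω x y : E) :
    ⟪stretch a b ω x, y⟫ = ⟪x, stretch a b ω y⟫ := by
  simp only [stretch_apply, inner_add_right, inner_smul_right, inner_add_left, inner_smul_left,
    real_inner_comm]
  simp; ring

lemma norm_stretch_sq {ω : E} (hω : ‖ω‖ = 1) (a b : ℝ) (y : E) :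
    ‖stretch a b ω y‖ ^ 2 = a ^ 2 * (‖y‖ ^ 2 - ⟪ω, y⟫ ^ 2) + b ^ 2 * ⟪ω, y⟫ ^ 2 := by
  rw [← real_inner_self_eq_norm_sq, stretch_apply]
  simp only [inner_add_right, inner_add_left, inner_smul_right, inner_smul_left,
    real_inner_self_eq_norm_sq, hω, real_inner_comm ω y]
  simp; ring

lemma inner_sq_le {ω : E} (hω : ‖ω‖ = 1) (y : E) : ⟪ω, y⟫ ^ 2 ≤ ‖y‖ ^ 2 := by
  rw [sq_le_sq, abs_norm]
  simpa [hω] using abs_real_inner_le_norm ω y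

lemma norm_stretch_mono {ω : E} (hω : ‖ω‖ = 1) {a b a' b' : ℝ} (ha : |a| ≤ |a'|) (hb : |b| ≤ |b'|)
    (y : E) : ‖stretch a b ω y‖ ≤ ‖stretch a' b' ω y‖ := by
  refine (abs_le_of_sq_le_sq' ?_ (norm_nonneg _)).2
  rw [norm_stretch_sq hω, norm_stretch_sq hω]
  have h1 := sq_le_sq.2 ha
  have h2 := sq_le_sq.2 hb
  have h3 := inner_sq_le hω y
  gcongr

variable [FiniteDimensional ℝ E]

lemma det_stretch {ω : E} (hω : ‖ω‖ = 1) {a : ℝ} (ha : a ≠ 0) (b : ℝ) :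
    LinearMap.det (stretch a b ω) = a ^ (finrank ℝ E - 1) * b := by
  have h : stretch a b ω = a • LinearMap.transvection (((b - a) / a) • innerₗ E ω) ω := by
    ext y
    simp only [stretch_apply, LinearMap.smul_apply, LinearMap.transvection.apply, smul_add,
      smul_smul, innerₗ_apply_apply, smul_eq_mul]
    congr 2; field_simp
  have hpos : 0 < finrank ℝ E := by
    have : Nontrivial E := ⟨ω, 0, fun h => by simp [h] at hω⟩
    exact finrank_pos
  rw [h, LinearMap.det_smul, LinearMap.transvection.det]
  obtain ⟨m, hm⟩ : ∃ m, finrank ℝ E = m + 1 := ⟨finrank ℝ E - 1, by omega⟩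
  simp only [hm, LinearMap.smul_apply, innerₗ_apply_apply, real_inner_self_eq_norm_sq, hω]
  simp; field_simp; ring

variable [MeasurableSpace E] [BorelSpace E]

lemma map_stretch {ω : E} (hω : ‖ω‖ = 1) {a b : ℝ} (ha : 0 < a) (hb : 0 < b) :
    Measure.map (stretch a b ω) volume
      = ENNReal.ofReal ((a ^ (finrank ℝ E - 1) * b)⁻¹) • (volume : Measure E) := by
  have hd := det_stretch hω ha.ne' b
  have hpos : 0 < a ^ (finrank ℝ E - 1) * b := by positivity
  rw [Measure.map_linearMap_addHaar_eq_smul_addHaar _ (by rw [hd]; exact hpos.ne'), hd,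
    abs_of_pos (inv_pos.2 hpos)]

lemma lintegral_comp_stretch {ω : E} (hω : ‖ω‖ = 1) {a b : ℝ} (ha : 0 < a) (hb : 0 < b)
    {f : E → ℝ≥0∞} (hf : Measurable f) :
    ENNReal.ofReal (a ^ (finrank ℝ E - 1) * b) * ∫⁻ y, f (stretch a b ω y) = ∫⁻ y, f y := by
  have hpos : 0 < a ^ (finrank ℝ E - 1) * b := by positivity
  rw [← lintegral_map hf (continuous_stretch a b ω).measurable, map_stretch hω ha hb,
    lintegral_smul_measure, smul_eq_mul, ← mul_assoc, ← ENNReal.ofReal_mul hpos.le,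
    mul_inv_cancel₀ hpos.ne', ENNReal.ofReal_one, one_mul]

lemma integral_comp_stretch {ω : E} (hω : ‖ω‖ = 1) {a b : ℝ} (ha : 0 < a) (hb : 0 < b)
    {f : E → ℂ} (hf : Continuous f) :
    ((a ^ (finrank ℝ E - 1) * b : ℝ) : ℂ) * ∫ y, f (stretch a b ω y) = ∫ y, f y := by
  have hpos : 0 < a ^ (finrank ℝ E - 1) * b := by positivity
  rw [← integral_map (continuous_stretch a b ω).aemeasurable hf.aestronglyMeasurable,
    map_stretch hω ha hb, integral_smul_measure, Complex.real_smul,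
    ENNReal.toReal_ofReal (inv_pos.2 hpos).le, ← mul_assoc, ← Complex.ofReal_mul,
    mul_inv_cancel₀ hpos.ne']
  simp

end Stretch

section Decay

variable {E : Type*} [NormedAddCommGroup E] [InnerProductSpace ℝ E]

/-- The weight `1 + ‖x‖` with values in `ℝ≥0∞`. -/
noncomputable def wt (x : E) : ℝ≥0∞ := 1 + ‖x‖ₑ

lemma one_le_wt (x : E) : 1 ≤ wt x := by simp [wt]
lemma wt_ne_zero (x : E) : wt x ≠ 0 := (one_pos.trans_le (one_le_wt x)).ne'
lemma wt_ne_top (x : E) : wt x ≠ ∞ := by simp [wt]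
lemma wt_eq_ofReal (x : E) : wt x = ENNReal.ofReal (1 + ‖x‖) := by
  rw [ENNReal.ofReal_add zero_le_one (norm_nonneg x), ofReal_norm, ENNReal.ofReal_one, wt]
lemma wt_mono {x y : E} (h : ‖x‖ ≤ ‖y‖) : wt x ≤ wt y := by
  rw [wt_eq_ofReal, wt_eq_ofReal]; gcongr
lemma wt_neg (x : E) : wt (-x) = wt x := by simp [wt]
lemma wt_add_le (x y : E) : wt (x + y) ≤ wt x * wt y := by
  rw [wt_eq_ofReal, wt_eq_ofReal, wt_eq_ofReal, ← ENNReal.ofReal_mul (by positivity)]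
  gcongr
  nlinarith [norm_add_le x y, norm_nonneg x, norm_nonneg y, mul_nonneg (norm_nonneg x) (norm_nonneg y)]
lemma continuous_wt : Continuous (wt : E → ℝ≥0∞) := by unfold wt; fun_prop

/-- The rapidly decaying profile `(1 + ‖x‖)⁻ᴺ`. -/
noncomputable def dk (N : ℕ) (x : E) : ℝ≥0∞ := (wt x ^ N)⁻¹

lemma dk_le_one (N : ℕ) (x : E) : dk N x ≤ 1 := by
  rw [dk, ENNReal.inv_le_one]; exact one_le_pow_of_one_le' (one_le_wt x) N
lemma dk_pos (N : ℕ) (x : E) : dk N x ≠ 0 := by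
  rw [dk, ENNReal.inv_ne_zero]; exact ENNReal.pow_ne_top (wt_ne_top x)
lemma dk_neg (N : ℕ) (x : E) : dk N (-x) = dk N x := by rw [dk, dk, wt_neg]
lemma dk_anti {N : ℕ} {x y : E} (h : ‖x‖ ≤ ‖y‖) : dk N y ≤ dk N x :=
  ENNReal.inv_le_inv.2 (by gcongr; exact wt_mono h)
lemma dk_mul (N M : ℕ) (x : E) : dk N x * dk M x = dk (N + M) x := by
  rw [dk, dk, dk, pow_add, ENNReal.mul_inv (Or.inl (pow_ne_zero _ (wt_ne_zero x)))
    (Or.inl (ENNReal.pow_ne_top (wt_ne_top x)))]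
lemma wt_pow_mul_dk (N M : ℕ) (x : E) : wt x ^ N * dk (N + M) x = dk M x := by
  rw [← dk_mul, ← mul_assoc, dk, ENNReal.mul_inv_cancel (pow_ne_zero _ (wt_ne_zero x))
    (ENNReal.pow_ne_top (wt_ne_top x)), one_mul]
/-- Slow variation of the decay profile. -/
lemma dk_le (N : ℕ) (x y : E) : dk N x ≤ wt y ^ N * dk N (x + y) := by
  have h : wt (x + y) ^ N ≤ wt y ^ N * wt x ^ N := by
    rw [← mul_pow]; gcongr; rw [mul_comm]; exact wt_add_le x y
  rw [dk, dk]
  have h1 := ENNReal.inv_le_inv.2 h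
  rw [ENNReal.mul_inv (Or.inl (pow_ne_zero _ (wt_ne_zero y)))
    (Or.inl (ENNReal.pow_ne_top (wt_ne_top y)))] at h1
  calc (wt x ^ N)⁻¹ = wt y ^ N * ((wt y ^ N)⁻¹ * (wt x ^ N)⁻¹) := by
        rw [← mul_assoc, ENNReal.mul_inv_cancel (pow_ne_zero _ (wt_ne_zero y))
          (ENNReal.pow_ne_top (wt_ne_top y)), one_mul]
    _ ≤ _ := by gcongr
@[fun_prop] lemma measurable_dk [MeasurableSpace E] [BorelSpace E] (N : ℕ) : Measurable (dk N : E → ℝ≥0∞) :=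
  (continuous_wt.measurable.pow_const N).inv

variable [FiniteDimensional ℝ E] [MeasurableSpace E] [BorelSpace E]

lemma lintegral_dk_lt_top {N : ℕ} (hN : finrank ℝ E < N) : ∫⁻ x : E, dk N x < ∞ := by
  have h := finite_integral_one_add_norm (E := E) (μ := volume) (r := N) (by exact_mod_cast hN)
  refine lt_of_le_of_lt (le_of_eq ?_) h
  congr 1; ext x
  rw [dk, wt_eq_ofReal, ← ENNReal.ofReal_pow (by positivity), ← ENNReal.ofReal_inv_of_pos
    (by positivity), Real.rpow_neg (by positivity), Real.rpow_natCast]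

/-- The base kernel: a Schwartz function with Fourier transform `1` on the unit ball and
supported in the ball of radius `2`. -/
noncomputable def baseBump (E : Type*) [NormedAddCommGroup E] [InnerProductSpace ℝ E]
    [FiniteDimensional ℝ E] : ContDiffBump (0 : E) := ⟨1, 2, one_pos, one_lt_two⟩

noncomputable def bumpSchwartz (E : Type*) [NormedAddCommGroup E] [InnerProductSpace ℝ E]
    [FiniteDimensional ℝ E] : SchwartzMap E ℂ :=
  HasCompactSupport.toSchwartzMap (f := fun x => ((baseBump E x : ℝ) : ℂ))
    ((baseBump E).hasCompactSupport.comp_left Complex.ofReal_zero)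
    (Complex.ofRealCLM.contDiff.comp (baseBump E).contDiff)

lemma bumpSchwartz_apply (x : E) : bumpSchwartz E x = ((baseBump E x : ℝ) : ℂ) := rfl

noncomputable def ker (E : Type*) [NormedAddCommGroup E] [InnerProductSpace ℝ E]
    [FiniteDimensional ℝ E] [MeasurableSpace E] [BorelSpace E] : SchwartzMap E ℂ :=
  𝓕⁻ (bumpSchwartz E)

lemma fourier_ker (ξ : E) : 𝓕 (ker E : E → ℂ) ξ = ((baseBump E ξ : ℝ) : ℂ) := by
  rw [← SchwartzMap.fourier_coe, ker, FourierTransform.fourier_fourierInv_eq, bumpSchwartz_apply]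

lemma fourier_ker_one {ξ : E} (h : ‖ξ‖ ≤ 1) : 𝓕 (ker E : E → ℂ) ξ = 1 := by
  rw [fourier_ker, (baseBump E).one_of_mem_closedBall (by simpa [baseBump] using h)]; simp

lemma fourier_ker_zero {ξ : E} (h : 2 ≤ ‖ξ‖) : 𝓕 (ker E : E → ℂ) ξ = 0 := by
  rw [fourier_ker, (baseBump E).zero_of_le_dist (by simpa [baseBump] using h)]; simp

lemma ker_zero_ne : ker E (0 : E) ≠ 0 := by
  have h : ker E (0 : E) = ((∫ x, baseBump E x : ℝ) : ℂ) := by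
    rw [ker, SchwartzMap.fourierInv_coe, Real.fourierInv_eq, ← integral_complex_ofReal]
    simp [bumpSchwartz_apply]
  rw [h]
  exact_mod_cast (baseBump E).integral_pos.ne'

lemma exists_ker_lower : ∃ c : ℝ, 0 < c ∧ c ≤ 1 ∧ ∀ x : E, ‖x‖ ≤ c → ENNReal.ofReal c ≤ ‖ker E x‖ₑ := by
  have h0 : 0 < ‖ker E (0 : E)‖ := norm_pos_iff.2 ker_zero_ne
  have hc : Continuous fun x => ‖ker E x‖ := (ker E).continuous.norm
  have := hc.continuousAt.eventually (lt_mem_nhds (half_lt_self h0))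
  obtain ⟨e, he, h⟩ := Metric.nhds_basis_closedBall.eventually_iff.1 this
  refine ⟨min (min e 1) (‖ker E (0 : E)‖ / 2), by positivity, by simp, fun x hx => ?_⟩
  rw [← ofReal_norm]
  refine ENNReal.ofReal_le_ofReal ((min_le_right _ _).trans (h ?_).le)
  simpa using hx.trans ((min_le_left _ _).trans (min_le_left _ _))

lemma exists_ker_decay (N : ℕ) : ∃ C : ℝ≥0, ∀ x : E, ‖ker E x‖ₑ ≤ C * dk N x := by
  have h := SchwartzMap.one_add_le_sup_seminorm_apply (𝕜 := ℝ) (m := (N, 0)) le_rfl le_rfl (ker E)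
  refine ⟨Real.toNNReal (2 ^ N * ((Finset.Iic (N, 0)).sup fun m => SchwartzMap.seminorm ℝ m.1 m.2)
    (ker E)), fun x => ?_⟩
  have h1 := h x
  rw [norm_iteratedFDeriv_zero] at h1
  rw [dk, ← div_eq_mul_inv, ENNReal.le_div_iff_mul_le (Or.inl (pow_ne_zero _ (wt_ne_zero x)))
    (Or.inl (ENNReal.pow_ne_top (wt_ne_top x))), wt_eq_ofReal, ← ofReal_norm,
    ← ENNReal.ofReal_pow (by positivity), ← ENNReal.ofReal_mul (norm_nonneg _), mul_comm]
  exact ENNReal.ofReal_le_ofReal h1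

/-- The `L¹`-normalised anisotropic rescaling of the base kernel. -/
noncomputable def sker (a b : ℝ) (ω : E) (x : E) : ℂ :=
  ((a ^ (finrank ℝ E - 1) * b : ℝ) : ℂ) * ker E (stretch a b ω x)

lemma fourier_comp_stretch {u : E → ℂ} (hu : Continuous u) {ω : E} (hω : ‖ω‖ = 1) {a b : ℝ}
    (ha : 0 < a) (hb : 0 < b) (ξ : E) :
    ((a ^ (finrank ℝ E - 1) * b : ℝ) : ℂ) * 𝓕 (fun x => u (stretch a b ω x)) ξ
      = 𝓕 u (stretch a⁻¹ b⁻¹ ω ξ) := by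
  have hc : Continuous fun y : E => Complex.exp (((-2 * Real.pi * ⟪y, stretch a⁻¹ b⁻¹ ω ξ⟫ : ℝ) : ℂ)
      * Complex.I) • u y := by
    fun_prop
  rw [Real.fourier_eq' u, ← integral_comp_stretch hω ha hb hc, Real.fourier_eq']
  congr 2; ext x
  rw [inner_stretch, stretch_stretch hω, mul_inv_cancel₀ ha.ne', mul_inv_cancel₀ hb.ne',
    stretch_one]

lemma fourier_sker {ω : E} (hω : ‖ω‖ = 1) {a b : ℝ} (ha : 0 < a) (hb : 0 < b) (ξ : E) :
    𝓕 (sker a b ω) ξ = 𝓕 (ker E : E → ℂ) (stretch a⁻¹ b⁻¹ ω ξ) := by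
  rw [← fourier_comp_stretch (ker E).continuous hω ha hb]
  exact fourier_const_mul _ _ _

lemma integrable_comp_stretch {u : E → ℂ} (hu : Integrable u) {ω : E} (hω : ‖ω‖ = 1) {a b : ℝ}
    (ha : 0 < a) (hb : 0 < b) : Integrable fun x => u (stretch a b ω x) := by
  have h : Integrable u (Measure.map (stretch a b ω) volume) := by
    rw [map_stretch hω ha hb]
    exact hu.smul_measure ENNReal.ofReal_ne_top
  exact h.comp_measurable (continuous_stretch a b ω).measurable

lemma integrable_sker {ω : E} (hω : ‖ω‖ = 1) {a b : ℝ} (ha : 0 < a) (hb : 0 < b) :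
    Integrable (sker a b ω : E → ℂ) :=
  (integrable_comp_stretch (ker E).integrable hω ha hb).const_mul _

lemma continuous_sker (a b : ℝ) (ω : E) : Continuous (sker a b ω : E → ℂ) :=
  continuous_const.mul ((ker E).continuous.comp (continuous_stretch a b ω))

lemma pw_sker {ω : E} (hω : ‖ω‖ = 1) {a b : ℝ} (ha : 0 < a) (hb : 0 < b) :
    PW {ξ : E | ‖stretch a⁻¹ b⁻¹ ω ξ‖ ≤ 2} (sker a b ω) :=
  ⟨continuous_sker a b ω, integrable_sker hω ha hb, fun ξ hξ => by
    rw [fourier_sker hω ha hb, fourier_ker_zero (not_le.1 hξ).le]⟩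

lemma integral_sker {ω : E} (hω : ‖ω‖ = 1) {a b : ℝ} (ha : 0 < a) (hb : 0 < b) :
    ∫ x, sker a b ω x = 1 := by
  rw [← fourier_zero, fourier_sker hω ha hb, map_zero, fourier_ker_one (by simp)]

lemma enorm_sker_le {N : ℕ} {C : ℝ≥0} (hC : ∀ x : E, ‖ker E x‖ₑ ≤ C * dk N x) {a b : ℝ}
    (ha : 0 < a) (hb : 0 < b) (ω x : E) :
    ‖sker a b ω x‖ₑ ≤ C * (ENNReal.ofReal (a ^ (finrank ℝ E - 1) * b) * dk N (stretch a b ω x)) := by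
  have hpos : 0 < a ^ (finrank ℝ E - 1) * b := by positivity
  rw [sker, enorm_mul, ← ofReal_norm, Complex.norm_real, Real.norm_of_nonneg hpos.le,
    mul_left_comm]
  gcongr
  exact hC _

/-- Reproducing formula. -/
lemma PW.reproduce {K : Set E} {u k : E → ℂ} (hu : PW K u) (hK : Bornology.IsBounded K)
    (hk : Integrable k) (hk1 : ∀ ξ ∈ K, 𝓕 k ξ = 1) (x : E) : u x = ∫ y, u y * k (x - y) := by
  obtain ⟨C, hC⟩ := hu.exists_bound hK
  have hf : ∀ ξ, 𝓕 (MeasureTheory.convolution k u (ContinuousLinearMap.mul ℂ ℂ) volume) ξ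
      = 𝓕 u ξ := fun ξ => by
    rw [Real.fourier_mul_convolution_eq hk hu.int]
    by_cases h : ξ ∈ K
    · rw [hk1 ξ h, one_mul]
    · rw [hu.supp ξ h, mul_zero]
  have hpw : PW K (MeasureTheory.convolution k u (ContinuousLinearMap.mul ℂ ℂ) volume) := by
    refine ⟨?_, hk.integrable_convolution _ hu.int, fun ξ hξ => by rw [hf, hu.supp ξ hξ]⟩
    refine BddAbove.continuous_convolution_right_of_integrable _ ⟨C, ?_⟩ hk hu.cont
    rintro _ ⟨x, rfl⟩; exact hC x
  have := congrFun (hu.ext_fourier hpw hK hK fun ξ => (hf ξ).symm) x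
  rw [this, convolution_eq_swap]
  simp [mul_comm]

/-- Local constancy of band-limited functions at the dual scale. -/
lemma exists_local_const (N : ℕ) (hN : finrank ℝ E < N) : ∃ C : ℝ≥0, ∀ {K : Set E} {u : E → ℂ}
    {ω ξ₀ : E} {a b : ℝ}, PW K u → Bornology.IsBounded K → ‖ω‖ = 1 → 0 < a → 0 < b →
    (∀ ξ ∈ K, ‖stretch a⁻¹ b⁻¹ ω (ξ - ξ₀)‖ ≤ 1) → ∀ x,
    ‖u x‖ₑ ^ 2 ≤ C * (ENNReal.ofReal (a ^ (finrank ℝ E - 1) * b) *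
      ∫⁻ y, ‖u y‖ₑ ^ 2 * dk N (stretch a b ω (x - y))) := by
  obtain ⟨C, hC⟩ := exists_ker_decay (E := E) N
  set I := ∫⁻ x : E, dk N x with hI
  have hItop : I ≠ ∞ := (lintegral_dk_lt_top hN).ne
  refine ⟨(C * C) * I.toNNReal, ?_⟩
  intro K u ω ξ₀ a b hu hK hω ha hb hsupp x
  set k := modul ξ₀ (sker a b ω) with hk
  have hki : Integrable k := integrable_modul (integrable_sker hω ha hb)
  have h1 := hu.reproduce hK hki (fun ξ hξ => by
    rw [hk, fourier_modul, fourier_sker hω ha hb, fourier_ker_one (hsupp ξ hξ)]) x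
  set D := ENNReal.ofReal (a ^ (finrank ℝ E - 1) * b) with hD
  have hkx : ∀ y, ‖k y‖ₑ ≤ C * (D * dk N (stretch a b ω y)) := fun y => by
    have : ‖k y‖ₑ = ‖sker a b ω y‖ₑ := by rw [← ofReal_norm, ← ofReal_norm, hk, norm_modul]
    rw [this]; exact enorm_sker_le hC ha hb ω y
  have hm : Measurable fun y => dk N (stretch a b ω (x - y)) :=
    (measurable_dk N).comp ((continuous_stretch a b ω).measurable.comp (by fun_prop))
  have hum : Measurable fun y => ‖u y‖ₑ := hu.cont.measurable.enorm
  have hsq : ∀ t : ℝ≥0∞, (t ^ (1 / 2 : ℝ)) ^ 2 = t := fun t => by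
    rw [← ENNReal.rpow_natCast, ← ENNReal.rpow_mul]; norm_num
  have hI' : D * ∫⁻ y, dk N (stretch a b ω (x - y)) = I := by
    rw [lintegral_sub_left_eq_self (fun y => dk N (stretch a b ω y)) x, hD,
      lintegral_comp_stretch hω ha hb (measurable_dk N)]
  calc ‖u x‖ₑ ^ 2 ≤ (∫⁻ y, ‖u y‖ₑ * (C * (D * dk N (stretch a b ω (x - y))))) ^ 2 := by
        rw [h1]
        gcongr
        refine (enorm_integral_le_lintegral_enorm _).trans (lintegral_mono fun y => ?_)
        rw [enorm_mul]; gcongr; exact hkx _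
    _ = (C * D) ^ 2 * (∫⁻ y, (‖u y‖ₑ * dk N (stretch a b ω (x - y)) ^ (1 / 2 : ℝ)) *
          dk N (stretch a b ω (x - y)) ^ (1 / 2 : ℝ)) ^ 2 := by
        rw [← mul_pow, ← lintegral_const_mul' _ _ (ENNReal.mul_ne_top (by simp) (by simp [hD]))]
        congr 2; ext y
        conv_lhs => rw [← hsq (dk N (stretch a b ω (x - y)))]
        ring
    _ ≤ (C * D) ^ 2 * ((∫⁻ y, ‖u y‖ₑ ^ 2 * dk N (stretch a b ω (x - y))) *
          ∫⁻ y, dk N (stretch a b ω (x - y))) := by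
        gcongr
        refine (lintegral_mul_sq_le (hum.mul (hm.pow_const _)).aemeasurable
          (hm.pow_const _).aemeasurable).trans (le_of_eq ?_)
        simp only [Pi.mul_apply, mul_pow, hsq]
    _ = C * C * (D * ∫⁻ y, dk N (stretch a b ω (x - y))) *
          (D * ∫⁻ y, ‖u y‖ₑ ^ 2 * dk N (stretch a b ω (x - y))) := by ring
    _ = _ := by
        rw [hI']; push_cast; rw [ENNReal.coe_toNNReal hItop]

end Decay

end Falconer

namespace Falconer

open MeasureTheory Metric Set Filter Topology Module
open scoped FourierTransform ENNReal NNReal Pointwise ComplexConjugate RealInnerProductSpace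

set_option linter.unusedSectionVars false

section Frostman

variable {E : Type*} [NormedAddCommGroup E] [InnerProductSpace ℝ E] [FiniteDimensional ℝ E]
  [MeasurableSpace E] [BorelSpace E]

/-- The Frostman growth condition of exponent `α`. -/
def HasPow (α : ℝ) (ν : Measure E) : Prop :=
  ∀ x : E, ∀ r : ℝ, 0 < r → ν (closedBall x r) ≤ ENNReal.ofReal (r ^ α)

lemma HasPow.mono {α : ℝ} {ν ν' : Measure E} (h : HasPow α ν) (h' : ν' ≤ ν) : HasPow α ν' :=
  fun x r hr => (h' _).trans (h x r hr)

lemma exists_lintegral_dk_le {α : ℝ} {N : ℕ} (hN : α < N) : ∃ C : ℝ≥0, ∀ ν : Measure E,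
    HasPow α ν → ∀ a : ℝ, 0 < a → ∀ x,
    ∫⁻ y, dk N (a • (x - y)) ∂ν ≤ C * ENNReal.ofReal (a ^ (-α)) := by
  set q : ℝ := 2 ^ (α - N) with hq
  have hq0 : 0 < q := by positivity
  have hq1 : q < 1 := Real.rpow_lt_one_of_one_lt_of_neg one_lt_two (by linarith)
  set S : ℝ≥0∞ := ENNReal.ofReal (2 ^ α) * (1 - ENNReal.ofReal q)⁻¹ with hS
  have hStop : S ≠ ∞ := by
    refine ENNReal.mul_ne_top ENNReal.ofReal_ne_top (ENNReal.inv_ne_top.2 ?_)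
    rw [ne_eq, tsub_eq_zero_iff_le, not_le]
    simpa using ENNReal.ofReal_lt_one.2 hq1
  refine ⟨S.toNNReal, fun ν hν a ha x => ?_⟩
  have hpt : ∀ y, dk N (a • (x - y)) ≤ ∑' j : ℕ, ENNReal.ofReal ((2 ^ (j * N))⁻¹) *
      (closedBall x (2 ^ (j + 1) / a)).indicator 1 y := fun y => by
    obtain ⟨j, hj1, hj2⟩ := exists_nat_pow_near (x := 1 + ‖a • (x - y)‖) (y := (2 : ℝ))
      (by simp) one_lt_two
    refine le_trans ?_ (ENNReal.le_tsum j)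
    have hy : y ∈ closedBall x (2 ^ (j + 1) / a) := by
      rw [mem_closedBall', dist_eq_norm, le_div_iff₀ ha, mul_comm]
      rw [norm_smul, Real.norm_of_nonneg ha.le] at hj2
      linarith
    rw [indicator_of_mem hy, Pi.one_apply, mul_one, dk, wt_eq_ofReal, ENNReal.ofReal_inv_of_pos
      (by positivity), pow_mul, ENNReal.ofReal_pow (by positivity)]
    gcongr
  calc ∫⁻ y, dk N (a • (x - y)) ∂ν ≤ ∫⁻ y, ∑' j : ℕ, ENNReal.ofReal ((2 ^ (j * N))⁻¹) *
      (closedBall x (2 ^ (j + 1) / a)).indicator 1 y ∂ν := lintegral_mono hpt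
    _ = ∑' j : ℕ, ENNReal.ofReal ((2 ^ (j * N))⁻¹) * ν (closedBall x (2 ^ (j + 1) / a)) := by
        rw [lintegral_tsum fun j => ((measurable_one.indicator
          measurableSet_closedBall).const_mul _).aemeasurable]
        congr 1; ext j
        rw [lintegral_const_mul' _ _ ENNReal.ofReal_ne_top, lintegral_indicator_one
          measurableSet_closedBall]
    _ ≤ ∑' j : ℕ, ENNReal.ofReal (a ^ (-α)) * ENNReal.ofReal (2 ^ α) * ENNReal.ofReal q ^ j := by
        refine ENNReal.tsum_le_tsum fun j => ?_
        refine (mul_le_mul_right (hν x _ (by positivity)) _).trans (le_of_eq ?_)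
        rw [← ENNReal.ofReal_mul (by positivity), ← ENNReal.ofReal_pow hq0.le,
          ← ENNReal.ofReal_mul (by positivity), ← ENNReal.ofReal_mul (by positivity)]
        congr 1
        rw [Real.div_rpow (by positivity) ha.le, Real.rpow_neg ha.le, hq, ← Real.rpow_natCast,
          ← Real.rpow_natCast, ← Real.rpow_natCast, ← Real.rpow_mul zero_le_two,
          ← Real.rpow_mul zero_le_two, ← Real.rpow_neg zero_le_two, div_eq_mul_inv]
        have e1 : (2 : ℝ) ^ (-((j * N : ℕ) : ℝ)) * 2 ^ (((j + 1 : ℕ) : ℝ) * α)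
            = 2 ^ α * 2 ^ ((α - N) * (j : ℝ)) := by
          rw [← Real.rpow_add two_pos, ← Real.rpow_add two_pos]
          congr 1; push_cast; ring
        linear_combination (a ^ α)⁻¹ * e1
    _ = S * ENNReal.ofReal (a ^ (-α)) := by
        rw [ENNReal.tsum_mul_left, ENNReal.tsum_geometric, hS]; ring
    _ = _ := by rw [ENNReal.coe_toNNReal hStop]

/-- The elementary `L²` bound for functions band-limited to a ball of radius `a`. -/
lemma exists_ball_bound [Nontrivial E] {α : ℝ} : ∃ C : ℝ≥0, ∀ ν : Measure E, SFinite ν →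
    HasPow α ν → ∀ {K : Set E} {u : E → ℂ} {ξ₀ : E} {a : ℝ}, 0 < a → PW K u →
    K ⊆ closedBall ξ₀ a →
    ∫⁻ x, ‖u x‖ₑ ^ 2 ∂ν ≤ C * ENNReal.ofReal (a ^ (finrank ℝ E - α)) * ∫⁻ x, ‖u x‖ₑ ^ 2 := by
  obtain ⟨N, hN⟩ := exists_nat_gt (max α (finrank ℝ E))
  have hN1 : α < N := (le_max_left _ _).trans_lt hN
  have hN2 : finrank ℝ E < N := by exact_mod_cast (le_max_right _ _).trans_lt hN
  obtain ⟨C₁, hC₁⟩ := exists_local_const (E := E) N hN2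
  obtain ⟨C₂, hC₂⟩ := exists_lintegral_dk_le (E := E) hN1
  refine ⟨C₁ * C₂, fun ν hsf hν K u ξ₀ a ha hu hK => ?_⟩
  obtain ⟨ω, hω⟩ := exists_norm_eq E zero_le_one
  have hKb : Bornology.IsBounded K := isBounded_closedBall.subset hK
  have hpos := finrank_pos (R := ℝ) (M := E)
  have hpow : a ^ (finrank ℝ E - 1) * a = a ^ (finrank ℝ E) := by
    rw [← pow_succ]; congr 1; omega
  set D := ENNReal.ofReal (a ^ (finrank ℝ E)) with hD
  have h1 := fun x => hC₁ hu hKb hω ha ha (ξ₀ := ξ₀) (fun ξ hξ => by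
    rw [stretch_self, norm_smul, Real.norm_of_nonneg (inv_pos.2 ha).le, inv_mul_le_iff₀ ha, mul_one,
      ← dist_eq_norm]
    exact hK hξ) x
  simp only [hpow, stretch_self] at h1
  have hum : Measurable fun y => ‖u y‖ₑ := hu.cont.measurable.enorm
  calc ∫⁻ x, ‖u x‖ₑ ^ 2 ∂ν
      ≤ ∫⁻ x, C₁ * (D * ∫⁻ y, ‖u y‖ₑ ^ 2 * dk N (a • (x - y))) ∂ν := lintegral_mono h1
    _ = C₁ * (D * ∫⁻ x, ∫⁻ y, ‖u y‖ₑ ^ 2 * dk N (a • (x - y)) ∂volume ∂ν) := by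
        rw [lintegral_const_mul' _ _ (by simp), lintegral_const_mul' _ _ (by simp [hD])]
    _ = C₁ * (D * ∫⁻ y, ‖u y‖ₑ ^ 2 * ∫⁻ x, dk N (a • (y - x)) ∂ν) := by
        rw [lintegral_lintegral_swap]
        · congr 2
          refine lintegral_congr fun y => ?_
          rw [lintegral_const_mul' _ _ (by simp)]
          congr 2; ext x
          rw [← dk_neg, ← smul_neg, neg_sub]
        · exact (Measurable.mul ((hum.comp measurable_snd).pow_const 2) ((measurable_dk N).comp (by fun_prop))).aemeasurable
    _ ≤ C₁ * (D * ∫⁻ y, ‖u y‖ₑ ^ 2 * (C₂ * ENNReal.ofReal (a ^ (-α)))) := by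
        gcongr with y
        exact hC₂ ν hν a ha y
    _ = _ := by
        rw [lintegral_mul_const' _ _ (ENNReal.mul_ne_top (by simp) (by simp)), hD, sub_eq_add_neg,
          Real.rpow_add ha, Real.rpow_natCast, ENNReal.ofReal_mul (by positivity)]
        push_cast; ring

/-- The spherical shell `{ξ : |‖ξ‖ - R| ≤ h}`. -/
def shell (E : Type*) [NormedAddCommGroup E] (R h : ℝ) : Set E := {ξ | |‖ξ‖ - R| ≤ h}

lemma shell_subset (R h : ℝ) : shell E R h ⊆ closedBall 0 (R + h) := fun ξ hξ => by
  have := (abs_le.1 (show |‖ξ‖ - R| ≤ h from hξ)).2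
  simp; linarith

lemma isBounded_shell (R h : ℝ) : Bornology.IsBounded (shell E R h) :=
  isBounded_closedBall.subset (shell_subset R h)

/-- The fractal `L²` extension estimate with exponent `γ`. -/
def ShellBound (E : Type*) [NormedAddCommGroup E] [InnerProductSpace ℝ E] [FiniteDimensional ℝ E]
    [MeasurableSpace E] [BorelSpace E] (α γ : ℝ) (A : ℝ≥0) : Prop :=
  ∀ R : ℝ, 1 ≤ R → ∀ ν : Measure E, IsFiniteMeasure ν → HasPow α ν → ∀ (x₀ : E) (u : E → ℂ),
    PW (shell E R 1) u →
    ∫⁻ x in closedBall x₀ 1, ‖u x‖ₑ ^ 2 ∂ν ≤ A * ENNReal.ofReal (R ^ γ) * ∫⁻ x, ‖u x‖ₑ ^ 2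

lemma exists_shellBound_trivial [Nontrivial E] {α : ℝ} (hα : α ≤ finrank ℝ E) :
    ∃ A, ShellBound E α (finrank ℝ E - α) A := by
  obtain ⟨C, hC⟩ := exists_ball_bound (E := E) (α := α)
  refine ⟨C * Real.toNNReal (2 ^ (finrank ℝ E - α)), fun R hR ν hfin hν x₀ u hu => ?_⟩
  refine (setLIntegral_le_lintegral _ _).trans ((hC ν inferInstance hν (by linarith) hu
    (shell_subset R 1)).trans ?_)
  rw [ENNReal.coe_mul]
  change _ ≤ C * ENNReal.ofReal _ * _ * _
  rw [mul_assoc (C : ℝ≥0∞) (ENNReal.ofReal _) (ENNReal.ofReal _),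
    ← ENNReal.ofReal_mul (by positivity), ← Real.mul_rpow (by norm_num) (by linarith)]
  gcongr
  linarith

/-- The extension estimate at a smaller spatial scale. -/
lemma ShellBound.rescale [Nontrivial E] {α γ : ℝ} {A : ℝ≥0} (h : ShellBound E α γ A) {R r : ℝ}
    (hr : 0 < r) (hrR : 1 ≤ r * R) (ν : Measure E) [IsFiniteMeasure ν] (hν : HasPow α ν)
    (z : E) {w : E → ℂ} (hw : PW (shell E R r⁻¹) w) :
    ∫⁻ x in closedBall z r, ‖w x‖ₑ ^ 2 ∂ν ≤
      A * ENNReal.ofReal (r ^ (α - finrank ℝ E) * (r * R) ^ γ) * ∫⁻ x, ‖w x‖ₑ ^ 2 := by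
  obtain ⟨ω, hω⟩ := exists_norm_eq E zero_le_one
  have hpos := finrank_pos (R := ℝ) (M := E)
  have hpow : r ^ (finrank ℝ E - 1) * r = r ^ (finrank ℝ E) := by
    rw [← pow_succ]; congr 1; omega
  have hv : PW (shell E (r * R) 1) fun x => w (r • x) := by
    refine ⟨hw.cont.comp (by fun_prop), ?_, fun ξ hξ => ?_⟩
    · simpa [stretch_self] using integrable_comp_stretch hw.int hω hr hr
    · have h1 := fourier_comp_stretch hw.cont hω hr hr ξ
      rw [hw.supp] at h1
      · simpa [stretch_self, hr.ne'] using h1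
      · intro h2
        apply hξ
        simp only [shell, mem_ofPred_eq, stretch_self, norm_smul, norm_inv, Real.norm_of_nonneg hr.le]
          at h2 ⊢
        have h3 : ‖ξ‖ - r * R = r * (r⁻¹ * ‖ξ‖ - R) := by field_simp
        rw [h3, abs_mul, abs_of_pos hr]
        calc r * |r⁻¹ * ‖ξ‖ - R| ≤ r * r⁻¹ := by gcongr
          _ = 1 := mul_inv_cancel₀ hr.ne'
  have hm : Measurable fun x : E => r⁻¹ • x := by fun_prop
  set c := ENNReal.ofReal (r ^ (-α)) with hc
  have hcc : ENNReal.ofReal (r ^ α) * c = 1 := by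
    rw [hc, ← ENNReal.ofReal_mul (by positivity), ← Real.rpow_add hr]; simp
  set ν' : Measure E := c • ν.map fun x => r⁻¹ • x with hν'
  have : IsFiniteMeasure ν' := by
    rw [hν', hc]
    exact Measure.smul_finite _ ENNReal.ofReal_ne_top
  have hpre : ∀ x ρ, (fun x : E => r⁻¹ • x) ⁻¹' closedBall x ρ = closedBall (r • x) (r * ρ) :=
    fun x ρ => by
      ext y
      simp only [mem_preimage, mem_closedBall, dist_eq_norm]
      have : y - r • x = r • (r⁻¹ • y - x) := by rw [smul_sub, smul_inv_smul₀ hr.ne']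
      rw [this, norm_smul, Real.norm_of_nonneg hr.le, mul_le_mul_iff_right₀ hr]
  have hν'p : HasPow α ν' := fun x ρ hρ => by
    rw [hν', Measure.smul_apply, Measure.map_apply hm measurableSet_closedBall, hpre, smul_eq_mul]
    refine (mul_le_mul_right (hν _ _ (by positivity)) _).trans (le_of_eq ?_)
    rw [Real.mul_rpow hr.le hρ.le, ENNReal.ofReal_mul (by positivity), ← mul_assoc, mul_comm c, hcc,
      one_mul]
  have h1 := h (r * R) hrR ν' this hν'p (r⁻¹ • z) _ hv
  have h2 : ∫⁻ x in closedBall (r⁻¹ • z) 1, ‖w (r • x)‖ₑ ^ 2 ∂ν'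
      = c * ∫⁻ x in closedBall z r, ‖w x‖ₑ ^ 2 ∂ν := by
    rw [hν', Measure.restrict_smul, lintegral_smul_measure, smul_eq_mul,
      setLIntegral_map measurableSet_closedBall _ hm, hpre]
    · simp [hr.ne']
    · have := hw.cont
      exact Measurable.pow_const (Continuous.measurable (by fun_prop)).enorm 2
  have h3 : ∫⁻ x, ‖w x‖ₑ ^ 2 = ENNReal.ofReal (r ^ finrank ℝ E) * ∫⁻ x, ‖w (r • x)‖ₑ ^ 2 := by
    have := lintegral_comp_stretch hω hr hr (f := fun x => ‖w x‖ₑ ^ 2)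
      (hw.cont.measurable.enorm.pow_const 2)
    rw [← this, hpow]
    simp only [stretch_self]
  rw [h2] at h1
  calc ∫⁻ x in closedBall z r, ‖w x‖ₑ ^ 2 ∂ν
      = ENNReal.ofReal (r ^ α) * (c * ∫⁻ x in closedBall z r, ‖w x‖ₑ ^ 2 ∂ν) := by
        rw [← mul_assoc, hcc, one_mul]
    _ ≤ ENNReal.ofReal (r ^ α) * (A * ENNReal.ofReal ((r * R) ^ γ) * ∫⁻ x, ‖w (r • x)‖ₑ ^ 2) := by
        gcongr
    _ = A * (ENNReal.ofReal (r ^ (α - finrank ℝ E)) * ENNReal.ofReal (r ^ finrank ℝ E)) *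
          ENNReal.ofReal ((r * R) ^ γ) * ∫⁻ x, ‖w (r • x)‖ₑ ^ 2 := by
        rw [← ENNReal.ofReal_mul (by positivity), ← Real.rpow_natCast, ← Real.rpow_add hr]
        simp only [sub_add_cancel]; ring
    _ = _ := by
        rw [h3, ENNReal.ofReal_mul (by positivity)]; ring

end Frostman

end Falconer

namespace Falconer

open MeasureTheory Metric Set Filter Topology Module
open scoped FourierTransform ENNReal NNReal Pointwise ComplexConjugate RealInnerProductSpace

set_option linter.unusedSectionVars false

section Plates

variable {E : Type*} [NormedAddCommGroup E] [InnerProductSpace ℝ E] [FiniteDimensional ℝ E]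
  [MeasurableSpace E] [BorelSpace E]

lemma fourier_sum {ι : Type*} (s : Finset ι) {u : ι → E → ℂ} (h : ∀ i ∈ s, Integrable (u i))
    (ξ : E) : 𝓕 (fun x => ∑ i ∈ s, u i x) ξ = ∑ i ∈ s, 𝓕 (u i) ξ := by
  classical
  induction s using Finset.induction_on with
  | empty => simpa using (PW.zero (K := ∅)).supp ξ (by simp)
  | insert i s hi ih =>
    simp only [Finset.sum_insert hi]
    rw [← ih fun j hj => h j (by simp [hj])]
    exact fourier_add (h i (by simp))
      (integrable_finsetSum s fun j hj => h j (by simp [hj])) ξ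

/-- The plate tangent to the sphere of radius `R` at `R • ω`. -/
def plate (R C : ℝ) (ω : E) : Set E := {ξ | ‖ξ - R • ω‖ ≤ C * √R ∧ |⟪ω, ξ - R • ω⟫| ≤ C}

/-- A finite family of functions band-limited to boundedly overlapping plates. -/
structure Fam {ι : Type*} (R C : ℝ) (s : Finset ι) (ω : ι → E) (u : ι → E → ℂ) : Prop where
  unit : ∀ k ∈ s, ‖ω k‖ = 1
  pw : ∀ k ∈ s, PW (plate R C (ω k)) (u k)
  count : ∀ (x : E) (T : ℝ), 1 ≤ T → ∀ t ⊆ s, (∀ k ∈ t, ‖R • ω k - x‖ ≤ T * √R) →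
    (t.card : ℝ) ≤ C * T ^ finrank ℝ E

lemma Fam.subset {ι : Type*} {R C : ℝ} {s s' : Finset ι} {ω : ι → E} {u : ι → E → ℂ}
    (h : Fam R C s ω u) (hs : s' ⊆ s) : Fam R C s' ω u :=
  ⟨fun k hk => h.unit k (hs hk), fun k hk => h.pw k (hs hk),
    fun x T hT t ht => h.count x T hT t (ht.trans hs)⟩

lemma isBounded_plate (R C : ℝ) (ω : E) : Bornology.IsBounded (plate R C ω) :=
  (isBounded_closedBall (x := R • ω) (r := C * √R)).subset fun ξ hξ => by
    rw [mem_closedBall, dist_eq_norm]; exact hξ.1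

lemma plate_subset_shell {R C : ℝ} (hR : 1 ≤ R) {ω : E} (hω : ‖ω‖ = 1) :
    plate R C ω ⊆ shell E R (2 * C + 2 * C ^ 2) := by
  rintro ξ ⟨h1, h2⟩
  change |‖ξ‖ - R| ≤ _
  set η := ξ - R • ω with hη
  have hC : 0 ≤ C := (abs_nonneg _).trans h2
  have hξ : ξ = R • ω + η := by rw [hη]; abel
  have hsq : ‖ξ‖ ^ 2 = R ^ 2 + 2 * R * ⟪ω, η⟫ + ‖η‖ ^ 2 := by
    rw [hξ, norm_add_sq_real, norm_smul, hω, inner_smul_left]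
    simp; ring
  have h3 : ‖η‖ ^ 2 ≤ C ^ 2 * R := by
    have := pow_le_pow_left₀ (norm_nonneg _) h1 2
    rwa [mul_pow, Real.sq_sqrt (by linarith)] at this
  have h4 := abs_le.1 h2
  have hn := norm_nonneg ξ
  have h5 : |‖ξ‖ - R| * R ≤ (2 * C + 2 * C ^ 2) * R := by
    have : |‖ξ‖ - R| * R ≤ |‖ξ‖ - R| * (‖ξ‖ + R) := by gcongr; linarith
    refine this.trans ?_
    rw [← abs_of_nonneg (show 0 ≤ ‖ξ‖ + R by linarith), ← abs_mul,
      show (‖ξ‖ - R) * (‖ξ‖ + R) = 2 * R * ⟪ω, η⟫ + ‖η‖ ^ 2 by linear_combination hsq]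
    rw [abs_le]
    constructor <;> nlinarith [mul_le_mul_of_nonneg_left h4.1 (show 0 ≤ R by linarith),
      mul_le_mul_of_nonneg_left h4.2 (show 0 ≤ R by linarith), sq_nonneg ‖η‖, sq_nonneg C]
  exact le_of_mul_le_mul_right h5 (by linarith)

lemma mem_plate_of_shell {R C : ℝ} (hR : 1 ≤ R) {ξ₀ ξ : E}
    (h₀ : ξ₀ ∈ shell E R 1) (h : ξ ∈ shell E R 1) (hne : ξ₀ ≠ 0) (hC : 1 ≤ C)
    (hd : ‖ξ - ξ₀‖ ≤ C * √R) : ξ ∈ plate R (4 * (C + 1) ^ 2) (‖ξ₀‖⁻¹ • ξ₀) := by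
  set ω := ‖ξ₀‖⁻¹ • ξ₀ with hω
  have hn0 : 0 < ‖ξ₀‖ := norm_pos_iff.2 hne
  have hω1 : ‖ω‖ = 1 := by rw [hω, norm_smul, norm_inv, norm_norm, inv_mul_cancel₀ hn0.ne']
  have h00 : ‖ξ₀ - R • ω‖ ≤ 1 := by
    have : ξ₀ - R • ω = (‖ξ₀‖ - R) • ω := by
      rw [sub_smul]; congr 1
      rw [hω, smul_smul, mul_inv_cancel₀ hn0.ne', one_smul]
    rw [this, norm_smul, hω1, mul_one]; exact h₀
  have hs : 1 ≤ √R := Real.one_le_sqrt.2 hR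
  set η := ξ - R • ω with hη
  have h1 : ‖η‖ ≤ (C + 1) * √R := by
    calc ‖η‖ = ‖(ξ - ξ₀) + (ξ₀ - R • ω)‖ := by rw [hη]; congr 1; abel
      _ ≤ C * √R + 1 := (norm_add_le _ _).trans (add_le_add hd h00)
      _ ≤ _ := by linarith
  have h3 : ‖η‖ ^ 2 ≤ (C + 1) ^ 2 * R := by
    have := pow_le_pow_left₀ (norm_nonneg _) h1 2
    rwa [mul_pow, Real.sq_sqrt (by linarith)] at this
  have hξ : ξ = R • ω + η := by rw [hη]; abel
  have hsq : ‖ξ‖ ^ 2 = R ^ 2 + 2 * R * ⟪ω, η⟫ + ‖η‖ ^ 2 := by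
    rw [hξ, norm_add_sq_real, norm_smul, hω1, inner_smul_left]
    simp; ring
  have h6 := abs_le.1 (show |‖ξ‖ - R| ≤ 1 from h)
  refine ⟨h1.trans ?_, ?_⟩
  · gcongr; nlinarith
  · have hn := norm_nonneg ξ
    rw [abs_le]
    have h7 : |‖ξ‖ ^ 2 - R ^ 2| ≤ 3 * R := by
      rw [abs_le]; constructor <;> nlinarith
    have h8 := abs_le.1 h7
    have hR0 : 0 < R := by linarith
    have : 1 ≤ (C + 1) ^ 2 := by nlinarith
    constructor
    · refine le_of_mul_le_mul_left (a := R) ?_ hR0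
      nlinarith
    · refine le_of_mul_le_mul_left (a := R) ?_ hR0
      nlinarith [sq_nonneg ‖η‖]

end Plates

section Cells

variable {d : ℕ}

lemma card_le_of_coords (t : Finset (Fin d → ℤ)) (p : Fin d → ℝ) {M : ℝ} (hM : 0 ≤ M)
    (h : ∀ k ∈ t, ∀ i, |(k i : ℝ) - p i| ≤ M) : (t.card : ℝ) ≤ (2 * M + 1) ^ d := by
  have hsub : t ⊆ Fintype.piFinset fun i => Finset.Icc ⌈p i - M⌉ ⌊p i + M⌋ := fun k hk => by
    rw [Fintype.mem_piFinset]
    intro i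
    have := abs_le.1 (h k hk i)
    rw [Finset.mem_Icc]
    exact ⟨Int.ceil_le.2 (by linarith), Int.le_floor.2 (by linarith)⟩
  have h1 := Finset.card_le_card hsub
  rw [Fintype.card_piFinset] at h1
  refine (Nat.cast_le.2 h1).trans ?_
  push_cast
  calc ∏ i, ((Finset.Icc ⌈p i - M⌉ ⌊p i + M⌋).card : ℝ) ≤ ∏ i : Fin d, (2 * M + 1) := by
        refine Finset.prod_le_prod (fun i _ => by positivity) fun i _ => ?_
        rw [Int.card_Icc]
        have h2 := Int.floor_le (p i + M)
        have h3 := Int.le_ceil (p i - M)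
        have h4 : (((⌊p i + M⌋ + 1 - ⌈p i - M⌉).toNat : ℤ) : ℝ) ≤ 2 * M + 1 := by
          rw [Int.toNat_eq_max]
          push_cast
          exact max_le (by linarith) (by linarith)
        exact_mod_cast h4
    _ = _ := by simp

/-- A smooth bump whose integer translates form a partition of unity. -/
noncomputable def bump (x : ℝ) : ℝ := Real.smoothTransition x - Real.smoothTransition (x - 1)

lemma bump_nonneg (x : ℝ) : 0 ≤ bump x :=
  sub_nonneg.2 (Real.smoothTransition.monotone (by linarith))

lemma bump_le_one (x : ℝ) : bump x ≤ 1 := by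
  have := Real.smoothTransition.le_one x
  have := Real.smoothTransition.nonneg (x - 1)
  unfold bump; linarith

lemma bump_ne_zero {x : ℝ} (h : bump x ≠ 0) : 0 ≤ x ∧ x ≤ 2 := by
  by_contra h'
  rw [not_and_or, not_le, not_le] at h'
  refine h ?_
  rcases h' with h' | h'
  · rw [bump, Real.smoothTransition.zero_of_nonpos h'.le,
      Real.smoothTransition.zero_of_nonpos (by linarith), sub_zero]
  · rw [bump, Real.smoothTransition.one_of_one_le (by linarith),
      Real.smoothTransition.one_of_one_le (by linarith), sub_self]

lemma contDiff_bump : ContDiff ℝ ((⊤ : ℕ∞) : WithTop ℕ∞) bump :=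
  Real.smoothTransition.contDiff.sub (Real.smoothTransition.contDiff.comp (by fun_prop))

lemma sum_bump (x : ℝ) (M : ℕ) : ∑ m ∈ Finset.Ico (-M : ℤ) M, bump (x - m) =
    Real.smoothTransition (x + M) - Real.smoothTransition (x - M) := by
  have h := Finset.sum_range_sub' (fun j : ℕ => Real.smoothTransition (x + M - j)) (2 * M)
  have h2 : ∑ m ∈ Finset.Ico (-M : ℤ) M, bump (x - m) = ∑ j ∈ Finset.range (2 * M),
      (Real.smoothTransition (x + M - (j : ℕ)) - Real.smoothTransition (x + M - (j + 1 : ℕ))) := by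
    symm
    refine Finset.sum_bij (fun j _ => (j : ℤ) - M) ?_ ?_ ?_ ?_
    · intro j hj; rw [Finset.mem_range] at hj; rw [Finset.mem_Ico]; omega
    · intro j _ j' _ h; have h : (j : ℤ) - M = j' - M := h; omega
    · intro m hm
      rw [Finset.mem_Ico] at hm
      exact ⟨(m + M).toNat, by rw [Finset.mem_range]; omega, by omega⟩
    · intro j _
      rw [bump]; push_cast; ring_nf
  rw [h2, h]
  push_cast; ring_nf

/-- The decomposition of a function band-limited to a shell into plate pieces. -/
lemma exists_cells (d : ℕ) : ∃ C : ℝ, 1 ≤ C ∧ ∀ R : ℝ, 1 < R →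
    ∀ u : EuclideanSpace ℝ (Fin d) → ℂ, PW (shell _ R 1) u →
    ∃ (s : Finset (Fin d → ℤ)) (ω : (Fin d → ℤ) → EuclideanSpace ℝ (Fin d))
      (U : (Fin d → ℤ) → EuclideanSpace ℝ (Fin d) → ℂ), Fam R C s ω U ∧
      (∀ k ∈ s, ∀ i, |R * ω k i - √R * k i| ≤ C * √R) ∧
      (∀ x, u x = ∑ k ∈ s, U k x) ∧
      ∑ k ∈ s, ∫⁻ x, ‖U k x‖ₑ ^ 2 ≤ ∫⁻ x, ‖u x‖ₑ ^ 2 := by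
  classical
  set C₁ : ℝ := 2 * √d + 2 with hC₁
  have hC₁2 : 2 ≤ C₁ := by rw [hC₁]; linarith [Real.sqrt_nonneg d]
  set C₂ : ℝ := 4 * (C₁ + 1) ^ 2 with hC₂
  set C₃ : ℝ := max C₂ ((2 * C₂ + 3) ^ d) with hC₃
  have hC₂1 : 1 ≤ C₂ := by nlinarith
  refine ⟨C₃, hC₂1.trans (le_max_left _ _), fun R hR u hu => ?_⟩
  set σ := √R with hσ
  have hσ1 : 1 ≤ σ := Real.one_le_sqrt.2 hR.le
  have hσ0 : 0 < σ := by linarith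
  obtain ⟨M, hM⟩ := exists_nat_gt ((R + 1) / σ + 2)
  set P : Finset (Fin d → ℤ) := Fintype.piFinset fun _ => Finset.Ico (-M : ℤ) M with hP
  set χ : (Fin d → ℤ) → EuclideanSpace ℝ (Fin d) → ℝ := fun k ξ => ∏ i, bump (ξ i / σ - k i) with hχ
  have hχsupp : ∀ k ξ, χ k ξ ≠ 0 → ∀ i, |ξ i - σ * k i| ≤ 2 * σ := fun k ξ h i => by
    have h1 := bump_ne_zero (Finset.prod_ne_zero_iff.1 h i (Finset.mem_univ i))
    have h2 : ξ i = σ * (ξ i / σ) := by field_simp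
    rw [abs_le]; constructor <;> nlinarith
  have hχnorm : ∀ k ξ ξ', χ k ξ ≠ 0 → χ k ξ' ≠ 0 → ‖ξ - ξ'‖ ≤ C₁ * σ := fun k ξ ξ' h h' => by
    have h3 : ∀ i, (ξ i - ξ' i) ^ 2 ≤ (2 * σ) ^ 2 := fun i => by
      have h1 := bump_ne_zero (Finset.prod_ne_zero_iff.1 h i (Finset.mem_univ i))
      have h2 := bump_ne_zero (Finset.prod_ne_zero_iff.1 h' i (Finset.mem_univ i))
      have e1 : ξ i = σ * (ξ i / σ) := by field_simp
      have e2 : ξ' i = σ * (ξ' i / σ) := by field_simp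
      rw [sq_le_sq, abs_of_nonneg (show 0 ≤ 2 * σ by linarith), abs_le]
      constructor <;> nlinarith
    rw [EuclideanSpace.norm_eq]
    calc √(∑ i, ‖(ξ - ξ') i‖ ^ 2) ≤ √(∑ i : Fin d, (2 * σ) ^ 2) := by
          refine Real.sqrt_le_sqrt (Finset.sum_le_sum fun i _ => ?_)
          rw [Real.norm_eq_abs, sq_abs]; exact h3 i
      _ = √d * (2 * σ) := by
          rw [Finset.sum_const, Finset.card_univ, Fintype.card_fin, nsmul_eq_mul,
            Real.sqrt_mul (by positivity), Real.sqrt_sq (by linarith)]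
      _ ≤ _ := by rw [hC₁]; nlinarith
  have hχ0 : ∀ k ξ, 0 ≤ χ k ξ := fun k ξ => Finset.prod_nonneg fun i _ => bump_nonneg _
  have hχ1 : ∀ k ξ, χ k ξ ≤ 1 := fun k ξ =>
    Finset.prod_le_one (fun i _ => bump_nonneg _) fun i _ => bump_le_one _
  have hsum : ∀ ξ, ∑ k ∈ P, χ k ξ = ∏ i : Fin d,
      (Real.smoothTransition (ξ i / σ + M) - Real.smoothTransition (ξ i / σ - M)) := fun ξ => by
    simp only [← sum_bump]
    rw [Finset.prod_univ_sum]
  have hsum1 : ∀ ξ ∈ shell (EuclideanSpace ℝ (Fin d)) R 1, ∑ k ∈ P, χ k ξ = 1 := fun ξ hξ => by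
    rw [hsum]
    refine Finset.prod_eq_one fun i _ => ?_
    have h1 : |ξ i| ≤ R + 1 := by
      have h2 := (abs_le.1 (show |‖ξ‖ - R| ≤ 1 from hξ)).2
      have := EuclideanSpace.norm_eq ξ
      have h3 : ‖ξ i‖ ≤ ‖ξ‖ := PiLp.norm_apply_le ξ i
      rw [Real.norm_eq_abs] at h3; linarith
    have h4 : |ξ i / σ| ≤ (R + 1) / σ := by
      rw [abs_div, abs_of_pos hσ0]; gcongr
    have h5 := abs_le.1 h4
    rw [Real.smoothTransition.one_of_one_le (by linarith),
      Real.smoothTransition.zero_of_nonpos (by linarith), sub_zero]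
  have hsumle : ∀ ξ, ∑ k ∈ P, χ k ξ ≤ 1 := fun ξ => by
    rw [hsum]
    refine Finset.prod_le_one (fun i _ => ?_) fun i _ => ?_
    · refine sub_nonneg.2 (Real.smoothTransition.monotone ?_)
      have : (0 : ℝ) ≤ M := by positivity
      linarith
    · linarith [Real.smoothTransition.le_one (ξ i / σ + M),
        Real.smoothTransition.nonneg (ξ i / σ - M)]
  have hcs : ∀ k, HasCompactSupport fun ξ => (χ k ξ : ℂ) := fun k => by
    by_cases hne : ∃ ξ₀, χ k ξ₀ ≠ 0
    · obtain ⟨ξ₀, h₀⟩ := hne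
      refine HasCompactSupport.intro (isCompact_closedBall ξ₀ (C₁ * σ)) fun ξ hξ => ?_
      by_contra h
      refine hξ ?_
      rw [mem_closedBall, dist_eq_norm]
      exact hχnorm k ξ ξ₀ (by exact_mod_cast h) h₀
    · push Not at hne
      refine HasCompactSupport.intro isCompact_empty fun ξ _ => by simp [hne]
  have hsm : ∀ k, ContDiff ℝ ((⊤ : ℕ∞) : WithTop ℕ∞) fun ξ => (χ k ξ : ℂ) := fun k => by
    have h : ContDiff ℝ ((⊤ : ℕ∞) : WithTop ℕ∞) fun ξ : EuclideanSpace ℝ (Fin d) =>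
        ∏ i ∈ Finset.univ, bump (ξ i / σ - k i) := by
      refine contDiff_prod fun i _ => contDiff_bump.comp ?_
      refine (ContDiff.div_const ?_ _).sub contDiff_const
      exact (EuclideanSpace.proj (𝕜 := ℝ) i : EuclideanSpace ℝ (Fin d) →L[ℝ] ℝ).contDiff
    exact Complex.ofRealCLM.contDiff.comp h
  choose U hU hUf using fun k => hu.exists_cutoff ((hcs k).toSchwartzMap (hsm k))
  have hUf' : ∀ k ξ, 𝓕 (U k) ξ = χ k ξ * 𝓕 u ξ := hUf
  have hU' : ∀ k, PW (shell _ R 1 ∩ {ξ | χ k ξ ≠ 0}) (U k) := fun k =>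
    (hU k).mono fun ξ hξ => ⟨hξ.1, by
      have : (χ k ξ : ℂ) ≠ 0 := hξ.2
      exact_mod_cast this⟩
  set s : Finset (Fin d → ℤ) := P.filter fun k =>
    (shell (EuclideanSpace ℝ (Fin d)) R 1 ∩ {ξ | χ k ξ ≠ 0}).Nonempty with hs
  have hbd : ∀ k, Bornology.IsBounded (shell (EuclideanSpace ℝ (Fin d)) R 1 ∩ {ξ | χ k ξ ≠ 0}) :=
    fun k => (isBounded_shell R 1).subset inter_subset_left
  have hzero : ∀ k ∈ P, k ∉ s → ∀ x, U k x = 0 := fun k hk hks => by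
    have he : shell (EuclideanSpace ℝ (Fin d)) R 1 ∩ {ξ | χ k ξ ≠ 0} = ∅ := by
      by_contra h
      exact hks (Finset.mem_filter.2 ⟨hk, nonempty_iff_ne_empty.2 h⟩)
    have := (hU' k).ext_fourier (PW.zero (K := ∅)) (hbd k) Bornology.isBounded_empty fun ξ => by
      rw [(hU' k).supp ξ (by simp [he]), (PW.zero (K := ∅)).supp ξ (by simp)]
    exact fun x => congrFun this x
  have hchoice : ∀ k, ∃ ξ : EuclideanSpace ℝ (Fin d), k ∈ s →
      ξ ∈ shell (EuclideanSpace ℝ (Fin d)) R 1 ∧ χ k ξ ≠ 0 := fun k => by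
    by_cases hk : k ∈ s
    · obtain ⟨ξ, hξ⟩ := (Finset.mem_filter.1 hk).2
      exact ⟨ξ, fun _ => hξ⟩
    · exact ⟨0, fun h => absurd h hk⟩
  choose ξ hξ using hchoice
  have hne : ∀ k ∈ s, ξ k ≠ 0 := fun k hk h0 => by
    have h2 := (abs_le.1 (show |‖ξ k‖ - R| ≤ 1 from (hξ k hk).1)).1
    rw [h0, norm_zero] at h2; linarith
  have hloc : ∀ k ∈ s, ∀ i, |R * (‖ξ k‖⁻¹ • ξ k) i - σ * k i| ≤ C₂ * σ := fun k hk i => by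
    have h1 := mem_plate_of_shell hR.le (hξ k hk).1 (hξ k hk).1 (hne k hk) (C := 1) le_rfl
      (by simp)
    have h00 := h1.2
    have h1' : ‖ξ k - R • (‖ξ k‖⁻¹ • ξ k)‖ ≤ 1 := by
      have : ξ k - R • (‖ξ k‖⁻¹ • ξ k) = (‖ξ k‖ - R) • (‖ξ k‖⁻¹ • ξ k) := by
        rw [sub_smul]; congr 1
        rw [smul_smul, mul_inv_cancel₀ (norm_ne_zero_iff.2 (hne k hk)), one_smul]
      rw [this, norm_smul, norm_smul, norm_inv, norm_norm,
        inv_mul_cancel₀ (norm_ne_zero_iff.2 (hne k hk)), mul_one]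
      exact (hξ k hk).1
    have h2 : |ξ k i - R * (‖ξ k‖⁻¹ • ξ k) i| ≤ 1 := by
      have := (PiLp.norm_apply_le (ξ k - R • (‖ξ k‖⁻¹ • ξ k)) i).trans h1'
      simpa using this
    have h3 := hχsupp k (ξ k) (hξ k hk).2 i
    have h2' := abs_le.1 h2
    have h3' := abs_le.1 h3
    have : 3 * σ ≤ C₂ * σ := by gcongr; rw [hC₂]; nlinarith
    rw [abs_le]; constructor <;> linarith
  refine ⟨s, fun k => ‖ξ k‖⁻¹ • ξ k, U, ⟨fun k hk => ?_, fun k hk => ?_, ?_⟩, ?_, ?_, ?_⟩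
  · rw [norm_smul, norm_inv, norm_norm, inv_mul_cancel₀ (norm_ne_zero_iff.2 (hne k hk))]
  · refine (hU' k).mono fun ζ hζ => ?_
    have := mem_plate_of_shell hR.le (hξ k hk).1 hζ.1 (hne k hk) (C := C₁) (by linarith)
      (hχnorm k _ _ hζ.2 (hξ k hk).2)
    have hle : C₂ ≤ C₃ := le_max_left _ _
    exact ⟨this.1.trans (by gcongr), this.2.trans hle⟩
  · intro x T hT t ht h
    have h1 := card_le_of_coords t (fun i => x i / σ) (M := T + C₂) (by linarith) fun k hk i => by
      have h2 := abs_le.1 (hloc k (ht hk) i)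
      have h3 := (PiLp.norm_apply_le _ i).trans (h k hk)
      have h4 : |R * (‖ξ k‖⁻¹ • ξ k) i - x i| ≤ T * σ := by simpa using h3
      have h4' := abs_le.1 h4
      have h5 : (k i : ℝ) - x i / σ = (σ * k i - x i) / σ := by field_simp
      rw [h5, abs_div, abs_of_pos hσ0, div_le_iff₀ hσ0, abs_le]
      constructor <;> linarith
    refine h1.trans ?_
    rw [finrank_euclideanSpace, Fintype.card_fin]
    calc (2 * (T + C₂) + 1) ^ d ≤ ((2 * C₂ + 3) * T) ^ d := by
          refine pow_le_pow_left₀ (by linarith) ?_ _; nlinarith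
      _ = (2 * C₂ + 3) ^ d * T ^ d := mul_pow _ _ _
      _ ≤ _ := by gcongr; exact le_max_right _ _
  · exact fun k hk i => (hloc k hk i).trans (by gcongr; exact le_max_left _ _)
  · intro x
    have h1 : u = fun x => ∑ k ∈ P, U k x := by
      refine hu.ext_fourier (PW.sum P fun k _ => (hU' k).mono inter_subset_left)
        (isBounded_shell R 1) (isBounded_shell R 1) fun ζ => ?_
      rw [fourier_sum P fun k _ => (hU' k).int]
      simp only [hUf']
      rw [← Finset.sum_mul]
      by_cases hζ : ζ ∈ shell (EuclideanSpace ℝ (Fin d)) R 1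
      · have := hsum1 ζ hζ
        rw [← Complex.ofReal_sum, this]; simp
      · rw [hu.supp ζ hζ]; simp
    rw [h1]
    symm
    exact Finset.sum_subset (Finset.filter_subset _ _) fun k hk hks => hzero k hk hks x
  · have h1 : ∀ k, ∫⁻ x, ‖U k x‖ₑ ^ 2 = ∫⁻ ζ, ENNReal.ofReal (χ k ζ) ^ 2 * ‖𝓕 u ζ‖ₑ ^ 2 :=
      fun k => by
      rw [← (hU' k).lintegral_fourier_sq (hbd k)]
      congr 1; ext ζ
      rw [hUf', enorm_mul, mul_pow]
      congr 2
      rw [← ofReal_norm, Complex.norm_real, Real.norm_of_nonneg (hχ0 k ζ)]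
    have hm : Measurable fun ζ => ‖𝓕 u ζ‖ₑ := (continuous_fourier hu.int).measurable.enorm
    have hχm : ∀ k, Measurable (χ k) := fun k => by
      have := Complex.continuous_re.comp (hsm k).continuous
      exact this.measurable
    calc ∑ k ∈ s, ∫⁻ x, ‖U k x‖ₑ ^ 2
        = ∫⁻ ζ, ∑ k ∈ s, ENNReal.ofReal (χ k ζ) ^ 2 * ‖𝓕 u ζ‖ₑ ^ 2 := by
          rw [lintegral_finsetSum']
          · exact Finset.sum_congr rfl fun k _ => h1 k
          · exact fun k _ => (((hχm k).ennreal_ofReal.pow_const 2).mul (hm.pow_const 2)).aemeasurable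
      _ ≤ ∫⁻ ζ, ‖𝓕 u ζ‖ₑ ^ 2 := by
          refine lintegral_mono fun ζ => ?_
          rw [← Finset.sum_mul]
          refine mul_le_of_le_one_left' ?_
          calc ∑ k ∈ s, ENNReal.ofReal (χ k ζ) ^ 2 ≤ ∑ k ∈ P, ENNReal.ofReal (χ k ζ) := by
                refine (Finset.sum_le_sum_of_subset (Finset.filter_subset _ _)).trans
                  (Finset.sum_le_sum fun k _ => ?_)
                rw [sq]
                exact mul_le_of_le_one_left' (by simpa using hχ1 k ζ)
            _ = ENNReal.ofReal (∑ k ∈ P, χ k ζ) :=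
                (ENNReal.ofReal_sum_of_nonneg fun k _ => hχ0 k ζ).symm
            _ ≤ 1 := by simpa using hsumle ζ
      _ = _ := hu.lintegral_fourier_sq (isBounded_shell R 1)

end Cells

end Falconer

namespace Falconer

open MeasureTheory Metric Set Filter Topology Module
open scoped FourierTransform ENNReal NNReal Pointwise ComplexConjugate RealInnerProductSpace

set_option linter.unusedSectionVars false

section Averages

variable {E : Type*} [NormedAddCommGroup E] [InnerProductSpace ℝ E] [FiniteDimensional ℝ E]
  [MeasurableSpace E] [BorelSpace E]

lemma dk_map_sub_le (N : ℕ) (L : E →ₗ[ℝ] E) (x x' y : E) :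
    dk N (L (x - y)) ≤ wt (L (x - x')) ^ N * dk N (L (x' - y)) := by
  have h := dk_le N (L (x - y)) (L (x' - x))
  rw [← map_add, show x - y + (x' - x) = x' - y by abel] at h
  rwa [← wt_neg, ← map_neg, neg_sub]

/-- Local `L²` average of `u` at the tube scale `σ⁻¹ × 1`. -/
noncomputable def avg (N : ℕ) (σ : ℝ) (ω : E) (u : E → ℂ) (x : E) : ℝ≥0∞ :=
  ENNReal.ofReal (σ ^ (finrank ℝ E - 1)) * ∫⁻ y, ‖u y‖ₑ ^ 2 * dk N (stretch σ 1 ω (x - y))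

lemma measurable_avg {N : ℕ} {σ : ℝ} {ω : E} {u : E → ℂ} (hu : Continuous u) :
    Measurable (avg N σ ω u) := by
  refine Measurable.const_mul ?_ _
  refine Measurable.lintegral_prod_right' (f := fun z : E × E =>
    ‖u z.2‖ₑ ^ 2 * dk N (stretch σ 1 ω (z.1 - z.2))) ?_
  exact ((hu.measurable.enorm.comp measurable_snd).pow_const 2).mul
    ((measurable_dk N).comp (by fun_prop))

lemma avg_le (N : ℕ) (σ : ℝ) (ω : E) (u : E → ℂ) (x x' : E) :
    avg N σ ω u x ≤ wt (stretch σ 1 ω (x - x')) ^ N * avg N σ ω u x' := by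
  rw [avg, avg, mul_left_comm, ← lintegral_const_mul' _ _ (ENNReal.pow_ne_top (wt_ne_top _))]
  refine mul_le_mul_right (lintegral_mono fun y => ?_) _
  rw [mul_left_comm]
  exact mul_le_mul_right (dk_map_sub_le N _ x x' y) _

lemma lintegral_dk_stretch (N : ℕ) {σ : ℝ} (hσ : 0 < σ) {ω : E} (hω : ‖ω‖ = 1) (y : E) :
    ENNReal.ofReal (σ ^ (finrank ℝ E - 1)) * ∫⁻ x, dk N (stretch σ 1 ω (x - y)) =
      ∫⁻ x : E, dk N x := by
  rw [lintegral_sub_right_eq_self (fun x => dk N (stretch σ 1 ω x)) y]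
  have := lintegral_comp_stretch hω hσ one_pos (measurable_dk (E := E) N)
  rwa [mul_one] at this

lemma lintegral_avg (N : ℕ) {σ : ℝ} (hσ : 0 < σ) {ω : E} (hω : ‖ω‖ = 1) {u : E → ℂ}
    (hu : Continuous u) :
    ∫⁻ x, avg N σ ω u x = (∫⁻ x : E, dk N x) * ∫⁻ x, ‖u x‖ₑ ^ 2 := by
  have hm : Measurable fun z : E × E => ‖u z.2‖ₑ ^ 2 * dk N (stretch σ 1 ω (z.1 - z.2)) :=
    ((hu.measurable.enorm.comp measurable_snd).pow_const 2).mul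
      ((measurable_dk N).comp (by fun_prop))
  simp only [avg]
  rw [lintegral_const_mul' _ _ ENNReal.ofReal_ne_top, lintegral_lintegral_swap hm.aemeasurable]
  have h1 : ∀ y, ∫⁻ x, ‖u y‖ₑ ^ 2 * dk N (stretch σ 1 ω (x - y)) =
      ‖u y‖ₑ ^ 2 * ∫⁻ x, dk N (stretch σ 1 ω (x - y)) := fun y =>
    lintegral_const_mul' _ _ (by simp)
  simp only [h1]
  rw [← lintegral_const_mul' _ _ ENNReal.ofReal_ne_top,
    ← lintegral_const_mul _ (hu.measurable.enorm.pow_const 2)]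
  congr 1; ext y
  rw [mul_left_comm, lintegral_dk_stretch N hσ hω, mul_comm]

lemma exists_sq_le_avg (N : ℕ) (hN : finrank ℝ E < N) {C₀ : ℝ} (hC₀ : 1 ≤ C₀) :
    ∃ C : ℝ≥0, ∀ {R : ℝ} {ω : E} {u : E → ℂ}, 1 ≤ R → ‖ω‖ = 1 → PW (plate R C₀ ω) u → ∀ x,
      ‖u x‖ₑ ^ 2 ≤ C * avg N √R ω u x := by
  obtain ⟨C, hC⟩ := exists_local_const (E := E) N hN
  refine ⟨C * Real.toNNReal ((2 * C₀) ^ (finrank ℝ E - 1) * (2 * C₀)), fun {R ω u} hR hω hu x => ?_⟩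
  have hσ : 0 < √R := by positivity
  have h := hC hu (isBounded_plate _ _ _) hω (a := 2 * C₀ * √R) (b := 2 * C₀) (ξ₀ := R • ω)
    (by positivity) (by positivity) (fun ξ hξ => by
      refine (abs_le_of_sq_le_sq' ?_ zero_le_one).2
      rw [norm_stretch_sq hω]
      have h1 : ‖ξ - R • ω‖ ^ 2 ≤ (C₀ * √R) ^ 2 := pow_le_pow_left₀ (norm_nonneg _) hξ.1 2
      have h2 : ⟪ω, ξ - R • ω⟫ ^ 2 ≤ C₀ ^ 2 := by
        rw [← sq_abs]; exact pow_le_pow_left₀ (abs_nonneg _) hξ.2 2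
      have h3 : (2 * C₀ * √R)⁻¹ ^ 2 * (‖ξ - R • ω‖ ^ 2 - ⟪ω, ξ - R • ω⟫ ^ 2)
          ≤ (2 * C₀ * √R)⁻¹ ^ 2 * (C₀ * √R) ^ 2 := by
        gcongr; nlinarith [sq_nonneg ⟪ω, ξ - R • ω⟫]
      have h4 : (2 * C₀)⁻¹ ^ 2 * ⟪ω, ξ - R • ω⟫ ^ 2 ≤ (2 * C₀)⁻¹ ^ 2 * C₀ ^ 2 := by gcongr
      have e1 : (2 * C₀ * √R)⁻¹ ^ 2 * (C₀ * √R) ^ 2 = 1 / 4 := by field_simp; norm_num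
      have e2 : (2 * C₀)⁻¹ ^ 2 * C₀ ^ 2 = 1 / 4 := by field_simp; norm_num
      linarith) x
  refine h.trans ?_
  have e : (2 * C₀ * √R) ^ (finrank ℝ E - 1) * (2 * C₀)
      = ((2 * C₀) ^ (finrank ℝ E - 1) * (2 * C₀)) * √R ^ (finrank ℝ E - 1) := by
    rw [mul_pow]; ring
  rw [e, ENNReal.ofReal_mul (by positivity), ENNReal.coe_mul, avg]
  change _ ≤ C * ENNReal.ofReal _ * _
  rw [mul_assoc, mul_assoc (C : ℝ≥0∞)]
  gcongr with y
  refine dk_anti (norm_stretch_mono hω ?_ ?_ _)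
  · rw [abs_of_pos hσ, abs_of_pos (by positivity)]
    nlinarith
  · rw [abs_one, abs_of_pos (by positivity)]; linarith

/-- The mass of `f` on `S` transported along the direction `ω` at transversal scale `σ⁻¹`. -/
noncomputable def tw (N : ℕ) (σ : ℝ) (ω : E) (f : E → ℝ≥0∞) (S : Set E) (x : E) : ℝ≥0∞ :=
  ∫⁻ y in S, f y * dk N (stretch σ 0 ω (x - y))

variable {N : ℕ} {σ : ℝ} {ω : E} {f : E → ℝ≥0∞} {S S' : Set E}

lemma measurable_tw (hf : Measurable f) : Measurable (tw N σ ω f S) := by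
  refine Measurable.lintegral_prod_right' (f := fun z : E × E =>
    f z.2 * dk N (stretch σ 0 ω (z.1 - z.2))) ?_
  exact (hf.comp measurable_snd).mul ((measurable_dk N).comp (by fun_prop))

lemma tw_le (N : ℕ) (σ : ℝ) (ω : E) (f : E → ℝ≥0∞) (S : Set E) (x x' : E) :
    tw N σ ω f S x ≤ wt (stretch σ 0 ω (x - x')) ^ N * tw N σ ω f S x' := by
  rw [tw, tw, ← lintegral_const_mul' _ _ (ENNReal.pow_ne_top (wt_ne_top _))]
  refine lintegral_mono fun y => ?_
  rw [mul_left_comm]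
  exact mul_le_mul_right (dk_map_sub_le N _ x x' y) _

lemma tw_mono (h : S ⊆ S') (x : E) : tw N σ ω f S x ≤ tw N σ ω f S' x :=
  lintegral_mono_set h

lemma tw_ne_top (hf : ∫⁻ x, f x ≠ ∞) (x : E) : tw N σ ω f S x ≠ ∞ := by
  refine ne_top_of_le_ne_top hf ((setLIntegral_le_lintegral _ _).trans (lintegral_mono fun y => ?_))
  exact mul_le_of_le_one_right' (dk_le_one _ _)

lemma tw_ne_zero (hf : Measurable f) (hf0 : ∀ x, f x ≠ 0) (hS : volume S ≠ 0) (x : E) :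
    tw N σ ω f S x ≠ 0 := by
  have hm : Measurable fun y => f y * dk N (stretch σ 0 ω (x - y)) :=
    hf.mul ((measurable_dk N).comp (by fun_prop))
  rw [tw, ← pos_iff_ne_zero, lintegral_pos_iff_support hm]
  have : Function.support (fun y => f y * dk N (stretch σ 0 ω (x - y))) = univ := by
    ext y; simp [hf0 y, dk_pos]
  rw [this, Measure.restrict_apply_univ]
  exact pos_iff_ne_zero.2 hS

lemma tw_add (hS : MeasurableSet S) (x : E) :
    tw N σ ω f (S' ∩ S) x + tw N σ ω f (S' \ S) x = tw N σ ω f S' x :=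
  lintegral_inter_add_sdiff _ _ hS

/-- Weights varying slowly at the tube scale. -/
def Slow (M : ℕ) (σ : ℝ) (ω : E) (p : E → ℝ≥0∞) : Prop :=
  ∀ x x', p x ≤ wt (stretch σ 1 ω (x - x')) ^ M * p x'

lemma wt_stretch_zero_le (hω : ‖ω‖ = 1) (x : E) :
    wt (stretch σ 0 ω x) ≤ wt (stretch σ 1 ω x) :=
  wt_mono (norm_stretch_mono hω le_rfl (by simp) x)

lemma div_le_mul_div {a a' b b' c c' : ℝ≥0∞} (ha : a ≤ c * a') (hb : b' ≤ c' * b) (hc : c' ≠ 0)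
    (hc' : c' ≠ ∞) : a / b ≤ c * c' * (a' / b') := by
  calc a / b ≤ (c * a') / (c'⁻¹ * b') := by
        gcongr
        rw [mul_comm, ← div_eq_mul_inv]
        exact ENNReal.div_le_of_le_mul' hb
    _ = c * c' * (a' / b') := by
        rw [div_eq_mul_inv, div_eq_mul_inv, ENNReal.mul_inv (Or.inl (ENNReal.inv_ne_zero.2 hc'))
          (Or.inl (ENNReal.inv_ne_top.2 hc)), inv_inv]
        ring

lemma slow_avg (N : ℕ) (σ : ℝ) (ω : E) (u : E → ℂ) : Slow N σ ω (avg N σ ω u) :=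
  avg_le N σ ω u

lemma slow_tw (N : ℕ) (σ : ℝ) (hω : ‖ω‖ = 1) (f : E → ℝ≥0∞) (S : Set E) :
    Slow N σ ω (tw N σ ω f S) := fun x x' =>
  (tw_le N σ ω f S x x').trans (by gcongr; exact wt_stretch_zero_le hω _)

lemma Slow.div {M M' : ℕ} {p q : E → ℝ≥0∞} (hp : Slow M σ ω p) (hq : Slow M' σ ω q) :
    Slow (M + M') σ ω fun x => p x / q x := fun x x' => by
  rw [pow_add]
  refine div_le_mul_div (hp x x') ?_ (pow_ne_zero _ (wt_ne_zero _))
    (ENNReal.pow_ne_top (wt_ne_top _))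
  have := hq x' x
  rwa [← wt_neg, ← map_neg, neg_sub] at this

/-- Band-limited smoothing of a slowly varying weight. -/
noncomputable def smooth (σ : ℝ) (ω : E) (p : E → ℝ≥0∞) (x : E) : ℂ :=
  ∫ y, ((p y).toReal : ℂ) * sker σ 1 ω (x - y)

lemma exists_smooth_le (M : ℕ) : ∃ C : ℝ≥0, ∀ {σ : ℝ} {ω : E} {p : E → ℝ≥0∞}, 0 < σ → ‖ω‖ = 1 →
    Slow M σ ω p → (∀ x, p x ≤ 1) → ∀ x q,
    ‖smooth σ ω p x‖ₑ ≤ C * (p q * wt (stretch σ 1 ω (x - q)) ^ M) := by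
  obtain ⟨C, hC⟩ := exists_ker_decay (E := E) (M + (finrank ℝ E + 1))
  have hI : ∫⁻ x : E, dk (finrank ℝ E + 1) x ≠ ∞ := (lintegral_dk_lt_top (by simp)).ne
  refine ⟨C * (∫⁻ x : E, dk (finrank ℝ E + 1) x).toNNReal, fun {σ ω p} hσ hω hp hp1 x q => ?_⟩
  rw [ENNReal.coe_mul, ENNReal.coe_toNNReal hI]
  set L := stretch σ 1 ω
  have hpt : ∀ y, ‖((p y).toReal : ℂ) * sker σ 1 ω (x - y)‖ₑ ≤
      (p q * wt (L (x - q)) ^ M) * C * (ENNReal.ofReal (σ ^ (finrank ℝ E - 1)) *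
        dk (finrank ℝ E + 1) (L (y - x))) := fun y => by
    have h1 := enorm_sker_le hC hσ one_pos ω (x - y)
    rw [mul_one] at h1
    rw [enorm_mul, ← ofReal_norm, Complex.norm_real, Real.norm_of_nonneg ENNReal.toReal_nonneg,
      ENNReal.ofReal_toReal (ne_top_of_le_ne_top ENNReal.one_ne_top (hp1 y))]
    have h2 : p y ≤ wt (L (x - y)) ^ M * (wt (L (x - q)) ^ M * p q) := by
      refine (hp y x).trans ?_
      rw [← wt_neg, ← map_neg, neg_sub]
      gcongr
      exact hp x q
    calc p y * ‖sker σ 1 ω (x - y)‖ₑ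
        ≤ (wt (L (x - y)) ^ M * (wt (L (x - q)) ^ M * p q)) *
          (C * (ENNReal.ofReal (σ ^ (finrank ℝ E - 1)) *
            dk (M + (finrank ℝ E + 1)) (L (x - y)))) := by gcongr
      _ = (p q * wt (L (x - q)) ^ M) * C * (ENNReal.ofReal (σ ^ (finrank ℝ E - 1)) *
          (wt (L (x - y)) ^ M * dk (M + (finrank ℝ E + 1)) (L (x - y)))) := by ring
      _ = _ := by rw [wt_pow_mul_dk, ← dk_neg _ (L (x - y)), ← map_neg, neg_sub]
  refine (enorm_integral_le_lintegral_enorm _).trans ((lintegral_mono hpt).trans (le_of_eq ?_))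
  have hpq : p q ≠ ∞ := ne_top_of_le_ne_top ENNReal.one_ne_top (hp1 q)
  rw [lintegral_const_mul' _ _ (by
      exact ENNReal.mul_ne_top (ENNReal.mul_ne_top hpq (ENNReal.pow_ne_top (wt_ne_top _))) (by simp)),
    lintegral_const_mul' _ _ ENNReal.ofReal_ne_top, lintegral_dk_stretch _ hσ hω]
  ring

lemma plate_add_subset {R C : ℝ} (hR : 1 ≤ R) (hω : ‖ω‖ = 1) :
    {ξ : E | ‖stretch (√R)⁻¹ 1⁻¹ ω ξ‖ ≤ 2} + plate R C ω ⊆ plate R (C + 2) ω := by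
  rintro _ ⟨ξ, hξ, ζ, hζ, rfl⟩
  have hσ : 1 ≤ √R := Real.one_le_sqrt.2 hR
  have h1 : ‖stretch (√R)⁻¹ 1⁻¹ ω ξ‖ ^ 2 ≤ 4 := by
    have := pow_le_pow_left₀ (norm_nonneg _) hξ 2
    linarith
  rw [norm_stretch_sq hω] at h1
  have h2 := inner_sq_le hω ξ
  have hs : (√R)⁻¹ ^ 2 ≤ 1 := by
    rw [inv_pow, inv_le_one₀ (by positivity)]; nlinarith
  have h3 : ⟪ω, ξ⟫ ^ 2 ≤ 2 ^ 2 := by nlinarith [mul_nonneg (sq_nonneg (√R)⁻¹) (sub_nonneg.2 h2)]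
  have h4 : ‖ξ‖ ^ 2 ≤ (2 * √R) ^ 2 := by
    have e : (√R)⁻¹ ^ 2 * ‖ξ‖ ^ 2 ≤ 4 := by
      nlinarith [mul_nonneg (sub_nonneg.2 hs) (sq_nonneg ⟪ω, ξ⟫)]
    have e2 : ‖ξ‖ ^ 2 = √R ^ 2 * ((√R)⁻¹ ^ 2 * ‖ξ‖ ^ 2) := by field_simp
    rw [e2]; nlinarith [sq_nonneg (√R)]
  have h5 := abs_le_of_sq_le_sq h3 (by norm_num)
  have h6 := (abs_le_of_sq_le_sq' h4 (by positivity)).2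
  simp only
  constructor
  · calc ‖ξ + ζ - R • ω‖ = ‖ξ + (ζ - R • ω)‖ := by congr 1; abel
      _ ≤ 2 * √R + C * √R := (norm_add_le _ _).trans (add_le_add h6 hζ.1)
      _ = _ := by ring
  · rw [show ξ + ζ - R • ω = ξ + (ζ - R • ω) by abel, inner_add_right]
    refine (abs_add_le _ _).trans ?_
    linarith [hζ.2, h5]

lemma isBounded_stretch_le (hω : ‖ω‖ = 1) {a b c : ℝ} (ha : 0 < a) (hb : 0 < b) :
    Bornology.IsBounded {ξ : E | ‖stretch a⁻¹ b⁻¹ ω ξ‖ ≤ c} := by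
  have h : {ξ : E | ‖stretch a⁻¹ b⁻¹ ω ξ‖ ≤ c} ⊆ stretch a b ω '' closedBall 0 c := fun ξ hξ =>
    ⟨stretch a⁻¹ b⁻¹ ω ξ, by simpa using hξ, by
      rw [stretch_stretch hω, mul_inv_cancel₀ ha.ne', mul_inv_cancel₀ hb.ne', stretch_one]⟩
  exact ((isCompact_closedBall 0 c).image (continuous_stretch a b ω)).isBounded.subset h

lemma PW.smooth_mul {R C : ℝ} {u : E → ℂ} {p : E → ℝ≥0∞} (hR : 1 ≤ R) (hω : ‖ω‖ = 1)
    (hu : PW (plate R C ω) u) (hp : Measurable p) (hp1 : ∀ x, p x ≤ 1) :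
    PW (plate R (C + 2) ω) fun x => smooth √R ω p x * u x := by
  have hσ : 0 < √R := by positivity
  refine (hu.mask (pw_sker hω hσ one_pos) ?_ hp.ennreal_toReal fun x => ?_).mono
    (plate_add_subset hR hω)
  · exact isBounded_stretch_le hω hσ one_pos
  · rw [abs_of_nonneg ENNReal.toReal_nonneg]
    exact ENNReal.toReal_le_of_le_ofReal zero_le_one (by simpa using hp1 x)

lemma smooth_add_smooth (hσ : 0 < σ) (hω : ‖ω‖ = 1) {p p' : E → ℝ≥0∞} (hp : Measurable p)
    (hp' : Measurable p') (h : ∀ x, p x + p' x = 1) (x : E) :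
    smooth σ ω p x + smooth σ ω p' x = 1 := by
  have hint : ∀ {p : E → ℝ≥0∞}, Measurable p → (∀ x, p x ≤ 1) →
      Integrable fun y => ((p y).toReal : ℂ) * sker σ 1 ω (x - y) := fun {p} hp hp1 =>
    ((integrable_sker hω hσ one_pos).comp_sub_left x).bdd_mul (c := 1)
      (Complex.measurable_ofReal.comp hp.ennreal_toReal).aestronglyMeasurable
      (Eventually.of_forall fun y => by
        rw [Complex.norm_real, Real.norm_of_nonneg ENNReal.toReal_nonneg]
        exact ENNReal.toReal_le_of_le_ofReal zero_le_one (by simpa using hp1 y))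
  have h1 : ∀ x, p x ≤ 1 := fun x => h x ▸ le_self_add
  have h2 : ∀ x, p' x ≤ 1 := fun x => h x ▸ le_add_self
  rw [smooth, smooth, ← integral_add (hint hp h1) (hint hp' h2), ← integral_sker hω hσ one_pos,
    ← integral_sub_left_eq_self (fun y => sker σ 1 ω y) volume x]
  congr 1; ext y
  rw [← add_mul, ← Complex.ofReal_add, ← ENNReal.toReal_add
    (ne_top_of_le_ne_top ENNReal.one_ne_top (h1 y)) (ne_top_of_le_ne_top ENNReal.one_ne_top (h2 y)),
    h y]
  simp

end Averages

end Falconer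

namespace Falconer

open MeasureTheory Metric Set Filter Topology Module
open scoped FourierTransform ENNReal NNReal Pointwise ComplexConjugate RealInnerProductSpace

set_option linter.unusedSectionVars false

section Near

variable {E : Type*} [NormedAddCommGroup E] [InnerProductSpace ℝ E] [FiniteDimensional ℝ E]
  [MeasurableSpace E] [BorelSpace E]

lemma pw_ker_stretch {ω : E} (hω : ‖ω‖ = 1) {a b : ℝ} (ha : 0 < a) (hb : 0 < b) (q : E) :
    PW {ξ : E | ‖stretch a⁻¹ b⁻¹ ω ξ‖ ≤ 2} fun x => ker E (stretch a b ω (x - q)) := by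
  have hne : ((a ^ (finrank ℝ E - 1) * b : ℝ) : ℂ) ≠ 0 := by
    rw [Complex.ofReal_ne_zero]; positivity
  have h := ((pw_sker hω ha hb).translate (-q)).const_mul (((a ^ (finrank ℝ E - 1) * b : ℝ) : ℂ)⁻¹)
  convert h using 2 with x
  rw [sker, inv_mul_cancel_left₀ hne, sub_eq_add_neg]

lemma lintegral_sum_sq_le_card {ι : Type*} (s : Finset ι) {S : ι → Set E} {A : ι → E → ℂ}
    (hA : ∀ i ∈ s, PW (S i) (A i)) (hS : ∀ i ∈ s, Bornology.IsBounded (S i))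
    (r : ι → ι → Prop) [DecidableRel r] (hsymm : ∀ i j, r i j → r j i)
    (hr : ∀ i ∈ s, ∀ j ∈ s, (S i ∩ S j).Nonempty → r i j) {K : ℝ≥0∞}
    (hK : ∀ i ∈ s, ((s.filter (r i)).card : ℝ≥0∞) ≤ K) :
    ∫⁻ x, ‖∑ i ∈ s, A i x‖ₑ ^ 2 ≤ 2 * K * ∑ i ∈ s, ∫⁻ x, ‖A i x‖ₑ ^ 2 := by
  refine (lintegral_sum_sq_le s hA hS r hr).trans ?_
  have h1 : ∑ i ∈ s, ∑ j ∈ s with r i j, ∫⁻ x, ‖A i x‖ₑ ^ 2 ≤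
      K * ∑ i ∈ s, ∫⁻ x, ‖A i x‖ₑ ^ 2 := by
    rw [Finset.mul_sum]
    refine Finset.sum_le_sum fun i hi => ?_
    rw [Finset.sum_const, nsmul_eq_mul]
    gcongr
    exact hK i hi
  have h2 : ∑ i ∈ s, ∑ j ∈ s with r i j, ∫⁻ x, ‖A j x‖ₑ ^ 2 =
      ∑ i ∈ s, ∑ j ∈ s with r i j, ∫⁻ x, ‖A i x‖ₑ ^ 2 := by
    refine Finset.sum_comm' fun i j => ?_
    simp only [Finset.mem_filter]
    exact ⟨fun h => ⟨⟨h.1, hsymm _ _ h.2.2⟩, h.2.1⟩,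
      fun h => ⟨h.1.1, h.2, hsymm _ _ h.1.2⟩⟩
  calc _ ≤ ∑ i ∈ s, ∑ j ∈ s with r i j, ((∫⁻ x, ‖A i x‖ₑ ^ 2) + ∫⁻ x, ‖A j x‖ₑ ^ 2) := by
        refine Finset.sum_le_sum fun i hi => Finset.sum_le_sum fun j hj => ?_
        rw [← lintegral_add_left' ((hA i hi).cont.measurable.enorm.pow_const 2).aemeasurable]
        refine lintegral_mono fun x => ?_
        simpa using ennreal_mul_le_add_sq (l := 1) one_ne_zero ‖A i x‖ₑ ‖A j x‖ₑ
    _ ≤ _ := by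
        simp only [Finset.sum_add_distrib]
        rw [h2, mul_assoc, two_mul]
        gcongr

lemma wt_zero : wt (0 : E) = 1 := by simp [wt]

lemma Slow.mul {M M' : ℕ} {σ : ℝ} {ω : E} {p q : E → ℝ≥0∞} (hp : Slow M σ ω p)
    (hq : Slow M' σ ω q) : Slow (M + M') σ ω fun x => p x * q x := fun x x' => by
  rw [pow_add, mul_mul_mul_comm]
  exact mul_le_mul' (hp x x') (hq x x')

lemma Slow.lintegral_mul_le {M : ℕ} {σ : ℝ} {ω : E} (hω : ‖ω‖ = 1) {h k : E → ℝ≥0∞}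
    (hh : Slow M σ ω h) (hm : Measurable h) (hk : Measurable k) {B : ℝ≥0∞}
    (hB : ∀ x, ∫⁻ τ in Icc (0 : ℝ) 1, k (x - τ • ω) ≤ B) :
    ∫⁻ x, h x * k x ≤ 2 ^ M * (B * ∫⁻ x, h x) := by
  have h1 : ∀ x, ∀ τ ∈ Icc (0 : ℝ) 1, h x ≤ 2 ^ M * h (x + τ • ω) := fun x τ hτ => by
    refine (hh x (x + τ • ω)).trans ?_
    gcongr
    have e : ‖stretch σ 1 ω (x - (x + τ • ω))‖ = τ := by
      rw [sub_add_cancel_left, map_neg, norm_neg, map_smul, norm_smul, Real.norm_of_nonneg hτ.1]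
      have h2 := norm_stretch_sq hω σ 1 ω
      rw [hω, real_inner_self_eq_norm_sq, hω] at h2
      have h3 : ‖stretch σ 1 ω ω‖ = 1 := by
        rw [← pow_left_inj₀ (norm_nonneg _) zero_le_one two_ne_zero, h2]; norm_num
      rw [h3, mul_one]
    rw [wt_eq_ofReal, e]
    exact ENNReal.ofReal_le_of_le_toReal (by simp; linarith [hτ.2])
  have hm2 : Measurable fun z : E × ℝ => 2 ^ M * h (z.1 + z.2 • ω) * k z.1 :=
    ((hm.comp (by fun_prop)).const_mul _).mul (hk.comp measurable_fst)
  have hm3 : Measurable fun z : ℝ × E => h z.2 * k (z.2 - z.1 • ω) :=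
    (hm.comp measurable_snd).mul (hk.comp (by fun_prop))
  calc ∫⁻ x, h x * k x = ∫⁻ x, ∫⁻ τ in Icc (0 : ℝ) 1, h x * k x := by simp
    _ ≤ ∫⁻ x, ∫⁻ τ in Icc (0 : ℝ) 1, 2 ^ M * h (x + τ • ω) * k x := by
        refine lintegral_mono fun x => setLIntegral_mono ?_ fun τ hτ => ?_
        · exact hm2.comp measurable_prodMk_left
        · gcongr; exact h1 x τ hτ
    _ = ∫⁻ τ in Icc (0 : ℝ) 1, ∫⁻ x, 2 ^ M * h (x + τ • ω) * k x :=
        lintegral_lintegral_swap hm2.aemeasurable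
    _ = ∫⁻ τ in Icc (0 : ℝ) 1, 2 ^ M * ∫⁻ x, h x * k (x - τ • ω) := by
        refine lintegral_congr fun τ => ?_
        rw [← lintegral_add_right_eq_self (fun x => h x * k (x - τ • ω)) (τ • ω),
          ← lintegral_const_mul' _ _ (by simp)]
        simp [mul_assoc]
    _ = 2 ^ M * ∫⁻ x, ∫⁻ τ in Icc (0 : ℝ) 1, h x * k (x - τ • ω) := by
        rw [lintegral_const_mul' _ _ (by simp), lintegral_lintegral_swap hm3.aemeasurable]
    _ = 2 ^ M * ∫⁻ x, h x * ∫⁻ τ in Icc (0 : ℝ) 1, k (x - τ • ω) := by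
        congr 1
        refine lintegral_congr fun x => lintegral_const_mul _ (hk.comp (by fun_prop))
    _ ≤ 2 ^ M * ∫⁻ x, h x * B := by gcongr; exact hB _
    _ = _ := by rw [lintegral_mul_const _ hm, mul_comm B]

lemma exists_lintegral_line_dk_le : ∃ C : ℝ≥0, ∀ {ω : E} {a : ℝ}, ‖ω‖ = 1 → 0 < a → ∀ x z : E,
    ∫⁻ τ in Icc (0 : ℝ) 1, dk 2 (a • (x - τ • ω - z)) ≤ C * ENNReal.ofReal a⁻¹ := by
  have hI : ∫⁻ x : ℝ, dk 2 x ≠ ∞ := (lintegral_dk_lt_top (by simp)).ne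
  refine ⟨(∫⁻ x : ℝ, dk 2 x).toNNReal, fun {ω a} hω ha x z => ?_⟩
  rw [ENNReal.coe_toNNReal hI]
  calc _ ≤ ∫⁻ τ : ℝ, dk 2 (a • (τ - ⟪ω, x - z⟫)) := by
        refine (setLIntegral_le_lintegral _ _).trans (lintegral_mono fun τ => ?_)
        rw [dk, dk, wt_eq_ofReal, wt_eq_ofReal, norm_smul, norm_smul]
        gcongr
        have h := abs_real_inner_le_norm ω (x - τ • ω - z)
        rw [hω, one_mul, show x - τ • ω - z = (x - z) - τ • ω by abel, inner_sub_right,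
          inner_smul_right, real_inner_self_eq_norm_sq, hω] at h
        rw [Real.norm_eq_abs, abs_sub_comm]
        simpa [show x - τ • ω - z = (x - z) - τ • ω by abel] using h
    _ = ∫⁻ τ : ℝ, dk 2 (a • τ) :=
        lintegral_sub_right_eq_self (fun τ : ℝ => dk 2 (a • τ)) _
    _ ≤ _ := by
        have h := lintegral_comp_stretch (E := ℝ) (ω := 1) (by simp) ha ha (measurable_dk 2)
        simp only [stretch_self, finrank_self, tsub_self, pow_zero, one_mul] at h
        rw [← h, mul_comm, ← mul_assoc, ENNReal.ofReal_inv_of_pos ha,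
          ENNReal.inv_mul_cancel (by simpa using ha) ENNReal.ofReal_ne_top, one_mul]

/-- Localised estimate for sums of wave packets with slowly varying amplitudes. -/
lemma exists_near_bound [Nontrivial E] (N M : ℕ) (hN : finrank ℝ E < N) {C₀ : ℝ} (hC₀ : 1 ≤ C₀) :
    ∃ C : ℝ≥0, ∀ {α γ : ℝ} {A : ℝ≥0}, ShellBound E α γ A → ∀ {ν : Measure E}, IsFiniteMeasure ν →
      HasPow α ν → ∀ {ι : Type} {s : Finset ι} {R ρ : ℝ} {ω : ι → E} {u : ι → E → ℂ},
      Fam R C₀ s ω u → 1 ≤ R → 0 < ρ → ρ⁻¹ ≤ √R → 100 * C₀ ^ 2 ≤ ρ⁻¹ →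
      ∀ p : ι → E → ℝ≥0∞, (∀ k ∈ s, Measurable (p k)) → (∀ k ∈ s, ∀ x, p k x ≤ 1) →
      (∀ k ∈ s, Slow M √R (ω k) (p k)) → ∀ z : E,
      ∫⁻ x in closedBall z ρ, ‖∑ k ∈ s, smooth √R (ω k) (p k) x * u k x‖ₑ ^ 2 ∂ν ≤
        C * (A * ENNReal.ofReal (ρ ^ (α - finrank ℝ E) * (ρ * R) ^ γ * ρ)) *
          ∑ k ∈ s, ∫⁻ x, p k x * avg N √R (ω k) (u k) x := by
  classical
  obtain ⟨c, hc0, hc1, hker⟩ := exists_ker_lower (E := E)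
  obtain ⟨Cd, hCd⟩ := exists_ker_decay (E := E) 2
  obtain ⟨Cs, hCs⟩ := exists_smooth_le (E := E) M
  obtain ⟨Ca, hCa⟩ := exists_sq_le_avg (E := E) N hN hC₀
  obtain ⟨Cl, hCl⟩ := exists_lintegral_line_dk_le (E := E)
  obtain ⟨e, he⟩ := exists_norm_eq E zero_le_one
  set Kc : ℝ := C₀ * (2 * (C₀ + 2) + 2) ^ finrank ℝ E with hKc
  set C : ℝ≥0∞ := (ENNReal.ofReal (c ^ 2))⁻¹ * (2 * ENNReal.ofReal Kc) *
    (Cs ^ 2 * Ca * Cd ^ 2 * (2 ^ (M + N) * (Cl * ENNReal.ofReal (4 / c)))) with hC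
  have hCtop : C ≠ ∞ := by
    have : ENNReal.ofReal (c ^ 2) ≠ 0 := by simpa using by positivity
    simp only [hC]
    finiteness
  refine ⟨C.toNNReal, ?_⟩
  rw [ENNReal.coe_toNNReal hCtop]
  intro α γ A hA ν hfin hν ι s R ρ ω u hu hR hρ hρR hρ0 p hpm hp1 hps z
  set a : ℝ := c / (4 * ρ) with ha
  have hapos : 0 < a := by positivity
  have haρ : a ≤ ρ⁻¹ / 4 := by
    rw [ha, div_le_iff₀ (by positivity)]
    field_simp; linarith
  set φ : E → ℂ := fun x => ker E (stretch a a e (x - z)) with hφ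
  set B : Set E := {ξ : E | ‖stretch a⁻¹ a⁻¹ e ξ‖ ≤ 2}
  have hB : ∀ ξ ∈ B, ‖ξ‖ ≤ ρ⁻¹ / 2 := fun ξ hξ => by
    have h : ‖stretch a⁻¹ a⁻¹ e ξ‖ ≤ 2 := hξ
    rw [stretch_self, norm_smul, norm_inv, Real.norm_of_nonneg hapos.le,
      inv_mul_le_iff₀ hapos] at h
    linarith
  have hφPW : PW B φ := pw_ker_stretch he hapos hapos z
  have hplate : ∀ k, Bornology.IsBounded (plate R (C₀ + 2) (ω k)) := fun k => isBounded_plate _ _ _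
  have hF : ∀ k ∈ s, PW (plate R (C₀ + 2) (ω k) + B)
      fun x => smooth √R (ω k) (p k) x * u k x * φ x := fun k hk =>
    ((hu.pw k hk).smooth_mul hR (hu.unit k hk) (hpm k hk) (hp1 k hk)).mul hφPW (hplate k)
  have hBb : Bornology.IsBounded B := isBounded_stretch_le he hapos hapos
  have hSb : ∀ k ∈ s, Bornology.IsBounded (plate R (C₀ + 2) (ω k) + B) := fun k _ =>
    (hplate k).add hBb
  have hw : PW (shell E R ρ⁻¹) fun x => ∑ k ∈ s, smooth √R (ω k) (p k) x * u k x * φ x := by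
    refine PW.sum s fun k hk => (hF k hk).mono ?_
    rintro _ ⟨ξ, hξ, ζ, hζ, rfl⟩
    have h1 : |‖ξ‖ - R| ≤ _ := plate_subset_shell hR (hu.unit k hk) hξ
    have h2 := hB ζ hζ
    have h3 : |‖ξ + ζ‖ - ‖ξ‖| ≤ ‖ζ‖ := by
      simpa using abs_norm_sub_norm_le (ξ + ζ) ξ
    change |‖ξ + ζ‖ - R| ≤ _
    have h4 := abs_add_le (‖ξ + ζ‖ - ‖ξ‖) (‖ξ‖ - R)
    rw [sub_add_sub_cancel] at h4
    nlinarith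
  have hres := hA.rescale hρ (by
    have h1 : 1 ≤ ρ * √R := by rwa [inv_le_iff_one_le_mul₀' hρ] at hρR
    have h2 : √R ≤ R := by
      rw [Real.sqrt_le_left (by linarith)]; nlinarith
    nlinarith) ν hν z hw
  have hlow : ENNReal.ofReal (c ^ 2) *
      ∫⁻ x in closedBall z ρ, ‖∑ k ∈ s, smooth √R (ω k) (p k) x * u k x‖ₑ ^ 2 ∂ν ≤
      ∫⁻ x in closedBall z ρ, ‖∑ k ∈ s, smooth √R (ω k) (p k) x * u k x * φ x‖ₑ ^ 2 ∂ν := by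
    rw [← lintegral_const_mul' _ _ ENNReal.ofReal_ne_top]
    refine setLIntegral_mono' isClosed_closedBall.measurableSet fun x hx => ?_
    rw [← Finset.sum_mul, enorm_mul, mul_pow, mul_comm, ENNReal.ofReal_pow hc0.le]
    gcongr
    refine hker _ ?_
    rw [stretch_self, norm_smul, Real.norm_of_nonneg hapos.le]
    rw [mem_closedBall, dist_eq_norm] at hx
    calc a * ‖x - z‖ ≤ a * ρ := by gcongr
      _ = c / 4 := by rw [ha]; field_simp
      _ ≤ c := by linarith
  have horth := lintegral_sum_sq_le_card s hF hSb
    (fun k j => ‖R • ω k - R • ω j‖ ≤ (2 * (C₀ + 2) + 2) * √R)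
    (fun i j h => by rwa [norm_sub_rev]) (by
      rintro k hk j hj ⟨_, ⟨ξ, hξ, ζ, hζ, rfl⟩, ξ', hξ', ζ', hζ', h⟩
      simp only at h
      have e1 : R • ω k - R • ω j = (ξ' - R • ω j) - (ξ - R • ω k) + ζ' - ζ := by
        have h' : ξ' + ζ' = ξ + ζ := h
        calc _ = (ξ + ζ) - (ξ - R • ω k) + (ξ' - R • ω j) - ξ' - ζ := by abel
          _ = _ := by rw [← h']; abel
      rw [e1]
      refine (norm_sub_le _ _).trans ?_
      have h1 := norm_add_le ((ξ' - R • ω j) - (ξ - R • ω k)) ζ'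
      have h2 := norm_sub_le (ξ' - R • ω j) (ξ - R • ω k)
      have h3 := hξ.1
      have h4 := hξ'.1
      have h5 := hB ζ hζ
      have h6 := hB ζ' hζ'
      linarith) (K := ENNReal.ofReal Kc) (fun k hk => by
      rw [← ENNReal.ofReal_natCast]
      refine ENNReal.ofReal_le_ofReal (hu.count (R • ω k) _ (by linarith) _
        (Finset.filter_subset _ _) fun j hj => ?_)
      rw [norm_sub_rev]
      exact (Finset.mem_filter.1 hj).2)
  have hterm : ∀ k ∈ s, ∫⁻ x, ‖smooth √R (ω k) (p k) x * u k x * φ x‖ₑ ^ 2 ≤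
      Cs ^ 2 * Ca * Cd ^ 2 * (2 ^ (M + N) * (Cl * ENNReal.ofReal (4 / c))) * ENNReal.ofReal ρ *
        ∫⁻ x, p k x * avg N √R (ω k) (u k) x := fun k hk => by
    have hω := hu.unit k hk
    have hm : Measurable fun x => p k x * avg N √R (ω k) (u k) x :=
      (hpm k hk).mul (measurable_avg (hu.pw k hk).cont)
    have hsl := ((hps k hk).mul (slow_avg N √R (ω k) (u k))).lintegral_mul_le hω hm
      (k := fun x => dk 2 (a • (x - z))) ((measurable_dk 2).comp (by fun_prop))
      (B := Cl * ENNReal.ofReal a⁻¹) (fun x => hCl hω hapos x z)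
    calc _ ≤ ∫⁻ x, (Cs ^ 2 * Ca * Cd ^ 2) *
          (p k x * avg N √R (ω k) (u k) x * dk 2 (a • (x - z))) := by
          refine lintegral_mono fun x => ?_
          have h1 := hCs (by positivity) hω (hps k hk) (hp1 k hk) x x
          rw [sub_self, map_zero, wt_zero, one_pow, mul_one] at h1
          have h2 := hCa hR hω (hu.pw k hk) x
          have h3 : ‖φ x‖ₑ ≤ Cd * dk 2 (a • (x - z)) := by
            have := hCd (stretch a a e (x - z))
            simpa only [hφ, stretch_self] using this
          rw [enorm_mul, enorm_mul, mul_pow, mul_pow]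
          have h4 : p k x ^ 2 ≤ p k x := by
            rw [sq]; exact mul_le_of_le_one_right' (hp1 k hk x)
          have h5 : dk 2 (a • (x - z)) ^ 2 ≤ dk 2 (a • (x - z)) := by
            rw [sq]; exact mul_le_of_le_one_right' (dk_le_one _ _)
          calc _ ≤ (Cs * p k x) ^ 2 * (Ca * avg N √R (ω k) (u k) x) *
                (Cd * dk 2 (a • (x - z))) ^ 2 := by gcongr
            _ = (Cs ^ 2 * Ca * Cd ^ 2) *
                (p k x ^ 2 * avg N √R (ω k) (u k) x * dk 2 (a • (x - z)) ^ 2) := by ring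
            _ ≤ _ := by gcongr
      _ ≤ (Cs ^ 2 * Ca * Cd ^ 2) * (2 ^ (M + N) * ((Cl * ENNReal.ofReal a⁻¹) *
          ∫⁻ x, p k x * avg N √R (ω k) (u k) x)) := by
          rw [lintegral_const_mul' _ _ (by finiteness)]
          gcongr
      _ = _ := by
          have : a⁻¹ = 4 / c * ρ := by rw [ha]; field_simp
          rw [this, ENNReal.ofReal_mul (by positivity)]
          ring
  have hc2 : ENNReal.ofReal (c ^ 2) ≠ 0 := by simpa using by positivity
  set I := ∫⁻ x in closedBall z ρ, ‖∑ k ∈ s, smooth √R (ω k) (p k) x * u k x‖ₑ ^ 2 ∂ν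
  calc I = (ENNReal.ofReal (c ^ 2))⁻¹ * (ENNReal.ofReal (c ^ 2) * I) := by
        rw [← mul_assoc, ENNReal.inv_mul_cancel hc2 ENNReal.ofReal_ne_top, one_mul]
    _ ≤ (ENNReal.ofReal (c ^ 2))⁻¹ * (A * ENNReal.ofReal (ρ ^ (α - finrank ℝ E) * (ρ * R) ^ γ) *
        (2 * ENNReal.ofReal Kc * ∑ k ∈ s, (Cs ^ 2 * Ca * Cd ^ 2 *
          (2 ^ (M + N) * (Cl * ENNReal.ofReal (4 / c))) * ENNReal.ofReal ρ *
        ∫⁻ x, p k x * avg N √R (ω k) (u k) x))) := by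
        refine mul_le_mul_right ((hlow.trans hres).trans (mul_le_mul_right ?_ _)) _
        refine horth.trans ?_
        gcongr with k hk
        exact hterm k hk
    _ = _ := by
        rw [← Finset.mul_sum, ENNReal.ofReal_mul (q := ρ) (by positivity), hC]
        ring

end Near

end Falconer

namespace Falconer

open MeasureTheory Metric Set Filter Topology Module
open scoped FourierTransform ENNReal NNReal Pointwise ComplexConjugate RealInnerProductSpace

set_option linter.unusedSectionVars false

section Geometry

variable {E : Type*} [NormedAddCommGroup E] [InnerProductSpace ℝ E]

lemma norm_sq_decomp {w : E} (hw : ‖w‖ = 1) (z : E) :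
    ‖z‖ ^ 2 = ⟪w, z⟫ ^ 2 + ‖z - ⟪w, z⟫ • w‖ ^ 2 := by
  have h := norm_sub_sq_real z (⟪w, z⟫ • w)
  rw [inner_smul_right, real_inner_comm w z, norm_smul, hw, Real.norm_eq_abs, mul_one, sq_abs] at h
  linarith

lemma inner_sub_inner_smul {w : E} (hw : ‖w‖ = 1) (z : E) : ⟪w, z - ⟪w, z⟫ • w⟫ = 0 := by
  rw [inner_sub_right, inner_smul_right, real_inner_self_eq_norm_sq, hw]; ring

lemma norm_sub_inner_le {w z : E} (hw : ‖w‖ = 1) (h0 : 0 ≤ ⟪w, z⟫) :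
    ‖z‖ * (‖z‖ - ⟪w, z⟫) ≤ ‖z - ⟪w, z⟫ • w‖ ^ 2 := by
  have h := norm_sq_decomp hw z
  have h1 := real_inner_le_norm w z
  rw [hw, one_mul] at h1
  nlinarith

/-- The defining function of the fan is small on the forward fan. -/
lemma abs_fan_le {w w₁ w₂ z : E} {K δ Θ H : ℝ} (hw : ‖w‖ = 1) (h1 : ‖w₁‖ = 1) (h2 : ‖w₂‖ = 1)
    (hK : |⟪w₁ + w₂, w⟫ - 1 / 2 * ‖w₁ + w₂‖ ^ 2| ≤ K * δ * Θ) (hw1 : ‖w₁ - w‖ ≤ Θ)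
    (hw2 : ‖w₂ - w‖ ≤ 2 * Θ) (hδ : 0 ≤ δ) (hδΘ : δ ≤ Θ) (hH : 1 ≤ H) (hz0 : 0 ≤ ⟪w, z⟫)
    (hz : ‖z - ⟪w, z⟫ • w‖ ≤ δ * H) (hz1 : 1 ≤ ‖z‖ * H) (hz2 : ‖z‖ ≤ 10) :
    |⟪z, w₁ + w₂⟫ - 1 / 2 * ‖w₁ + w₂‖ ^ 2 * ‖z‖| ≤ (10 * K + 10) * (H ^ 3 * δ * Θ) := by
  set η := w₁ + w₂ with hη
  set a := ⟪w, z⟫ with ha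
  set h := z - a • w with hh
  have hΘ : 0 ≤ Θ := hδ.trans hδΘ
  have e : ⟪z, η⟫ - 1 / 2 * ‖η‖ ^ 2 * ‖z‖ =
      a * (⟪η, w⟫ - 1 / 2 * ‖η‖ ^ 2) + ⟪h, η⟫ - 1 / 2 * ‖η‖ ^ 2 * (‖z‖ - a) := by
    have : ⟪z, η⟫ = a * ⟪η, w⟫ + ⟪h, η⟫ := by
      rw [hh, inner_sub_left, inner_smul_left, real_inner_comm w η]; simp
    rw [this]; ring
  have ha10 : a ≤ ‖z‖ := by
    have := real_inner_le_norm w z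
    rwa [hw, one_mul] at this
  have t1 : |a * (⟪η, w⟫ - 1 / 2 * ‖η‖ ^ 2)| ≤ 10 * (K * δ * Θ) := by
    rw [abs_mul, abs_of_nonneg hz0]
    exact mul_le_mul (ha10.trans hz2) hK (abs_nonneg _) (by norm_num)
  have t2 : |⟪h, η⟫| ≤ 3 * (δ * H * Θ) := by
    have e2 : ⟪h, η⟫ = ⟪h, (w₁ - w) + (w₂ - w)⟫ := by
      have h0 : ⟪h, w⟫ = 0 := by rw [real_inner_comm]; exact inner_sub_inner_smul hw z
      rw [show (w₁ - w) + (w₂ - w) = η - w - w by rw [hη]; abel, inner_sub_right, inner_sub_right,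
        h0]; ring
    rw [e2]
    have h3 : ‖(w₁ - w) + (w₂ - w)‖ ≤ 3 * Θ := (norm_add_le _ _).trans (by linarith)
    refine (abs_real_inner_le_norm _ _).trans ?_
    have := mul_le_mul hz h3 (norm_nonneg _) (by positivity)
    linarith
  have hη2 : ‖η‖ ≤ 2 := (norm_add_le _ _).trans (by rw [h1, h2]; norm_num)
  have t3 : |1 / 2 * ‖η‖ ^ 2 * (‖z‖ - a)| ≤ 2 * (H ^ 3 * δ * Θ) := by
    have h4 := norm_sub_inner_le hw hz0
    rw [abs_of_nonneg (mul_nonneg (by positivity) (sub_nonneg.2 ha10))]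
    have h5 : ‖z‖ - a ≤ H ^ 3 * δ ^ 2 := by
      calc ‖z‖ - a ≤ (‖z‖ * H) * (‖z‖ - a) := le_mul_of_one_le_left (sub_nonneg.2 ha10) hz1
        _ = H * (‖z‖ * (‖z‖ - a)) := by ring
        _ ≤ H * ((δ * H) ^ 2) := by gcongr; exact h4.trans (pow_le_pow_left₀ (norm_nonneg _) hz 2)
        _ = _ := by ring
    have h6 : H ^ 3 * δ ^ 2 ≤ H ^ 3 * δ * Θ := by
      rw [sq, ← mul_assoc]; gcongr
    have h7 : 1 / 2 * ‖η‖ ^ 2 ≤ 2 := by nlinarith [norm_nonneg η]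
    exact mul_le_mul h7 (h5.trans h6) (sub_nonneg.2 ha10) (by norm_num)
  have hK0 : 0 ≤ K * δ * Θ := (abs_nonneg _).trans hK
  have hH3 : 1 ≤ H ^ 3 := one_le_pow₀ hH
  have hHH : H ≤ H ^ 3 := by nlinarith [sq_nonneg (H - 1)]
  have u1 : 10 * (K * δ * Θ) ≤ 10 * (H ^ 3 * (K * δ * Θ)) := by nlinarith
  have u2 : δ * H * Θ ≤ H ^ 3 * δ * Θ := by
    have := mul_le_mul_of_nonneg_right hHH (mul_nonneg hδ hΘ); linarith
  have u3 : 0 ≤ H ^ 3 * δ * Θ := by positivity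
  rw [e]
  have := abs_sub (a * (⟪η, w⟫ - 1 / 2 * ‖η‖ ^ 2) + ⟪h, η⟫) (1 / 2 * ‖η‖ ^ 2 * (‖z‖ - a))
  have := abs_add_le (a * (⟪η, w⟫ - 1 / 2 * ‖η‖ ^ 2)) ⟪h, η⟫
  linarith

/-- Lines in the second cluster of directions meet the forward fan in short segments. -/
lemma fan_line_le {w w₁ w₂ v z z' : E} {B Θ t : ℝ} (h1 : ‖w₁‖ = 1) (h2 : ‖w₂‖ = 1) (hv : ‖v‖ = 1)
    (hw : ‖w‖ = 1) (hΘ : 0 < Θ) (hΘ1 : Θ ≤ 1 / 2)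
    (h1v : ‖w₁ - v‖ ≤ 101 / 100 * Θ) (h2v : ‖w₂ - v‖ ≤ 1 / 100 * Θ)
    (h12 : 99 / 100 * Θ ≤ ‖w₁ - w₂‖) (h12' : ‖w₁ - w₂‖ ≤ 101 / 100 * Θ)
    (hwv : 99 / 100 * Θ ≤ ‖w - v‖) (hwv' : ‖w - v‖ ≤ 101 / 100 * Θ)
    (ht : 0 ≤ t) (hzz : z' = z + t • v) (hz0 : 0 ≤ ⟪w, z'⟫) (hz' : 0 < ‖z'‖)
    (hzw : ‖z' - ⟪w, z'⟫ • w‖ ≤ 1 / 200 * Θ * ‖z'‖)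
    (hF : |⟪z, w₁ + w₂⟫ - 1 / 2 * ‖w₁ + w₂‖ ^ 2 * ‖z‖| ≤ B * Θ)
    (hF' : |⟪z', w₁ + w₂⟫ - 1 / 2 * ‖w₁ + w₂‖ ^ 2 * ‖z'‖| ≤ B * Θ) :
    t * Θ ≤ 4 * B := by
  set y : E := ‖z'‖⁻¹ • z' with hy
  have hy1 : ‖y‖ = 1 := by rw [hy, norm_smul, norm_inv, norm_norm, inv_mul_cancel₀ hz'.ne']
  have hyw : ‖y - w‖ ≤ 1 / 100 * Θ := by
    have e : ‖z'‖ • (y - w) = (z' - ⟪w, z'⟫ • w) - (‖z'‖ - ⟪w, z'⟫) • w := by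
      rw [hy, smul_sub, smul_smul, mul_inv_cancel₀ hz'.ne', one_smul, sub_smul]; abel
    have h3 : ‖‖z'‖ • (y - w)‖ ≤ 1 / 100 * Θ * ‖z'‖ := by
      rw [e]
      refine (norm_sub_le _ _).trans ?_
      have h4 : 0 ≤ ‖z'‖ - ⟪w, z'⟫ := by
        have := real_inner_le_norm w z'
        rw [hw, one_mul] at this; linarith
      have h5 : ‖z'‖ - ⟪w, z'⟫ ≤ ‖z' - ⟪w, z'⟫ • w‖ := by
        have := norm_sq_decomp hw z'
        refine (abs_le_of_sq_le_sq' ?_ (norm_nonneg _)).2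
        have h6 : ‖z'‖ ^ 2 - ⟪w, z'⟫ ^ 2 = ‖z' - ⟪w, z'⟫ • w‖ ^ 2 := by linarith
        nlinarith
      rw [norm_smul, hw, mul_one, Real.norm_of_nonneg h4]
      linarith
    rw [norm_smul, norm_norm, mul_comm] at h3
    exact le_of_mul_le_mul_right h3 hz'
  have hz : ‖z'‖ - ‖z‖ ≤ t * ⟪v, y⟫ := by
    have h3 := real_inner_le_norm z y
    rw [hy1, mul_one, show z = z' - t • v by rw [hzz]; abel, inner_sub_left, inner_smul_left] at h3
    have h4 : ⟪z', y⟫ = ‖z'‖ := by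
      rw [hy, inner_smul_right, real_inner_self_eq_norm_sq]; field_simp
    simp only [conj_trivial] at h3
    rw [h4, ← show z = z' - t • v by rw [hzz]; abel] at h3
    linarith
  have ev1 := norm_sub_sq_real w₁ v
  have ev2 := norm_sub_sq_real w₂ v
  have ey := norm_sub_sq_real y v
  have e12 := norm_sub_sq_real w₁ w₂
  have eη := norm_add_sq_real w₁ w₂
  rw [h1, hv] at ev1
  rw [h2, hv] at ev2
  rw [hy1, hv] at ey
  rw [h1, h2] at e12 eη
  have hyv : 98 / 100 * Θ ≤ ‖y - v‖ := by
    have := norm_sub_norm_le (w - v) (w - y)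
    rw [show w - v - (w - y) = y - v by abel, norm_sub_rev w y] at this
    linarith
  have hyv' : ‖y - v‖ ≤ 102 / 100 * Θ := by
    have := norm_add_le (y - w) (w - v)
    rw [sub_add_sub_cancel] at this
    linarith
  have q1 : ‖w₁ - v‖ ^ 2 ≤ (101 / 100 * Θ) ^ 2 := by gcongr
  have q2 : ‖w₂ - v‖ ^ 2 ≤ (1 / 100 * Θ) ^ 2 := by gcongr
  have q3 : (99 / 100 * Θ) ^ 2 ≤ ‖w₁ - w₂‖ ^ 2 := by gcongr
  have q3' : ‖w₁ - w₂‖ ^ 2 ≤ (101 / 100 * Θ) ^ 2 := by gcongr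
  have q4 : (98 / 100 * Θ) ^ 2 ≤ ‖y - v‖ ^ 2 := by gcongr
  have q4' : ‖y - v‖ ^ 2 ≤ (102 / 100 * Θ) ^ 2 := by gcongr
  have hΘ2 : Θ ^ 2 ≤ 1 / 4 := by nlinarith
  set N := 1 / 2 * ‖w₁ + w₂‖ ^ 2 with hN
  have hbr : 1 / 2 * Θ ^ 2 ≤ ⟪v, w₁⟫ + ⟪v, w₂⟫ - N * ⟪v, y⟫ := by
    rw [real_inner_comm w₁ v, real_inner_comm w₂ v, real_inner_comm y v]
    have a1 : ⟪w₁, v⟫ = 1 - ‖w₁ - v‖ ^ 2 / 2 := by linarith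
    have a2 : ⟪w₂, v⟫ = 1 - ‖w₂ - v‖ ^ 2 / 2 := by linarith
    have a3 : ⟪y, v⟫ = 1 - ‖y - v‖ ^ 2 / 2 := by linarith
    have a4 : N = 2 - ‖w₁ - w₂‖ ^ 2 / 2 := by rw [hN]; linarith
    rw [a1, a2, a3, a4]
    have p : ‖w₁ - w₂‖ ^ 2 * ‖y - v‖ ^ 2 ≤ (101 / 100 * Θ) ^ 2 * (102 / 100 * Θ) ^ 2 := by gcongr
    have p2 : (101 / 100 * Θ) ^ 2 * (102 / 100 * Θ) ^ 2 ≤ 1 / 3 * Θ ^ 2 := by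
      linarith [mul_nonneg (sq_nonneg Θ) (sub_nonneg.2 hΘ2)]
    linarith
  have hN0 : 0 ≤ N := by positivity
  have hdiff : t * (1 / 2 * Θ ^ 2) ≤
      (⟪z', w₁ + w₂⟫ - N * ‖z'‖) - (⟪z, w₁ + w₂⟫ - N * ‖z‖) := by
    have e : ⟪z', w₁ + w₂⟫ = ⟪z, w₁ + w₂⟫ + t * (⟪v, w₁⟫ + ⟪v, w₂⟫) := by
      rw [hzz, inner_add_left, inner_smul_left, inner_add_right v]; simp
    have h3 := mul_le_mul_of_nonneg_left hz hN0
    have h4 := mul_le_mul_of_nonneg_left hbr ht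
    rw [e]; linarith
  have h3 := (abs_le.1 hF).1
  have h4 := (abs_le.1 hF').2
  have h5 : t * Θ * Θ ≤ 4 * B * Θ := by linarith
  exact le_of_mul_le_mul_right h5 hΘ

lemma abs_inner_sub_le_of_add_eq {w₁ w₂ w w' Z : E} {R K Θ : ℝ} (hR : 0 < R) (hw : ‖w‖ = 1)
    (hw' : ‖w'‖ = 1) (h : R • (w₁ + w₂ - w - w') = Z) (hZ : ‖Z‖ ≤ K * √R)
    (hZ' : |⟪w', Z⟫| ≤ K * (√R * Θ)) (hΘ : 1 ≤ √R * Θ) :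
    |⟪w₁ + w₂, w⟫ - 1 / 2 * ‖w₁ + w₂‖ ^ 2| ≤ (K + K ^ 2) * (√R)⁻¹ * Θ := by
  have hσ : 0 < √R := Real.sqrt_pos.2 hR
  have hσ2 : √R ^ 2 = R := Real.sq_sqrt hR.le
  set η := w₁ + w₂ with hη
  have e1 : R • (η - w) = R • w' + Z := by rw [← h]; module
  have e2 : R ^ 2 * ‖η - w‖ ^ 2 = R ^ 2 + 2 * R * ⟪w', Z⟫ + ‖Z‖ ^ 2 := by
    have := congrArg (fun x => ‖x‖ ^ 2) e1
    simp only [norm_add_sq_real, norm_smul, mul_pow, Real.norm_eq_abs, sq_abs, hw',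
      inner_smul_left, conj_trivial] at this
    linarith
  rw [norm_sub_sq_real, hw] at e2
  have e3 : R ^ 2 * (⟪η, w⟫ - 1 / 2 * ‖η‖ ^ 2) = -(R * ⟪w', Z⟫ + 1 / 2 * ‖Z‖ ^ 2) := by linarith
  have h4 : |R ^ 2 * (⟪η, w⟫ - 1 / 2 * ‖η‖ ^ 2)| ≤ R ^ 2 * ((K + K ^ 2) * (√R)⁻¹ * Θ) := by
    rw [e3, abs_neg]
    have h5 : |R * ⟪w', Z⟫| ≤ R * (K * (√R * Θ)) := by
      rw [abs_mul, abs_of_pos hR]; gcongr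
    have h6 : |1 / 2 * ‖Z‖ ^ 2| ≤ K ^ 2 * R := by
      rw [abs_of_nonneg (by positivity)]
      have : ‖Z‖ ^ 2 ≤ (K * √R) ^ 2 := by gcongr
      rw [mul_pow, hσ2] at this
      nlinarith [sq_nonneg ‖Z‖]
    have h7 : R ^ 2 * ((K + K ^ 2) * (√R)⁻¹ * Θ) = R * (K * (√R * Θ)) + K ^ 2 * R * (√R * Θ) := by
      have h8 : R * (√R)⁻¹ = √R := by
        rw [mul_inv_eq_iff_eq_mul₀ hσ.ne', ← sq, hσ2]
      calc R ^ 2 * ((K + K ^ 2) * (√R)⁻¹ * Θ) = R * (K + K ^ 2) * (R * (√R)⁻¹) * Θ := by ring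
        _ = _ := by rw [h8]; ring
    rw [h7]
    refine (abs_add_le _ _).trans (add_le_add h5 (h6.trans ?_))
    exact le_mul_of_one_le_right (by positivity) hΘ
  rw [abs_mul, abs_of_pos (by positivity)] at h4
  exact le_of_mul_le_mul_left h4 (by positivity)

lemma norm_sub_inner_smul_le {w : E} (hw : ‖w‖ = 1) (z : E) (t : ℝ) :
    ‖z - ⟪w, z⟫ • w‖ ≤ ‖z - t • w‖ := by
  have h1 := norm_sq_decomp hw (z - t • w)
  rw [inner_sub_right, inner_smul_right, real_inner_self_eq_norm_sq, hw,
    show z - t • w - (⟪w, z⟫ - t * 1 ^ 2) • w = z - ⟪w, z⟫ • w by module] at h1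
  refine (abs_le_of_sq_le_sq' ?_ (norm_nonneg _)).2
  nlinarith [sq_nonneg (⟪w, z⟫ - t * 1 ^ 2)]

lemma norm_stretch_le_norm_stretch {w w' : E} (hw : ‖w‖ = 1) (hw' : ‖w'‖ = 1) {σ Θ : ℝ}
    (h : ‖w - w'‖ ≤ 2 * Θ) (hσ : 1 ≤ σ) (hσΘ : 1 ≤ σ * Θ) (y : E) :
    ‖stretch σ 1 w y‖ ≤ 6 * ‖stretch σ (σ * Θ) w' y‖ := by
  have hΘ0 : 0 < Θ := by
    by_contra hc
    nlinarith
  set p := ‖y - ⟪w', y⟫ • w'‖ with hp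
  set m := |⟪w', y⟫| with hm
  have h1 := norm_sq_decomp hw y
  have h1' := norm_sq_decomp hw' y
  have e1 := norm_stretch_sq hw σ 1 y
  have e2 := norm_stretch_sq hw' σ (σ * Θ) y
  have hp0 : 0 ≤ p := norm_nonneg _
  have hm0 : 0 ≤ m := abs_nonneg _
  have b1 : ‖y - ⟪w, y⟫ • w‖ ≤ p + 2 * Θ * m := by
    refine (norm_sub_inner_smul_le hw y ⟪w', y⟫).trans ?_
    rw [show y - ⟪w', y⟫ • w = (y - ⟪w', y⟫ • w') - ⟪w', y⟫ • (w - w') by module]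
    refine (norm_sub_le _ _).trans ?_
    rw [norm_smul, Real.norm_eq_abs, ← hm]
    linarith [mul_le_mul_of_nonneg_left h hm0]
  have b2 : |⟪w, y⟫| ≤ m + 2 * p + 0 := by
    have e : ⟪w, y⟫ = ⟪w, y - ⟪w', y⟫ • w'⟫ + ⟪w', y⟫ * ⟪w, w'⟫ := by
      rw [inner_sub_right, inner_smul_right]; ring
    rw [e]
    refine (abs_add_le _ _).trans ?_
    have c1 := abs_real_inner_le_norm w (y - ⟪w', y⟫ • w')
    have c2 := abs_real_inner_le_norm w w'
    rw [hw, one_mul] at c1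
    rw [hw, hw', one_mul] at c2
    rw [abs_mul]
    linarith [mul_le_mul_of_nonneg_left c2 hm0]
  set q := ‖stretch σ (σ * Θ) w' y‖ with hq
  have hq2 : q ^ 2 = σ ^ 2 * p ^ 2 + (σ * Θ) ^ 2 * m ^ 2 := by
    rw [e2, hm, sq_abs, h1']; ring
  have hpq : σ * p ≤ q := by
    refine (abs_le_of_sq_le_sq' ?_ (norm_nonneg _)).2
    rw [hq2]; nlinarith [sq_nonneg (σ * Θ * m)]
  have hmq : σ * Θ * m ≤ q := by
    refine (abs_le_of_sq_le_sq' ?_ (norm_nonneg _)).2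
    rw [hq2]; nlinarith [sq_nonneg (σ * p)]
  have hpq' : p ≤ q := (le_mul_of_one_le_left hp0 hσ).trans hpq
  have hmq' : m ≤ q := (le_mul_of_one_le_left hm0 hσΘ).trans hmq
  have f1 : σ * ‖y - ⟪w, y⟫ • w‖ ≤ 3 * q := by
    linarith [mul_le_mul_of_nonneg_left b1 (zero_le_one.trans hσ)]
  have f2 : |⟪w, y⟫| ≤ 3 * q := by linarith
  refine (abs_le_of_sq_le_sq' ?_ (by positivity)).2
  rw [e1, show ‖y‖ ^ 2 - ⟪w, y⟫ ^ 2 = ‖y - ⟪w, y⟫ • w‖ ^ 2 by linarith, ← sq_abs ⟪w, y⟫]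
  have g1 : (σ * ‖y - ⟪w, y⟫ • w‖) ^ 2 ≤ (3 * q) ^ 2 := by gcongr
  have g2 : |⟪w, y⟫| ^ 2 ≤ (3 * q) ^ 2 := by gcongr
  linarith [mul_pow σ ‖y - ⟪w, y⟫ • w‖ 2, mul_pow 3 q 2, mul_pow 6 q 2, sq_nonneg q]

end Geometry

end Falconer

namespace Falconer

open MeasureTheory Metric Set Filter Topology Module
open scoped FourierTransform ENNReal NNReal Pointwise ComplexConjugate RealInnerProductSpace

set_option linter.unusedSectionVars false

section Fan

variable {E : Type*} [NormedAddCommGroup E] [InnerProductSpace ℝ E]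

lemma norm_stretch_zero {ω : E} (hω : ‖ω‖ = 1) {σ : ℝ} (hσ : 0 ≤ σ) (z : E) :
    ‖stretch σ 0 ω z‖ = σ * ‖z - ⟪ω, z⟫ • ω‖ := by
  rw [← pow_left_inj₀ (norm_nonneg _) (by positivity) two_ne_zero, norm_stretch_sq hω, mul_pow,
    ← sub_eq_iff_eq_add'.2 (norm_sq_decomp hω z)]
  ring

lemma norm_sub_inner_smul_neg (w z : E) : ‖-z - ⟪w, -z⟫ • w‖ = ‖z - ⟪w, z⟫ • w‖ := by
  rw [inner_neg_right, ← norm_neg]; congr 1; module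

/-- Forward cones of width `r` around the directions `ω`, at distances between `2 / H` and `10`. -/
def fan {ι : Type*} (s : Finset ι) (ω : ι → E) (r H : ℝ) : Set E :=
  {z | 2 ≤ ‖z‖ * H ∧ ‖z‖ ≤ 10 ∧ ∃ k ∈ s, 0 ≤ ⟪ω k, z⟫ ∧ ‖z - ⟪ω k, z⟫ • ω k‖ ≤ r}

lemma isClosed_fan {ι : Type*} (s : Finset ι) (ω : ι → E) (r H : ℝ) : IsClosed (fan s ω r H) := by
  have e : fan s ω r H = {z | 2 ≤ ‖z‖ * H} ∩ ({z | ‖z‖ ≤ 10} ∩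
      ⋃ k ∈ s, ({z | 0 ≤ ⟪ω k, z⟫} ∩ {z | ‖z - ⟪ω k, z⟫ • ω k‖ ≤ r})) := by
    ext z; simp only [fan, mem_ofPred_eq, mem_inter_iff, mem_iUnion, exists_prop]
  rw [e]
  refine (isClosed_le (by fun_prop) (by fun_prop)).inter
    ((isClosed_le (by fun_prop) (by fun_prop)).inter ?_)
  exact s.finite_toSet.isClosed_biUnion fun k _ =>
    (isClosed_le (by fun_prop) (by fun_prop)).inter (isClosed_le (by fun_prop) (by fun_prop))

lemma norm_sub_normalize_le {w z : E} {r H : ℝ} (hw : ‖w‖ = 1) (hz : 2 ≤ ‖z‖ * H)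
    (h0 : 0 ≤ ⟪w, z⟫) (hr : ‖z - ⟪w, z⟫ • w‖ ≤ r) : ‖w - ‖z‖⁻¹ • z‖ ≤ r * H := by
  have hz0 : 0 < ‖z‖ := by
    by_contra hc
    have : ‖z‖ = 0 := le_antisymm (not_lt.1 hc) (norm_nonneg _)
    rw [this] at hz; linarith
  have hle : ⟪w, z⟫ ≤ ‖z‖ := by
    have := real_inner_le_norm w z; rwa [hw, one_mul] at this
  have h1 : ‖z‖ - ⟪w, z⟫ ≤ ‖z - ⟪w, z⟫ • w‖ := by
    have := norm_sub_inner_smul_le hw z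
    have h2 := norm_sq_decomp hw z
    refine (abs_le_of_sq_le_sq' ?_ (norm_nonneg _)).2
    nlinarith
  have e : ‖z‖ • (w - ‖z‖⁻¹ • z) = (‖z‖ - ⟪w, z⟫) • w - (z - ⟪w, z⟫ • w) := by
    rw [smul_sub, smul_smul, mul_inv_cancel₀ hz0.ne', one_smul]; module
  have h2 : ‖z‖ * ‖w - ‖z‖⁻¹ • z‖ ≤ 2 * r := by
    rw [← norm_norm z, ← norm_smul, norm_norm, e]
    refine (norm_sub_le _ _).trans ?_
    rw [norm_smul, hw, mul_one, Real.norm_of_nonneg (sub_nonneg.2 hle)]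
    linarith
  have hr0 : 0 ≤ r := (norm_nonneg _).trans hr
  have h3 : 2 * r ≤ ‖z‖ * (r * H) := by
    have := mul_le_mul_of_nonneg_left hz hr0; linarith
  exact le_of_mul_le_mul_left (h2.trans h3) hz0

end Fan

section Fan

variable {E : Type*} [NormedAddCommGroup E] [InnerProductSpace ℝ E] [FiniteDimensional ℝ E]
  [MeasurableSpace E] [BorelSpace E]

lemma Fam.sum_dk_le {ι : Type*} {R C₀ H : ℝ} {s : Finset ι} {ω : ι → E} {u : ι → E → ℂ}
    (hu : Fam R C₀ s ω u) (hR : 1 ≤ R) (hH : 1 ≤ H) (N : ℕ) {z : E} (hz : 2 ≤ ‖z‖ * H)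
    (hz' : ‖z‖ ≤ 10) : ∑ k ∈ s, dk N (stretch √R 0 (ω k) z) ≤
      s.card * ENNReal.ofReal (H ^ N)⁻¹ + ENNReal.ofReal (C₀ * (H ^ 2) ^ finrank ℝ E) *
        ((fan s ω ((√R)⁻¹ * H) H).indicator 1 z + (fan s ω ((√R)⁻¹ * H) H).indicator 1 (-z)) := by
  classical
  have hσ : 0 < √R := by positivity
  set F := fan s ω ((√R)⁻¹ * H) H with hF
  let t : E → Finset ι := fun z =>
    s.filter fun k => 0 ≤ ⟪ω k, z⟫ ∧ ‖z - ⟪ω k, z⟫ • ω k‖ ≤ (√R)⁻¹ * H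
  have ht : ∀ z : E, 2 ≤ ‖z‖ * H → ‖z‖ ≤ 10 →
      ((t z).card : ℝ≥0∞) ≤ ENNReal.ofReal (C₀ * (H ^ 2) ^ finrank ℝ E) * F.indicator 1 z := by
    intro z hz hz'
    by_cases hzF : z ∈ F
    · rw [indicator_of_mem hzF, Pi.one_apply, mul_one, ← ENNReal.ofReal_natCast]
      refine ENNReal.ofReal_le_ofReal (hu.count (R • ‖z‖⁻¹ • z) _ (one_le_pow₀ hH) _
        (Finset.filter_subset _ _) fun k hk => ?_)
      obtain ⟨hk, h0, hr⟩ := Finset.mem_filter.1 hk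
      have h1 := norm_sub_normalize_le (hu.unit k hk) hz h0 hr
      rw [← smul_sub, norm_smul, Real.norm_of_nonneg (by linarith)]
      calc R * ‖ω k - ‖z‖⁻¹ • z‖ ≤ R * ((√R)⁻¹ * H * H) := by gcongr
        _ = √R ^ 2 * ((√R)⁻¹ * H * H) := by rw [Real.sq_sqrt (by linarith)]
        _ = H ^ 2 * √R := by field_simp
    · rw [indicator_of_notMem hzF, mul_zero, nonpos_iff_eq_zero, Nat.cast_eq_zero,
        Finset.card_eq_zero, Finset.filter_eq_empty_iff]
      exact fun k hk h => hzF ⟨hz, hz', k, hk, h⟩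
  have hterm : ∀ k ∈ s, dk N (stretch √R 0 (ω k) z) ≤ ENNReal.ofReal (H ^ N)⁻¹ +
      ((if k ∈ t z then 1 else 0) + if k ∈ t (-z) then 1 else 0) := by
    intro k hk
    rcases le_total ‖z - ⟪ω k, z⟫ • ω k‖ ((√R)⁻¹ * H) with h | h
    · refine (dk_le_one _ _).trans (le_add_left ?_)
      rcases le_total 0 ⟪ω k, z⟫ with h0 | h0
      · rw [if_pos (Finset.mem_filter.2 ⟨hk, h0, h⟩)]; exact le_self_add
      · rw [if_pos (Finset.mem_filter.2 ⟨hk, by rwa [inner_neg_right, neg_nonneg], by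
          rwa [norm_sub_inner_smul_neg]⟩ : k ∈ t (-z))]
        exact le_add_self
    · refine le_add_right ?_
      rw [dk, wt_eq_ofReal, norm_stretch_zero (hu.unit k hk) hσ.le,
        ENNReal.ofReal_inv_of_pos (by positivity), ENNReal.ofReal_pow (by positivity)]
      gcongr
      have := mul_le_mul_of_nonneg_left h hσ.le
      rw [← mul_assoc, mul_inv_cancel₀ hσ.ne', one_mul] at this
      linarith
  have hs : ∀ z, ∑ k ∈ s, (if k ∈ t z then (1 : ℝ≥0∞) else 0) = (t z).card := fun z => by
    rw [Finset.sum_ite_mem, Finset.inter_eq_right.2 (Finset.filter_subset _ _), Finset.sum_const,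
      nsmul_eq_mul, mul_one]
  refine (Finset.sum_le_sum hterm).trans ?_
  rw [Finset.sum_add_distrib, Finset.sum_add_distrib, hs, hs, Finset.sum_const, nsmul_eq_mul,
    mul_add]
  gcongr
  · exact ht z hz hz'
  · exact ht (-z) (by rwa [norm_neg]) (by rwa [norm_neg])

lemma volume_le_of_sub_le {T : Set ℝ} {L : ℝ} (h : ∀ τ ∈ T, ∀ τ' ∈ T, τ ≤ τ' → τ' - τ ≤ L) :
    volume T ≤ ENNReal.ofReal L := by
  refine (Real.volume_le_diam T).trans (ediam_le fun x hx y hy => ?_)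
  rw [edist_dist, Real.dist_eq]
  refine ENNReal.ofReal_le_ofReal (abs_le.2 ?_)
  rcases le_total x y with hxy | hxy
  · have := h x hx y hy hxy; constructor <;> linarith
  · have := h y hy x hx hxy; constructor <;> linarith

/-- Two clusters of directions at mutual distance about `Θ`. -/
structure Sep {ι : Type*} (I₁ I₂ : Finset ι) (ω : ι → E) (Θ : ℝ) : Prop where
  near₁ : ∀ i ∈ I₁, ∀ j ∈ I₁, ‖ω i - ω j‖ ≤ 1 / 100 * Θ
  near₂ : ∀ i ∈ I₂, ∀ j ∈ I₂, ‖ω i - ω j‖ ≤ 1 / 100 * Θ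
  le_norm : ∀ i ∈ I₁, ∀ j ∈ I₂, 99 / 100 * Θ ≤ ‖ω i - ω j‖
  norm_le : ∀ i ∈ I₁, ∀ j ∈ I₂, ‖ω i - ω j‖ ≤ 101 / 100 * Θ

lemma fan_lintegral_line_le {ι : Type*} {I₁ I₂ t : Finset ι} {ω : ι → E} {Θ δ H K : ℝ}
    (hs : Sep I₁ I₂ ω Θ) (h1 : ∀ k ∈ I₁, ‖ω k‖ = 1) (h2 : ∀ k ∈ I₂, ‖ω k‖ = 1) (hΘ : 0 < Θ)
    (hΘ1 : Θ ≤ 1 / 2) (hδ : 0 ≤ δ) (hδΘ : δ ≤ Θ) (hH : 1 ≤ H) (hδH : 100 * (δ * H ^ 2) ≤ Θ)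
    {i j k : ι} (hi : i ∈ I₁) (hj : j ∈ I₂) (hk : k ∈ I₂) (ht : t ⊆ I₁)
    (hK : ∀ l ∈ t, |⟪ω i + ω j, ω l⟫ - 1 / 2 * ‖ω i + ω j‖ ^ 2| ≤ K * δ * Θ) (a : E)
    {c : ℝ} (hc : c = 1 ∨ c = -1) :
    ∫⁻ τ in Icc (0 : ℝ) 1, (fan t ω (δ * H) H).indicator 1 (a + (c * τ) • ω k) ≤
      ENNReal.ofReal (40 * (K + 1) * H ^ 3 * δ / Θ) := by
  have hpair : ∀ z ∈ fan t ω (δ * H) H, ∀ τ : ℝ, 0 ≤ τ → z + τ • ω k ∈ fan t ω (δ * H) H →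
      τ ≤ 40 * (K + 1) * H ^ 3 * δ / Θ := by
    have hbound : ∀ z ∈ fan t ω (δ * H) H, |⟪z, ω i + ω j⟫ - 1 / 2 * ‖ω i + ω j‖ ^ 2 * ‖z‖| ≤
        (10 * K + 10) * (H ^ 3 * δ) * Θ := by
      rintro z ⟨hz1, hz2, l, hl, h0, hr⟩
      refine (abs_fan_le (h1 l (ht hl)) (h1 i hi) (h2 j hj) (hK l hl) ?_ ?_ hδ hδΘ hH h0 hr
        (by linarith) hz2).trans_eq (by ring)
      · linarith [hs.near₁ i hi l (ht hl)]
      · rw [norm_sub_rev]; linarith [hs.norm_le l (ht hl) j hj]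
    intro z hz τ hτ hz'
    have hB' := hbound _ hz'
    obtain ⟨hz1, hz2, l, hl, h0, hr⟩ := hz'
    have hpos : 0 < ‖z + τ • ω k‖ := by
      by_contra hc
      have : ‖z + τ • ω k‖ = 0 := le_antisymm (not_lt.1 hc) (norm_nonneg _)
      rw [this] at hz1; linarith
    have := fan_line_le (h1 i hi) (h2 j hj) (h2 k hk) (h1 l (ht hl)) hΘ hΘ1
      (hs.norm_le i hi k hk) (hs.near₂ j hj k hk) (hs.le_norm i hi j hj) (hs.norm_le i hi j hj)
      (hs.le_norm l (ht hl) k hk) (hs.norm_le l (ht hl) k hk) hτ rfl h0 hpos (hr.trans ?_)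
      (hbound z hz) hB'
    · rw [le_div_iff₀ hΘ]; linarith
    · have h3 : δ * H * 2 ≤ δ * H * (‖z + τ • ω k‖ * H) := by gcongr
      have h4 := mul_le_mul_of_nonneg_right hδH hpos.le
      linarith
  have hmeas : MeasurableSet {τ : ℝ | a + (c * τ) • ω k ∈ fan t ω (δ * H) H} :=
    ((isClosed_fan t ω _ _).preimage (by fun_prop)).measurableSet
  calc _ ≤ ∫⁻ τ : ℝ, {τ : ℝ | a + (c * τ) • ω k ∈ fan t ω (δ * H) H}.indicator 1 τ :=
        setLIntegral_le_lintegral _ _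
    _ = volume {τ : ℝ | a + (c * τ) • ω k ∈ fan t ω (δ * H) H} := lintegral_indicator_one hmeas
    _ ≤ _ := by
        refine volume_le_of_sub_le fun τ hτ τ' hτ' hle => ?_
        rcases hc with rfl | rfl
        · refine hpair _ hτ _ (sub_nonneg.2 hle) ?_
          rw [show a + (1 * τ) • ω k + (τ' - τ) • ω k = a + (1 * τ') • ω k by module]
          exact hτ'
        · refine hpair _ hτ' _ (sub_nonneg.2 hle) ?_
          rw [show a + (-1 * τ') • ω k + (τ' - τ) • ω k = a + (-1 * τ) • ω k by module]
          exact hτ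

/-- Total mass near a point of the tubes in directions `t` through that point. -/
lemma Fam.sum_tw_le {ι : Type*} {R C₀ H Θ K : ℝ} {I₁ I₂ t : Finset ι} {ω : ι → E}
    {u : ι → E → ℂ} (hu₁ : Fam R C₀ I₁ ω u) (hu₂ : Fam R C₀ I₂ ω u) (hs : Sep I₁ I₂ ω Θ)
    (hR : 1 ≤ R) (hΘ : 0 < Θ) (hΘ1 : Θ ≤ 1 / 2) (hδΘ : (√R)⁻¹ ≤ Θ) (hH : 1 ≤ H)
    (hδH : 100 * ((√R)⁻¹ * H ^ 2) ≤ Θ) {i j : ι} (hi : i ∈ I₁) (hj : j ∈ I₂) (ht : t ⊆ I₁)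
    (hK : ∀ l ∈ t, |⟪ω i + ω j, ω l⟫ - 1 / 2 * ‖ω i + ω j‖ ^ 2| ≤ K * (√R)⁻¹ * Θ) (N M : ℕ)
    {S : Set E} (hS : MeasurableSet S) {q : E} (hq : ∀ y ∈ S, 2 ≤ ‖q - y‖ * H)
    (hq' : ∀ y ∈ S, ‖q - y‖ ≤ 10) :
    ∑ l ∈ t, tw N √R (ω l) (fun x => ∑ k ∈ I₂, avg M √R (ω k) (u k) x) S q ≤
      (t.card * ENNReal.ofReal (H ^ N)⁻¹ + ENNReal.ofReal (C₀ * (H ^ 2) ^ finrank ℝ E) *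
        (2 * (2 ^ M * ENNReal.ofReal (40 * (K + 1) * H ^ 3 * (√R)⁻¹ / Θ)))) *
        ∑ k ∈ I₂, ∫⁻ x, avg M √R (ω k) (u k) x := by
  have hσ : 0 < √R := by positivity
  have hm : ∀ k ∈ I₂, Measurable (avg M √R (ω k) (u k)) := fun k hk =>
    measurable_avg (hu₂.pw k hk).cont
  have hm2 : Measurable fun x => ∑ k ∈ I₂, avg M √R (ω k) (u k) x :=
    Finset.measurable_fun_sum _ hm
  set D : E → ℝ≥0∞ := fun x => ∑ k ∈ I₂, avg M √R (ω k) (u k) x with hD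
  set F := fan t ω ((√R)⁻¹ * H) H with hF
  set a : ℝ≥0∞ := t.card * ENNReal.ofReal (H ^ N)⁻¹
  set b : ℝ≥0∞ := ENNReal.ofReal (C₀ * (H ^ 2) ^ finrank ℝ E)
  set B : ℝ≥0∞ := ENNReal.ofReal (40 * (K + 1) * H ^ 3 * (√R)⁻¹ / Θ)
  have hFm : Measurable (F.indicator (1 : E → ℝ≥0∞)) :=
    measurable_one.indicator (isClosed_fan t ω _ _).measurableSet
  have hFp : Measurable fun y => F.indicator (1 : E → ℝ≥0∞) (q - y) := hFm.comp (by fun_prop)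
  have hFn : Measurable fun y => F.indicator (1 : E → ℝ≥0∞) (-(q - y)) := hFm.comp (by fun_prop)
  have hline := fun k (hk : k ∈ I₂) => fan_lintegral_line_le hs hu₁.unit hu₂.unit hΘ hΘ1
    (by positivity) hδΘ hH hδH hi hj hk ht hK
  have hk1 : ∀ k ∈ I₂, ∫⁻ y, avg M √R (ω k) (u k) y * F.indicator 1 (q - y) ≤
      2 ^ M * (B * ∫⁻ y, avg M √R (ω k) (u k) y) := fun k hk => by
    refine (slow_avg M √R (ω k) (u k)).lintegral_mul_le (hu₂.unit k hk) (hm k hk) hFp fun x => ?_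
    refine (lintegral_congr fun τ => ?_).trans_le (hline k hk (q - x) (c := 1) (.inl rfl))
    congr 1; module
  have hk2 : ∀ k ∈ I₂, ∫⁻ y, avg M √R (ω k) (u k) y * F.indicator 1 (-(q - y)) ≤
      2 ^ M * (B * ∫⁻ y, avg M √R (ω k) (u k) y) := fun k hk => by
    refine (slow_avg M √R (ω k) (u k)).lintegral_mul_le (hu₂.unit k hk) (hm k hk) hFn fun x => ?_
    refine (lintegral_congr fun τ => ?_).trans_le (hline k hk (x - q) (c := -1) (.inr rfl))
    congr 1; module
  have hsum : ∀ {g : E → ℝ≥0∞}, Measurable g → (∀ k ∈ I₂, ∫⁻ y, avg M √R (ω k) (u k) y * g y ≤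
      2 ^ M * (B * ∫⁻ y, avg M √R (ω k) (u k) y)) →
      ∫⁻ y, D y * g y ≤ 2 ^ M * (B * ∑ k ∈ I₂, ∫⁻ y, avg M √R (ω k) (u k) y) :=
    fun {g} hg h => by
      simp only [hD, Finset.sum_mul]
      rw [lintegral_finsetSum _ fun k hk => (hm k hk).fun_mul hg, Finset.mul_sum, Finset.mul_sum]
      exact Finset.sum_le_sum h
  calc _ = ∫⁻ y in S, D y * ∑ l ∈ t, dk N (stretch √R 0 (ω l) (q - y)) := by
        simp only [tw, Finset.mul_sum]
        refine (lintegral_finsetSum _ fun l _ => ?_).symm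
        exact hm2.mul ((measurable_dk N).comp (by fun_prop))
    _ ≤ ∫⁻ y in S, D y * (a + b * (F.indicator 1 (q - y) + F.indicator 1 (-(q - y)))) := by
        refine setLIntegral_mono' hS fun y hy => ?_
        gcongr
        exact (hu₁.subset ht).sum_dk_le hR hH N (hq y hy) (hq' y hy)
    _ ≤ ∫⁻ y, D y * (a + b * (F.indicator 1 (q - y) + F.indicator 1 (-(q - y)))) :=
        setLIntegral_le_lintegral _ _
    _ = a * (∫⁻ y, D y) + b * ((∫⁻ y, D y * F.indicator 1 (q - y)) +
          ∫⁻ y, D y * F.indicator 1 (-(q - y))) := by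
        rw [← lintegral_const_mul _ hm2, ← lintegral_add_left (hm2.fun_mul hFp),
          ← lintegral_const_mul _ ((hm2.fun_mul hFp).fun_add (hm2.fun_mul hFn)),
          ← lintegral_add_left (hm2.const_mul _)]
        refine lintegral_congr fun y => ?_
        ring
    _ ≤ a * (∑ k ∈ I₂, ∫⁻ y, avg M √R (ω k) (u k) y) + b *
          (2 ^ M * (B * ∑ k ∈ I₂, ∫⁻ y, avg M √R (ω k) (u k) y) +
          2 ^ M * (B * ∑ k ∈ I₂, ∫⁻ y, avg M √R (ω k) (u k) y)) := by
        rw [hD, lintegral_finsetSum _ hm]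
        gcongr
        · exact hsum hFp hk1
        · exact hsum hFn hk2
    _ = _ := by ring

end Fan

end Falconer

namespace Falconer

open MeasureTheory Metric Set Filter Topology Module
open scoped FourierTransform ENNReal NNReal Pointwise ComplexConjugate RealInnerProductSpace

set_option linter.unusedSectionVars false

section Far

variable {E : Type*} [NormedAddCommGroup E] [InnerProductSpace ℝ E] [FiniteDimensional ℝ E]
  [MeasurableSpace E] [BorelSpace E]

lemma abs_inner_le_of_mem_plate {R C σ Θ : ℝ} {w v ξ : E} (hξ : ξ ∈ plate R C w) (hσ : σ = √R)
    (hC : 0 ≤ C) (h : ‖v - w‖ ≤ 2 * Θ) (hΘ : 1 ≤ σ * Θ) :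
    |⟪v, ξ - R • w⟫| ≤ 3 * C * (σ * Θ) := by
  subst hσ
  have e : ⟪v, ξ - R • w⟫ = ⟪w, ξ - R • w⟫ + ⟪v - w, ξ - R • w⟫ := by
    rw [inner_sub_left]; ring
  rw [e]
  refine (abs_add_le _ _).trans ?_
  have h1 := (abs_real_inner_le_norm (v - w) (ξ - R • w)).trans
    (mul_le_mul h hξ.1 (norm_nonneg _) ((norm_nonneg _).trans h))
  have h2 := hξ.2
  have h3 := mul_le_mul_of_nonneg_left hΘ hC
  linarith

/-- Frequency support of a product of two packets and a window. -/
def pairSupp (R C₀ Θ : ℝ) (v w₁ w₂ : E) : Set E :=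
  plate R (C₀ + 2) w₁ + plate R C₀ w₂ + {ξ : E | ‖stretch (√R)⁻¹ (√R * Θ)⁻¹ v ξ‖ ≤ 2}

lemma isBounded_pairSupp {R C₀ Θ : ℝ} (hR : 0 < R) (hΘ : 0 < Θ) {v : E} (hv : ‖v‖ = 1)
    (w₁ w₂ : E) : Bornology.IsBounded (pairSupp R C₀ Θ v w₁ w₂) :=
  ((isBounded_plate _ _ _).add (isBounded_plate _ _ _)).add
    (isBounded_stretch_le hv (by positivity) (by positivity))

lemma resonance {R C₀ Θ : ℝ} (hR : 1 ≤ R) (hC₀ : 1 ≤ C₀) (hΘ0 : 0 < Θ) (hΘ1 : Θ ≤ 1)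
    (hΘ : 1 ≤ √R * Θ) {v w₁ w₂ w₁' w₂' : E} (hv : ‖v‖ = 1) (h1 : ‖w₂' - w₁‖ ≤ 2 * Θ)
    (h2 : ‖w₂' - w₂‖ ≤ 2 * Θ) (h1' : ‖w₂' - w₁'‖ ≤ 2 * Θ) (h2v : ‖w₂' - v‖ ≤ 2 * Θ)
    (h : (pairSupp R C₀ Θ v w₁ w₂ ∩ pairSupp R C₀ Θ v w₁' w₂').Nonempty) :
    ‖R • (w₁ + w₂ - w₁' - w₂')‖ ≤ (12 * (C₀ + 2) + 12) * √R ∧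
      |⟪w₂', R • (w₁ + w₂ - w₁' - w₂')⟫| ≤ (12 * (C₀ + 2) + 12) * (√R * Θ) := by
  obtain ⟨_, ⟨_, ⟨a₁, ha₁, a₂, ha₂, rfl⟩, b, hb, rfl⟩, _, ⟨a₁', ha₁', a₂', ha₂', rfl⟩, b', hb', e⟩ := h
  have hσ : 0 < √R := by positivity
  have e' : a₁' + a₂' + b' = a₁ + a₂ + b := e
  have hZ : R • (w₁ + w₂ - w₁' - w₂') = (a₁' - R • w₁') + (a₂' - R • w₂') + b' - (a₁ - R • w₁)
      - (a₂ - R • w₂) - b := by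
    have : b' = a₁ + a₂ + b - a₁' - a₂' := by rw [← e']; abel
    rw [this]; module
  have hB : ∀ b : E, ‖stretch (√R)⁻¹ (√R * Θ)⁻¹ v b‖ ≤ 2 →
      ‖b‖ ≤ 2 * √R ∧ |⟪w₂', b⟫| ≤ 6 * (√R * Θ) := fun b hb => by
    have hn : ‖b‖ ≤ 2 * √R := by
      have := norm_stretch_mono hv (a := (√R)⁻¹) (b := (√R)⁻¹) (a' := (√R)⁻¹) (b' := (√R * Θ)⁻¹)
        le_rfl (by
          rw [abs_of_pos (by positivity), abs_of_pos (by positivity)]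
          gcongr
          exact mul_le_of_le_one_right hσ.le hΘ1) b
      rw [stretch_self, norm_smul, norm_inv, Real.norm_of_nonneg hσ.le] at this
      have := this.trans hb
      rwa [inv_mul_le_iff₀ hσ, mul_comm] at this
    refine ⟨hn, ?_⟩
    have h3 : |⟪v, b⟫| ≤ 2 * (√R * Θ) := by
      have h4 : ⟪v, stretch (√R)⁻¹ (√R * Θ)⁻¹ v b⟫ = (√R * Θ)⁻¹ * ⟪v, b⟫ := by
        rw [← inner_stretch, stretch_apply, real_inner_self_eq_norm_sq, hv]
        simp only [inner_add_left, inner_smul_left, conj_trivial]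
        ring
      have h5 := (abs_real_inner_le_norm v (stretch (√R)⁻¹ (√R * Θ)⁻¹ v b))
      rw [h4, hv, one_mul, abs_mul, abs_of_pos (by positivity)] at h5
      have := h5.trans hb
      rwa [inv_mul_le_iff₀ (by positivity), mul_comm] at this
    rw [show ⟪w₂', b⟫ = ⟪v, b⟫ + ⟪w₂' - v, b⟫ by rw [inner_sub_left]; ring]
    have h6 := (abs_real_inner_le_norm (w₂' - v) b).trans
      (mul_le_mul h2v hn (norm_nonneg _) ((norm_nonneg _).trans h2v))
    have := abs_add_le ⟪v, b⟫ ⟪w₂' - v, b⟫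
    linarith
  rw [hZ]
  constructor
  · have n1 := norm_sub_le ((a₁' - R • w₁') + (a₂' - R • w₂') + b' - (a₁ - R • w₁)
      - (a₂ - R • w₂)) b
    have n2 := norm_sub_le ((a₁' - R • w₁') + (a₂' - R • w₂') + b' - (a₁ - R • w₁)) (a₂ - R • w₂)
    have n3 := norm_sub_le ((a₁' - R • w₁') + (a₂' - R • w₂') + b') (a₁ - R • w₁)
    have n4 := norm_add_le ((a₁' - R • w₁') + (a₂' - R • w₂')) b'
    have n5 := norm_add_le (a₁' - R • w₁') (a₂' - R • w₂')
    have m1 := ha₁.1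
    have m2 := ha₂.1
    have m3 := ha₁'.1
    have m4 := ha₂'.1
    have m5 := (hB b hb).1
    have m6 := (hB b' hb').1
    have : 0 ≤ C₀ * √R := by positivity
    linarith
  · simp only [inner_sub_right _ _ b, inner_sub_right _ _ (a₂ - R • w₂),
      inner_sub_right _ _ (a₁ - R • w₁), inner_add_right]
    have m1 := abs_le.1 (abs_inner_le_of_mem_plate ha₁ rfl (by linarith) h1 hΘ)
    have m2 := abs_le.1 (abs_inner_le_of_mem_plate ha₂ rfl (by linarith) h2 hΘ)
    have m3 := abs_le.1 (abs_inner_le_of_mem_plate ha₁' rfl (by linarith) h1' hΘ)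
    have m4 := abs_le.1 (abs_inner_le_of_mem_plate ha₂' rfl (by linarith)
      (by rw [sub_self, norm_zero]; positivity : ‖w₂' - w₂'‖ ≤ 2 * Θ) hΘ)
    have m5 := abs_le.1 (hB b hb).2
    have m6 := abs_le.1 (hB b' hb').2
    have : 0 ≤ C₀ * (√R * Θ) := by positivity
    rw [abs_le]
    constructor <;> linarith

lemma ennreal_mul_le_add_of_sq_le {a b X Y P Q : ℝ≥0∞} (ha : a ^ 2 ≤ X) (hb : b ^ 2 ≤ Y)
    (h : X * Y ≤ P * Q) : a * b ≤ P + Q := by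
  rw [← ENNReal.pow_le_pow_left_iff two_ne_zero, mul_pow]
  calc a ^ 2 * b ^ 2 ≤ P * Q := (mul_le_mul' ha hb).trans h
    _ ≤ (P + Q) * (P + Q) := mul_le_mul' le_self_add le_add_self
    _ = _ := (sq _).symm

lemma wt_le_mul {x y : E} {c : ℝ≥0} (hc : 1 ≤ c) (h : ‖x‖ ≤ c * ‖y‖) : wt x ≤ c * wt y := by
  rw [wt_eq_ofReal, wt_eq_ofReal, ← ENNReal.ofReal_coe_nnreal, ← ENNReal.ofReal_mul (p := (c : ℝ)) c.coe_nonneg]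
  refine ENNReal.ofReal_le_ofReal ?_
  have : (1 : ℝ) ≤ c := hc
  linarith

/-- Pointwise bound for a windowed product of two packets. -/
lemma exists_pair_le (N : ℕ) (hN : finrank ℝ E < N) {C₀ : ℝ} (hC₀ : 1 ≤ C₀) :
    ∃ C : ℝ≥0, ∀ {R Θ : ℝ} {v w₁ w₂ : E} {u₁ u₂ : E → ℂ} {p : E → ℝ≥0∞}, 1 ≤ R → 1 ≤ √R * Θ →
      ‖v‖ = 1 → ‖w₁‖ = 1 → ‖w₂‖ = 1 → ‖w₁ - v‖ ≤ 2 * Θ → ‖w₂ - v‖ ≤ 2 * Θ →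
      PW (plate R C₀ w₁) u₁ → PW (plate R C₀ w₂) u₂ → Slow (N + N) √R w₁ p → (∀ x, p x ≤ 1) →
      ∀ q x, ‖smooth √R w₁ p x * u₁ x * u₂ x * ker E (stretch √R (√R * Θ) v (x - q))‖ₑ ^ 2 ≤
        C * (p q ^ 2 * (avg N √R w₁ u₁ q * avg N √R w₂ u₂ q)) *
          dk (finrank ℝ E + 1) (stretch √R (√R * Θ) v (x - q)) ^ 2 := by
  obtain ⟨Cs, hCs⟩ := exists_smooth_le (E := E) (N + N)
  obtain ⟨Ca, hCa⟩ := exists_sq_le_avg (E := E) N hN hC₀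
  obtain ⟨Cd, hCd⟩ := exists_ker_decay (E := E) (N + N + N + (finrank ℝ E + 1))
  refine ⟨Cs ^ 2 * (6 ^ (N + N)) ^ 2 * Ca ^ 2 * 6 ^ (N + N) * Cd ^ 2, ?_⟩
  intro R Θ v w₁ w₂ u₁ u₂ p hR hΘ hv h1 h2 h1v h2v hu₁ hu₂ hp hp1 q x
  have hσ : 1 ≤ √R := by rwa [Real.one_le_sqrt]
  set y := x - q with hy
  set W := wt (stretch √R (√R * Θ) v y) with hW
  have hw : ∀ {w : E}, ‖w‖ = 1 → ‖w - v‖ ≤ 2 * Θ → wt (stretch √R 1 w y) ≤ 6 * W := fun hw h => by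
    refine wt_le_mul (c := 6) (by norm_num) ?_
    exact norm_stretch_le_norm_stretch hw hv h hσ hΘ y
  have b1 : ‖smooth √R w₁ p x‖ₑ ≤ Cs * (p q * (6 * W) ^ (N + N)) := by
    refine (hCs (by positivity) h1 hp hp1 x q).trans ?_
    gcongr
    exact hw h1 h1v
  have b2 : ∀ {w : E} {u : E → ℂ}, ‖w‖ = 1 → ‖w - v‖ ≤ 2 * Θ → PW (plate R C₀ w) u →
      ‖u x‖ₑ ^ 2 ≤ Ca * ((6 * W) ^ N * avg N √R w u q) := fun {w u} h h' hu => by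
    refine (hCa hR h hu x).trans ?_
    gcongr
    refine (slow_avg N √R w u x q).trans ?_
    gcongr
    exact hw h h'
  have b3 := hCd (stretch √R (√R * Θ) v y)
  have e := wt_pow_mul_dk (N + N + N) (finrank ℝ E + 1) (stretch √R (√R * Θ) v y)
  rw [enorm_mul, enorm_mul, enorm_mul, mul_pow, mul_pow, mul_pow]
  calc _ ≤ (Cs * (p q * (6 * W) ^ (N + N))) ^ 2 * (Ca * ((6 * W) ^ N * avg N √R w₁ u₁ q)) *
        (Ca * ((6 * W) ^ N * avg N √R w₂ u₂ q)) *
        (Cd * dk (N + N + N + (finrank ℝ E + 1)) (stretch √R (√R * Θ) v y)) ^ 2 := by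
        gcongr
        · exact b2 h1 h1v hu₁
        · exact b2 h2 h2v hu₂
    _ = Cs ^ 2 * (6 ^ (N + N)) ^ 2 * Ca ^ 2 * 6 ^ (N + N) * Cd ^ 2 *
        (p q ^ 2 * (avg N √R w₁ u₁ q * avg N √R w₂ u₂ q)) *
        (W ^ (N + N + N) * dk (N + N + N + (finrank ℝ E + 1)) (stretch √R (√R * Θ) v y)) ^ 2 := by
        ring
    _ = _ := by rw [hW, e]; push_cast; ring

/-- The resonance constant. -/
noncomputable def resK (C₀ : ℝ) : ℝ :=
  (12 * (C₀ + 2) + 12) + (12 * (C₀ + 2) + 12) ^ 2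

lemma exists_window_sq_le (N : ℕ) (hN : finrank ℝ E < N) {C₀ : ℝ} (hC₀ : 1 ≤ C₀) :
    ∃ C : ℝ≥0, ∀ {ι : Type} {R Θ : ℝ} {I₁ I₂ : Finset ι} {ω : ι → E} {u : ι → E → ℂ} {v : ι},
      Fam R C₀ I₁ ω u → Fam R C₀ I₂ ω u → Sep I₁ I₂ ω Θ → 1 ≤ R → 0 < Θ → Θ ≤ 1 / 2 →
      1 ≤ √R * Θ → v ∈ I₂ → ∀ f w : ι → E → ℝ≥0∞, (∀ k ∈ I₁, Measurable (f k)) →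
      (∀ k ∈ I₁, Measurable (w k)) → (∀ k ∈ I₁, Slow N √R (ω k) (f k)) →
      (∀ k ∈ I₁, Slow N √R (ω k) (w k)) → (∀ k ∈ I₁, ∀ x, f k x ≤ w k x) → ∀ (q : E) (G : ℝ≥0∞),
      (∀ i ∈ I₁, ∀ j ∈ I₂, ∀ t ⊆ I₁, (∀ l ∈ t, |⟪ω i + ω j, ω l⟫ - 1 / 2 * ‖ω i + ω j‖ ^ 2| ≤
        resK C₀ * (√R)⁻¹ * Θ) → ∑ l ∈ t, f l q ≤ G) →
      ∫⁻ x, ‖(∑ i ∈ I₁, smooth √R (ω i) (fun x => f i x / w i x) x * u i x) * (∑ j ∈ I₂, u j x) *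
        ker E (stretch √R (√R * Θ) (ω v) (x - q))‖ₑ ^ 2 ≤
      C * (ENNReal.ofReal (√R ^ (finrank ℝ E - 1) * (√R * Θ)))⁻¹ * G *
        ((∑ i ∈ I₁, avg N √R (ω i) (u i) q / w i q) * ∑ j ∈ I₂, avg N √R (ω j) (u j) q) := by
  classical
  obtain ⟨Cp, hCp⟩ := exists_pair_le (E := E) N hN hC₀
  have hI : ∫⁻ x : E, dk (finrank ℝ E + 1) x ≠ ∞ := (lintegral_dk_lt_top (by simp)).ne
  set I := (∫⁻ x : E, dk (finrank ℝ E + 1) x).toNNReal with hIdef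
  set K : ℝ := 12 * (C₀ + 2) + 12 with hK
  refine ⟨2 * (Cp * I * Real.toNNReal (C₀ * K ^ finrank ℝ E)), ?_⟩
  intro ι R Θ I₁ I₂ ω u v hu₁ hu₂ hs hR hΘ0 hΘ1 hΘ hv f w hfm hwm hfs hws hfw q G hG
  have hσ : 0 < √R := by positivity
  have hv1 := hu₂.unit v hv
  set L := stretch √R (√R * Θ) (ω v) with hL
  set p : ι → E → ℝ≥0∞ := fun k x => f k x / w k x with hp
  have hpm : ∀ k ∈ I₁, Measurable (p k) := fun k hk => (hfm k hk).div (hwm k hk)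
  have hp1 : ∀ k ∈ I₁, ∀ x, p k x ≤ 1 := fun k hk x =>
    ENNReal.div_le_of_le_mul (by rw [one_mul]; exact hfw k hk x)
  have hps : ∀ k ∈ I₁, Slow (N + N) √R (ω k) (p k) := fun k hk => (hfs k hk).div (hws k hk)
  have d12 : ∀ i ∈ I₁, ∀ j ∈ I₂, ‖ω i - ω j‖ ≤ 2 * Θ := fun i hi j hj => by
    linarith [hs.norm_le i hi j hj]
  have d22 : ∀ i ∈ I₂, ∀ j ∈ I₂, ‖ω i - ω j‖ ≤ 2 * Θ := fun i hi j hj => by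
    linarith [hs.near₂ i hi j hj]
  set S : ι × ι → Set E := fun k => pairSupp R C₀ Θ (ω v) (ω k.1) (ω k.2) with hS
  set A : ι × ι → E → ℂ := fun k x =>
    smooth √R (ω k.1) (p k.1) x * u k.1 x * u k.2 x * ker E (L (x - q)) with hA
  set a : ι → ℝ≥0∞ := fun k => avg N √R (ω k) (u k) q with ha
  have hAPW : ∀ k ∈ I₁ ×ˢ I₂, PW (S k) (A k) := fun k hk => by
    obtain ⟨hk1, hk2⟩ := Finset.mem_product.1 hk
    exact ((((hu₁.pw _ hk1).smooth_mul hR (hu₁.unit _ hk1) (hpm _ hk1) (hp1 _ hk1)).mul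
      (hu₂.pw _ hk2) (isBounded_plate _ _ _)).mul (pw_ker_stretch hv1 hσ (by positivity) q)
      ((isBounded_plate _ _ _).add (isBounded_plate _ _ _)))
  have hexp : ∀ x, (∑ i ∈ I₁, smooth √R (ω i) (p i) x * u i x) * (∑ j ∈ I₂, u j x) *
      ker E (L (x - q)) = ∑ k ∈ I₁ ×ˢ I₂, A k x := fun x => by
    rw [Finset.sum_mul_sum, Finset.sum_product, Finset.sum_mul]
    exact Finset.sum_congr rfl fun i _ => Finset.sum_mul _ _ _
  set κ : E → ℝ≥0∞ := fun x => dk (finrank ℝ E + 1) (L (x - q)) with hκ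
  have hκm : Measurable κ := (measurable_dk _).comp (by fun_prop)
  have hκI : ∫⁻ x, κ x ^ 2 ≤ I * (ENNReal.ofReal (√R ^ (finrank ℝ E - 1) * (√R * Θ)))⁻¹ := by
    have h0 : ENNReal.ofReal (√R ^ (finrank ℝ E - 1) * (√R * Θ)) ≠ 0 := by
      have : 0 < √R ^ (finrank ℝ E - 1) * (√R * Θ) := by positivity
      exact (ENNReal.ofReal_pos.2 this).ne'
    rw [← div_eq_mul_inv, ENNReal.le_div_iff_mul_le (.inl h0) (.inl ENNReal.ofReal_ne_top), mul_comm]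
    calc _ ≤ ENNReal.ofReal (√R ^ (finrank ℝ E - 1) * (√R * Θ)) * ∫⁻ x, κ x := by
          gcongr with x
          rw [sq]; exact mul_le_of_le_one_right' (dk_le_one _ _)
      _ = _ := by
          rw [hIdef, ENNReal.coe_toNNReal hI,
            ← lintegral_comp_stretch hv1 hσ (b := √R * Θ) (by positivity) (measurable_dk _)]
          congr 1
          exact lintegral_sub_right_eq_self (fun x => dk (finrank ℝ E + 1) (L x)) q
  have hmul : ∀ i ∈ I₁ ×ˢ I₂, ∀ j ∈ I₁ ×ˢ I₂, ∀ x, ‖A i x‖ₑ * ‖A j x‖ₑ ≤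
      Cp * (a i.1 * a i.2) * (f j.1 q / w i.1 q) * κ x ^ 2 +
      Cp * (a j.1 * a j.2) * (f i.1 q / w j.1 q) * κ x ^ 2 := fun i hi j hj x => by
    obtain ⟨hi1, hi2⟩ := Finset.mem_product.1 hi
    obtain ⟨hj1, hj2⟩ := Finset.mem_product.1 hj
    have hb := fun (k : ι × ι) (h1 : k.1 ∈ I₁) (h2 : k.2 ∈ I₂) => hCp hR hΘ hv1 (hu₁.unit k.1 h1)
      (hu₂.unit k.2 h2) (d12 k.1 h1 v hv) (d22 k.2 h2 v hv) (hu₁.pw _ h1) (hu₂.pw _ h2)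
      (hps _ h1) (hp1 _ h1) q x
    refine ennreal_mul_le_add_of_sq_le (hb i hi1 hi2) (hb j hj1 hj2) ?_
    have hpp : ∀ k ∈ I₁, p k q ^ 2 ≤ f k q / w k q := fun k hk => by
      rw [sq]; exact mul_le_of_le_one_right' (hp1 k hk q)
    calc _ ≤ Cp * (f i.1 q / w i.1 q * (a i.1 * a i.2)) * κ x ^ 2 *
          (Cp * (f j.1 q / w j.1 q * (a j.1 * a j.2)) * κ x ^ 2) := by
          gcongr
          · exact hpp _ hi1
          · exact hpp _ hj1
      _ = _ := by simp only [div_eq_mul_inv]; ring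
  set r : ι × ι → ι × ι → Prop := fun i j => (S i ∩ S j).Nonempty with hr
  have hcount : ∀ i ∈ I₁ ×ˢ I₂, ∑ j ∈ I₁ ×ˢ I₂ with r i j, f j.1 q ≤
      ENNReal.ofReal (C₀ * K ^ finrank ℝ E) * G := fun i hi => by
    obtain ⟨hi1, hi2⟩ := Finset.mem_product.1 hi
    have hres := fun (j : ι × ι) (hj1 : j.1 ∈ I₁) (hj2 : j.2 ∈ I₂) (h : r i j) =>
      resonance hR hC₀ hΘ0 (by linarith) hΘ hv1
        (by rw [norm_sub_rev]; exact d12 _ hi1 _ hj2) (d22 _ hj2 _ hi2)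
        (by rw [norm_sub_rev]; exact d12 _ hj1 _ hj2) (d22 _ hj2 _ hv) h
    set t := I₁.filter fun l => ∃ j ∈ I₂, r i (l, j) with ht
    have h1 : ∑ j ∈ I₁ ×ˢ I₂ with r i j, f j.1 q =
        ∑ l ∈ t, ∑ j ∈ I₂ with r i (l, j), f l q := by
      refine Finset.sum_finset_product' (f := fun l _ => f l q) _ _ _ fun k => ?_
      simp only [ht, Finset.mem_filter, Finset.mem_product]
      exact ⟨fun h => ⟨⟨h.1.1, k.2, h.1.2, h.2⟩, h.1.2, h.2⟩, fun h => ⟨⟨h.1.1, h.2.1⟩, h.2.2⟩⟩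
    rw [h1]
    calc _ ≤ ∑ l ∈ t, ENNReal.ofReal (C₀ * K ^ finrank ℝ E) * f l q := by
          refine Finset.sum_le_sum fun l hl => ?_
          rw [Finset.sum_const, nsmul_eq_mul, ← ENNReal.ofReal_natCast]
          refine mul_le_mul_left (ENNReal.ofReal_le_ofReal ?_) _
          refine hu₂.count (R • (ω i.1 + ω i.2 - ω l)) K (by rw [hK]; linarith) _
            (Finset.filter_subset _ _) fun j hj => ?_
          obtain ⟨hj, hrj⟩ := Finset.mem_filter.1 hj
          rw [norm_sub_rev, ← smul_sub]
          exact (hres (l, j) (Finset.mem_filter.1 hl).1 hj hrj).1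
      _ ≤ _ := by
          rw [← Finset.mul_sum]
          gcongr
          refine hG i.1 hi1 i.2 hi2 t (Finset.filter_subset _ _) fun l hl => ?_
          obtain ⟨hl1, j, hj, hrj⟩ := Finset.mem_filter.1 hl
          have hZ := hres (l, j) hl1 hj hrj
          exact abs_inner_sub_le_of_add_eq (by linarith) (hu₁.unit l hl1) (hu₂.unit j hj) rfl
            hZ.1 hZ.2 hΘ
  have hswap : ∑ i ∈ I₁ ×ˢ I₂, ∑ j ∈ I₁ ×ˢ I₂ with r i j,
      ∫⁻ x, Cp * (a j.1 * a j.2) * (f i.1 q / w j.1 q) * κ x ^ 2 =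
      ∑ i ∈ I₁ ×ˢ I₂, ∑ j ∈ I₁ ×ˢ I₂ with r i j,
      ∫⁻ x, Cp * (a i.1 * a i.2) * (f j.1 q / w i.1 q) * κ x ^ 2 := by
    refine Finset.sum_comm' fun i j => ?_
    simp only [Finset.mem_filter, hr]
    rw [inter_comm]
    tauto
  set V := (ENNReal.ofReal (√R ^ (finrank ℝ E - 1) * (√R * Θ)))⁻¹ with hV
  calc _ = ∫⁻ x, ‖∑ k ∈ I₁ ×ˢ I₂, A k x‖ₑ ^ 2 := lintegral_congr fun x => by rw [← hexp]
    _ ≤ ∑ i ∈ I₁ ×ˢ I₂, ∑ j ∈ I₁ ×ˢ I₂ with r i j, ∫⁻ x, ‖A i x‖ₑ * ‖A j x‖ₑ :=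
        lintegral_sum_sq_le _ hAPW (fun _ _ => isBounded_pairSupp (by linarith) hΘ0 hv1 _ _) r
          fun _ _ _ _ h => h
    _ ≤ ∑ i ∈ I₁ ×ˢ I₂, ∑ j ∈ I₁ ×ˢ I₂ with r i j,
        ((∫⁻ x, Cp * (a i.1 * a i.2) * (f j.1 q / w i.1 q) * κ x ^ 2) +
          ∫⁻ x, Cp * (a j.1 * a j.2) * (f i.1 q / w j.1 q) * κ x ^ 2) := by
        refine Finset.sum_le_sum fun i hi => Finset.sum_le_sum fun j hj => ?_
        rw [← lintegral_add_left ((hκm.pow_const 2).const_mul _)]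
        exact lintegral_mono fun x => hmul i hi j (Finset.mem_filter.1 hj).1 x
    _ = 2 * ∑ i ∈ I₁ ×ˢ I₂, ∑ j ∈ I₁ ×ˢ I₂ with r i j,
        ∫⁻ x, Cp * (a i.1 * a i.2) * (f j.1 q / w i.1 q) * κ x ^ 2 := by
        simp only [Finset.sum_add_distrib]
        rw [hswap, two_mul]
    _ ≤ 2 * ∑ i ∈ I₁ ×ˢ I₂, ∑ j ∈ I₁ ×ˢ I₂ with r i j,
        Cp * (a i.1 * a i.2) * (f j.1 q / w i.1 q) * (I * V) := by
        gcongr with i hi j hj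
        rw [lintegral_const_mul _ (hκm.pow_const 2)]
        gcongr
    _ = 2 * ∑ i ∈ I₁ ×ˢ I₂, Cp * I * V * (a i.1 / w i.1 q * a i.2) *
          ∑ j ∈ I₁ ×ˢ I₂ with r i j, f j.1 q := by
        simp only [Finset.mul_sum]
        refine Finset.sum_congr rfl fun i _ => Finset.sum_congr rfl fun j _ => ?_
        simp only [div_eq_mul_inv]; ring
    _ ≤ 2 * ∑ i ∈ I₁ ×ˢ I₂, Cp * I * V * (a i.1 / w i.1 q * a i.2) *
          (ENNReal.ofReal (C₀ * K ^ finrank ℝ E) * G) := by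
        gcongr with i hi
        exact hcount i hi
    _ = _ := by
        rw [← Finset.sum_mul, ← Finset.mul_sum, Finset.sum_mul_sum, Finset.sum_product]
        push_cast
        rw [ENNReal.ofReal]
        ring

end Far

end Falconer

namespace Falconer

open MeasureTheory Metric Set Filter Topology Module
open scoped FourierTransform ENNReal NNReal Pointwise ComplexConjugate RealInnerProductSpace

set_option linter.unusedSectionVars false

section FarGlobal

variable {E : Type*} [NormedAddCommGroup E] [InnerProductSpace ℝ E] [FiniteDimensional ℝ E]
  [MeasurableSpace E] [BorelSpace E]

lemma wt_le_two {x : E} (h : ‖x‖ ≤ 1) : wt x ≤ 2 := by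
  rw [wt_eq_ofReal, ← ENNReal.ofReal_ofNat]
  exact ENNReal.ofReal_le_ofReal (by linarith)

lemma lintegral_indicator_stretch {ω : E} (hω : ‖ω‖ = 1) {a b : ℝ} (ha : 0 < a) (hb : 0 < b)
    (r : ℝ) (x : E) :
    ENNReal.ofReal (a ^ (finrank ℝ E - 1) * b) *
      ∫⁻ y, (closedBall (0 : E) r).indicator 1 (stretch a b ω (x - y)) =
      volume (closedBall (0 : E) r) := by
  rw [lintegral_sub_left_eq_self
    (fun y => (closedBall (0 : E) r).indicator (1 : E → ℝ≥0∞) (stretch a b ω y)),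
    lintegral_comp_stretch hω ha hb (measurable_one.indicator measurableSet_closedBall),
    lintegral_indicator_one measurableSet_closedBall]

lemma exists_lintegral_div_tw_le (N : ℕ) : ∃ C : ℝ≥0, ∀ {σ : ℝ} {ω : E}, 0 < σ → ‖ω‖ = 1 →
    ∀ {a D : E → ℝ≥0∞} (S : Set E), Measurable a → Measurable D → Slow N σ ω a →
    ∫⁻ q in S, a q / tw N σ ω D S q * D q ≤
      C * ENNReal.ofReal (σ ^ (finrank ℝ E - 1)) * ∫⁻ x, a x := by
  set κ := volume (closedBall (0 : E) 1) with hκ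
  have hκ0 : κ ≠ 0 := (measure_closedBall_pos _ _ one_pos).ne'
  have hκt : κ ≠ ∞ := measure_closedBall_lt_top.ne
  refine ⟨(κ⁻¹ * 2 ^ (N + N + N)).toNNReal, ?_⟩
  intro σ ω hσ hω a D S ha hD hs
  rw [ENNReal.coe_toNNReal (ENNReal.mul_ne_top (ENNReal.inv_ne_top.2 hκ0) (by finiteness))]
  set w := tw N σ ω D S with hw
  have hwm : Measurable w := measurable_tw hD
  set h : E → ℝ≥0∞ := fun x => a x / w x with hh
  have hhm : Measurable h := ha.div hwm
  have hhs : Slow (N + N) σ ω h := hs.div (slow_tw N σ hω D S)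
  set χ : E → ℝ≥0∞ := fun y => (closedBall (0 : E) 1).indicator 1 (stretch σ 1 ω y) with hχ
  have hχm : Measurable χ := (measurable_one.indicator measurableSet_closedBall).comp (by fun_prop)
  have hχ1 : ∀ y, χ y ≠ 0 → χ y = 1 ∧ ‖stretch σ 1 ω y‖ ≤ 1 := fun y hy => by
    have : stretch σ 1 ω y ∈ closedBall (0 : E) 1 := Set.mem_of_indicator_ne_zero hy
    exact ⟨by simp [hχ, Set.indicator_of_mem this], by simpa using this⟩
  have hint : ∀ q, ENNReal.ofReal (σ ^ (finrank ℝ E - 1)) * ∫⁻ y, χ (q - y) = κ := fun q => by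
    have := lintegral_indicator_stretch hω hσ one_pos 1 q
    rwa [mul_one] at this
  have hpt : ∀ q y, χ (q - y) * (h q * D q) ≤
      2 ^ (N + N + N) * (h y * (D q * dk N (stretch σ 0 ω (y - q)))) := fun q y => by
    by_cases h0 : χ (q - y) = 0
    · simp [h0]
    obtain ⟨e1, e2⟩ := hχ1 _ h0
    have e3 : 1 ≤ 2 ^ N * dk N (stretch σ 0 ω (y - q)) := by
      have := wt_pow_mul_dk N 0 (stretch σ 0 ω (y - q))
      rw [add_zero, show dk 0 (stretch σ 0 ω (y - q)) = 1 by simp [dk]] at this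
      rw [← this]
      gcongr
      refine (wt_stretch_zero_le hω _).trans (wt_le_two ?_)
      rwa [← neg_sub, map_neg, norm_neg]
    rw [e1, one_mul]
    calc h q * D q ≤ wt (stretch σ 1 ω (q - y)) ^ (N + N) * h y * D q * 1 := by
          rw [mul_one]; gcongr; exact hhs q y
      _ ≤ 2 ^ (N + N) * h y * D q * (2 ^ N * dk N (stretch σ 0 ω (y - q))) := by
          gcongr; exact wt_le_two e2
      _ = _ := by ring
  have hm2 : Measurable fun p : E × E => χ (p.1 - p.2) * (h p.1 * D p.1) := by fun_prop
  have key : κ * ∫⁻ q in S, h q * D q ≤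
      ENNReal.ofReal (σ ^ (finrank ℝ E - 1)) * (2 ^ (N + N + N) * ∫⁻ x, a x) := by
    calc _ = ENNReal.ofReal (σ ^ (finrank ℝ E - 1)) *
          ∫⁻ q in S, ∫⁻ y, χ (q - y) * (h q * D q) := by
          rw [← lintegral_const_mul _ (by fun_prop), ← lintegral_const_mul _ (by fun_prop)]
          refine lintegral_congr fun q => ?_
          rw [lintegral_mul_const _ (by fun_prop), ← mul_assoc (ENNReal.ofReal _), hint]
      _ = ENNReal.ofReal (σ ^ (finrank ℝ E - 1)) *
          ∫⁻ y, ∫⁻ q in S, χ (q - y) * (h q * D q) := by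
          rw [lintegral_lintegral_swap hm2.aemeasurable]
      _ ≤ ENNReal.ofReal (σ ^ (finrank ℝ E - 1)) * ∫⁻ y, 2 ^ (N + N + N) * (h y * w y) := by
          gcongr with y
          calc _ ≤ ∫⁻ q in S, 2 ^ (N + N + N) * (h y * (D q * dk N (stretch σ 0 ω (y - q)))) :=
                lintegral_mono fun q => hpt q y
            _ = _ := by
                have hd : Measurable fun q => D q * dk N (stretch σ 0 ω (y - q)) :=
                  hD.mul ((measurable_dk N).comp (by fun_prop))
                rw [lintegral_const_mul _ (hd.const_mul _), lintegral_const_mul _ hd]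
                rfl
      _ ≤ _ := by
          gcongr
          rw [lintegral_const_mul _ (hhm.fun_mul hwm)]
          gcongr with y
          rw [mul_comm]; exact ENNReal.mul_div_le
  calc _ = κ⁻¹ * (κ * ∫⁻ q in S, h q * D q) := by
        rw [← mul_assoc, ENNReal.inv_mul_cancel hκ0 hκt, one_mul]
    _ ≤ κ⁻¹ * (ENNReal.ofReal (σ ^ (finrank ℝ E - 1)) * (2 ^ (N + N + N) * ∫⁻ x, a x)) := by gcongr
    _ = _ := by ring

variable (E) in
lemma exists_window_lower : ∃ c : ℝ≥0, c ≠ 0 ∧ ∀ {σ τ r : ℝ} {ω : E}, ‖ω‖ = 1 → 0 < τ → τ ≤ σ →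
    1 ≤ τ * r → ∀ x, c ≤ ENNReal.ofReal (σ ^ (finrank ℝ E - 1) * τ) *
      ∫⁻ q in closedBall x r, ‖ker E (stretch σ τ ω (x - q))‖ₑ ^ 2 := by
  obtain ⟨c, hc, hc1, hk⟩ := exists_ker_lower (E := E)
  set κ := volume (closedBall (0 : E) c) with hκ
  have hκ0 : κ ≠ 0 := (measure_closedBall_pos _ _ hc).ne'
  have hκt : κ ≠ ∞ := measure_closedBall_lt_top.ne
  have ht : ENNReal.ofReal c ^ 2 * κ ≠ ∞ := by finiteness
  refine ⟨(ENNReal.ofReal c ^ 2 * κ).toNNReal, ?_, ?_⟩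
  · rw [Ne, ENNReal.toNNReal_eq_zero_iff]
    push Not
    exact ⟨mul_ne_zero (pow_ne_zero _ (ENNReal.ofReal_pos.2 hc).ne') hκ0, ht⟩
  intro σ τ r ω hω hτ hτσ hr x
  have hσ : 0 < σ := hτ.trans_le hτσ
  rw [ENNReal.coe_toNNReal ht, hκ, ← lintegral_indicator_stretch hω hσ hτ c x, mul_left_comm]
  gcongr
  have hm : Measurable fun y =>
      (closedBall (0 : E) c).indicator (1 : E → ℝ≥0∞) (stretch σ τ ω (x - y)) :=
    (measurable_one.indicator measurableSet_closedBall).comp (by fun_prop)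
  rw [← lintegral_const_mul _ hm, ← lintegral_indicator measurableSet_closedBall]
  refine lintegral_mono fun q => ?_
  by_cases h : stretch σ τ ω (x - q) ∈ closedBall (0 : E) c
  · have h' : ‖stretch σ τ ω (x - q)‖ ≤ c := by simpa using h
    have hq : q ∈ closedBall x r := by
      rw [mem_closedBall_iff_norm']
      have h2 := norm_stretch_mono hω (a := τ) (b := τ) (a' := σ) (b' := τ)
        (by rwa [abs_of_pos hτ, abs_of_pos hσ]) le_rfl (x - q)
      rw [stretch_self, norm_smul, Real.norm_of_nonneg hτ.le] at h2
      exact le_of_mul_le_mul_left (h2.trans (h'.trans (hc1.trans hr))) hτ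
    rw [Set.indicator_of_mem h, Set.indicator_of_mem hq, Pi.one_apply, mul_one]
    gcongr
    exact hk _ h'
  · rw [Set.indicator_of_notMem h, mul_zero]
    exact zero_le

lemma plate_subset_closedBall {R C : ℝ} (hR : 1 ≤ R) (hC : 0 ≤ C) {ω : E} (hω : ‖ω‖ = 1) :
    plate R C ω ⊆ closedBall 0 ((1 + C) * R) := fun ξ hξ => by
  rw [mem_closedBall_zero_iff]
  have h1 : ‖R • ω‖ = R := by rw [norm_smul, hω, mul_one, Real.norm_of_nonneg (by linarith)]
  have h2 : √R ≤ R := Real.sqrt_le_iff.2 ⟨by linarith, by nlinarith⟩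
  have h3 := norm_add_le (ξ - R • ω) (R • ω)
  rw [sub_add_cancel, h1] at h3
  have := hξ.1
  have := mul_le_mul_of_nonneg_left h2 hC
  linarith

lemma mul_lintegral_le_of_window {ν : Measure E} [IsFiniteMeasure ν] {g : E → ℂ} {φ : E → E → ℂ}
    (hg : Measurable g) (hφ : Measurable fun p : E × E => φ p.2 p.1) {c V : ℝ≥0∞} {z : E} {r : ℝ}
    (h : ∀ x ∈ closedBall z r, c ≤ V * ∫⁻ q in closedBall x r, ‖φ q x‖ₑ ^ 2) :
    c * ∫⁻ x in closedBall z r, ‖g x‖ₑ ^ 2 ∂ν ≤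
      V * ∫⁻ q in closedBall z (2 * r), ∫⁻ x, ‖g x * φ q x‖ₑ ^ 2 ∂ν := by
  have hm : Measurable fun p : E × E => ‖g p.1 * φ p.2 p.1‖ₑ ^ 2 :=
    ((hg.comp measurable_fst).mul hφ).enorm.pow_const 2
  have hm1 : ∀ x, Measurable fun q => ‖φ q x‖ₑ ^ 2 := fun x => by
    have : Measurable fun q => φ q x := hφ.comp measurable_prodMk_left
    exact this.enorm.pow_const 2
  have hm' : Measurable fun x => ‖g x‖ₑ ^ 2 := hg.enorm.pow_const 2
  calc _ = ∫⁻ x in closedBall z r, c * ‖g x‖ₑ ^ 2 ∂ν := by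
        rw [lintegral_const_mul _ hm']
    _ ≤ ∫⁻ x in closedBall z r, (V * ∫⁻ q in closedBall z (2 * r), ‖g x * φ q x‖ₑ ^ 2) ∂ν := by
        refine setLIntegral_mono' measurableSet_closedBall fun x hx => ?_
        have hsub : closedBall x r ⊆ closedBall z (2 * r) :=
          closedBall_subset_closedBall' (by have : dist x z ≤ r := hx; linarith)
        calc _ ≤ (V * ∫⁻ q in closedBall z (2 * r), ‖φ q x‖ₑ ^ 2) * ‖g x‖ₑ ^ 2 := by
              gcongr
              refine (h x hx).trans ?_
              gcongr
          _ = _ := by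
              rw [mul_assoc, mul_comm _ (‖g x‖ₑ ^ 2), ← lintegral_const_mul _ (hm1 x)]
              simp only [enorm_mul, mul_pow]
    _ = V * ∫⁻ q in closedBall z (2 * r), ∫⁻ x in closedBall z r, ‖g x * φ q x‖ₑ ^ 2 ∂ν := by
        rw [lintegral_const_mul _ hm.lintegral_prod_right', lintegral_lintegral_swap hm.aemeasurable]
    _ ≤ _ := by
        gcongr
        exact Measure.restrict_le_self

set_option maxHeartbeats 1000000 in
lemma exists_far_bound [Nontrivial E] (N : ℕ) (hN : finrank ℝ E < N) {C₀ α : ℝ} (hC₀ : 1 ≤ C₀) :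
    ∃ C : ℝ≥0, ∀ {ν : Measure E}, IsFiniteMeasure ν → HasPow α ν → ∀ {ι : Type} {R H Θ : ℝ}
      {I₁ I₂ : Finset ι} {ω : ι → E} {u : ι → E → ℂ}, Fam R C₀ I₁ ω u → Fam R C₀ I₂ ω u →
      Sep I₁ I₂ ω Θ → 1 ≤ R → 0 < Θ → Θ ≤ 1 / 2 → 1 ≤ H → 100 * ((√R)⁻¹ * H ^ 2) ≤ Θ →
      √R ^ (finrank ℝ E + 1) ≤ H ^ N → ∀ {D : E → ℝ≥0∞},
      (D = fun x => ∑ j ∈ I₂, avg N √R (ω j) (u j) x) → ∀ x₀ z : E, z ∈ closedBall x₀ 1 →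
      ∫⁻ x in closedBall z H⁻¹, ‖(∑ i ∈ I₁, smooth √R (ω i) (fun x =>
          tw N √R (ω i) D (ball x₀ 4 \ ball z (4 * H⁻¹)) x / tw N √R (ω i) D (ball x₀ 4) x) x *
          u i x) * ∑ j ∈ I₂, u j x‖ₑ ^ 2 ∂ν ≤
        C * ENNReal.ofReal (R ^ (finrank ℝ E - α) * √R ^ (finrank ℝ E - 1) *
          (H ^ (2 * finrank ℝ E + 3) * (√R)⁻¹ / Θ)) *
          ((∑ i ∈ I₁, ∫⁻ x, ‖u i x‖ₑ ^ 2) * ∑ j ∈ I₂, ∫⁻ x, ‖u j x‖ₑ ^ 2) := by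
  obtain ⟨Cb, hCb⟩ := exists_ball_bound (E := E) (α := α)
  obtain ⟨Cw, hCw⟩ := exists_window_sq_le (E := E) N hN hC₀
  obtain ⟨Cd, hCd⟩ := exists_lintegral_div_tw_le (E := E) N
  obtain ⟨c, hc, hcl⟩ := exists_window_lower E
  have hI : ∫⁻ x : E, dk N x ≠ ∞ := (lintegral_dk_lt_top hN).ne
  set n := finrank ℝ E with hn
  set I := (∫⁻ x : E, dk N x).toNNReal with hIdef
  set c₁ : ℝ := (1 + (C₀ + 2)) + (1 + C₀) + 2 with hc₁
  set CG : ℝ := C₀ + C₀ * (2 * (2 ^ N * (40 * (resK C₀ + 1)))) with hCG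
  have hK : 0 ≤ resK C₀ := by unfold resK; positivity
  refine ⟨c⁻¹ * (Cb * (c₁ ^ (n - α)).toNNReal * Cw * CG.toNNReal * I * Cd * I), ?_⟩
  intro ν hν hνα ι R H Θ I₁ I₂ ω u hu₁ hu₂ hs hR hΘ0 hΘ1 hH hδH hHN D hD x₀ z hz
  have hR0 : 0 < R := by linarith
  have hσ : 0 < √R := by positivity
  have hσ1 : 1 ≤ √R := by rwa [Real.one_le_sqrt]
  rcases I₂.eq_empty_or_nonempty with h0 | ⟨v, hv⟩
  · simp [h0]
  have hH0 : 0 < H := by linarith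
  have hH2 : H ≤ H ^ 2 := by nlinarith
  have hτ : 100 * H ^ 2 ≤ √R * Θ := by
    have := mul_le_mul_of_nonneg_left hδH hσ.le
    have e : √R * (100 * ((√R)⁻¹ * H ^ 2)) = 100 * H ^ 2 := by field_simp
    linarith
  have hτ1 : 1 ≤ √R * Θ := by nlinarith
  have hδΘ : (√R)⁻¹ ≤ Θ := by rwa [inv_le_iff_one_le_mul₀' hσ]
  have hv1 := hu₂.unit v hv
  have ham : ∀ k ∈ I₁, Measurable (avg N √R (ω k) (u k)) := fun k hk =>
    measurable_avg (hu₁.pw k hk).cont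
  have hDm : Measurable D := by
    rw [hD]
    exact Finset.measurable_fun_sum _ fun k hk => measurable_avg (hu₂.pw k hk).cont
  set G := ball x₀ 4 with hG
  set F := G \ ball z (4 * H⁻¹) with hF
  set f : ι → E → ℝ≥0∞ := fun k => tw N √R (ω k) D F with hf
  set w : ι → E → ℝ≥0∞ := fun k => tw N √R (ω k) D G with hw
  have hfw : ∀ k x, f k x ≤ w k x := fun k x => tw_mono sdiff_subset x
  set g : E → ℂ := fun x => (∑ i ∈ I₁, smooth √R (ω i) (fun x => f i x / w i x) x * u i x) *
    ∑ j ∈ I₂, u j x with hg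
  set φ : E → E → ℂ := fun q x => ker E (stretch √R (√R * Θ) (ω v) (x - q)) with hφ
  set E₁ := ∑ i ∈ I₁, ∫⁻ x, ‖u i x‖ₑ ^ 2
  set E₂ := ∑ j ∈ I₂, ∫⁻ x, ‖u j x‖ₑ ^ 2
  set A : ℝ := H ^ (2 * n + 3) * (√R)⁻¹ / Θ with hA
  set V := ENNReal.ofReal (√R ^ (n - 1) * (√R * Θ)) with hV
  have hV0 : V ≠ 0 := by
    have : 0 < √R ^ (n - 1) * (√R * Θ) := by positivity
    exact (ENNReal.ofReal_pos.2 this).ne'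
  have hDint : ∑ j ∈ I₂, ∫⁻ x, avg N √R (ω j) (u j) x = I * E₂ := by
    rw [Finset.mul_sum]
    refine Finset.sum_congr rfl fun j hj => ?_
    rw [lintegral_avg N hσ (hu₂.unit j hj) (hu₂.pw j hj).cont, hIdef, ENNReal.coe_toNNReal hI]
  have h1 := PW.sum I₁ (K := closedBall (0 : E) ((1 + (C₀ + 2)) * R)) fun i hi =>
    ((hu₁.pw i hi).smooth_mul hR (hu₁.unit i hi) (p := fun x => f i x / w i x)
      ((measurable_tw hDm).div (measurable_tw hDm))
      (fun x => ENNReal.div_le_of_le_mul (by rw [one_mul]; exact hfw i x))).mono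
      (plate_subset_closedBall hR (by linarith) (hu₁.unit i hi))
  have h2 := PW.sum I₂ (K := closedBall (0 : E) ((1 + C₀) * R)) fun i hi =>
    (hu₂.pw i hi).mono (plate_subset_closedBall hR (by linarith) (hu₂.unit i hi))
  have hPW : ∀ q, PW (closedBall 0 (c₁ * R)) fun x => g x * φ q x := fun q => by
    have hRσ : √R ≤ R := Real.sqrt_le_iff.2 ⟨by linarith, by nlinarith⟩
    have h3 := (pw_ker_stretch hv1 hσ (b := √R * Θ) (by positivity) q).mono
      (K' := closedBall (0 : E) (2 * R)) fun ξ hξ => by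
        rw [mem_closedBall_zero_iff]
        have hξ' : ‖stretch (√R)⁻¹ (√R * Θ)⁻¹ (ω v) ξ‖ ≤ 2 := hξ
        have h4 := norm_stretch_mono hv1 (a := (√R)⁻¹) (b := (√R)⁻¹) (a' := (√R)⁻¹)
          (b' := (√R * Θ)⁻¹) le_rfl (by
            rw [abs_of_pos (by positivity), abs_of_pos (by positivity)]
            gcongr
            exact mul_le_of_le_one_right hσ.le (by linarith)) ξ
        rw [stretch_self, norm_smul, norm_inv, Real.norm_of_nonneg hσ.le] at h4
        have h5 := h4.trans hξ'
        rw [inv_mul_le_iff₀ hσ] at h5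
        linarith
    have h4 := (h1.mul h2 isBounded_closedBall).mul h3
      (isBounded_closedBall.add isBounded_closedBall)
    refine h4.mono ?_
    rw [closedBall_add_closedBall (by positivity) (by positivity),
      closedBall_add_closedBall (by positivity) (by positivity), add_zero, add_zero, hc₁]
    refine closedBall_subset_closedBall (le_of_eq (by ring))
  have hgm : Measurable g := (h1.cont.mul h2.cont).measurable
  have hgain : ∀ q ∈ closedBall z (2 * H⁻¹), ∀ i ∈ I₁, ∀ j ∈ I₂, ∀ t ⊆ I₁,
      (∀ l ∈ t, |⟪ω i + ω j, ω l⟫ - 1 / 2 * ‖ω i + ω j‖ ^ 2| ≤ resK C₀ * (√R)⁻¹ * Θ) →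
      ∑ l ∈ t, f l q ≤ CG.toNNReal * ENNReal.ofReal A * (I * E₂) := fun q hq i hi j hj t ht hres => by
    have hqz : ‖q - z‖ ≤ 2 * H⁻¹ := mem_closedBall_iff_norm.1 hq
    have hzx : ‖z - x₀‖ ≤ 1 := mem_closedBall_iff_norm.1 hz
    have hH1 : H⁻¹ ≤ 1 := inv_le_one_of_one_le₀ hH
    have hq1 : ∀ y ∈ F, 2 ≤ ‖q - y‖ * H := fun y hy => by
      have h1 : 4 * H⁻¹ ≤ ‖y - z‖ := by
        have := hy.2
        rwa [mem_ball_iff_norm, not_lt] at this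
      have h2 := norm_sub_le_norm_sub_add_norm_sub z q y
      rw [norm_sub_rev z y, norm_sub_rev z q] at h2
      have h3 : 2 * H⁻¹ ≤ ‖q - y‖ := by linarith
      have h4 := mul_le_mul_of_nonneg_right h3 hH0.le
      rwa [mul_assoc, inv_mul_cancel₀ hH0.ne', mul_one] at h4
    have hq2 : ∀ y ∈ F, ‖q - y‖ ≤ 10 := fun y hy => by
      have h1 : ‖y - x₀‖ < 4 := mem_ball_iff_norm.1 hy.1
      have h2 := norm_sub_le_norm_sub_add_norm_sub q z y
      have h3 := norm_sub_le_norm_sub_add_norm_sub z x₀ y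
      rw [norm_sub_rev x₀ y] at h3
      linarith
    have key := hu₁.sum_tw_le hu₂ hs hR hΘ0 hΘ1 hδΘ hH hδH hi hj ht hres N N
      (measurableSet_ball.diff measurableSet_ball) hq1 hq2
    rw [← hD, hDint] at key
    refine key.trans ?_
    refine mul_le_mul_left ?_ _
    have hcard : (t.card : ℝ) ≤ C₀ * √R ^ n := by
      refine hu₁.count 0 √R hσ1 t ht fun k hk => ?_
      rw [sub_zero, norm_smul, hu₁.unit k (ht hk), mul_one, Real.norm_of_nonneg hR0.le,
        Real.mul_self_sqrt hR0.le]
    rw [← ENNReal.ofReal_natCast, ← ENNReal.ofReal_ofNat 2, ← ENNReal.ofReal_pow (by norm_num),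
      ← ENNReal.ofReal_mul (by positivity), ← ENNReal.ofReal_mul (by positivity),
      ← ENNReal.ofReal_mul (by positivity), ← ENNReal.ofReal_mul (by positivity),
      ← ENNReal.ofReal_add (by positivity) (by positivity)]
    change _ ≤ ENNReal.ofReal CG * ENNReal.ofReal A
    rw [← ENNReal.ofReal_mul (by positivity)]
    refine ENNReal.ofReal_le_ofReal ?_
    have e1 : (t.card : ℝ) * (H ^ N)⁻¹ ≤ C₀ * A := by
      have hA1 : (√R)⁻¹ ≤ A := by
        rw [hA, le_div_iff₀ hΘ0]
        have : (1 : ℝ) ≤ H ^ (2 * n + 3) := one_le_pow₀ hH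
        calc (√R)⁻¹ * Θ ≤ (√R)⁻¹ * 1 := by gcongr; linarith
          _ ≤ H ^ (2 * n + 3) * (√R)⁻¹ := by rw [mul_comm]; gcongr
      calc (t.card : ℝ) * (H ^ N)⁻¹ ≤ C₀ * √R ^ n * (√R ^ (n + 1))⁻¹ := by gcongr
        _ = C₀ * (√R)⁻¹ := by rw [pow_succ]; field_simp
        _ ≤ C₀ * A := by gcongr
    have e2 : C₀ * (H ^ 2) ^ n * (2 * (2 ^ N * (40 * (resK C₀ + 1) * H ^ 3 * (√R)⁻¹ / Θ))) =
        C₀ * (2 * (2 ^ N * (40 * (resK C₀ + 1)))) * A := by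
      rw [hA, pow_add, pow_mul]; ring
    rw [e2, hCG, add_mul]
    exact add_le_add_left e1 _
  have hwin : ∀ q ∈ closedBall z (2 * H⁻¹), ∫⁻ x, ‖g x * φ q x‖ₑ ^ 2 ∂ν ≤
      Cb * ENNReal.ofReal ((c₁ * R) ^ (n - α)) * (Cw * V⁻¹ * (CG.toNNReal * ENNReal.ofReal A *
        (I * E₂)) * ((∑ i ∈ I₁, avg N √R (ω i) (u i) q / w i q) * D q)) := fun q hq => by
    refine (hCb ν inferInstance hνα (by positivity) (hPW q) subset_rfl).trans ?_
    gcongr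
    have := hCw hu₁ hu₂ hs hR hΘ0 hΘ1 hτ1 hv f w (fun _ _ => measurable_tw hDm)
      (fun _ _ => measurable_tw hDm) (fun k hk => slow_tw _ _ (hu₁.unit k hk) _ _)
      (fun k hk => slow_tw _ _ (hu₁.unit k hk) _ _) (fun k _ => hfw k) q _ (hgain q hq)
    rw [hD]
    exact this
  have hint : ∫⁻ q in closedBall z (2 * H⁻¹), (∑ i ∈ I₁, avg N √R (ω i) (u i) q / w i q) * D q ≤
      Cd * ENNReal.ofReal (√R ^ (n - 1)) * (I * E₁) := by
    calc _ ≤ ∫⁻ q in G, (∑ i ∈ I₁, avg N √R (ω i) (u i) q / w i q) * D q :=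
          lintegral_mono_set (closedBall_subset_ball' (by
            have hzx : dist z x₀ ≤ 1 := hz
            have hH1 : H⁻¹ ≤ 1 := inv_le_one_of_one_le₀ hH
            linarith))
      _ = ∑ i ∈ I₁, ∫⁻ q in G, avg N √R (ω i) (u i) q / w i q * D q := by
          simp only [Finset.sum_mul]
          refine lintegral_finsetSum' _ fun i hi => ?_
          exact (((ham i hi).div (measurable_tw hDm)).mul hDm).aemeasurable
      _ ≤ ∑ i ∈ I₁, Cd * ENNReal.ofReal (√R ^ (n - 1)) * (I * ∫⁻ x, ‖u i x‖ₑ ^ 2) := by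
          refine Finset.sum_le_sum fun i hi => ?_
          refine (hCd hσ (hu₁.unit i hi) G (ham i hi) hDm (slow_avg _ _ _ _)).trans (le_of_eq ?_)
          rw [lintegral_avg N hσ (hu₁.unit i hi) (hu₁.pw i hi).cont, hIdef,
            ENNReal.coe_toNNReal hI]
      _ = _ := by rw [← Finset.mul_sum, ← Finset.mul_sum]
  have hfin : c * ∫⁻ x in closedBall z H⁻¹, ‖g x‖ₑ ^ 2 ∂ν ≤
      V * ∫⁻ q in closedBall z (2 * H⁻¹), ∫⁻ x, ‖g x * φ q x‖ₑ ^ 2 ∂ν := by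
    have hφm : Measurable fun p : E × E => φ p.2 p.1 := by
      have : Continuous fun p : E × E => φ p.2 p.1 :=
        (ker E).continuous.comp ((continuous_stretch _ _ _).comp (by fun_prop))
      exact this.measurable
    refine mul_lintegral_le_of_window hgm hφm fun x _ => ?_
    exact hcl hv1 (σ := √R) (τ := √R * Θ) (r := H⁻¹) (by positivity)
      (mul_le_of_le_one_right hσ.le (by linarith))
      (by rw [← div_eq_mul_inv, one_le_div₀ hH0]; nlinarith) x
  have hc1R : (c₁ * R) ^ (n - α) = c₁ ^ (n - α) * R ^ (n - α) :=
    Real.mul_rpow (by positivity) hR0.le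
  have hsm : Measurable fun q => (∑ i ∈ I₁, avg N √R (ω i) (u i) q / w i q) * D q :=
    (Finset.measurable_fun_sum _ fun i hi => (ham i hi).div (measurable_tw hDm)).mul hDm
  have hmain : c * ∫⁻ x in closedBall z H⁻¹, ‖g x‖ₑ ^ 2 ∂ν ≤
      (Cb * (c₁ ^ (n - α)).toNNReal * Cw * CG.toNNReal * I * Cd * I : ℝ≥0) *
        ENNReal.ofReal (R ^ (n - α) * √R ^ (n - 1) * A) * (E₁ * E₂) := by
    calc _ ≤ V * ∫⁻ q in closedBall z (2 * H⁻¹), Cb * ENNReal.ofReal ((c₁ * R) ^ (n - α)) *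
          (Cw * V⁻¹ * (CG.toNNReal * ENNReal.ofReal A * (I * E₂)) *
            ((∑ i ∈ I₁, avg N √R (ω i) (u i) q / w i q) * D q)) := by
          refine hfin.trans ?_
          gcongr 1
          exact setLIntegral_mono' measurableSet_closedBall hwin
      _ ≤ V * (Cb * ENNReal.ofReal ((c₁ * R) ^ (n - α)) * (Cw * V⁻¹ *
            (CG.toNNReal * ENNReal.ofReal A * (I * E₂)) *
              (Cd * ENNReal.ofReal (√R ^ (n - 1)) * (I * E₁)))) := by
          rw [lintegral_const_mul _ (hsm.const_mul _), lintegral_const_mul _ hsm]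
          gcongr
      _ = (V * V⁻¹) * ((Cb * (c₁ ^ (n - α)).toNNReal * Cw * CG.toNNReal * I * Cd * I : ℝ≥0) *
            (ENNReal.ofReal (R ^ (n - α)) * ENNReal.ofReal (√R ^ (n - 1)) * ENNReal.ofReal A) *
            (E₁ * E₂)) := by
          rw [hc1R, ENNReal.ofReal_mul (by positivity)]
          push_cast
          simp only [ENNReal.ofReal]
          ring
      _ = _ := by
          rw [ENNReal.mul_inv_cancel hV0 ENNReal.ofReal_ne_top, one_mul,
            ENNReal.ofReal_mul (by positivity), ENNReal.ofReal_mul (by positivity)]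
  calc _ = (c : ℝ≥0∞)⁻¹ * (c * ∫⁻ x in closedBall z H⁻¹, ‖g x‖ₑ ^ 2 ∂ν) := by
        rw [← mul_assoc, ENNReal.inv_mul_cancel (by simpa using hc) ENNReal.coe_ne_top, one_mul]
    _ ≤ _ := by
        rw [ENNReal.coe_mul, ENNReal.coe_inv hc, mul_assoc, mul_assoc, ← mul_assoc _ _ (E₁ * E₂)]
        gcongr

end FarGlobal

end Falconer

namespace Falconer

open MeasureTheory Metric Set Filter Topology Module
open scoped FourierTransform ENNReal NNReal Pointwise ComplexConjugate RealInnerProductSpace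

set_option linter.unusedSectionVars false

section Bilinear

variable {E : Type*} [NormedAddCommGroup E] [InnerProductSpace ℝ E] [FiniteDimensional ℝ E]
  [MeasurableSpace E] [BorelSpace E]

lemma card_le_of_separated {Z : Finset E} {r s : ℝ} {q : E} (hr : 0 < r) (hs : 0 ≤ s)
    (hZ : ∀ z ∈ Z, ‖z - q‖ ≤ s) (hsep : ∀ z ∈ Z, ∀ z' ∈ Z, z ≠ z' → r < ‖z - z'‖) :
    (Z.card : ℝ) ≤ (2 * s / r + 1) ^ finrank ℝ E := by
  have hμ : volume (ball (0 : E) 1) ≠ 0 := (measure_ball_pos _ _ one_pos).ne'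
  have hμt : volume (ball (0 : E) 1) ≠ ∞ := measure_ball_lt_top.ne
  have h1 : ∑ z ∈ Z, volume (ball z (r / 2)) ≤ volume (ball q (s + r / 2)) := by
    rw [← measure_biUnion_finset _ fun _ _ => measurableSet_ball]
    · refine measure_mono (iUnion₂_subset fun z hz => ball_subset_ball' ?_)
      have := hZ z hz
      rw [dist_eq_norm]
      linarith
    · intro z hz z' hz' hne
      refine ball_disjoint_ball ?_
      rw [dist_eq_norm]
      linarith [hsep z hz z' hz' hne]
  simp only [Measure.addHaar_ball_of_pos volume _ (half_pos hr),
    Measure.addHaar_ball_of_pos volume q (show 0 < s + r / 2 by linarith)] at h1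
  rw [Finset.sum_const, nsmul_eq_mul, ← mul_assoc, ENNReal.mul_le_mul_iff_left hμ hμt,
    ← ENNReal.ofReal_natCast, ← ENNReal.ofReal_mul (by positivity),
    ENNReal.ofReal_le_ofReal_iff (by positivity), ← le_div_iff₀ (by positivity), ← div_pow] at h1
  refine h1.trans (le_of_eq ?_)
  congr 1
  field_simp

open Classical in
lemma exists_net (x₀ : E) {r : ℝ} (hr : 0 < r) (hr1 : r ≤ 1) : ∃ Z : Finset E,
    (∀ z ∈ Z, z ∈ closedBall x₀ 1) ∧ closedBall x₀ 1 ⊆ ⋃ z ∈ Z, closedBall z r ∧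
    (Z.card : ℝ) ≤ (3 * r⁻¹) ^ finrank ℝ E ∧
    ∀ q, ((Z.filter fun z => q ∈ ball z (4 * r)).card : ℝ) ≤ 9 ^ finrank ℝ E := by
  set P : Finset E → Prop := fun Z => (∀ z ∈ Z, ‖z - x₀‖ ≤ 1) ∧
    ∀ z ∈ Z, ∀ z' ∈ Z, z ≠ z' → r < ‖z - z'‖ with hP
  have hcard : ∀ Z, P Z → (Z.card : ℝ) ≤ (3 * r⁻¹) ^ finrank ℝ E := fun Z hZ => by
    refine (card_le_of_separated hr zero_le_one hZ.1 hZ.2).trans ?_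
    have : 1 ≤ r⁻¹ := (one_le_inv₀ hr).2 hr1
    refine pow_le_pow_left₀ (by positivity) ?_ _
    rw [mul_one, div_eq_mul_inv]; linarith
  have hb : BddAbove (Finset.card '' {Z | P Z}) := by
    obtain ⟨m, hm⟩ := exists_nat_ge ((3 * r⁻¹) ^ finrank ℝ E)
    refine ⟨m, ?_⟩
    rintro _ ⟨Z, hZ, rfl⟩
    exact_mod_cast (hcard Z hZ).trans hm
  obtain ⟨Z, hZ, hZc⟩ := Nat.sSup_mem (s := Finset.card '' {Z | P Z})
    ⟨_, ∅, by simp [hP], rfl⟩ hb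
  refine ⟨Z, fun z hz => mem_closedBall_iff_norm.2 (hZ.1 z hz), fun x hx => ?_, hcard Z hZ,
    fun q => ?_⟩
  · by_contra hne
    simp only [mem_iUnion, mem_closedBall_iff_norm, not_exists, not_le] at hne
    have hxZ : x ∉ Z := fun h => by
      have := hne x h
      rw [sub_self, norm_zero] at this
      linarith
    have : P (insert x Z) := by
      refine ⟨fun z hz => ?_, fun z hz z' hz' hzz => ?_⟩
      · rcases Finset.mem_insert.1 hz with rfl | hz
        · exact mem_closedBall_iff_norm.1 hx
        · exact hZ.1 z hz
      · rcases Finset.mem_insert.1 hz with h | h <;> rcases Finset.mem_insert.1 hz' with h' | h'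
        · exact absurd (h.trans h'.symm) hzz
        · rw [h]; exact hne _ h'
        · rw [norm_sub_rev, h']; exact hne _ h
        · exact hZ.2 z h z' h' hzz
    have h2 := le_csSup hb ⟨_, this, rfl⟩
    rw [← hZc, Finset.card_insert_of_notMem hxZ] at h2
    omega
  · refine (card_le_of_separated (q := q) (s := 4 * r) hr (by linarith) (fun z hz => ?_)
      fun z hz z' hz' => hZ.2 z (Finset.mem_filter.1 hz).1 z' (Finset.mem_filter.1 hz').1).trans ?_
    · have := mem_ball_iff_norm'.1 (Finset.mem_filter.1 hz).2
      exact this.le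
    · refine le_of_eq ?_
      congr 1
      field_simp
      norm_num

open Classical in
lemma sum_setLIntegral_inter_le {μ : Measure E} {h : E → ℝ≥0∞} (hh : Measurable h) {Z : Finset E}
    {S : E → Set E} (hS : ∀ z, MeasurableSet (S z)) (A : Set E) {m : ℝ}
    (hm : ∀ q, ((Z.filter fun z => q ∈ S z).card : ℝ) ≤ m) :
    ∑ z ∈ Z, ∫⁻ x in A ∩ S z, h x ∂μ ≤ ENNReal.ofReal m * ∫⁻ x in A, h x ∂μ := by
  calc _ = ∑ z ∈ Z, ∫⁻ x in A, (S z).indicator h x ∂μ := by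
        refine Finset.sum_congr rfl fun z _ => ?_
        rw [lintegral_indicator (hS z), Measure.restrict_restrict (hS z), inter_comm]
    _ = ∫⁻ x in A, ∑ z ∈ Z, (S z).indicator h x ∂μ :=
        (lintegral_finsetSum _ fun z _ => hh.indicator (hS z)).symm
    _ ≤ ∫⁻ x in A, ENNReal.ofReal m * h x ∂μ := by
        refine lintegral_mono fun x => ?_
        simp only [Set.indicator_apply]
        rw [← Finset.sum_filter, Finset.sum_const, nsmul_eq_mul, ← ENNReal.ofReal_natCast]
        gcongr
        exact hm x
    _ = _ := lintegral_const_mul _ hh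

lemma setLIntegral_le_sum_inter {μ : Measure E} {h : E → ℝ≥0∞} (hh : Measurable h) {Z : Finset E}
    {S : E → Set E} (hS : ∀ z, MeasurableSet (S z)) {A : Set E} (hA : MeasurableSet A)
    (hc : A ⊆ ⋃ z ∈ Z, S z) : ∫⁻ x in A, h x ∂μ ≤ ∑ z ∈ Z, ∫⁻ x in A ∩ S z, h x ∂μ := by
  calc _ ≤ ∫⁻ x in A, ∑ z ∈ Z, (S z).indicator h x ∂μ := by
        refine setLIntegral_mono' hA fun x hx => ?_
        obtain ⟨z, hz, hxz⟩ := mem_iUnion₂.1 (hc hx)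
        refine le_trans ?_ (Finset.single_le_sum (fun _ _ => zero_le) hz)
        rw [Set.indicator_of_mem hxz]
    _ = ∑ z ∈ Z, ∫⁻ x in A, (S z).indicator h x ∂μ :=
        lintegral_finsetSum _ fun z _ => hh.indicator (hS z)
    _ = _ := by
        refine Finset.sum_congr rfl fun z _ => ?_
        rw [lintegral_indicator (hS z), Measure.restrict_restrict (hS z), inter_comm]

end Bilinear

end Falconer

namespace Falconer

open MeasureTheory Metric Set Filter Topology Module
open scoped FourierTransform ENNReal NNReal Pointwise ComplexConjugate RealInnerProductSpace

set_option linter.unusedSectionVars false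

section Bilinear

variable {E : Type*} [NormedAddCommGroup E] [InnerProductSpace ℝ E] [FiniteDimensional ℝ E]
  [MeasurableSpace E] [BorelSpace E]

lemma Fam.lintegral_sum_sq_le {ι : Type*} {R C₀ : ℝ} {s : Finset ι} {ω : ι → E} {u : ι → E → ℂ}
    (hu : Fam R C₀ s ω u) (hC₀ : 1 ≤ C₀) :
    ∫⁻ x, ‖∑ k ∈ s, u k x‖ₑ ^ 2 ≤
      2 * (C₀ * (2 * C₀) ^ finrank ℝ E).toNNReal * ∑ k ∈ s, ∫⁻ x, ‖u k x‖ₑ ^ 2 := by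
  classical
  refine lintegral_sum_sq_le_card s hu.pw (fun _ _ => isBounded_plate _ _ _)
    (fun i j => (plate R C₀ (ω i) ∩ plate R C₀ (ω j)).Nonempty)
    (fun i j h => by rwa [inter_comm]) (fun i _ j _ h => h) fun i hi => ?_
  have h : ((s.filter fun j => (plate R C₀ (ω i) ∩ plate R C₀ (ω j)).Nonempty).card : ℝ) ≤
      C₀ * (2 * C₀) ^ finrank ℝ E := by
    refine hu.count (R • ω i) _ (by linarith) _ (Finset.filter_subset _ _) fun k hk => ?_
    obtain ⟨ξ, h1, h2⟩ := (Finset.mem_filter.1 hk).2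
    calc ‖R • ω k - R • ω i‖ = ‖(ξ - R • ω i) - (ξ - R • ω k)‖ := by congr 1; abel
      _ ≤ _ := norm_sub_le _ _
      _ ≤ C₀ * √R + C₀ * √R := add_le_add h1.1 h2.1
      _ = _ := by ring
  change _ ≤ ENNReal.ofReal _
  rw [← ENNReal.ofReal_natCast]
  exact ENNReal.ofReal_le_ofReal h

lemma PW.fam_sum {ι : Type*} {R C₀ : ℝ} {s : Finset ι} {ω : ι → E} {u : ι → E → ℂ}
    (hu : Fam R C₀ s ω u) (hR : 1 ≤ R) :
    PW (shell E R (2 * C₀ + 2 * C₀ ^ 2)) (fun x => ∑ k ∈ s, u k x) := by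
  convert PW.sum s fun k hk => (hu.pw k hk).mono (plate_subset_shell hR (hu.unit k hk)) using 2

lemma exists_fam_bound [Nontrivial E] {C₀ α γ : ℝ} (hC₀ : 1 ≤ C₀) : ∃ C : ℝ≥0,
    ∀ {A : ℝ≥0}, ShellBound E α γ A → ∀ {ν : Measure E}, IsFiniteMeasure ν → HasPow α ν →
    ∀ {ι : Type} {R : ℝ} {s : Finset ι} {ω : ι → E} {u : ι → E → ℂ}, Fam R C₀ s ω u →
    2 * C₀ + 2 * C₀ ^ 2 ≤ R → ∀ x₀ : E, ∫⁻ x in closedBall x₀ 1, ‖∑ k ∈ s, u k x‖ₑ ^ 2 ∂ν ≤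
      C * (A * ENNReal.ofReal (R ^ γ)) * ∑ k ∈ s, ∫⁻ x, ‖u k x‖ₑ ^ 2 := by
  set C' := 2 * C₀ + 2 * C₀ ^ 2 with hC'
  have hC1 : 1 ≤ C' := by nlinarith
  set c := (C'⁻¹) ^ (α - finrank ℝ E) * (C'⁻¹) ^ γ with hc
  set m := (3 * C') ^ finrank ℝ E with hm
  set k₁ := C₀ * (2 * C₀) ^ finrank ℝ E with hk₁
  refine ⟨m.toNNReal * c.toNNReal * (2 * k₁.toNNReal), ?_⟩
  intro A hA ν hν hνα ι R s ω u hu hR x₀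
  have hR1 : 1 ≤ R := by linarith
  obtain ⟨Z, -, hZc, hZm, -⟩ := exists_net x₀ (inv_pos.2 (by linarith : 0 < C'))
    (inv_le_one_of_one_le₀ hC1)
  rw [inv_inv] at hZm
  have hpw := PW.fam_sum hu hR1
  calc _ ≤ ∑ z ∈ Z, ∫⁻ x in closedBall x₀ 1 ∩ closedBall z C'⁻¹, ‖∑ k ∈ s, u k x‖ₑ ^ 2 ∂ν :=
        setLIntegral_le_sum_inter (hpw.cont.measurable.enorm.pow_const 2)
          (fun _ => measurableSet_closedBall) measurableSet_closedBall hZc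
    _ ≤ ∑ z ∈ Z, A * ENNReal.ofReal (c * R ^ γ) * ∫⁻ x, ‖∑ k ∈ s, u k x‖ₑ ^ 2 := by
        refine Finset.sum_le_sum fun z _ => (lintegral_mono_set inter_subset_right).trans ?_
        have := hA.rescale (R := R) (r := C'⁻¹) (by positivity)
          (by rw [inv_mul_eq_div, one_le_div (by positivity)]; exact hR) ν hνα z
          (w := fun x => ∑ k ∈ s, u k x) (by rwa [inv_inv])
        rwa [Real.mul_rpow (by positivity) (by positivity), ← mul_assoc, ← hc] at this
    _ ≤ ENNReal.ofReal m * (A * ENNReal.ofReal (c * R ^ γ) *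
          (2 * k₁.toNNReal * ∑ k ∈ s, ∫⁻ x, ‖u k x‖ₑ ^ 2)) := by
        rw [Finset.sum_const, nsmul_eq_mul, ← ENNReal.ofReal_natCast]
        gcongr
        exact hu.lintegral_sum_sq_le hC₀
    _ = _ := by
        rw [ENNReal.ofReal_mul (by positivity)]
        push_cast
        change (m.toNNReal : ℝ≥0∞) * (A * ((c.toNNReal : ℝ≥0∞) * _) * _) = _
        ring

lemma eq_zero_of_avg_eq_zero [Nontrivial E] {N : ℕ} (hN : finrank ℝ E < N) {C₀ : ℝ}
    (hC₀ : 1 ≤ C₀) {ι : Type*} {R : ℝ} {s : Finset ι} {ω : ι → E} {u : ι → E → ℂ}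
    (hu : Fam R C₀ s ω u) (hR : 1 ≤ R) {x : E} (h : ∑ j ∈ s, avg N √R (ω j) (u j) x = 0) {j : ι}
    (hj : j ∈ s) (y : E) : u j y = 0 := by
  obtain ⟨C, hC⟩ := exists_sq_le_avg (E := E) N hN hC₀
  have h1 := Finset.sum_eq_zero_iff.1 h j hj
  have h2 := slow_avg N √R (ω j) (u j) y x
  rw [h1, mul_zero] at h2
  have h3 := hC hR (hu.unit j hj) (hu.pw j hj) y
  rw [le_antisymm h2 zero_le, mul_zero] at h3
  simpa using le_antisymm h3 zero_le

lemma le_of_sq_le {x e : ℝ≥0∞} {c : ℝ≥0} {Y : ℝ} (hY : 0 ≤ Y)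
    (h : x ^ 2 ≤ c * ENNReal.ofReal Y * e ^ 2) :
    x ≤ (1 + c : ℝ≥0) * ENNReal.ofReal √Y * e := by
  rw [← ENNReal.pow_le_pow_left_iff two_ne_zero]
  refine h.trans ?_
  rw [mul_pow, mul_pow, ← ENNReal.ofReal_pow (Real.sqrt_nonneg _), Real.sq_sqrt hY]
  gcongr
  rw [← ENNReal.coe_pow, ENNReal.coe_le_coe]
  nlinarith [c.2, sq_nonneg c, c.coe_nonneg, zero_le (a := c), zero_le (a := c ^ 2)]

lemma sum_tw_div_le {N : ℕ} {σ : ℝ} {ω : E} {D : E → ℝ≥0∞} (hD : Measurable D) {Z : Finset E}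
    {S : E → Set E} (hS : ∀ z, MeasurableSet (S z)) (G : Set E) {m : ℝ}
    (hm : ∀ q, ((open Classical in Z.filter fun z => q ∈ S z).card : ℝ) ≤ m) (x : E) :
    ∑ z ∈ Z, tw N σ ω D (G ∩ S z) x / tw N σ ω D G x ≤ ENNReal.ofReal m := by
  simp only [div_eq_mul_inv, ← Finset.sum_mul]
  have h := sum_setLIntegral_inter_le (μ := volume)
    (h := fun y => D y * dk N (stretch σ 0 ω (x - y)))
    (hD.mul ((measurable_dk N).comp (by fun_prop))) hS G hm
  calc _ ≤ ENNReal.ofReal m * tw N σ ω D G x * (tw N σ ω D G x)⁻¹ := by gcongr; exact h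
    _ ≤ _ := by
        rw [mul_assoc]
        exact mul_le_of_le_one_right' (ENNReal.mul_inv_le_one _)

end Bilinear

end Falconer

namespace Falconer

open MeasureTheory Metric Set Filter Topology Module
open scoped FourierTransform ENNReal NNReal Pointwise ComplexConjugate RealInnerProductSpace

set_option linter.unusedSectionVars false

section Bilinear

variable {E : Type*} [NormedAddCommGroup E] [InnerProductSpace ℝ E] [FiniteDimensional ℝ E]
  [MeasurableSpace E] [BorelSpace E]

lemma lintegral_near_far {ν : Measure E} {n f v : E → ℂ} (hn : Continuous n)
    (hv : Continuous v) {l : ℝ≥0} (hl : l ≠ 0) (A B : Set E) :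
    ∫⁻ x in A ∩ B, ‖n x + f x‖ₑ * ‖v x‖ₑ ∂ν ≤
      l * (∫⁻ x in B, ‖n x‖ₑ ^ 2 ∂ν) + (l⁻¹ : ℝ≥0) * (∫⁻ x in A ∩ B, ‖v x‖ₑ ^ 2 ∂ν) +
        ∫⁻ x in B, ‖f x * v x‖ₑ ∂ν := by
  calc _ ≤ ∫⁻ x in A ∩ B, (‖n x‖ₑ * ‖v x‖ₑ + ‖f x * v x‖ₑ) ∂ν := by
        refine lintegral_mono fun x => ?_
        dsimp only
        rw [enorm_mul, ← add_mul]
        gcongr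
        exact enorm_add_le _ _
    _ = (∫⁻ x in A ∩ B, ‖n x‖ₑ * ‖v x‖ₑ ∂ν) + ∫⁻ x in A ∩ B, ‖f x * v x‖ₑ ∂ν :=
        lintegral_add_left (hn.measurable.enorm.mul hv.measurable.enorm) _
    _ ≤ _ := by
        refine add_le_add ((lintegral_mul_le_add_sq hn.measurable.enorm.aemeasurable hl).trans
          (add_le_add_left (mul_le_mul_right (lintegral_mono_set inter_subset_right) _) _))
          (lintegral_mono_set inter_subset_right)

lemma exists_bilinear_bound [Nontrivial E] (N : ℕ) (hN : finrank ℝ E < N) {C₀ α γ : ℝ}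
    (hC₀ : 1 ≤ C₀) (hα : 0 ≤ α) (hγ : 4 / 5 ≤ α - finrank ℝ E + γ + 1) :
    ∃ C : ℝ≥0, ∀ {A : ℝ≥0}, ShellBound E α γ A → ∀ {ν : Measure E}, IsFiniteMeasure ν →
      HasPow α ν → ∀ {ι : Type} {R H Θ : ℝ} {I₁ I₂ : Finset ι} {ω : ι → E} {u : ι → E → ℂ},
      Fam R C₀ I₁ ω u → Fam R C₀ I₂ ω u → Sep I₁ I₂ ω Θ → 1 ≤ R → 0 < Θ → Θ ≤ 1 / 2 → 1 ≤ H →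
      100 * C₀ ^ 2 ≤ H → 100 * ((√R)⁻¹ * H ^ 2) ≤ Θ → √R ^ (finrank ℝ E + 1) ≤ H ^ N → ∀ x₀ : E,
      ∫⁻ x in closedBall x₀ 1, ‖∑ i ∈ I₁, u i x‖ₑ * ‖∑ j ∈ I₂, u j x‖ₑ ∂ν ≤
        C * (A * ENNReal.ofReal (R ^ γ * H ^ (-2 / 5 : ℝ)) + ENNReal.ofReal (H ^ finrank ℝ E *
          √(R ^ (finrank ℝ E - α) * √R ^ (finrank ℝ E - 1) *
          (H ^ (2 * finrank ℝ E + 3) * (√R)⁻¹ / Θ)))) *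
          ((∑ i ∈ I₁, ∫⁻ x, ‖u i x‖ₑ ^ 2) + ∑ j ∈ I₂, ∫⁻ x, ‖u j x‖ₑ ^ 2) := by
  classical
  obtain ⟨Cn, hCn⟩ := exists_near_bound (E := E) N (N + N) hN hC₀
  obtain ⟨Cf, hCf⟩ := exists_far_bound (E := E) (α := α) N hN hC₀
  obtain ⟨Cv, hCv⟩ := exists_fam_bound (E := E) (α := α) (γ := γ) hC₀
  have hI : ∫⁻ x : E, dk N x ≠ ∞ := (lintegral_dk_lt_top hN).ne
  set n := finrank ℝ E with hn
  set I := (∫⁻ x : E, dk N x).toNNReal with hIdef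
  have hIe : (I : ℝ≥0∞) = ∫⁻ x : E, dk N x := ENNReal.coe_toNNReal hI
  set m : ℝ := 9 ^ n with hm
  refine ⟨m.toNNReal * (Cn * I) + m.toNNReal * Cv + (3 ^ n : ℝ).toNNReal * (1 + Cf), ?_⟩
  intro A hA ν hν hνα ι R H Θ I₁ I₂ ω u hu₁ hu₂ hs hR hΘ0 hΘ1 hH hHC hδH hHN x₀
  have hR0 : 0 < R := by linarith
  have hH0 : 0 < H := by linarith
  have hσ : 0 < √R := by positivity
  have hHσ : H ^ 2 ≤ √R := by
    have := mul_le_mul_of_nonneg_left (hδH.trans hΘ1) hσ.le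
    have e : √R * (100 * ((√R)⁻¹ * H ^ 2)) = 100 * H ^ 2 := by field_simp
    nlinarith
  have hHσ1 : H ≤ √R := by nlinarith
  have hHR : H ≤ R := by
    have := Real.sq_sqrt hR0.le
    have h1 : 1 ≤ √R := hH.trans hHσ1
    nlinarith
  have hCR : 2 * C₀ + 2 * C₀ ^ 2 ≤ R := by nlinarith
  set E₁ := ∑ i ∈ I₁, ∫⁻ x, ‖u i x‖ₑ ^ 2 with hE₁
  set E₂ := ∑ j ∈ I₂, ∫⁻ x, ‖u j x‖ₑ ^ 2 with hE₂
  set Y := R ^ (n - α) * √R ^ (n - 1) * (H ^ (2 * n + 3) * (√R)⁻¹ / Θ) with hY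
  have hY0 : 0 ≤ Y := by positivity
  set D : E → ℝ≥0∞ := fun x => ∑ j ∈ I₂, avg N √R (ω j) (u j) x with hD
  by_cases hdeg : ∃ x, D x = 0
  · obtain ⟨x, hx⟩ := hdeg
    have : ∀ y, ∑ j ∈ I₂, u j y = 0 := fun y => Finset.sum_eq_zero fun j hj =>
      eq_zero_of_avg_eq_zero hN hC₀ hu₂ hR hx hj y
    simp [this]
  push Not at hdeg
  have ham : ∀ k ∈ I₂, Measurable (avg N √R (ω k) (u k)) := fun k hk =>
    measurable_avg (hu₂.pw k hk).cont
  have hDm : Measurable D := Finset.measurable_fun_sum _ ham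
  have hDi : ∫⁻ x, D x ≠ ∞ := by
    rw [hD, lintegral_finsetSum' _ fun k hk => (ham k hk).aemeasurable]
    refine (ENNReal.sum_lt_top.2 fun k hk => ?_).ne
    rw [lintegral_avg N hσ (hu₂.unit k hk) (hu₂.pw k hk).cont]
    exact ENNReal.mul_lt_top hI.lt_top
      ((hu₂.pw k hk).lintegral_sq_ne_top (isBounded_plate _ _ _)).lt_top
  set G : Set E := ball x₀ 4 with hG
  have hGt : ∀ ω x, tw N √R ω D G x ≠ ∞ := fun ω x => tw_ne_top hDi x
  have hG0 : ∀ ω x, tw N √R ω D G x ≠ 0 := fun ω x =>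
    tw_ne_zero hDm hdeg (measure_ball_pos _ _ (by norm_num)).ne' x
  set S : E → Set E := fun z => ball z (4 * H⁻¹) with hS
  set pn : E → ι → E → ℝ≥0∞ := fun z i x =>
    tw N √R (ω i) D (G ∩ S z) x / tw N √R (ω i) D G x with hpn
  set pf : E → ι → E → ℝ≥0∞ := fun z i x =>
    tw N √R (ω i) D (G \ S z) x / tw N √R (ω i) D G x with hpf
  have hpnm : ∀ z i, Measurable (pn z i) := fun z i => (measurable_tw hDm).div (measurable_tw hDm)
  have hpfm : ∀ z i, Measurable (pf z i) := fun z i => (measurable_tw hDm).div (measurable_tw hDm)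
  have hp1 : ∀ z i x, pn z i x + pf z i x = 1 := fun z i x => by
    rw [hpn, hpf]
    dsimp only
    rw [← ENNReal.add_div, tw_add measurableSet_ball]
    exact ENNReal.div_self (hG0 _ _) (hGt _ _)
  have hpn1 : ∀ z i x, pn z i x ≤ 1 := fun z i x => (hp1 z i x) ▸ le_self_add
  have hpf1 : ∀ z i x, pf z i x ≤ 1 := fun z i x => (hp1 z i x) ▸ le_add_self
  have hpns : ∀ z, ∀ i ∈ I₁, Slow (N + N) √R (ω i) (pn z i) := fun z i hi =>
    (slow_tw N √R (hu₁.unit i hi) D _).div (slow_tw N √R (hu₁.unit i hi) D _)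
  set vn : E → E → ℂ := fun z x => ∑ i ∈ I₁, smooth √R (ω i) (pn z i) x * u i x with hvn
  set vf : E → E → ℂ := fun z x => ∑ i ∈ I₁, smooth √R (ω i) (pf z i) x * u i x with hvf
  set v₂ : E → ℂ := fun x => ∑ j ∈ I₂, u j x with hv₂
  have hvnc : ∀ z, Continuous (vn z) := fun z => continuous_finsetSum _ fun i hi =>
    (PW.smooth_mul hR (hu₁.unit i hi) (hu₁.pw i hi) (hpnm z i) (hpn1 z i)).cont
  have hvfc : ∀ z, Continuous (vf z) := fun z => continuous_finsetSum _ fun i hi =>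
    (PW.smooth_mul hR (hu₁.unit i hi) (hu₁.pw i hi) (hpfm z i) (hpf1 z i)).cont
  have hv₂c : Continuous v₂ := continuous_finsetSum _ fun j hj => (hu₂.pw j hj).cont
  have hv₁c : Continuous fun x => ∑ i ∈ I₁, u i x :=
    continuous_finsetSum _ fun j hj => (hu₁.pw j hj).cont
  have hv₁ : ∀ z x, ∑ i ∈ I₁, u i x = vn z x + vf z x := fun z x => by
    rw [hvn, hvf]
    dsimp only
    rw [← Finset.sum_add_distrib]
    refine Finset.sum_congr rfl fun i hi => ?_
    rw [← add_mul, smooth_add_smooth hσ (hu₁.unit i hi) (hpnm z i) (hpfm z i) (hp1 z i), one_mul]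
  obtain ⟨Z, hZ, hZc, hZm, hZo⟩ := exists_net x₀ (inv_pos.2 hH0) (inv_le_one_of_one_le₀ hH)
  rw [inv_inv] at hZm
  set l : ℝ≥0 := (H ^ (2 / 5 : ℝ)).toNNReal with hl
  have hl0 : l ≠ 0 := by
    rw [hl, Ne, Real.toNNReal_eq_zero, not_le]; positivity
  have hlinv : ((l⁻¹ : ℝ≥0) : ℝ≥0∞) = ENNReal.ofReal (H ^ (-2 / 5 : ℝ)) := by
    rw [hl, ← Real.toNNReal_inv, ← Real.rpow_neg hH0.le]
    norm_num [ENNReal.ofReal]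
  -- the near part
  have hnear : ∑ z ∈ Z, ∫⁻ x in closedBall z H⁻¹, ‖vn z x‖ₑ ^ 2 ∂ν ≤
      Cn * (A * ENNReal.ofReal (H⁻¹ ^ (α - n) * (H⁻¹ * R) ^ γ * H⁻¹)) *
        (ENNReal.ofReal m * (I * E₁)) := by
    calc _ ≤ ∑ z ∈ Z, Cn * (A * ENNReal.ofReal (H⁻¹ ^ (α - n) * (H⁻¹ * R) ^ γ * H⁻¹)) *
          ∑ k ∈ I₁, ∫⁻ x, pn z k x * avg N √R (ω k) (u k) x :=
          Finset.sum_le_sum fun z _ => hCn hA hν hνα hu₁ hR (inv_pos.2 hH0)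
            (by rwa [inv_inv]) (by rwa [inv_inv]) (pn z) (fun k _ => hpnm z k)
            (fun k _ => hpn1 z k) (hpns z) z
      _ ≤ _ := by
        rw [← Finset.mul_sum, Finset.sum_comm, hE₁, ← mul_assoc (ENNReal.ofReal m),
          Finset.mul_sum I₁ _ (ENNReal.ofReal m * I)]
        refine mul_le_mul_right (Finset.sum_le_sum fun k hk => ?_) _
        rw [mul_assoc]
        have hak : Measurable (avg N √R (ω k) (u k)) := measurable_avg (hu₁.pw k hk).cont
        rw [← lintegral_finsetSum _ fun z _ => (hpnm z k).fun_mul hak, hIe,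
          ← lintegral_avg N hσ (hu₁.unit k hk) (hu₁.pw k hk).cont,
          ← lintegral_const_mul _ hak]
        refine lintegral_mono fun x => ?_
        dsimp only
        rw [← Finset.sum_mul]
        gcongr
        exact sum_tw_div_le hDm (fun z => measurableSet_ball) G hZo x
  have hlR : (l : ℝ≥0∞) * ENNReal.ofReal (H⁻¹ ^ (α - n) * (H⁻¹ * R) ^ γ * H⁻¹) ≤
      ENNReal.ofReal (R ^ γ * H ^ (-2 / 5 : ℝ)) := by
    rw [hl]
    change ENNReal.ofReal _ * _ ≤ _
    rw [← ENNReal.ofReal_mul (by positivity)]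
    refine ENNReal.ofReal_le_ofReal ?_
    have e : H ^ (2 / 5 : ℝ) * (H⁻¹ ^ (α - n) * (H⁻¹ * R) ^ γ * H⁻¹) =
        R ^ γ * H ^ (2 / 5 - (α - n + γ + 1)) := by
      rw [Real.mul_rpow (by positivity) hR0.le, Real.inv_rpow hH0.le, Real.inv_rpow hH0.le,
        ← Real.rpow_neg hH0.le, ← Real.rpow_neg hH0.le, ← Real.rpow_neg_one H,
        show 2 / 5 - (α - n + γ + 1) = 2 / 5 + -(α - n) + -γ + -1 by ring,
        Real.rpow_add hH0, Real.rpow_add hH0, Real.rpow_add hH0]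
      ring
    rw [e]
    gcongr
    linarith
  have hbdd : ∑ z ∈ Z, ∫⁻ x in closedBall x₀ 1 ∩ closedBall z H⁻¹, ‖v₂ x‖ₑ ^ 2 ∂ν ≤
      ENNReal.ofReal m * (Cv * (A * ENNReal.ofReal (R ^ γ)) * E₂) := by
    refine (sum_setLIntegral_inter_le (hv₂c.measurable.enorm.pow_const 2)
      (fun _ => measurableSet_closedBall) (closedBall x₀ 1) (m := m) fun q => ?_).trans
        (mul_le_mul_right (hCv hA hν hνα hu₂ hCR x₀) _)
    refine le_trans ?_ (hZo q)
    norm_cast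
    refine Finset.card_le_card (Finset.monotone_filter_right _ fun z _ hz => ?_)
    exact closedBall_subset_ball (by linarith [inv_pos.2 hH0]) hz
  have hfar : ∀ z ∈ Z, ∫⁻ x in closedBall z H⁻¹, ‖vf z x * v₂ x‖ₑ ∂ν ≤
      (1 + Cf : ℝ≥0) * ENNReal.ofReal √Y * (E₁ + E₂) := fun z hz => by
    refine le_of_sq_le hY0 ?_
    have h1 := lintegral_mul_sq_le (μ := ν.restrict (closedBall z H⁻¹)) (f := fun _ => 1)
      (g := fun x => ‖vf z x * v₂ x‖ₑ) aemeasurable_const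
      ((hvfc z).mul hv₂c).measurable.enorm.aemeasurable
    simp only [one_mul, one_pow, lintegral_const, Measure.restrict_apply_univ] at h1
    refine h1.trans ?_
    have h2 : ν (closedBall z H⁻¹) ≤ 1 := by
      refine (hνα z _ (inv_pos.2 hH0)).trans ?_
      rw [ENNReal.ofReal_le_one]
      exact Real.rpow_le_one (by positivity) (inv_le_one_of_one_le₀ hH) hα
    have h3 := hCf hν hνα hu₁ hu₂ hs hR hΘ0 hΘ1 hH hδH hHN hD x₀ z (hZ z hz)
    calc _ ≤ 1 * (Cf * ENNReal.ofReal Y * (E₁ * E₂)) := mul_le_mul' h2 h3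
      _ ≤ _ := by
        rw [one_mul, sq]
        gcongr
        · exact le_self_add
        · exact le_add_self
  calc _ ≤ ∑ z ∈ Z, ∫⁻ x in closedBall x₀ 1 ∩ closedBall z H⁻¹,
          ‖∑ i ∈ I₁, u i x‖ₑ * ‖v₂ x‖ₑ ∂ν :=
        setLIntegral_le_sum_inter (hv₁c.measurable.enorm.mul hv₂c.measurable.enorm)
          (fun _ => measurableSet_closedBall) measurableSet_closedBall hZc
    _ ≤ ∑ z ∈ Z, (l * (∫⁻ x in closedBall z H⁻¹, ‖vn z x‖ₑ ^ 2 ∂ν) + (l⁻¹ : ℝ≥0) *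
          (∫⁻ x in closedBall x₀ 1 ∩ closedBall z H⁻¹, ‖v₂ x‖ₑ ^ 2 ∂ν) +
          (1 + Cf : ℝ≥0) * ENNReal.ofReal √Y * (E₁ + E₂)) := by
        refine Finset.sum_le_sum fun z hz => ?_
        simp only [hv₁ z]
        exact (lintegral_near_far (hvnc z) hv₂c hl0 _ _).trans
          (add_le_add_right (hfar z hz) _)
    _ ≤ l * (Cn * (A * ENNReal.ofReal (H⁻¹ ^ (α - n) * (H⁻¹ * R) ^ γ * H⁻¹)) *
          (ENNReal.ofReal m * (I * E₁))) + (l⁻¹ : ℝ≥0) *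
          (ENNReal.ofReal m * (Cv * (A * ENNReal.ofReal (R ^ γ)) * E₂)) +
          ENNReal.ofReal ((3 * H) ^ n) * ((1 + Cf : ℝ≥0) * ENNReal.ofReal √Y * (E₁ + E₂)) := by
        rw [Finset.sum_add_distrib, Finset.sum_add_distrib, ← Finset.mul_sum, ← Finset.mul_sum,
          Finset.sum_const, nsmul_eq_mul, ← ENNReal.ofReal_natCast]
        gcongr
    _ = ENNReal.ofReal m * (Cn * I) * (A * (l * ENNReal.ofReal
          (H⁻¹ ^ (α - n) * (H⁻¹ * R) ^ γ * H⁻¹))) * E₁ + ENNReal.ofReal m * Cv *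
          (A * (ENNReal.ofReal (R ^ γ) * (l⁻¹ : ℝ≥0))) * E₂ +
          ENNReal.ofReal ((3 * H) ^ n) * ((1 + Cf : ℝ≥0) * ENNReal.ofReal √Y * (E₁ + E₂)) := by
        ring
    _ ≤ ENNReal.ofReal m * (Cn * I) * (A * ENNReal.ofReal (R ^ γ * H ^ (-2 / 5 : ℝ))) *
          (E₁ + E₂) + ENNReal.ofReal m * Cv *
          (A * ENNReal.ofReal (R ^ γ * H ^ (-2 / 5 : ℝ))) * (E₁ + E₂) +
          ENNReal.ofReal ((3 : ℝ) ^ n) * (1 + Cf : ℝ≥0) * ENNReal.ofReal (H ^ n * √Y) *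
          (E₁ + E₂) := by
        rw [hlinv, ← ENNReal.ofReal_mul (by positivity)]
        refine add_le_add (add_le_add ?_ ?_) (le_of_eq ?_)
        · gcongr
          exact le_self_add
        · gcongr
          exact le_add_self
        · rw [mul_pow, ENNReal.ofReal_mul (by positivity), ENNReal.ofReal_mul (by positivity)]
          ring
    _ ≤ _ := by
        rw [← add_mul, ← add_mul]
        refine mul_le_mul_left ?_ _
        have e : ((m.toNNReal * (Cn * I) + m.toNNReal * Cv + (3 ^ n : ℝ).toNNReal * (1 + Cf) : ℝ≥0) :
            ℝ≥0∞) = ENNReal.ofReal m * (Cn * I) + ENNReal.ofReal m * Cv +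
            ENNReal.ofReal ((3 : ℝ) ^ n) * (1 + Cf : ℝ≥0) := by
          push_cast [ENNReal.ofReal]
          ring
        rw [e, mul_add _ (_ * _), add_mul, add_mul _ (_ * _)]
        refine add_le_add le_self_add ?_
        exact mul_le_mul_left le_add_self _

end Bilinear

end Falconer

namespace Falconer

open MeasureTheory Metric Set Filter Topology Module
open scoped FourierTransform ENNReal NNReal Pointwise ComplexConjugate RealInnerProductSpace

set_option linter.unusedSectionVars false

section Whitney

lemma enorm_sum_sum_ite_le {κ κ' : Type*} [DecidableEq κ'] (s : Finset κ) (q : κ → κ')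
    (r : κ' → κ' → Prop) [DecidableRel r]
    (f : κ → ℂ) :
    ‖∑ k ∈ s, ∑ l ∈ s, if r (q k) (q l) then f k * conj (f l) else 0‖ₑ ≤
      ∑ a ∈ s.image q, ∑ b ∈ s.image q with r a b,
        ‖∑ k ∈ s with q k = a, f k‖ₑ * ‖∑ l ∈ s with q l = b, f l‖ₑ := by
  have h : ∑ k ∈ s, ∑ l ∈ s, (if r (q k) (q l) then f k * conj (f l) else 0) =
      ∑ a ∈ s.image q, ∑ b ∈ s.image q with r a b,
        (∑ k ∈ s with q k = a, f k) * conj (∑ l ∈ s with q l = b, f l) := by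
    rw [← Finset.sum_fiberwise_of_maps_to (t := s.image q) (g := q)
      fun k hk => Finset.mem_image_of_mem q hk]
    refine Finset.sum_congr rfl fun a _ => ?_
    have hin : ∀ k ∈ s.filter (q · = a), (∑ l ∈ s, if r (q k) (q l) then f k * conj (f l) else 0) =
        ∑ b ∈ s.image q with r a b, f k * conj (∑ l ∈ s with q l = b, f l) := fun k hk => by
      rw [← Finset.sum_fiberwise_of_maps_to (t := s.image q) (g := q)
        fun k hk => Finset.mem_image_of_mem q hk, Finset.sum_filter]
      refine Finset.sum_congr rfl fun b _ => ?_
      rw [(Finset.mem_filter.1 hk).2, map_sum, Finset.mul_sum]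
      split_ifs with hr
      · refine Finset.sum_congr rfl fun l hl => ?_
        rw [(Finset.mem_filter.1 hl).2, if_pos hr]
      · refine Finset.sum_eq_zero fun l hl => ?_
        rw [(Finset.mem_filter.1 hl).2, if_neg hr]
    rw [Finset.sum_congr rfl hin, Finset.sum_comm]
    exact Finset.sum_congr rfl fun b _ => (Finset.sum_mul _ _ _).symm
  rw [h]
  refine (enorm_sum_le _ _).trans (Finset.sum_le_sum fun a _ => (enorm_sum_le _ _).trans
    (Finset.sum_le_sum fun b _ => ?_))
  rw [enorm_mul, RCLike.enorm_conj]

lemma lintegral_sum_sum_ite_le {X κ κ' : Type*} [MeasurableSpace X] [DecidableEq κ'] {μ : Measure X}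
    (s : Finset κ) (q : κ → κ') (r : κ' → κ' → Prop) [DecidableRel r] (hsymm : ∀ a b, r a b → r b a) {U : κ → X → ℂ}
    (hU : ∀ k ∈ s, Measurable (U k)) {e : κ → ℝ≥0∞} {K : ℝ≥0} {B : ℝ≥0∞}
    (hK : ∀ a ∈ s.image q, (((s.image q).filter (r a)).card : ℝ≥0∞) ≤ K)
    (hB : ∀ a ∈ s.image q, ∀ b ∈ s.image q, r a b →
      ∫⁻ x, ‖∑ k ∈ s with q k = a, U k x‖ₑ * ‖∑ l ∈ s with q l = b, U l x‖ₑ ∂μ ≤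
        B * (∑ k ∈ s with q k = a, e k + ∑ l ∈ s with q l = b, e l)) :
    ∫⁻ x, ‖∑ k ∈ s, ∑ l ∈ s, if r (q k) (q l) then U k x * conj (U l x) else 0‖ₑ ∂μ ≤
      2 * K * B * ∑ k ∈ s, e k := by
  set Q := s.image q with hQ
  set F : κ' → ℝ≥0∞ := fun a => ∑ k ∈ s with q k = a, e k with hF
  have hF' : ∑ a ∈ Q, F a = ∑ k ∈ s, e k :=
    Finset.sum_fiberwise_of_maps_to (fun k hk => Finset.mem_image_of_mem q hk) _
  have hm : ∀ a, Measurable fun x => ‖∑ k ∈ s with q k = a, U k x‖ₑ := fun a =>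
    (Finset.measurable_fun_sum _ fun k hk => hU k (Finset.mem_filter.1 hk).1).enorm
  have h1 : ∑ a ∈ Q, ∑ b ∈ Q with r a b, F a ≤ K * ∑ a ∈ Q, F a := by
    rw [Finset.mul_sum]
    refine Finset.sum_le_sum fun a ha => ?_
    rw [Finset.sum_const, nsmul_eq_mul]
    exact mul_le_mul_left (hK a ha) _
  have h2 : ∑ a ∈ Q, ∑ b ∈ Q with r a b, F b ≤ K * ∑ a ∈ Q, F a := by
    refine le_trans (le_of_eq ?_) h1
    exact Finset.sum_comm' fun a b => by
      simp only [Finset.mem_filter]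
      exact ⟨fun h => ⟨⟨h.1, hsymm _ _ h.2.2⟩, h.2.1⟩, fun h => ⟨h.1.1, h.2, hsymm _ _ h.1.2⟩⟩
  calc _ ≤ ∫⁻ x, ∑ a ∈ Q, ∑ b ∈ Q with r a b,
        ‖∑ k ∈ s with q k = a, U k x‖ₑ * ‖∑ l ∈ s with q l = b, U l x‖ₑ ∂μ :=
        lintegral_mono fun x => enorm_sum_sum_ite_le s q r _
    _ = ∑ a ∈ Q, ∑ b ∈ Q with r a b, ∫⁻ x,
        ‖∑ k ∈ s with q k = a, U k x‖ₑ * ‖∑ l ∈ s with q l = b, U l x‖ₑ ∂μ := by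
        rw [lintegral_finsetSum _ fun a _ => Finset.measurable_fun_sum _ fun b _ =>
          (hm a).fun_mul (hm b)]
        exact Finset.sum_congr rfl fun a _ => lintegral_finsetSum _ fun b _ =>
          (hm a).fun_mul (hm b)
    _ ≤ ∑ a ∈ Q, ∑ b ∈ Q with r a b, B * (F a + F b) :=
        Finset.sum_le_sum fun a ha => Finset.sum_le_sum fun b hb =>
          hB a ha b (Finset.mem_filter.1 hb).1 (Finset.mem_filter.1 hb).2
    _ = B * ((∑ a ∈ Q, ∑ b ∈ Q with r a b, F a) + ∑ a ∈ Q, ∑ b ∈ Q with r a b, F b) := by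
        simp only [← Finset.mul_sum, ← Finset.sum_add_distrib]
    _ ≤ B * (K * ∑ a ∈ Q, F a + K * ∑ a ∈ Q, F a) := by gcongr
    _ = _ := by rw [hF']; ring

variable {d : ℕ}

/-- The dyadic ancestor, `j` levels up, of a lattice point. -/
def anc (j : ℕ) (k : Fin d → ℤ) : Fin d → ℤ := fun i => k i / 2 ^ j

lemma anc_succ (j : ℕ) (k : Fin d → ℤ) : anc (j + 1) k = fun i => anc j k i / 2 := by
  funext i
  rw [anc, anc, pow_succ, Int.ediv_ediv_of_nonneg (by positivity)]

/-- Lattice points at sup-distance at most `N`. -/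
def Close (N : ℤ) (a b : Fin d → ℤ) : Prop := ∀ i, |a i - b i| ≤ N

lemma Close.symm {N : ℤ} {a b : Fin d → ℤ} (h : Close N a b) : Close N b a := fun i => by
  rw [abs_sub_comm]; exact h i

lemma Close.half {N : ℤ} (_ : 1 ≤ N) {a b : Fin d → ℤ} (h : Close N a b) :
    Close N (fun i => a i / 2) fun i => b i / 2 := fun i => by
  have := abs_le.1 (h i)
  refine abs_le.2 ⟨?_, ?_⟩ <;> dsimp only <;> omega

lemma Close.of_half {N : ℤ} {a b : Fin d → ℤ}
    (h : Close N (fun i => a i / 2) fun i => b i / 2) : Close (2 * N + 1) a b := fun i => by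
  have := abs_le.1 (h i)
  dsimp only at this
  refine abs_le.2 ⟨?_, ?_⟩ <;> omega

lemma card_close_le (Q : Finset (Fin d → ℤ)) (a : Fin d → ℤ) {M : ℤ} (hM : 0 ≤ M)
    {r : (Fin d → ℤ) → Prop} [DecidablePred r] (hr : ∀ b, r b → Close M a b) :
    ((Q.filter r).card : ℝ≥0∞) ≤ (((2 * M + 1 : ℝ) ^ d).toNNReal : ℝ≥0) := by
  have h := card_le_of_coords (Q.filter r) (fun i => (a i : ℝ)) (M := M) (by exact_mod_cast hM)
    fun b hb i => by
      have := hr b (Finset.mem_filter.1 hb).2 i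
      rw [abs_sub_comm] at this
      exact_mod_cast this
  change _ ≤ ENNReal.ofReal _
  rw [← ENNReal.ofReal_natCast]
  exact ENNReal.ofReal_le_ofReal h

/-- The Whitney decomposition of `|∑ U|²` by dyadic scale of separation. -/
lemma lintegral_whitney_le {X : Type*} [MeasurableSpace X] {μ : Measure X} {N : ℤ} (hN : 1 ≤ N)
    {s : Finset (Fin d → ℤ)} {U : (Fin d → ℤ) → X → ℂ} (hU : ∀ k ∈ s, Measurable (U k))
    {e : (Fin d → ℤ) → ℝ≥0∞} {B₁ B₂ : ℝ≥0∞} {j₀ J : ℕ} (hJ : j₀ ≤ J)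
    (htop : ∀ k ∈ s, ∀ l ∈ s, anc J k = anc J l)
    (hnarrow : ∀ t ⊆ s, (∀ k ∈ t, ∀ l ∈ t, anc j₀ k = anc j₀ l) →
      ∫⁻ x, ‖∑ k ∈ t, U k x‖ₑ ^ 2 ∂μ ≤ B₁ * ∑ k ∈ t, e k)
    (hbil : ∀ j, j₀ ≤ j → j < J → ∀ a b, ¬ Close N a b → Close (2 * N + 1) a b →
      ∀ t₁ ⊆ s, ∀ t₂ ⊆ s, t₁.Nonempty → t₂.Nonempty → (∀ k ∈ t₁, anc j k = a) →
      (∀ k ∈ t₂, anc j k = b) →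
      ∫⁻ x, ‖∑ k ∈ t₁, U k x‖ₑ * ‖∑ l ∈ t₂, U l x‖ₑ ∂μ ≤
        B₂ * ((∑ k ∈ t₁, e k) + ∑ l ∈ t₂, e l)) :
    ∫⁻ x, ‖∑ k ∈ s, U k x‖ₑ ^ 2 ∂μ ≤
      2 * (((4 * N + 3 : ℝ) ^ d).toNNReal : ℝ≥0) * (B₁ + (J - j₀ : ℕ) * B₂) * ∑ k ∈ s, e k := by
  classical
  set K : ℝ≥0 := ((4 * N + 3 : ℝ) ^ d).toNNReal with hK
  have hKc : ∀ (Q : Finset (Fin d → ℤ)) a {r : (Fin d → ℤ) → Prop},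
      (∀ b, r b → Close (2 * N + 1) a b) → ((Q.filter r).card : ℝ≥0∞) ≤ K := fun Q a r hr => by
    have := card_close_le Q a (by linarith) hr
    have e : (4 * N + 3 : ℝ) = 2 * ((2 * N + 1 : ℤ) : ℝ) + 1 := by push_cast; ring
    rwa [hK, e]
  set G : ℕ → X → ℂ := fun j x => ∑ k ∈ s, ∑ l ∈ s,
    if Close N (anc j k) (anc j l) then U k x * conj (U l x) else 0 with hG
  have hGm : ∀ j, Measurable (G j) := fun j => Finset.measurable_fun_sum _ fun k hk =>
    Finset.measurable_fun_sum _ fun l hl => by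
      split_ifs
      · exact (hU k hk).mul (Complex.continuous_conj.measurable.comp (hU l hl))
      · exact measurable_const
  have hfib : ∀ (j : ℕ) a, a ∈ s.image (anc j) → (s.filter fun k => anc j k = a).Nonempty :=
    fun j a ha => by
      obtain ⟨k, hk, rfl⟩ := Finset.mem_image.1 ha
      exact ⟨k, Finset.mem_filter.2 ⟨hk, rfl⟩⟩
  have hbase : ∫⁻ x, ‖G j₀ x‖ₑ ∂μ ≤ 2 * K * B₁ * ∑ k ∈ s, e k := by
    refine lintegral_sum_sum_ite_le s (anc j₀) (Close N) (fun a b h => h.symm) hU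
      (fun a _ => hKc _ a fun b h i => (h i).trans (by linarith)) fun a ha b hb hab => ?_
    have hfa : ∀ a, ∫⁻ x, ‖∑ k ∈ s with anc j₀ k = a, U k x‖ₑ ^ 2 ∂μ ≤
        B₁ * ∑ k ∈ s with anc j₀ k = a, e k := fun a =>
      hnarrow _ (Finset.filter_subset _ _) fun k hk l hl =>
        (Finset.mem_filter.1 hk).2.trans (Finset.mem_filter.1 hl).2.symm
    refine (lintegral_mul_le_add_sq (Finset.measurable_fun_sum _ fun k hk =>
      hU k (Finset.mem_filter.1 hk).1).enorm.aemeasurable one_ne_zero).trans ?_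
    rw [inv_one, ENNReal.coe_one, one_mul, one_mul, mul_add]
    exact add_le_add (hfa a) (hfa b)
  have hstep : ∀ j, j₀ ≤ j → j < J → ∫⁻ x, ‖G (j + 1) x‖ₑ ∂μ ≤
      (∫⁻ x, ‖G j x‖ₑ ∂μ) + 2 * K * B₂ * ∑ k ∈ s, e k := fun j hj hjJ => by
    obtain ⟨r, hr⟩ : ∃ r : (Fin d → ℤ) → (Fin d → ℤ) → Prop, ∀ a b, r a b ↔
      Close N (fun i => a i / 2) (fun i => b i / 2) ∧ ¬ Close N a b := ⟨_, fun _ _ => Iff.rfl⟩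
    have h1 : ∀ x, G (j + 1) x = G j x + ∑ k ∈ s, ∑ l ∈ s,
        if r (anc j k) (anc j l) then U k x * conj (U l x) else 0 := fun x => by
      rw [hG]
      dsimp only
      rw [← Finset.sum_add_distrib]
      refine Finset.sum_congr rfl fun k _ => ?_
      rw [← Finset.sum_add_distrib]
      refine Finset.sum_congr rfl fun l _ => ?_
      rw [anc_succ, anc_succ]
      by_cases hc : Close N (anc j k) (anc j l)
      · rw [if_pos (hc.half hN), if_pos hc, if_neg fun h => ((hr _ _).1 h).2 hc, add_zero]
      · by_cases hc' : Close N (fun i => anc j k i / 2) (fun i => anc j l i / 2)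
        · rw [if_pos hc', if_neg hc, if_pos ((hr _ _).2 ⟨hc', hc⟩), zero_add]
        · rw [if_neg hc', if_neg hc, if_neg fun h => hc' ((hr _ _).1 h).1, zero_add]
    simp only [h1]
    refine (lintegral_mono fun x => enorm_add_le _ _).trans ?_
    rw [lintegral_add_left (hGm j).enorm]
    refine add_le_add_right (lintegral_sum_sum_ite_le s (anc j) r
      (fun a b h => (hr _ _).2 ⟨((hr _ _).1 h).1.symm, fun h' => ((hr _ _).1 h).2 h'.symm⟩) hU
      (fun a _ => hKc _ a fun b h => ((hr _ _).1 h).1.of_half) fun a ha b hb hab => ?_) _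
    exact hbil j hj hjJ a b ((hr _ _).1 hab).2 ((hr _ _).1 hab).1.of_half _ (Finset.filter_subset _ _) _
      (Finset.filter_subset _ _) (hfib j a ha) (hfib j b hb)
      (fun k hk => (Finset.mem_filter.1 hk).2) fun k hk => (Finset.mem_filter.1 hk).2
  have hind : ∀ m, j₀ + m ≤ J → ∫⁻ x, ‖G (j₀ + m) x‖ₑ ∂μ ≤
      2 * K * (B₁ + m * B₂) * ∑ k ∈ s, e k := fun m => by
    induction m with
    | zero => intro _; simpa using hbase
    | succ m ih =>
      intro hm
      refine (hstep (j₀ + m) (by omega) (by omega)).trans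
        ((add_le_add_left (ih (by omega)) _).trans (le_of_eq ?_))
      push_cast
      ring
  have := hind (J - j₀) (by omega)
  rw [Nat.add_sub_cancel' hJ] at this
  refine le_trans (le_of_eq (lintegral_congr fun x => ?_)) this
  have : G J x = (∑ k ∈ s, U k x) * conj (∑ k ∈ s, U k x) := by
    rw [hG, map_sum, Finset.sum_mul_sum]
    refine Finset.sum_congr rfl fun k hk => Finset.sum_congr rfl fun l hl => ?_
    rw [if_pos]
    intro i
    rw [htop k hk l hl, sub_self, abs_zero]
    linarith
  rw [this, enorm_mul, RCLike.enorm_conj, sq]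

end Whitney

end Falconer

namespace Falconer

open MeasureTheory Metric Set Filter Topology Module
open scoped FourierTransform ENNReal NNReal Pointwise ComplexConjugate RealInnerProductSpace

set_option linter.unusedSectionVars false

section Cells

variable {d : ℕ}

lemma norm_le_of_coords {x : EuclideanSpace ℝ (Fin d)} {M : ℝ} (h : ∀ i, |x i| ≤ M) :
    ‖x‖ ≤ d * M := by
  rcases d.eq_zero_or_pos with rfl | hd
  · simp [EuclideanSpace.norm_eq]
  have hM : 0 ≤ M := (abs_nonneg _).trans (h ⟨0, hd⟩)
  rw [EuclideanSpace.norm_eq]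
  refine Real.sqrt_le_iff.2 ⟨by positivity, ?_⟩
  calc ∑ i, ‖x i‖ ^ 2 ≤ ∑ _i : Fin d, M ^ 2 := by
        gcongr with i; exact h i
    _ = d * M ^ 2 := by simp
    _ ≤ (d * M) ^ 2 := by
        rw [mul_pow]
        have : (1 : ℝ) ≤ d := by exact_mod_cast hd
        gcongr
        nlinarith

lemma anc_bounds (j : ℕ) (k : Fin d → ℤ) (i : Fin d) :
    (anc j k i : ℝ) * 2 ^ j ≤ k i ∧ (k i : ℝ) < (anc j k i + 1) * 2 ^ j := by
  have h1 := Int.ediv_mul_le (k i) (b := 2 ^ j) (by positivity)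
  have h2 := Int.lt_ediv_add_one_mul_self (k i) (b := 2 ^ j) (by positivity)
  exact ⟨by exact_mod_cast h1, by exact_mod_cast h2⟩

lemma anc_sub_le {j : ℕ} {k l : Fin d → ℤ} (i : Fin d) :
    |(k i : ℝ) - l i| ≤ (|(anc j k i : ℝ) - anc j l i| + 1) * 2 ^ j := by
  have hk := anc_bounds j k i
  have hl := anc_bounds j l i
  have h1 := le_abs_self ((anc j k i : ℝ) - anc j l i)
  have h2 := neg_abs_le ((anc j k i : ℝ) - anc j l i)
  have hp : (0 : ℝ) < 2 ^ j := by positivity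
  have e1 := mul_le_mul_of_nonneg_right h1 hp.le
  have e2 := mul_le_mul_of_nonneg_right h2 hp.le
  rw [abs_le]
  constructor <;> nlinarith

lemma le_anc_sub {j : ℕ} {k l : Fin d → ℤ} (i : Fin d) :
    (|(anc j k i : ℝ) - anc j l i| - 1) * 2 ^ j ≤ |(k i : ℝ) - l i| := by
  have hk := anc_bounds j k i
  have hl := anc_bounds j l i
  have h1 := le_abs_self ((k i : ℝ) - l i)
  have h2 := neg_abs_le ((k i : ℝ) - l i)
  have hp : (0 : ℝ) < 2 ^ j := by positivity
  rcases abs_cases ((anc j k i : ℝ) - anc j l i) with ⟨h, -⟩ | ⟨h, -⟩ <;> rw [h] <;> nlinarith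

lemma exists_sep (hd : 1 ≤ d) {s : Finset (Fin d → ℤ)} {ω : (Fin d → ℤ) → EuclideanSpace ℝ (Fin d)}
    {σ C : ℝ} (hσ : 0 < σ) (hω : ∀ k ∈ s, ∀ i, |σ * ω k i - k i| ≤ C) {j : ℕ}
    (hj : 2 * C ≤ 2 ^ j) {a b : Fin d → ℤ} (hab : ¬ Close (400 * d + 1) a b)
    (hab' : Close (2 * (400 * d + 1) + 1) a b) {t₁ t₂ : Finset (Fin d → ℤ)} (ht₁ : t₁ ⊆ s)
    (ht₂ : t₂ ⊆ s) (h₁ : t₁.Nonempty) (h₂ : t₂.Nonempty) (ha : ∀ k ∈ t₁, anc j k = a)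
    (hb : ∀ k ∈ t₂, anc j k = b) :
    ∃ Θ, Sep t₁ t₂ ω Θ ∧ 2 ^ j ≤ σ * Θ ∧ σ * Θ ≤ d * (800 * d + 5) * 2 ^ j := by
  have hd' : (1 : ℝ) ≤ d := by exact_mod_cast hd
  have hp : (0 : ℝ) < 2 ^ j := by positivity
  have key : ∀ k ∈ s, ∀ l ∈ s, ∀ i, |σ * (ω k i - ω l i) - (k i - l i)| ≤ 2 ^ j := by
    intro k hk l hl i
    have := abs_sub (σ * ω k i - k i) (σ * ω l i - l i)
    have h1 := hω k hk i
    have h2 := hω l hl i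
    rw [show σ * (ω k i - ω l i) - (k i - l i : ℝ) = (σ * ω k i - k i) - (σ * ω l i - l i) by ring]
    linarith
  have hup : ∀ k ∈ s, ∀ l ∈ s, ∀ m : ℝ, (∀ i, |(anc j k i : ℝ) - anc j l i| ≤ m) →
      σ * ‖ω k - ω l‖ ≤ d * (m + 2) * 2 ^ j := by
    intro k hk l hl m hm
    rw [← abs_of_pos hσ, ← Real.norm_eq_abs, ← norm_smul, mul_assoc]
    refine norm_le_of_coords fun i => ?_
    simp only [PiLp.smul_apply, PiLp.sub_apply, smul_eq_mul]
    have h1 := key k hk l hl i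
    have h2 := anc_sub_le (j := j) (k := k) (l := l) i
    have h3 := abs_sub_abs_le_abs_sub (σ * (ω k i - ω l i)) (k i - l i : ℝ)
    have h4 := mul_le_mul_of_nonneg_right (hm i) hp.le
    linarith
  have hnear : ∀ t ⊆ s, ∀ c, (∀ k ∈ t, anc j k = c) → ∀ k ∈ t, ∀ l ∈ t,
      σ * ‖ω k - ω l‖ ≤ 2 * d * 2 ^ j := by
    intro t ht c hc k hk l hl
    have := hup k (ht hk) l (ht hl) 0 fun i => by rw [hc k hk, hc l hl]; simp
    linarith
  have hacr : ∀ k ∈ t₁, ∀ l ∈ t₂, σ * ‖ω k - ω l‖ ≤ d * (800 * d + 5) * 2 ^ j := by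
    intro k hk l hl
    have := hup k (ht₁ hk) l (ht₂ hl) (800 * d + 3) fun i => by
      rw [ha k hk, hb l hl]
      have := hab' i
      have h' : |(a i : ℝ) - b i| ≤ 2 * (400 * d + 1) + 1 := by exact_mod_cast this
      linarith
    linarith
  have hlow : ∀ k ∈ t₁, ∀ l ∈ t₂, 400 * d * 2 ^ j ≤ σ * ‖ω k - ω l‖ := by
    intro k hk l hl
    obtain ⟨i, hi⟩ := not_forall.1 hab
    rw [not_le, Int.lt_iff_add_one_le] at hi
    have hi' : (400 * d + 1 + 1 : ℝ) ≤ |(a i : ℝ) - b i| := by exact_mod_cast hi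
    have h1 := key k (ht₁ hk) l (ht₂ hl) i
    have h2 := le_anc_sub (j := j) (k := k) (l := l) i
    rw [ha k hk, hb l hl] at h2
    have h3 := abs_sub_abs_le_abs_sub (k i - l i : ℝ) (σ * (ω k i - ω l i))
    rw [abs_sub_comm (k i - l i : ℝ)] at h3
    have h4 := mul_le_mul_of_nonneg_right hi' hp.le
    have h5 : |σ * (ω k i - ω l i)| ≤ σ * ‖ω k - ω l‖ := by
      rw [abs_mul, abs_of_pos hσ]
      exact mul_le_mul_of_nonneg_left (PiLp.norm_apply_le (ω k - ω l) i) hσ.le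
    linarith
  obtain ⟨k₀, hk₀⟩ := h₁
  obtain ⟨l₀, hl₀⟩ := h₂
  have hΘ := hlow k₀ hk₀ l₀ hl₀
  set Θ := ‖ω k₀ - ω l₀‖ with hΘe
  have hn : ∀ t ⊆ s, ∀ c, (∀ k ∈ t, anc j k = c) → ∀ k ∈ t, ∀ l ∈ t,
      ‖ω k - ω l‖ ≤ 1 / 200 * Θ := by
    intro t ht c hc k hk l hl
    have := hnear t ht c hc k hk l hl
    refine le_of_mul_le_mul_left ?_ hσ
    linarith
  have hΘ0 : 0 ≤ Θ := norm_nonneg _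
  refine ⟨Θ, ⟨fun k hk l hl => ?_, fun k hk l hl => ?_, fun k hk l hl => ?_, fun k hk l hl => ?_⟩,
    ?_, hacr _ hk₀ _ hl₀⟩
  · linarith [hn t₁ ht₁ a ha k hk l hl]
  · linarith [hn t₂ ht₂ b hb k hk l hl]
  · have h1 := hn t₁ ht₁ a ha k₀ hk₀ k hk
    have h2 := hn t₂ ht₂ b hb l hl l₀ hl₀
    have : Θ ≤ ‖ω k₀ - ω k‖ + ‖ω k - ω l‖ + ‖ω l - ω l₀‖ := by
      rw [hΘe, show ω k₀ - ω l₀ = (ω k₀ - ω k) + (ω k - ω l) + (ω l - ω l₀) by abel]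
      exact norm_add₃_le
    linarith
  · have h1 := hn t₁ ht₁ a ha k hk k₀ hk₀
    have h2 := hn t₂ ht₂ b hb l₀ hl₀ l hl
    have : ‖ω k - ω l‖ ≤ ‖ω k - ω k₀‖ + Θ + ‖ω l₀ - ω l‖ := by
      rw [hΘe, show ω k - ω l = (ω k - ω k₀) + (ω k₀ - ω l₀) + (ω l₀ - ω l) by abel]
      exact norm_add₃_le
    linarith
  · nlinarith

lemma exists_multiscale_bound (hd : 1 ≤ d) : ∃ K : ℝ≥0, ∀ {R C : ℝ} {s : Finset (Fin d → ℤ)}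
    {ω : (Fin d → ℤ) → EuclideanSpace ℝ (Fin d)} {U : (Fin d → ℤ) → EuclideanSpace ℝ (Fin d) → ℂ},
    Fam R C s ω U → 1 ≤ R → C ≤ √R → (∀ k ∈ s, ∀ i, |√R * ω k i - k i| ≤ C) →
    ∀ {j₀ J : ℕ}, j₀ ≤ J → 2 * C ≤ 2 ^ j₀ → 2 ^ J * (2 * (d * (800 * d + 5))) ≤ √R →
    √R ≤ 2 ^ J * (4 * (d * (800 * d + 5))) →
    ∀ {μ : Measure (EuclideanSpace ℝ (Fin d))} {B₁ B₂ : ℝ≥0∞},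
    (∀ t ⊆ s, (∀ k ∈ t, ∀ l ∈ t, anc j₀ k = anc j₀ l) →
      ∫⁻ x, ‖∑ k ∈ t, U k x‖ₑ ^ 2 ∂μ ≤ B₁ * ∑ k ∈ t, ∫⁻ x, ‖U k x‖ₑ ^ 2) →
    (∀ t₁ ⊆ s, ∀ t₂ ⊆ s, ∀ Θ, Sep t₁ t₂ ω Θ → 2 ^ j₀ ≤ √R * Θ → Θ ≤ 1 / 2 →
      ∫⁻ x, ‖∑ k ∈ t₁, U k x‖ₑ * ‖∑ l ∈ t₂, U l x‖ₑ ∂μ ≤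
        B₂ * ((∑ k ∈ t₁, ∫⁻ x, ‖U k x‖ₑ ^ 2) + ∑ l ∈ t₂, ∫⁻ x, ‖U l x‖ₑ ^ 2)) →
    ∫⁻ x, ‖∑ k ∈ s, U k x‖ₑ ^ 2 ∂μ ≤ K * (B₁ + J * B₂) * ∑ k ∈ s, ∫⁻ x, ‖U k x‖ₑ ^ 2 := by
  classical
  have hd' : (1 : ℝ) ≤ d := by exact_mod_cast hd
  set m : ℝ := d * (800 * d + 5) with hm
  have hm1 : 1 ≤ m := by nlinarith
  set K₁ : ℝ := (2 * (8 * m + 1) + 1) ^ d with hK₁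
  refine ⟨K₁.toNNReal * (2 * ((4 * (400 * d + 1 : ℤ) + 3 : ℝ) ^ d).toNNReal), ?_⟩
  intro R C s ω U hU hR hC hω j₀ J hJ hj₀ hJ1 hJ2 μ B₁ B₂ hn hb
  have hσ1 : 1 ≤ √R := Real.one_le_sqrt.2 hR
  have hσ : 0 < √R := by linarith
  have hmeas : ∀ k ∈ s, Measurable (U k) := fun k hk => (hU.pw k hk).cont.measurable
  set Q := s.image (anc J) with hQ
  have hQc : (Q.card : ℝ≥0∞) ≤ ENNReal.ofReal K₁ := by
    rw [← ENNReal.ofReal_natCast]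
    refine ENNReal.ofReal_le_ofReal
      (card_le_of_coords Q 0 (by positivity : 0 ≤ 8 * m + 1) fun a ha i => ?_)
    obtain ⟨k, hk, rfl⟩ := Finset.mem_image.1 ha
    have h1 := anc_bounds J k i
    have h2 := abs_le.1 (hω k hk i)
    have h3 := PiLp.norm_apply_le (ω k) i
    rw [hU.unit k hk, Real.norm_eq_abs] at h3
    have h4 := abs_le.1 h3
    have hp : (0 : ℝ) < 2 ^ J := by positivity
    have h5 : √R * ω k i ≤ √R := by nlinarith
    have h6 : -√R ≤ √R * ω k i := by nlinarith
    simp only [Pi.zero_apply, sub_zero]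
    rw [abs_le]
    constructor
    · refine le_of_mul_le_mul_right (a := 2 ^ J) ?_ hp
      nlinarith
    · refine le_of_mul_le_mul_right (a := 2 ^ J) ?_ hp
      nlinarith
  set V : (Fin d → ℤ) → EuclideanSpace ℝ (Fin d) → ℂ := fun a x =>
    ∑ k ∈ s with anc J k = a, U k x with hV
  have hVb : ∀ a, ∫⁻ x, ‖V a x‖ₑ ^ 2 ∂μ ≤ 2 *
      (((4 * (400 * d + 1 : ℤ) + 3 : ℝ) ^ d).toNNReal : ℝ≥0) * (B₁ + J * B₂) *
      ∑ k ∈ s with anc J k = a, ∫⁻ x, ‖U k x‖ₑ ^ 2 := fun a => by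
    have hsub := Finset.filter_subset (fun k => anc J k = a) s
    refine (lintegral_whitney_le (N := 400 * d + 1) (B₁ := B₁) (B₂ := B₂)
      (e := fun k => ∫⁻ x, ‖U k x‖ₑ ^ 2) (by omega)
      (fun k hk => hmeas k (hsub hk)) hJ (fun k hk l hl => (Finset.mem_filter.1 hk).2.trans
        (Finset.mem_filter.1 hl).2.symm) (fun t ht => hn t (ht.trans hsub)) ?_).trans ?_
    · intro j hj hjJ a' b' hab hab' t₁ ht₁ t₂ ht₂ hne₁ hne₂ ha' hb'
      have hpj : (2 : ℝ) ^ j₀ ≤ 2 ^ j := pow_le_pow_right₀ one_le_two hj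
      have hpJ : (2 : ℝ) ^ j ≤ 2 ^ J := pow_le_pow_right₀ one_le_two hjJ.le
      obtain ⟨Θ, hΘ, hΘ1, hΘ2⟩ := exists_sep hd hσ hω (hj₀.trans hpj) hab hab' (ht₁.trans hsub)
        (ht₂.trans hsub) hne₁ hne₂ ha' hb'
      refine hb t₁ (ht₁.trans hsub) t₂ (ht₂.trans hsub) Θ hΘ (hpj.trans hΘ1) ?_
      refine le_of_mul_le_mul_left ?_ hσ
      rw [← hm] at hΘ2
      have := mul_le_mul_of_nonneg_left hpJ (by linarith : 0 ≤ m)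
      linarith
    · push_cast
      gcongr
      exact tsub_le_self
  calc _ ≤ ∫⁻ x, Q.card * ∑ a ∈ Q, ‖V a x‖ₑ ^ 2 ∂μ := by
        refine lintegral_mono fun x => ?_
        dsimp only
        rw [← Finset.sum_fiberwise_of_maps_to (t := Q) (g := anc J)
          fun k hk => Finset.mem_image_of_mem _ hk]
        exact le_trans (by gcongr; exact enorm_sum_le _ _) (sum_enorm_sq_le _ _)
    _ = Q.card * ∑ a ∈ Q, ∫⁻ x, ‖V a x‖ₑ ^ 2 ∂μ := by
        have hVm : ∀ a, Measurable fun x => ‖V a x‖ₑ ^ 2 := fun a =>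
          (Finset.measurable_fun_sum _ fun k hk =>
            hmeas k (Finset.mem_filter.1 hk).1).enorm.pow_const 2
        rw [lintegral_const_mul _ (Finset.measurable_fun_sum _ fun a _ => hVm a),
          lintegral_finsetSum _ fun a _ => hVm a]
    _ ≤ ENNReal.ofReal K₁ * ∑ a ∈ Q, 2 *
      (((4 * (400 * d + 1 : ℤ) + 3 : ℝ) ^ d).toNNReal : ℝ≥0) * (B₁ + J * B₂) *
      ∑ k ∈ s with anc J k = a, ∫⁻ x, ‖U k x‖ₑ ^ 2 := by
        gcongr with a _
        exact hVb a
    _ = _ := by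
        rw [← Finset.mul_sum, Finset.sum_fiberwise_of_maps_to
          (fun k hk => Finset.mem_image_of_mem _ hk), ENNReal.coe_mul, ENNReal.coe_mul,
          ENNReal.coe_ofNat]
        simp only [← mul_assoc]
        rfl

end Cells

end Falconer

namespace Falconer

open MeasureTheory Metric Set Filter Topology Module
open scoped FourierTransform ENNReal NNReal Pointwise ComplexConjugate RealInnerProductSpace

set_option linter.unusedSectionVars false

section Step

variable {d : ℕ}

lemma exists_narrow_bound (hd : 1 ≤ d) {C α : ℝ} (hC : 1 ≤ C) :
    ∃ B : ℝ≥0, ∀ {ν : Measure (EuclideanSpace ℝ (Fin d))}, IsFiniteMeasure ν → HasPow α ν →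
    ∀ {R : ℝ} {s : Finset (Fin d → ℤ)} {ω : (Fin d → ℤ) → EuclideanSpace ℝ (Fin d)}
      {U : (Fin d → ℤ) → EuclideanSpace ℝ (Fin d) → ℂ},
    Fam R C s ω U → 1 ≤ R → (∀ k ∈ s, ∀ i, |√R * ω k i - k i| ≤ C) →
    ∀ {j : ℕ}, 2 * C ≤ 2 ^ j → (∀ k ∈ s, ∀ l ∈ s, anc j k = anc j l) →
    ∫⁻ x, ‖∑ k ∈ s, U k x‖ₑ ^ 2 ∂ν ≤
      B * ENNReal.ofReal ((√R * 2 ^ j) ^ ((d : ℝ) - α)) * ∑ k ∈ s, ∫⁻ x, ‖U k x‖ₑ ^ 2 := by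
  have : NeZero d := ⟨by omega⟩
  obtain ⟨B, hB⟩ := exists_ball_bound (E := EuclideanSpace ℝ (Fin d)) (α := α)
  have hd' : (1 : ℝ) ≤ d := by exact_mod_cast hd
  set n := finrank ℝ (EuclideanSpace ℝ (Fin d)) with hn
  have hnd : n = d := by simp [hn]
  refine ⟨B * (Real.toNNReal ((3 * d) ^ ((d : ℝ) - α))) * (2 * (C * (2 * C) ^ n).toNNReal), ?_⟩
  intro ν _ hν R s ω U hU hR hω j hj hanc
  have hσ1 : 1 ≤ √R := Real.one_le_sqrt.2 hR
  have hσ : 0 < √R := by linarith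
  have hσR : √R * √R = R := Real.mul_self_sqrt (by linarith)
  rcases s.eq_empty_or_nonempty with rfl | ⟨l, hl⟩
  · simp
  have h2j : (0 : ℝ) < 2 ^ j := by positivity
  have hcell : ∀ k ∈ s, plate R C (ω k) ⊆ closedBall (R • ω l) (3 * d * (√R * 2 ^ j)) := by
    intro k hk ξ hξ
    have h1 : ‖√R • (ω k - ω l)‖ ≤ d * (2 * 2 ^ j) := by
      refine norm_le_of_coords fun i => ?_
      have h2 := abs_le.1 (hω k hk i)
      have h3 := abs_le.1 (hω l hl i)
      have h4 := anc_bounds j k i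
      have h5 := anc_bounds j l i
      rw [hanc k hk l hl] at h4
      simp only [PiLp.smul_apply, PiLp.sub_apply, smul_eq_mul, mul_sub]
      rw [abs_le]
      constructor <;> linarith [h4.1, h4.2, h5.1, h5.2]
    have h2 : ‖R • ω k - R • ω l‖ ≤ √R * (d * (2 * 2 ^ j)) := by
      have h3 : R • ω k - R • ω l = √R • √R • (ω k - ω l) := by rw [← smul_sub, smul_smul, hσR]
      rw [h3, norm_smul, Real.norm_of_nonneg hσ.le]
      exact mul_le_mul_of_nonneg_left h1 hσ.le
    rw [mem_closedBall, dist_eq_norm]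
    have h3 := hξ.1
    have h4 : ξ - R • ω l = (ξ - R • ω k) + (R • ω k - R • ω l) := by abel
    rw [h4]
    refine (norm_add_le _ _).trans ?_
    have h5 : C * √R ≤ d * (√R * 2 ^ j) := by
      have : C ≤ 2 ^ j := by linarith
      calc C * √R ≤ 1 * (√R * 2 ^ j) := by nlinarith
        _ ≤ _ := by gcongr
    linarith
  have hpw : PW (closedBall (R • ω l) (3 * d * (√R * 2 ^ j))) (fun x => ∑ k ∈ s, U k x) := by
    have := PW.sum s (fun k hk => (hU.pw k hk).mono (hcell k hk))
    convert this using 1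
  have h1 := hB ν inferInstance hν (by positivity : 0 < 3 * d * (√R * 2 ^ j)) hpw subset_rfl
  refine h1.trans ?_
  have h2 := hU.lintegral_sum_sq_le hC
  rw [hnd, Real.mul_rpow (by positivity) (by positivity), ENNReal.ofReal_mul (by positivity)]
  rw [finrank_euclideanSpace, Fintype.card_fin] at h2
  refine (mul_le_mul_right h2 _).trans (le_of_eq ?_)
  push_cast
  change _ = (B : ℝ≥0∞) * ENNReal.ofReal _ * _ * _ * _
  ring

lemma exists_shellBound_of_le (hd : 1 ≤ d) {α γ : ℝ} (hα : α ≤ d) (hγ : 0 ≤ γ) {R₀ : ℝ} {A : ℝ≥0}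
    (h : ∀ R ≥ R₀, 1 < R → ∀ ν : Measure (EuclideanSpace ℝ (Fin d)), IsFiniteMeasure ν →
      HasPow α ν → ∀ x₀ u, PW (shell _ R 1) u →
      ∫⁻ x in closedBall x₀ 1, ‖u x‖ₑ ^ 2 ∂ν ≤ A * ENNReal.ofReal (R ^ γ) * ∫⁻ x, ‖u x‖ₑ ^ 2) :
    ∃ A', ShellBound (EuclideanSpace ℝ (Fin d)) α γ A' := by
  have : NeZero d := ⟨by omega⟩
  obtain ⟨A₁, hA₁⟩ := exists_shellBound_trivial (E := EuclideanSpace ℝ (Fin d)) (α := α)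
    (by simpa using hα)
  set R₁ := max R₀ 2
  refine ⟨A + A₁ * (R₁ ^ (finrank ℝ (EuclideanSpace ℝ (Fin d)) - α)).toNNReal, ?_⟩
  intro R hR ν hν hp x₀ u hu
  have hR1 : ENNReal.ofReal 1 ≤ ENNReal.ofReal (R ^ γ) :=
    ENNReal.ofReal_le_ofReal (Real.one_le_rpow hR hγ)
  rw [ENNReal.ofReal_one] at hR1
  push_cast
  rcases le_total R₁ R with h1 | h1
  · refine (h R ((le_max_left _ _).trans h1) (by linarith [le_max_right R₀ 2]) ν hν hp x₀ u hu).trans ?_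
    gcongr
    exact le_self_add
  · refine (hA₁ R hR ν hν hp x₀ u hu).trans ?_
    refine mul_le_mul_left ?_ _
    rw [add_mul]
    refine le_add_left ?_
    change _ ≤ A₁ * ENNReal.ofReal _ * _
    refine le_trans ?_ (le_mul_of_one_le_right' hR1)
    gcongr
    rw [finrank_euclideanSpace, Fintype.card_fin]
    linarith

lemma exists_two_pow_near {x : ℝ} (hx : 1 ≤ x) : ∃ j : ℕ, (2 : ℝ) ^ j ≤ x ∧ x ≤ 2 ^ j * 2 := by
  obtain ⟨j, h1, h2⟩ := exists_nat_pow_near hx (one_lt_two)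
  exact ⟨j, h1, by rw [pow_succ] at h2; exact h2.le⟩

lemma sqrt_rpow_le {R Θ ε α φ : ℝ} (hd : 1 ≤ d) (hR : 1 ≤ R) (hΘ : R ^ (-φ) ≤ Θ) :
    (R ^ ε) ^ d * √(R ^ (d - α) * √R ^ (d - 1) * ((R ^ ε) ^ (2 * d + 3) * (√R)⁻¹ / Θ)) ≤
      R ^ (ε * d + ((d - α) + (d - 1) / 2 + ε * (2 * d + 3) - 1 / 2 + φ) / 2) := by
  have hR0 : 0 < R := by linarith
  have hΘ0 : 0 < Θ := (Real.rpow_pos_of_pos hR0 _).trans_le hΘ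
  have h1 : Θ⁻¹ ≤ R ^ φ := by
    rw [inv_le_comm₀ hΘ0 (Real.rpow_pos_of_pos hR0 _), ← Real.rpow_neg hR0.le]
    exact hΘ
  have h2 : R ^ (d - α) * √R ^ (d - 1) * ((R ^ ε) ^ (2 * d + 3) * (√R)⁻¹ / Θ) ≤
      R ^ ((d - α) + (d - 1) / 2 + ε * (2 * d + 3) - 1 / 2 + φ) := by
    have h3 : √R ^ (d - 1) = R ^ (((d : ℝ) - 1) / 2) := by
      rw [Real.sqrt_eq_rpow, ← Real.rpow_natCast, ← Real.rpow_mul hR0.le, Nat.cast_sub hd]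
      congr 1
      push_cast
      ring
    have h4 : (R ^ ε) ^ (2 * d + 3) = R ^ (ε * (2 * d + 3)) := by
      rw [← Real.rpow_natCast, ← Real.rpow_mul hR0.le]
      push_cast
      rfl
    have h5 : (√R)⁻¹ = R ^ (-(1 / 2) : ℝ) := by
      rw [Real.sqrt_eq_rpow, ← Real.rpow_neg hR0.le]
    rw [h3, h4, h5]
    rw [div_eq_mul_inv _ Θ]
    calc _ ≤ R ^ (d - α) * R ^ (((d : ℝ) - 1) / 2) * (R ^ (ε * (2 * d + 3)) * R ^ (-(1 / 2) : ℝ) *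
          R ^ φ) := by gcongr
      _ = _ := by
        simp only [← Real.rpow_add hR0]
        congr 1
        ring
  have h3 : (R ^ ε) ^ d = R ^ (ε * d) := by
    rw [← Real.rpow_natCast, ← Real.rpow_mul hR0.le]
  calc _ ≤ R ^ (ε * d) * √(R ^ ((d - α) + (d - 1) / 2 + ε * (2 * d + 3) - 1 / 2 + φ)) := by
        rw [h3]
        gcongr
    _ = _ := by
      rw [Real.sqrt_eq_rpow, ← Real.rpow_mul hR0.le, ← Real.rpow_add hR0]
      congr 1
      ring

lemma eventually_le_rpow {c a : ℝ} (ha : 0 < a) : ∀ᶠ R : ℝ in atTop, c ≤ R ^ a :=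
  (tendsto_rpow_atTop ha).eventually_ge_atTop c

set_option maxHeartbeats 1000000 in
lemma exists_shellBound_improve (hd : 3 ≤ d) {α γ : ℝ} (hα : (d : ℝ) / 2 + 5 / 12 < α) (hα' : α < d / 2 + 1 / 2)
    (hγ : α - 51 / 50 ≤ γ) {ε : ℝ} (hε : ε = 1 / (1000 * d)) {A : ℝ≥0}
    (hA : ShellBound (EuclideanSpace ℝ (Fin d)) α γ A) :
    ∃ A', ShellBound (EuclideanSpace ℝ (Fin d)) α (max (γ - 3 / 10 * ε) (α - 51 / 50)) A' := by
  have : NeZero d := ⟨by omega⟩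
  have hd3 : (3 : ℝ) ≤ d := by exact_mod_cast hd
  have hε0 : 0 < ε := by rw [hε]; positivity
  have hεd : ε * d = 1 / 1000 := by rw [hε]; field_simp
  have hε3 : ε ≤ 1 / 3000 := by nlinarith
  obtain ⟨C, hC, hcells⟩ := exists_cells d
  obtain ⟨K, hK⟩ := exists_multiscale_bound (d := d) (by omega)
  obtain ⟨B, hB⟩ := exists_narrow_bound (d := d) (C := C) (α := α) (by omega) hC
  set N := 1000 * d * (d + 1) with hN
  obtain ⟨D, hD⟩ := exists_bilinear_bound (E := EuclideanSpace ℝ (Fin d)) N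
    (by rw [finrank_euclideanSpace, Fintype.card_fin]; nlinarith) (C₀ := C) (α := α) (γ := γ) hC
    (by linarith) (by rw [finrank_euclideanSpace, Fintype.card_fin]; linarith)
  set γ' := max (γ - 3 / 10 * ε) (α - 51 / 50) with hγ'
  set m : ℝ := d * (800 * d + 5) with hm
  have hm0 : 0 < m := by positivity
  have hev : ∀ᶠ R : ℝ in atTop, 2 * C ≤ R ^ (8 / 25 : ℝ) ∧ 16 * m ≤ R ^ (9 / 50 : ℝ) ∧
      100 * C ^ 2 ≤ R ^ ε ∧ 100 ≤ R ^ (8 / 25 - 2 * ε) ∧ 1 < R :=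
    (eventually_le_rpow (by norm_num)).and ((eventually_le_rpow (by norm_num)).and
      ((eventually_le_rpow hε0).and ((eventually_le_rpow (by linarith)).and (eventually_gt_atTop 1))))
  obtain ⟨R₀, hR₀⟩ := eventually_atTop.1 hev
  set L : ℝ := 1 / (ε / 10 * Real.log 2) with hL
  refine exists_shellBound_of_le (by omega) (by linarith) (γ := γ') (R₀ := R₀)
    (A := K * (B * ((2 : ℝ) ^ ((d : ℝ) - α)).toNNReal + L.toNNReal * (D * (A + 1))))
    (le_max_of_le_right (by linarith)) ?_
  intro R hRR hR1 ν hν hp x₀ u hu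
  obtain ⟨e1, e2, e3, e4, -⟩ := hR₀ R hRR
  have hR0 : 0 < R := by linarith
  have hσ1 : 1 ≤ √R := Real.one_le_sqrt.2 hR1.le
  have hσ : 0 < √R := by linarith
  have hσR : √R * √R = R := Real.mul_self_sqrt (by linarith)
  have hσp : √R = R ^ (8 / 25 : ℝ) * R ^ (9 / 50 : ℝ) := by
    rw [Real.sqrt_eq_rpow, ← Real.rpow_add hR0]; norm_num
  have hR8 : 1 ≤ R ^ (8 / 25 : ℝ) := Real.one_le_rpow hR1.le (by norm_num)
  have hR9 : 1 ≤ R ^ (9 / 50 : ℝ) := Real.one_le_rpow hR1.le (by norm_num)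
  obtain ⟨s, ω, U, hU, hω, hsum, hle⟩ := hcells R hR1 u hu
  have hω' : ∀ k ∈ s, ∀ i, |√R * ω k i - k i| ≤ C := by
    intro k hk i
    have h1 := hω k hk i
    have h2 : R * ω k i - √R * k i = √R * (√R * ω k i - k i) := by
      rw [mul_sub, ← mul_assoc, hσR]
    rw [h2, abs_mul, abs_of_pos hσ, mul_comm] at h1
    exact le_of_mul_le_mul_right h1 hσ
  obtain ⟨j₀, hj1, hj2⟩ := exists_two_pow_near (x := 2 * R ^ (8 / 25 : ℝ)) (by linarith)
  have hj3 : R ^ (8 / 25 : ℝ) ≤ 2 ^ j₀ := by linarith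
  have hmσ : 16 * m * R ^ (8 / 25 : ℝ) ≤ √R := by
    rw [hσp, mul_comm]; gcongr
  obtain ⟨J, hJ1, hJ2⟩ := exists_two_pow_near (x := √R / (2 * m)) (by
    rw [le_div_iff₀ (by positivity)]
    nlinarith)
  rw [le_div_iff₀ (by positivity)] at hJ1
  rw [div_le_iff₀ (by positivity)] at hJ2
  have hJj : j₀ ≤ J := by
    have h1 : (2 : ℝ) ^ j₀ ≤ 2 ^ J := by
      refine hj1.trans ?_
      have : m * (2 * R ^ (8 / 25 : ℝ)) ≤ m * 2 ^ J := by nlinarith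
      exact le_of_mul_le_mul_left this hm0
    exact (pow_le_pow_iff_right₀ (one_lt_two)).1 h1
  have hJL : (J : ℝ) ≤ L * R ^ (ε / 10) := by
    have h1 : (2 : ℝ) ^ J ≤ R := by
      have : (1 : ℝ) ≤ 2 * m := by nlinarith
      have h2J : (0 : ℝ) < 2 ^ J := by positivity
      nlinarith
    have h2 := Real.log_le_log (by positivity) h1
    rw [Real.log_pow] at h2
    have h3 := Real.log_le_rpow_div hR0.le (by positivity : 0 < ε / 10)
    have hl : 0 < Real.log 2 := Real.log_pos one_lt_two
    rw [hL, div_mul_eq_mul_div, one_mul, ← div_div, le_div_iff₀ hl]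
    exact h2.trans h3
  have hmain := hK hU hR1.le (by nlinarith) hω' hJj (by linarith) (by linarith) (by linarith)
    (μ := ν.restrict (closedBall x₀ 1)) (B₁ := B * ENNReal.ofReal ((√R * 2 ^ j₀) ^ ((d : ℝ) - α)))
    (B₂ := D * (A * ENNReal.ofReal (R ^ γ * (R ^ ε) ^ (-2 / 5 : ℝ)) + ENNReal.ofReal
      (R ^ (ε * d + ((d - α) + (d - 1) / 2 + ε * (2 * d + 3) - 1 / 2 + 9 / 50) / 2))))
    (fun t ht hanc => (setLIntegral_le_lintegral _ _).trans
      (hB hν hp (hU.subset ht) hR1.le (fun k hk => hω' k (ht hk)) (by linarith) hanc)) ?_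
  · simp_rw [hsum]
    refine hmain.trans (mul_le_mul' ?_ (by simpa [hsum] using hle))
    push_cast
    rw [mul_assoc]
    gcongr
    rw [add_mul]
    refine add_le_add ?_ ?_
    · rw [mul_assoc]
      gcongr
      change _ ≤ ENNReal.ofReal _ * ENNReal.ofReal _
      rw [← ENNReal.ofReal_mul (by positivity)]
      refine ENNReal.ofReal_le_ofReal ?_
      calc (√R * 2 ^ j₀) ^ ((d : ℝ) - α)
          ≤ (R ^ (1 / 2 : ℝ) * (2 * R ^ (8 / 25 : ℝ))) ^ ((d : ℝ) - α) := by
            rw [Real.sqrt_eq_rpow]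
            refine Real.rpow_le_rpow (by positivity) (by gcongr) (by linarith)
        _ = 2 ^ ((d : ℝ) - α) * R ^ (41 / 50 * ((d : ℝ) - α)) := by
            rw [Real.rpow_mul hR0.le, ← Real.mul_rpow (by positivity) (by positivity)]
            congr 1
            rw [mul_left_comm, ← Real.rpow_add hR0]
            norm_num
        _ ≤ _ := by
            gcongr
            · exact hR1.le
            · exact le_max_of_le_right (by linarith)
    · rw [mul_left_comm, mul_assoc, mul_left_comm]
      have hJ' : (J : ℝ≥0∞) ≤ (L.toNNReal : ℝ≥0∞) * ENNReal.ofReal (R ^ (ε / 10)) := by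
        change _ ≤ ENNReal.ofReal _ * _
        rw [← ENNReal.ofReal_mul (by positivity), ← ENNReal.ofReal_natCast]
        exact ENNReal.ofReal_le_ofReal hJL
      have hp1 : ENNReal.ofReal (R ^ (ε / 10)) *
          ENNReal.ofReal (R ^ γ * (R ^ ε) ^ (-2 / 5 : ℝ)) ≤ ENNReal.ofReal (R ^ γ') := by
        rw [← ENNReal.ofReal_mul (by positivity), ← Real.rpow_mul hR0.le, ← Real.rpow_add hR0,
          ← Real.rpow_add hR0]
        exact ENNReal.ofReal_le_ofReal (Real.rpow_le_rpow_of_exponent_le hR1.le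
          (le_max_of_le_left (by linarith)))
      have hp2 : ENNReal.ofReal (R ^ (ε / 10)) * ENNReal.ofReal (R ^ (ε * d + ((d - α) + (d - 1) / 2
          + ε * (2 * d + 3) - 1 / 2 + 9 / 50) / 2)) ≤ ENNReal.ofReal (R ^ γ') := by
        rw [← ENNReal.ofReal_mul (by positivity), ← Real.rpow_add hR0]
        refine ENNReal.ofReal_le_ofReal (Real.rpow_le_rpow_of_exponent_le hR1.le
          (le_max_of_le_right ?_))
        nlinarith
      set P := ENNReal.ofReal (R ^ (ε / 10))
      set X := ENNReal.ofReal (R ^ γ * (R ^ ε) ^ (-2 / 5 : ℝ))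
      set Y := ENNReal.ofReal (R ^ (ε * d + ((d - α) + (d - 1) / 2
          + ε * (2 * d + 3) - 1 / 2 + 9 / 50) / 2))
      set Z := ENNReal.ofReal (R ^ γ')
      calc J * (D * (A * X + Y)) ≤ (L.toNNReal * P) * (D * (A * X + Y)) := by gcongr
        _ = D * (L.toNNReal * (A * (P * X) + P * Y)) := by ring
        _ ≤ D * (L.toNNReal * (A * Z + Z)) := by gcongr
        _ = _ := by ring
  · intro t₁ ht₁ t₂ ht₂ Θ hS hΘ hΘ'
    have hΘR : R ^ (-(9 / 50) : ℝ) ≤ Θ := by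
      have h1 : √R * R ^ (-(9 / 50) : ℝ) ≤ √R * Θ := by
        refine le_trans ?_ (hj3.trans hΘ)
        rw [Real.sqrt_eq_rpow, ← Real.rpow_add hR0]
        norm_num
      exact le_of_mul_le_mul_left h1 hσ
    have hΘ0 : 0 < Θ := (Real.rpow_pos_of_pos hR0 _).trans_le hΘR
    have hb := hD hA hν hp (hU.subset ht₁) (hU.subset ht₂) hS hR1.le hΘ0 hΘ' (H := R ^ ε)
      (Real.one_le_rpow hR1.le hε0.le) e3 ?_ ?_ x₀
    · refine hb.trans ?_
      gcongr
      rw [finrank_euclideanSpace, Fintype.card_fin]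
      exact sqrt_rpow_le (by omega) hR1.le hΘR
    · refine le_trans ?_ hΘR
      have h1 : 100 * ((√R)⁻¹ * (R ^ ε) ^ 2) ≤ R ^ (8 / 25 - 2 * ε) * ((√R)⁻¹ * (R ^ ε) ^ 2) := by
        gcongr
      refine h1.trans (le_of_eq ?_)
      rw [Real.sqrt_eq_rpow, ← Real.rpow_neg hR0.le, ← Real.rpow_natCast, ← Real.rpow_mul hR0.le,
        ← Real.rpow_add hR0, ← Real.rpow_add hR0]
      congr 1
      push_cast
      ring
    · rw [finrank_euclideanSpace, Fintype.card_fin, Real.sqrt_eq_rpow, ← Real.rpow_natCast,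
        ← Real.rpow_natCast, ← Real.rpow_mul hR0.le, ← Real.rpow_mul hR0.le]
      refine Real.rpow_le_rpow_of_exponent_le hR1.le ?_
      rw [hN]
      push_cast
      have : ε * (1000 * d * (d + 1)) = d + 1 := by
        calc ε * (1000 * d * (d + 1)) = ε * d * (1000 * (d + 1)) := by ring
          _ = _ := by rw [hεd]; ring
      rw [this]
      linarith

theorem exists_shellBound (hd : 3 ≤ d) {α : ℝ} (hα : (d : ℝ) / 2 + 5 / 12 < α)
    (hα' : α < d / 2 + 1 / 2) :
    ∃ A, ShellBound (EuclideanSpace ℝ (Fin d)) α (α - 51 / 50) A := by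
  have : NeZero d := ⟨by omega⟩
  have hd3 : (3 : ℝ) ≤ d := by exact_mod_cast hd
  set ε : ℝ := 1 / (1000 * d) with hε
  have hε0 : 0 < ε := by positivity
  have hiter : ∀ k : ℕ, ∃ A, ShellBound (EuclideanSpace ℝ (Fin d)) α
      (max (d - α - k * (3 / 10 * ε)) (α - 51 / 50)) A := by
    intro k
    induction k with
    | zero =>
      obtain ⟨A, hA⟩ := exists_shellBound_trivial (E := EuclideanSpace ℝ (Fin d)) (α := α)
        (by rw [finrank_euclideanSpace, Fintype.card_fin]; linarith)
      refine ⟨A, fun R hR ν hν hp x₀ u hu => (hA R hR ν hν hp x₀ u hu).trans ?_⟩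
      refine mul_le_mul_left (mul_le_mul_right (ENNReal.ofReal_le_ofReal
        (Real.rpow_le_rpow_of_exponent_le hR ?_)) _) _
      rw [finrank_euclideanSpace, Fintype.card_fin]
      exact le_max_of_le_left (by simp)
    | succ k ih =>
      obtain ⟨A, hA⟩ := ih
      obtain ⟨A', hA'⟩ := exists_shellBound_improve hd hα hα' (le_max_right _ _) hε hA
      refine ⟨A', fun R hR ν hν hp x₀ u hu => (hA' R hR ν hν hp x₀ u hu).trans ?_⟩
      refine mul_le_mul_left (mul_le_mul_right (ENNReal.ofReal_le_ofReal
        (Real.rpow_le_rpow_of_exponent_le hR ?_)) _) _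
      · refine max_le ?_ (le_max_right _ _)
        rw [sub_le_iff_le_add]
        refine max_le ?_ ?_
        · rw [← sub_le_iff_le_add]
          refine le_max_of_le_left (le_of_eq ?_)
          push_cast
          ring
        · have := le_max_right (d - α - (k + 1 : ℕ) * (3 / 10 * ε)) (α - 51 / 50)
          linarith
  obtain ⟨k, hk⟩ := exists_nat_ge ((d : ℝ) / (3 / 10 * ε))
  rw [div_le_iff₀ (by positivity)] at hk
  obtain ⟨A, hA⟩ := hiter k
  rw [max_eq_right (by linarith)] at hA
  exact ⟨A, hA⟩

end Step

end Falconer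

namespace Falconer

open MeasureTheory Metric Set Filter Topology Module
open scoped FourierTransform ENNReal NNReal Pointwise ComplexConjugate RealInnerProductSpace

set_option linter.unusedSectionVars false

section Greedy

variable {κ β : Type*} [DecidableEq κ] [DecidableEq β]

/-- Greedy weights: one can put mass on `s`, respecting finitely many families of capacity
constraints, so that every point belongs to a saturated block. -/
lemma exists_saturated_weights (n : ℕ) (a : ℕ → κ → β) {c : ℕ → ℝ} (hc : ∀ j, 0 ≤ c j)
    (s : Finset κ) : ∃ w : κ → ℝ, (∀ k, 0 ≤ w k) ∧
      (∀ j ≤ n, ∀ b, ∑ k ∈ s with a j k = b, w k ≤ c j) ∧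
      ∀ k ∈ s, ∃ j ≤ n, ∑ l ∈ s with a j l = a j k, w l = c j := by
  induction s using Finset.induction with
  | empty => exact ⟨0, by simp, by simpa using fun j _ _ => hc j, by simp⟩
  | insert q s hq ih =>
    obtain ⟨w, h0, hcap, hsat⟩ := ih
    set slack : ℕ → ℝ := fun j => c j - ∑ k ∈ s with a j k = a j q, w k with hslack
    obtain ⟨i, hi, hmin⟩ := Finset.exists_min_image (Finset.range (n + 1)) slack ⟨0, by simp⟩
    have hi' : i ≤ n := by simpa [Nat.lt_succ_iff] using hi
    have hpos : 0 ≤ slack i := sub_nonneg.2 (hcap i hi' _)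
    set w' := Function.update w q (slack i) with hw'
    have hs : ∀ t ⊆ s, ∑ k ∈ t, w' k = ∑ k ∈ t, w k := fun t ht =>
      Finset.sum_congr rfl fun k hk =>
        Function.update_of_ne (ne_of_mem_of_not_mem (ht hk) hq) _ _
    have hsum : ∀ j b, ∑ k ∈ insert q s with a j k = b, w' k =
        (if a j q = b then slack i else 0) + ∑ k ∈ s with a j k = b, w k := by
      intro j b
      rw [Finset.filter_insert]
      split_ifs with h
      · rw [Finset.sum_insert (by simp [hq]), hs _ (Finset.filter_subset _ _)]
        simp [hw']
      · rw [hs _ (Finset.filter_subset _ _), zero_add]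
    have hcap' : ∀ j ≤ n, ∀ b, ∑ k ∈ insert q s with a j k = b, w' k ≤ c j := by
      intro j hj b
      rw [hsum]
      split_ifs with h
      · subst h
        have : slack i ≤ slack j := hmin j (by simpa [Nat.lt_succ_iff] using hj)
        simp only [hslack] at this ⊢
        linarith
      · rw [zero_add]; exact hcap j hj b
    refine ⟨w', fun k => ?_, hcap', fun k hk => ?_⟩
    · by_cases h : k = q
      · subst h; simpa [hw'] using hpos
      · simpa [hw', h] using h0 k
    · rcases Finset.mem_insert.1 hk with rfl | hk
      · refine ⟨i, hi', ?_⟩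
        rw [hsum, if_pos rfl]
        simp [hslack]
      · obtain ⟨j, hj, h⟩ := hsat k hk
        refine ⟨j, hj, le_antisymm (hcap' j hj _) ?_⟩
        rw [hsum, h]
        split_ifs <;> linarith

/-- Choosing for every point its coarsest saturated block gives a partition into saturated
blocks. -/
lemma exists_saturated_partition (n : ℕ) {a : ℕ → κ → β}
    (ha : ∀ {j j'} k l, j ≤ j' → a j k = a j l → a j' k = a j' l) {c : ℕ → ℝ} {s : Finset κ}
    {w : κ → ℝ} (h : ∀ k ∈ s, ∃ j ≤ n, ∑ l ∈ s with a j l = a j k, w l = c j) :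
    ∃ Q : Finset (ℕ × β), (∀ q ∈ Q, q.1 ≤ n) ∧ (∀ k ∈ s, ∃ q ∈ Q, a q.1 k = q.2) ∧
      ∑ q ∈ Q, c q.1 = ∑ k ∈ s, w k := by
  classical
  set S : κ → ℕ → Prop := fun k j => ∑ l ∈ s with a j l = a j k, w l = c j with hS
  set J : κ → ℕ := fun k => Nat.findGreatest (S k) n with hJ
  have hJn : ∀ k, J k ≤ n := fun k => Nat.findGreatest_le n
  have hJS : ∀ k ∈ s, S k (J k) := fun k hk => by
    obtain ⟨j, hj, h⟩ := h k hk
    exact Nat.findGreatest_spec hj h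
  have hSc : ∀ {k l j}, a j k = a j l → S k j → S l j := fun {k l j} h1 h2 => by
    simpa only [hS, h1] using h2
  have hle : ∀ k ∈ s, ∀ l ∈ s, a (J k) k = a (J k) l → J k = J l := by
    intro k hk l hl h1
    have h2 : J k ≤ J l := Nat.le_findGreatest (hJn k) (hSc h1 (hJS k hk))
    exact le_antisymm h2 (Nat.le_findGreatest (hJn l) (hSc (ha k l h2 h1).symm (hJS l hl)))
  refine ⟨s.image fun k => (J k, a (J k) k), ?_, ?_, ?_⟩
  · simp only [Finset.forall_mem_image]
    exact fun k _ => hJn k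
  · exact fun k hk => ⟨_, Finset.mem_image_of_mem _ hk, rfl⟩
  · rw [← Finset.sum_fiberwise_of_maps_to
      (fun k hk => Finset.mem_image_of_mem (fun k => (J k, a (J k) k)) hk)]
    refine Finset.sum_congr rfl fun q hq => ?_
    obtain ⟨k, hk, rfl⟩ := Finset.mem_image.1 hq
    rw [← hJS k hk]
    refine Finset.sum_congr (Finset.filter_congr fun l hl => ?_) fun _ _ => rfl
    simp only [Prod.mk.injEq]
    constructor
    · intro h1
      have := hle k hk l hl h1.symm
      exact ⟨this.symm, by rw [← this, h1]⟩
    · rintro ⟨h1, h2⟩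
      rw [← h1, h2, h1]

end Greedy

section Content

lemma exists_content_pos {X ι : Type*} [MetricSpace X] [MeasurableSpace X] [BorelSpace X]
    {A : Set X} {α : ℝ} (hα : 0 < α) (h : μH[α] A ≠ 0) :
    ∃ c > 0, ∀ (s : Finset ι) (U : ι → Set X) (r : ι → ℝ), (∀ i ∈ s, 0 ≤ r i) →
      (∀ i ∈ s, ediam (U i) ≤ ENNReal.ofReal (r i)) → A ⊆ ⋃ i ∈ s, U i → c ≤ ∑ i ∈ s, r i ^ α := by
  by_contra! hcon
  choose s U r hr hU hA hlt using fun n : ℕ => hcon (1 / (n + 1)) (by positivity)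
  have hlim : Tendsto (fun n : ℕ => ENNReal.ofReal (1 / ((n : ℝ) + 1))) atTop (𝓝 0) := by
    rw [← ENNReal.ofReal_zero]
    exact (ENNReal.continuous_ofReal.tendsto 0).comp tendsto_one_div_add_atTop_nhds_zero_nat
  have hlim' : Tendsto (fun n : ℕ => ENNReal.ofReal (1 / ((n : ℝ) + 1)) ^ α⁻¹) atTop (𝓝 0) := by
    have := (ENNReal.continuous_rpow_const (y := α⁻¹)).tendsto 0
    rw [ENNReal.zero_rpow_of_pos (inv_pos.2 hα)] at this
    exact this.comp hlim
  have hsum : ∀ n, ∑ i : s n, ediam (U n i) ^ α ≤ ENNReal.ofReal (1 / ((n : ℝ) + 1)) := by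
    intro n
    rw [Finset.sum_coe_sort (s n) (fun i => ediam (U n i) ^ α)]
    calc ∑ i ∈ s n, ediam (U n i) ^ α ≤ ∑ i ∈ s n, ENNReal.ofReal (r n i ^ α) := by
          refine Finset.sum_le_sum fun i hi => ?_
          rw [← ENNReal.ofReal_rpow_of_nonneg (hr n i hi) hα.le]
          exact ENNReal.rpow_le_rpow (hU n i hi) hα.le
      _ ≤ _ := by
          rw [← ENNReal.ofReal_sum_of_nonneg fun i hi => Real.rpow_nonneg (hr n i hi) _]
          exact ENNReal.ofReal_le_ofReal (hlt n).le
  refine h (le_antisymm ?_ zero_le)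
  refine (Measure.hausdorffMeasure_le_liminf_sum α A (l := atTop) _ hlim'
    (fun n (i : s n) => U n i) (Eventually.of_forall fun n i => ?_)
    (Eventually.of_forall fun n => ?_)).trans ?_
  · rw [ENNReal.le_rpow_inv_iff hα]
    exact (Finset.single_le_sum (f := fun i : s n => ediam (U n i) ^ α) (fun _ _ => zero_le)
      (Finset.mem_univ i)).trans (hsum n)
  · simpa [Set.iUnion_subtype] using hA n
  · exact (liminf_le_liminf (Eventually.of_forall hsum)).trans hlim.liminf_eq.le

end Content

section Weights

variable {d : ℕ}

lemma anc_eq_of_le {j j' : ℕ} (k l : Fin d → ℤ) (hj : j ≤ j') (h : anc j k = anc j l) :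
    anc j' k = anc j' l := by
  obtain ⟨m, rfl⟩ := Nat.exists_eq_add_of_le hj
  induction m with
  | zero => exact h
  | succ m ih =>
    have := ih (Nat.le_add_right _ _)
    rw [← add_assoc, anc_succ, anc_succ, this]

lemma exists_weights {A : Set (EuclideanSpace ℝ (Fin d))} (hA : IsCompact A) {α : ℝ} (hα : 0 < α)
    (h : μH[α] A ≠ 0) : ∃ c > 0, ∃ M : ℝ, ∀ n : ℕ, ∃ (s : Finset (Fin d → ℤ)) (w : (Fin d → ℤ) → ℝ),
      (∀ k, 0 ≤ w k) ∧ (∀ k ∈ s, ∃ a ∈ A, ∀ i, ⌊2 ^ n * a i⌋ = k i) ∧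
      (∀ j ≤ n, ∀ b, ∑ k ∈ s with anc j k = b, w k ≤ (2 ^ j / 2 ^ n : ℝ) ^ α) ∧
      c ≤ ∑ k ∈ s, w k ∧ ∑ k ∈ s, w k ≤ M := by
  classical
  obtain ⟨B, hB⟩ := hA.isBounded.exists_norm_le
  obtain ⟨c, hc, hcont⟩ := exists_content_pos (ι := ℕ × (Fin d → ℤ)) hα h
  have hB0 : 0 ≤ max B 0 := le_max_right _ _
  set D : ℝ := 2 * d + 1 with hD'
  have hD : 0 < D := by positivity
  refine ⟨c / D ^ α, by positivity, (2 * (max B 0 + 2) + 1) ^ d, fun n => ?_⟩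
  have h2n : (0 : ℝ) < 2 ^ n := by positivity
  have hbd : ∀ a ∈ A, ∀ i, |a i| ≤ max B 0 := fun a ha i =>
    ((PiLp.norm_apply_le a i).trans (hB a ha)).trans (le_max_left _ _)
  have hfin : {k : Fin d → ℤ | ∃ a ∈ A, ∀ i, ⌊2 ^ n * a i⌋ = k i}.Finite := by
    refine (Set.finite_Icc (fun _ => ⌊2 ^ n * (-max B 0)⌋) (fun _ => ⌊2 ^ n * max B 0⌋)).subset ?_
    rintro k ⟨a, ha, hk⟩
    refine ⟨fun i => ?_, fun i => ?_⟩ <;>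
    · rw [← hk i]
      refine Int.floor_le_floor ?_
      gcongr
      first | exact (abs_le.1 (hbd a ha i)).1 | exact (abs_le.1 (hbd a ha i)).2
  set s := hfin.toFinset with hs
  have hsm : ∀ {k}, k ∈ s ↔ ∃ a ∈ A, ∀ i, ⌊2 ^ n * a i⌋ = k i := by
    intro k; simp [hs]
  obtain ⟨w, hw0, hcap, hsat⟩ := exists_saturated_weights n anc
    (c := fun j => (2 ^ j / 2 ^ n : ℝ) ^ α) (fun j => by positivity) s
  obtain ⟨Q, hQn, hQs, hQ⟩ := exists_saturated_partition n anc_eq_of_le hsat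
  refine ⟨s, w, hw0, fun k hk => hsm.1 hk, hcap, ?_, ?_⟩
  · have h1 := hcont Q (fun q => {x | anc q.1 (fun i => ⌊2 ^ n * x i⌋) = q.2})
      (fun q => D * (2 ^ q.1 / 2 ^ n)) (fun q _ => by positivity) ?_ ?_
    · rw [div_le_iff₀' (by positivity), ← hQ, Finset.mul_sum]
      refine h1.trans (le_of_eq (Finset.sum_congr rfl fun q _ => ?_))
      rw [Real.mul_rpow (by positivity) (by positivity)]
    · intro q hq
      refine ediam_le fun x hx y hy => ?_
      rw [edist_dist]
      refine ENNReal.ofReal_le_ofReal ?_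
      rw [dist_eq_norm]
      have h2 : ∀ i, |(x - y) i| ≤ 2 * (2 ^ q.1 / 2 ^ n) := by
        intro i
        have hx1 := anc_bounds q.1 (fun i => ⌊2 ^ n * x i⌋) i
        have hy1 := anc_bounds q.1 (fun i => ⌊2 ^ n * y i⌋) i
        rw [show anc q.1 (fun i => ⌊2 ^ n * x i⌋) = q.2 from hx] at hx1
        rw [show anc q.1 (fun i => ⌊2 ^ n * y i⌋) = q.2 from hy] at hy1
        have h3 := Int.floor_le (2 ^ n * x i)
        have h4 := Int.lt_floor_add_one (2 ^ n * x i)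
        have h5 := Int.floor_le (2 ^ n * y i)
        have h6 := Int.lt_floor_add_one (2 ^ n * y i)
        have h7 : (1 : ℝ) ≤ 2 ^ q.1 := one_le_pow₀ (by norm_num)
        have h8 : 2 * (2 ^ q.1 / 2 ^ n : ℝ) * 2 ^ n = 2 * 2 ^ q.1 := by field_simp
        rw [PiLp.sub_apply, abs_le]
        constructor
        · refine le_of_mul_le_mul_right ?_ h2n
          linarith
        · refine le_of_mul_le_mul_right ?_ h2n
          linarith
      refine (norm_le_of_coords h2).trans ?_
      have : (0 : ℝ) ≤ 2 ^ q.1 / 2 ^ n := by positivity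
      rw [hD']
      linarith
    · intro x hx
      obtain ⟨q, hq, h2⟩ := hQs (fun i => ⌊2 ^ n * x i⌋) (hsm.2 ⟨x, hx, fun _ => rfl⟩)
      exact mem_iUnion₂.2 ⟨q, hq, h2⟩
  · rw [← Finset.sum_fiberwise_of_maps_to (fun k hk => Finset.mem_image_of_mem (anc n) hk)]
    calc ∑ b ∈ s.image (anc n), ∑ k ∈ s with anc n k = b, w k ≤ ∑ b ∈ s.image (anc n), 1 := by
          refine Finset.sum_le_sum fun b _ => (hcap n le_rfl b).trans ?_
          rw [div_self h2n.ne', Real.one_rpow]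
      _ = ((s.image (anc n)).card : ℝ) := by simp
      _ ≤ _ := by
        refine card_le_of_coords _ 0 (by positivity) fun b hb i => ?_
        obtain ⟨k, hk, rfl⟩ := Finset.mem_image.1 hb
        obtain ⟨a, ha, hak⟩ := hsm.1 hk
        have h1 := anc_bounds n k i
        have h2 := Int.floor_le (2 ^ n * a i)
        have h3 := Int.lt_floor_add_one (2 ^ n * a i)
        have h4 := abs_le.1 (hbd a ha i)
        rw [hak i] at h2 h3
        have h5 : (1 : ℝ) ≤ 2 ^ n := one_le_pow₀ (by norm_num)
        rw [Pi.zero_apply, sub_zero, abs_le]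
        constructor
        · refine le_of_mul_le_mul_right ?_ h2n
          nlinarith
        · refine le_of_mul_le_mul_right ?_ h2n
          nlinarith

end Weights

end Falconer

namespace Falconer

open MeasureTheory Metric Set Filter Topology Module
open scoped FourierTransform ENNReal NNReal Pointwise ComplexConjugate RealInnerProductSpace

set_option linter.unusedSectionVars false

section Frostman

variable {d : ℕ}

/-- The lattice point `2⁻ⁿ k`. -/
noncomputable def node (n : ℕ) (k : Fin d → ℤ) : EuclideanSpace ℝ (Fin d) :=
  WithLp.toLp 2 fun i => (k i : ℝ) / 2 ^ n

lemma sum_weights_le {s : Finset (Fin d → ℤ)} {w : (Fin d → ℤ) → ℝ} {n : ℕ} {α : ℝ} (hα : 0 < α)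
    (hw : ∀ k, 0 ≤ w k)
    (hcap : ∀ j ≤ n, ∀ b, ∑ k ∈ s with anc j k = b, w k ≤ (2 ^ j / 2 ^ n : ℝ) ^ α)
    {r : ℝ} (hr : 1 ≤ 2 ^ n * r) (hr1 : r ≤ 1) (x : EuclideanSpace ℝ (Fin d)) :
    ∑ k ∈ s with ‖x - node n k‖ ≤ 2 * r, w k ≤ 11 ^ d * r ^ α := by
  classical
  have h2n : (0 : ℝ) < 2 ^ n := by positivity
  have hr0 : 0 < r := pos_of_mul_pos_right (by linarith) h2n.le
  obtain ⟨j, hj1, hj2⟩ := exists_two_pow_near hr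
  have hjn : j ≤ n := by
    refine (pow_le_pow_iff_right₀ (one_lt_two (α := ℝ))).1 (hj1.trans ?_)
    nlinarith
  have h2j : (0 : ℝ) < 2 ^ j := by positivity
  set t := s.filter fun k => ‖x - node n k‖ ≤ 2 * r with ht
  rw [← Finset.sum_fiberwise_of_maps_to (fun k hk => Finset.mem_image_of_mem (anc j) hk)]
  calc ∑ b ∈ t.image (anc j), ∑ k ∈ t with anc j k = b, w k ≤ ∑ b ∈ t.image (anc j), r ^ α := by
        refine Finset.sum_le_sum fun b _ => ?_
        refine (Finset.sum_le_sum_of_subset_of_nonneg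
          (Finset.filter_subset_filter _ (Finset.filter_subset _ _)) fun k _ _ => hw k).trans
          ((hcap j hjn b).trans (Real.rpow_le_rpow (by positivity) ?_ hα.le))
        rw [div_le_iff₀ h2n]
        linarith
    _ = ((t.image (anc j)).card : ℝ) * r ^ α := by simp
    _ ≤ _ := by
      gcongr
      have h11 : (11 : ℝ) = 2 * 5 + 1 := by norm_num
      rw [h11]
      refine card_le_of_coords _ (fun i => 2 ^ n * x i / 2 ^ j) (by positivity) fun b hb i => ?_
      obtain ⟨k, hk, rfl⟩ := Finset.mem_image.1 hb
      have h1 := anc_bounds j k i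
      have h2 := (PiLp.norm_apply_le (x - node n k) i).trans (Finset.mem_filter.1 hk).2
      rw [PiLp.sub_apply, Real.norm_eq_abs, node, abs_le] at h2
      have h3 : 2 ^ n * ((k i : ℝ) / 2 ^ n) = k i := by field_simp
      have h4 : 2 ^ n * x i / 2 ^ j * 2 ^ j = 2 ^ n * x i := by field_simp
      have h5 : 2 ^ n * x i ≤ k i + 2 * (2 ^ n * r) := by
        have := mul_le_mul_of_nonneg_left h2.2 h2n.le
        simp only at this
        linarith
      have h6 : k i - 2 * (2 ^ n * r) ≤ 2 ^ n * x i := by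
        have := mul_le_mul_of_nonneg_left h2.1 h2n.le
        simp only at this
        linarith
      rw [abs_le]
      constructor
      · refine le_of_mul_le_mul_right ?_ h2j
        linarith
      · refine le_of_mul_le_mul_right ?_ h2j
        linarith

lemma setLIntegral_bump_le {E : Type*} [NormedAddCommGroup E] [InnerProductSpace ℝ E]
    [FiniteDimensional ℝ E] [MeasurableSpace E] [BorelSpace E] (b : ContDiffBump (0 : E)) (p x : E)
    {r : ℝ} (hr : 0 ≤ r) :
    ∫⁻ y in closedBall x r, ENNReal.ofReal (b.normed volume (y - p)) ≤
      if ‖x - p‖ ≤ r + b.rOut then min 1 (ENNReal.ofReal ((r / b.rIn) ^ finrank ℝ E)) else 0 := by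
  split_ifs with h
  · refine le_min ?_ ?_
    · refine (setLIntegral_le_lintegral _ _).trans ?_
      rw [lintegral_sub_right_eq_self (fun y => ENNReal.ofReal (b.normed volume y)),
        ← ofReal_integral_eq_lintegral_ofReal b.integrable_normed
          (Eventually.of_forall b.nonneg_normed), b.integral_normed, ENNReal.ofReal_one]
    · have h0 := b.rIn_pos
      calc ∫⁻ y in closedBall x r, ENNReal.ofReal (b.normed volume (y - p))
          ≤ ∫⁻ y in closedBall x r,
            ENNReal.ofReal (1 / volume.real (closedBall (0 : E) b.rIn)) :=
            lintegral_mono fun y => ENNReal.ofReal_le_ofReal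
              (b.normed_le_div_measure_closedBall_rIn volume _)
        _ = ENNReal.ofReal ((r / b.rIn) ^ finrank ℝ E) := by
            have h1 : volume.real (closedBall x r) = r ^ finrank ℝ E * volume.real (ball (0 : E) 1) := by
              rw [Measure.real, Measure.addHaar_closedBall _ _ hr, ENNReal.toReal_mul,
                ENNReal.toReal_ofReal (by positivity), Measure.real]
            have h2 : volume.real (closedBall (0 : E) b.rIn) =
                b.rIn ^ finrank ℝ E * volume.real (ball (0 : E) 1) := by
              rw [Measure.real, Measure.addHaar_closedBall _ _ h0.le, ENNReal.toReal_mul,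
                ENNReal.toReal_ofReal (by positivity), Measure.real]
            have h3 : 0 < volume.real (ball (0 : E) 1) :=
              ENNReal.toReal_pos (measure_ball_pos _ _ one_pos).ne' measure_ball_lt_top.ne
            rw [setLIntegral_const, ← ofReal_measureReal measure_closedBall_lt_top.ne,
              ← ENNReal.ofReal_mul (by positivity), h1, h2, div_pow]
            congr 1
            field_simp
  · refine (setLIntegral_congr_fun measurableSet_closedBall (g := fun _ => 0) fun y hy => ?_).trans_le
      (by simp)
    have h1 : y - p ∉ Function.support (b.normed volume) := by
      rw [b.support_normed_eq, mem_ball_zero_iff, not_lt]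
      rw [mem_closedBall_iff_norm] at hy
      have := norm_sub_le_norm_sub_add_norm_sub x y p
      rw [norm_sub_rev x y] at this
      linarith
    simp [Function.notMem_support.1 h1]

lemma exists_frostman {A : Set (EuclideanSpace ℝ (Fin d))} (hA : IsCompact A) {α : ℝ} (hα : 0 < α)
    (hαd : α ≤ d) (h : μH[α] A ≠ 0) : ∃ c > 0, ∀ δ > 0, ∃ f : EuclideanSpace ℝ (Fin d) → ℝ,
      ContDiff ℝ ((⊤ : ℕ∞) : WithTop ℕ∞) f ∧ HasCompactSupport f ∧ (∀ x, 0 ≤ f x) ∧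
      (∀ x, f x ≠ 0 → ∃ a ∈ A, dist x a ≤ δ) ∧ c ≤ ∫ x, f x ∧
      HasPow α (volume.withDensity fun x => ENNReal.ofReal (f x)) := by
  obtain ⟨c, hc, M, hW⟩ := exists_weights hA hα h
  set M' : ℝ := max M (44 ^ d) with hM'
  have hM0 : 0 < M' := lt_max_of_lt_right (by positivity)
  refine ⟨c / M', by positivity, fun δ hδ => ?_⟩
  obtain ⟨n, hn⟩ := exists_pow_lt_of_lt_one (show 0 < δ / (d + 1) by positivity)
    (show (1 / 2 : ℝ) < 1 by norm_num)
  rw [lt_div_iff₀ (by positivity)] at hn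
  set η : ℝ := (1 / 2) ^ n with hη
  have hη0 : 0 < η := by positivity
  have hη2 : 2 ^ n * η = 1 := by rw [hη, ← mul_pow]; norm_num
  have hη1 : η ≤ 1 := pow_le_one₀ (by norm_num) (by norm_num)
  have h2n : (0 : ℝ) < 2 ^ n := by positivity
  obtain ⟨s, w, hw, hs, hcap, hc1, hc2⟩ := hW n
  set b : ContDiffBump (0 : EuclideanSpace ℝ (Fin d)) := ⟨η / 2, η, by positivity, by linarith⟩ with hb
  set g : (Fin d → ℤ) → EuclideanSpace ℝ (Fin d) → ℝ := fun k x => b.normed volume (x - node n k) with hg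
  have hg0 : ∀ k x, 0 ≤ g k x := fun k x => b.nonneg_normed _
  have hgi : ∀ k, Integrable (g k) := fun k => b.integrable_normed.comp_sub_right _
  have hgc : ∀ k, HasCompactSupport (g k) := fun k =>
    b.hasCompactSupport_normed.comp_homeomorph (Homeomorph.subRight (node n k))
  have hgm : ∀ k, Measurable (g k) := fun k =>
    (b.continuous_normed.comp (continuous_id.sub continuous_const)).measurable
  refine ⟨fun x => M'⁻¹ * ∑ k ∈ s, w k * g k x, ?_, ?_, ?_, ?_, ?_, ?_⟩
  · exact contDiff_const.mul (ContDiff.sum fun k _ => contDiff_const.mul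
      (b.contDiff_normed.comp (contDiff_id.sub contDiff_const)))
  · have : HasCompactSupport (fun x => ∑ k ∈ s, w k * g k x) := by
      clear hc1 hc2 hs hcap
      induction s using Finset.induction with
      | empty => simp only [Finset.sum_empty]; exact HasCompactSupport.zero
      | insert q s hq ih =>
        simp_rw [Finset.sum_insert hq]
        exact ((hgc q).mul_left).add ih
    exact this.mul_left
  · intro x
    exact mul_nonneg (by positivity) (Finset.sum_nonneg fun k _ => mul_nonneg (hw k) (hg0 k x))
  · intro x hx
    obtain ⟨k, hk, hkx⟩ := Finset.exists_ne_zero_of_sum_ne_zero (right_ne_zero_of_mul hx)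
    obtain ⟨a, ha, hak⟩ := hs k hk
    refine ⟨a, ha, ?_⟩
    have h1 : x - node n k ∈ Function.support (b.normed volume) := right_ne_zero_of_mul hkx
    rw [b.support_normed_eq, mem_ball_zero_iff] at h1
    have h2 : ‖node n k - a‖ ≤ d * η := by
      refine norm_le_of_coords fun i => ?_
      have h3 := Int.floor_le (2 ^ n * a i)
      have h4 := Int.lt_floor_add_one (2 ^ n * a i)
      rw [hak i] at h3 h4
      have h5 : 2 ^ n * ((k i : ℝ) / 2 ^ n) = k i := by field_simp
      rw [PiLp.sub_apply, node, abs_le]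
      simp only
      constructor
      · refine le_of_mul_le_mul_left ?_ h2n
        linarith
      · refine le_of_mul_le_mul_left ?_ h2n
        linarith
    rw [dist_eq_norm]
    have h3 := norm_sub_le_norm_sub_add_norm_sub x (node n k) a
    have h4 : b.rOut = η := rfl
    nlinarith
  · rw [integral_const_mul, integral_finsetSum _ fun k _ => (hgi k).const_mul _, div_eq_inv_mul]
    gcongr
    refine hc1.trans (le_of_eq (Finset.sum_congr rfl fun k _ => ?_))
    rw [integral_const_mul, hg, integral_sub_right_eq_self (fun x => b.normed volume x),
      b.integral_normed, mul_one]
  · intro x r hr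
    rw [withDensity_apply _ measurableSet_closedBall]
    have h1 : ∀ y, ENNReal.ofReal (M'⁻¹ * ∑ k ∈ s, w k * g k y) =
        ENNReal.ofReal M'⁻¹ * ∑ k ∈ s, ENNReal.ofReal (w k) * ENNReal.ofReal (g k y) := by
      intro y
      rw [ENNReal.ofReal_mul (by positivity), ENNReal.ofReal_sum_of_nonneg
        fun k _ => mul_nonneg (hw k) (hg0 k y)]
      simp_rw [ENNReal.ofReal_mul (hw _)]
    simp_rw [h1]
    rw [lintegral_const_mul _ (Finset.measurable_fun_sum _ fun k _ =>
      ((hgm k).ennreal_ofReal).const_mul _),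
      lintegral_finsetSum _ fun k _ => ((hgm k).ennreal_ofReal).const_mul _]
    simp_rw [lintegral_const_mul _ (hgm _).ennreal_ofReal]
    have hmain : ∑ k ∈ s, ENNReal.ofReal (w k) * ∫⁻ y in closedBall x r, ENNReal.ofReal (g k y) ≤
        ENNReal.ofReal (M' * r ^ α) := by
      have hbound := fun k => setLIntegral_bump_le b (node n k) x hr.le
      rw [finrank_euclideanSpace, Fintype.card_fin] at hbound
      have hi : b.rIn = η / 2 := rfl
      have ho : b.rOut = η := rfl
      rcases le_total 1 r with hr1 | hr1
      · calc _ ≤ ∑ k ∈ s, ENNReal.ofReal (w k) := by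
              refine Finset.sum_le_sum fun k _ => mul_le_of_le_one_right' ((hbound k).trans ?_)
              split_ifs
              · exact min_le_left _ _
              · exact zero_le_one
          _ ≤ _ := by
            rw [← ENNReal.ofReal_sum_of_nonneg fun k _ => hw k]
            have hM' : M ≤ M' := le_max_left _ _
            refine ENNReal.ofReal_le_ofReal (hc2.trans (hM'.trans ?_))
            exact le_mul_of_one_le_right hM0.le (Real.one_le_rpow hr1 hα.le)
      rcases le_total η r with hηr | hηr
      · calc _ ≤ ∑ k ∈ s with ‖x - node n k‖ ≤ 2 * r, ENNReal.ofReal (w k) := by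
              rw [Finset.sum_filter]
              refine Finset.sum_le_sum fun k _ => ?_
              refine (mul_le_mul_right (hbound k) _).trans ?_
              rw [ho]
              split_ifs with h2 h3 h3
              · exact mul_le_of_le_one_right' (min_le_left _ _)
              · linarith
              · simp
              · simp
          _ ≤ _ := by
            rw [← ENNReal.ofReal_sum_of_nonneg fun k _ => hw k]
            refine ENNReal.ofReal_le_ofReal ((sum_weights_le hα hw hcap (r := r)
              (by nlinarith) hr1 x).trans ?_)
            gcongr
            refine le_trans ?_ (le_max_right _ _)
            gcongr
            norm_num
      · calc _ ≤ ∑ k ∈ s with ‖x - node n k‖ ≤ 2 * η,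
                ENNReal.ofReal (w k) * ENNReal.ofReal ((r / (η / 2)) ^ d) := by
              rw [Finset.sum_filter]
              refine Finset.sum_le_sum fun k _ => ?_
              refine (mul_le_mul_right (hbound k) _).trans ?_
              rw [ho, hi]
              split_ifs with h2 h3 h3
              · exact mul_le_mul_right (min_le_right _ _) _
              · linarith
              · simp
              · simp
          _ ≤ _ := by
            rw [← Finset.sum_mul, ← ENNReal.ofReal_sum_of_nonneg fun k _ => hw k,
              ← ENNReal.ofReal_mul (Finset.sum_nonneg fun k _ => hw k)]
            refine ENNReal.ofReal_le_ofReal ?_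
            calc _ ≤ 11 ^ d * η ^ α * (r / (η / 2)) ^ d := by
                  gcongr
                  exact sum_weights_le hα hw hcap hη2.ge hη1 x
              _ = 22 ^ d * (η ^ α * (r / η) ^ (d : ℝ)) := by
                  have h22 : (22 : ℝ) = 11 * 2 := by norm_num
                  have hr2 : r / (η / 2) = 2 * (r / η) := by field_simp
                  rw [Real.rpow_natCast, hr2, mul_pow, h22, mul_pow]
                  ring
              _ ≤ 22 ^ d * (η ^ α * (r / η) ^ α) := by
                  gcongr 22 ^ d * (η ^ α * ?_)
                  exact Real.rpow_le_rpow_of_exponent_ge (by positivity)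
                    ((div_le_one hη0).2 hηr) hαd
              _ = 22 ^ d * r ^ α := by
                  rw [← Real.mul_rpow hη0.le (by positivity), mul_div_cancel₀ _ hη0.ne']
              _ ≤ _ := by
                  gcongr
                  refine le_trans ?_ (le_max_right _ _)
                  gcongr
                  norm_num
    calc _ ≤ ENNReal.ofReal M'⁻¹ * ENNReal.ofReal (M' * r ^ α) := by gcongr
      _ = _ := by
        rw [← ENNReal.ofReal_mul (by positivity), inv_mul_cancel_left₀ hM0.ne']

end Frostman

end Falconer

namespace Falconer

open MeasureTheory Metric Set Filter Topology Module
open scoped FourierTransform ENNReal NNReal Pointwise ComplexConjugate RealInnerProductSpace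

set_option linter.unusedSectionVars false

lemma exists_smooth_cutoff {V : Type*} [NormedAddCommGroup V] [InnerProductSpace ℝ V]
    [FiniteDimensional ℝ V] {K U : Set V} (hK : IsClosed K) (hU : IsOpen U) (h : K ⊆ U) :
    ∃ η : V → ℝ, ContDiff ℝ ((⊤ : ℕ∞) : WithTop ℕ∞) η ∧ (∀ x ∈ K, η x = 1) ∧
      (∀ x ∉ U, η x = 0) ∧ ∀ x, 0 ≤ η x ∧ η x ≤ 1 := by
  obtain ⟨g, hg0, hg1, hg⟩ := exists_contMDiffMap_zero_one_of_isClosed (n := (⊤ : ℕ∞))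
    (modelWithCornersSelf ℝ V) hU.isClosed_compl hK
    (disjoint_left.2 fun x hx hx' => hx (h hx'))
  exact ⟨g, g.contMDiff.contDiff, fun x hx => hg1 hx, fun x hx => hg0 hx, fun x => hg x⟩

variable {E : Type*} [NormedAddCommGroup E] [InnerProductSpace ℝ E] [FiniteDimensional ℝ E]
  [MeasurableSpace E] [BorelSpace E]

lemma lintegral_cutoff_fourier_sq_le {f : E → ℝ} (hf : Continuous f) (hfc : HasCompactSupport f)
    (hf0 : ∀ x, 0 ≤ f x) {η : E → ℝ} (hη : ContDiff ℝ ((⊤ : ℕ∞) : WithTop ℕ∞) η)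
    (hη01 : ∀ x, 0 ≤ η x ∧ η x ≤ 1) {K : Set E} (hK : Bornology.IsBounded K)
    (hηK : ∀ x ∉ K, η x = 0) {B : ℝ≥0∞}
    (hB : ∀ v, PW K v → ∫⁻ x, ‖v x‖ₑ ^ 2 ∂(volume.withDensity fun x => ENNReal.ofReal (f x)) ≤
      B * ∫⁻ x, ‖v x‖ₑ ^ 2) :
    ∫⁻ ξ, ENNReal.ofReal (η ξ) * ‖𝓕 (fun x => (f x : ℂ)) ξ‖ₑ ^ 2 ≤
      (volume.withDensity fun x => ENNReal.ofReal (f x)) univ * B := by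
  set ν := volume.withDensity fun x => ENNReal.ofReal (f x) with hν
  set ρ : E → ℂ := fun x => (f x : ℂ) with hρ
  have hρc : Continuous ρ := Complex.continuous_ofReal.comp hf
  have hρi : Integrable ρ := hρc.integrable_of_hasCompactSupport
    (hfc.comp_left (g := fun t : ℝ => (t : ℂ)) Complex.ofReal_zero)
  have hρPW : PW univ ρ := ⟨hρc, hρi, fun ξ hξ => absurd (mem_univ ξ) hξ⟩
  have hηc : HasCompactSupport η :=
    HasCompactSupport.of_support_subset_isCompact
      (isCompact_of_isClosed_isBounded isClosed_closure hK.closure)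
      fun x hx => subset_closure (by_contra fun h => hx (hηK x h))
  have hηc' : HasCompactSupport fun x => (η x : ℂ) :=
    hηc.comp_left (g := fun t : ℝ => (t : ℂ)) Complex.ofReal_zero
  set χ : SchwartzMap E ℂ := hηc'.toSchwartzMap (Complex.ofRealCLM.contDiff.comp hη) with hχ
  have hχa : ∀ x, χ x = (η x : ℂ) := fun x => rfl
  obtain ⟨v, hv, hvF⟩ := hρPW.exists_cutoff χ
  have hvK : PW K v := hv.mono fun x hx => by
    by_contra h
    exact hx.2 (by rw [hχa, hηK x h, Complex.ofReal_zero])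
  have hconj : ∀ ξ, 𝓕 ρ (-ξ) = conj (𝓕 ρ ξ) := fun ξ => by
    have := fourier_conj ρ (-ξ)
    rw [neg_neg, show (fun x => conj (ρ x)) = ρ by ext; simp [ρ]] at this
    exact this
  have hid : ∫ ξ, ((η ξ * ‖𝓕 ρ ξ‖ ^ 2 : ℝ) : ℂ) = ∫ x, ρ x * v x := by
    have h1 := integral_fourier_mul hρi (v := fun ζ => 𝓕 v (-ζ))
      ((hvK.fourier_integrable hK).comp_neg)
    rw [← hvK.eq_fourier_neg hK] at h1
    rw [← h1, ← integral_neg_eq_self]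
    refine integral_congr_ae (ae_of_all _ fun ξ => ?_)
    simp only []
    rw [hvF, hconj, hχa]
    push_cast
    rw [← Complex.conj_mul', RCLike.conj_conj]
    have hη' : η (-ξ) = η (-ξ) := rfl
    ring
  have hX : ∫⁻ ξ, ENNReal.ofReal (η ξ) * ‖𝓕 ρ ξ‖ₑ ^ 2 = ‖∫ x, ρ x * v x‖ₑ := by
    rw [← hid, integral_complex_ofReal, ← ofReal_norm, Complex.norm_real, Real.norm_eq_abs]
    have hi : Integrable fun ξ => η ξ * ‖𝓕 ρ ξ‖ ^ 2 :=
      (hη.continuous.mul ((continuous_fourier hρi).norm.pow 2)).integrable_of_hasCompactSupport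
        (hηc.mul_right)
    rw [abs_of_nonneg (integral_nonneg fun ξ => mul_nonneg (hη01 ξ).1 (sq_nonneg _)),
      ofReal_integral_eq_lintegral_ofReal hi
        (ae_of_all _ fun ξ => mul_nonneg (hη01 ξ).1 (sq_nonneg _))]
    refine lintegral_congr fun ξ => ?_
    rw [ENNReal.ofReal_mul (hη01 ξ).1, ENNReal.ofReal_pow (norm_nonneg _), ofReal_norm]
  set X := ∫⁻ ξ, ENNReal.ofReal (η ξ) * ‖𝓕 ρ ξ‖ₑ ^ 2 with hXdef
  have hXtop : X ≠ ∞ := by rw [hX]; exact enorm_ne_top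
  have hX1 : X ≤ ∫⁻ x, ‖v x‖ₑ ∂ν := by
    rw [hX, hν, lintegral_withDensity_eq_lintegral_mul _ hf.measurable.ennreal_ofReal
      hvK.cont.measurable.enorm]
    refine (enorm_integral_le_lintegral_enorm _).trans_eq (lintegral_congr fun x => ?_)
    simp only [Pi.mul_apply]
    rw [enorm_mul, ← ofReal_norm (ρ x), Complex.norm_real, Real.norm_of_nonneg (hf0 x)]
  have hV : ∫⁻ x, ‖v x‖ₑ ^ 2 ≤ X := by
    rw [← hvK.lintegral_fourier_sq hK, hXdef]
    refine lintegral_mono fun ξ => ?_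
    rw [hvF, enorm_mul, mul_pow, hχa, ← ofReal_norm, Complex.norm_real,
      Real.norm_of_nonneg (hη01 ξ).1, ← ENNReal.ofReal_pow (hη01 ξ).1]
    gcongr
    exact pow_le_of_le_one (hη01 ξ).1 (hη01 ξ).2 two_ne_zero
  have hX2 : X ^ 2 ≤ ν univ * (B * X) := by
    calc X ^ 2 ≤ (∫⁻ x, 1 * ‖v x‖ₑ ∂ν) ^ 2 := by simp only [one_mul]; gcongr
      _ ≤ (∫⁻ x, 1 ^ 2 ∂ν) * ∫⁻ x, ‖v x‖ₑ ^ 2 ∂ν :=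
        lintegral_mul_sq_le aemeasurable_const hvK.cont.measurable.enorm.aemeasurable
      _ ≤ _ := by
        rw [one_pow, lintegral_one]
        gcongr
        exact (hB v hvK).trans (by gcongr)
  rcases eq_or_ne X 0 with h0 | h0
  · rw [h0]; exact zero_le
  · rw [← ENNReal.mul_le_mul_iff_left h0 hXtop, mul_assoc, ← sq]
    exact hX2

/-- The half-open annulus `k ≤ ‖ξ‖ < k + 1`. -/
def annulus (E : Type*) [NormedAddCommGroup E] (k : ℕ) : Set E := {ξ | k ≤ ‖ξ‖ ∧ ‖ξ‖ < k + 1}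

lemma exists_energy_bounds [Nontrivial E] {α γ : ℝ} (hγ : 0 ≤ γ) {A : ℝ≥0}
    (hA : ShellBound E α γ A) (r₀ : ℝ) : ∃ C : ℝ≥0, ∀ f : E → ℝ, Continuous f →
    HasCompactSupport f → (∀ x, 0 ≤ f x) → (∀ x, f x ≠ 0 → ‖x‖ ≤ r₀) →
    HasPow α (volume.withDensity fun x => ENNReal.ofReal (f x)) →
    (∀ R : ℝ, 0 < R → ∫⁻ ξ in closedBall 0 R, ‖𝓕 (fun x => (f x : ℂ)) ξ‖ₑ ^ 2 ≤
      C * ENNReal.ofReal (R ^ (finrank ℝ E - α))) ∧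
    ∀ k : ℕ, ∫⁻ ξ in annulus E k, ‖𝓕 (fun x => (f x : ℂ)) ξ‖ₑ ^ 2 ≤
      C * ENNReal.ofReal ((k + 1 : ℝ) ^ γ) := by
  obtain ⟨t, -, htf, ht⟩ := (isCompact_closedBall (0 : E) r₀).finite_cover_balls one_pos
  obtain ⟨C₁, hC₁⟩ := exists_ball_bound (E := E) (α := α)
  lift t to Finset E using htf
  set C₂ : ℝ≥0 := t.card * (C₁ * Real.toNNReal ((2 : ℝ) ^ (finrank ℝ E - α))) with hC₂
  refine ⟨C₂ + t.card * (t.card * A), fun f hf hfc hf0 hfs hν => ?_⟩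
  set ν := volume.withDensity fun x => ENNReal.ofReal (f x) with hνdef
  have hnull : ν (closedBall 0 r₀)ᶜ = 0 := by
    rw [hνdef, withDensity_apply _ measurableSet_closedBall.compl]
    refine (setLIntegral_congr_fun measurableSet_closedBall.compl fun x hx => ?_).trans
      lintegral_zero
    have : f x = 0 := by
      by_contra h
      exact hx (by simpa using hfs x h)
    simp [this]
  have hcov : ∀ g : E → ℝ≥0∞, ∫⁻ x, g x ∂ν ≤ ∑ y ∈ t, ∫⁻ x in closedBall y 1, g x ∂ν := fun g => by
    have h1 : ∫⁻ x, g x ∂ν = ∫⁻ x in closedBall 0 r₀, g x ∂ν := by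
      rw [Measure.restrict_eq_self_of_ae_mem]
      exact mem_ae_iff.2 hnull
    rw [h1]
    refine (lintegral_mono_set (ht.trans (iUnion₂_mono fun y _ => ball_subset_closedBall))).trans ?_
    rw [biUnion_eq_iUnion]
    refine (lintegral_iUnion_le (fun y : t => closedBall (y : E) 1) g).trans_eq ?_
    rw [tsum_fintype, Finset.sum_coe_sort t fun y => ∫⁻ x in closedBall y 1, g x ∂ν]
  have hmass : ν univ ≤ t.card := by
    have := hcov 1
    simp only [Pi.one_apply, lintegral_one, Measure.restrict_apply_univ] at this
    refine this.trans ((Finset.sum_le_card_nsmul _ _ 1 fun y _ => ?_).trans_eq (by simp))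
    simpa using hν y 1 one_pos
  have : IsFiniteMeasure ν := ⟨hmass.trans_lt (by finiteness)⟩
  have hball : ∀ R : ℝ, 0 < R → ∫⁻ ξ in closedBall 0 R, ‖𝓕 (fun x => (f x : ℂ)) ξ‖ₑ ^ 2 ≤
      C₂ * ENNReal.ofReal (R ^ (finrank ℝ E - α)) := fun R hR => by
    obtain ⟨η, hη, hη1, hη0, hη01⟩ := exists_smooth_cutoff (isClosed_closedBall (x := (0 : E)) (ε := R))
      (isOpen_ball (x := (0 : E)) (ε := 2 * R)) (closedBall_subset_ball (by linarith))
    have := lintegral_cutoff_fourier_sq_le hf hfc hf0 hη hη01 isBounded_ball hη0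
      fun v hv => hC₁ ν inferInstance hν (by linarith) hv ball_subset_closedBall
    calc _ = ∫⁻ ξ in closedBall 0 R, ENNReal.ofReal (η ξ) * ‖𝓕 (fun x => (f x : ℂ)) ξ‖ₑ ^ 2 :=
          setLIntegral_congr_fun measurableSet_closedBall fun ξ hξ => by simp [hη1 ξ hξ]
      _ ≤ _ := setLIntegral_le_lintegral _ _
      _ ≤ _ := this
      _ ≤ t.card * (C₁ * ENNReal.ofReal ((2 * R) ^ (finrank ℝ E - α))) := by gcongr
      _ = _ := by
        rw [Real.mul_rpow two_pos.le hR.le, ENNReal.ofReal_mul (by positivity), hC₂]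
        push_cast
        simp only [mul_assoc]
        rfl
  refine ⟨fun R hR => (hball R hR).trans (by push_cast; gcongr; exact le_self_add), fun k => ?_⟩
  have hk1 : (0 : ℝ) ≤ k := k.cast_nonneg
  rcases Nat.eq_zero_or_pos k with rfl | hk
  · calc _ ≤ ∫⁻ ξ in closedBall 0 1, ‖𝓕 (fun x => (f x : ℂ)) ξ‖ₑ ^ 2 :=
          lintegral_mono_set fun ξ hξ => by
            have := hξ.2
            simp only [Nat.cast_zero, zero_add] at this
            simpa using this.le
      _ ≤ _ := hball 1 one_pos
      _ ≤ _ := by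
        simp only [Real.one_rpow, Nat.cast_zero, zero_add]
        push_cast
        gcongr
        exact le_self_add
  · have hk2 : (1 : ℝ) ≤ k := by exact_mod_cast hk
    set R : ℝ := k + 1 / 2 with hR
    obtain ⟨η, hη, hη1, hη0, hη01⟩ := exists_smooth_cutoff
      (K := shell E R (1 / 2)) (U := {ξ | |‖ξ‖ - R| < 1})
      (isClosed_le (by fun_prop) continuous_const) (isOpen_lt (by fun_prop) continuous_const)
      fun ξ (hξ : |‖ξ‖ - R| ≤ 1 / 2) => show |‖ξ‖ - R| < 1 by linarith
    have hη0' : ∀ ξ ∉ shell E R 1, η ξ = 0 := fun ξ hξ =>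
      hη0 ξ fun h => hξ (show |‖ξ‖ - R| ≤ 1 from le_of_lt h)
    have := lintegral_cutoff_fourier_sq_le hf hfc hf0 hη hη01 (isBounded_shell R 1) hη0'
      (B := t.card * (A * ENNReal.ofReal (R ^ γ))) fun v hv => by
        refine (hcov _).trans ((Finset.sum_le_card_nsmul _ _ _ fun y _ =>
          hA R (by linarith) ν inferInstance hν y v hv).trans_eq ?_)
        rw [nsmul_eq_mul]
        ring
    calc _ ≤ ∫⁻ ξ in shell E R (1 / 2), ‖𝓕 (fun x => (f x : ℂ)) ξ‖ₑ ^ 2 :=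
          lintegral_mono_set fun ξ hξ => by
            obtain ⟨h1, h2⟩ : (k : ℝ) ≤ ‖ξ‖ ∧ ‖ξ‖ < k + 1 := hξ
            change |‖ξ‖ - R| ≤ 1 / 2
            exact abs_le.2 ⟨by linarith, by linarith⟩
      _ = ∫⁻ ξ in shell E R (1 / 2), ENNReal.ofReal (η ξ) * ‖𝓕 (fun x => (f x : ℂ)) ξ‖ₑ ^ 2 :=
          setLIntegral_congr_fun (isClosed_le (by fun_prop) continuous_const).measurableSet
            fun ξ hξ => by simp [hη1 ξ hξ]
      _ ≤ _ := setLIntegral_le_lintegral _ _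
      _ ≤ _ := this
      _ ≤ t.card * (t.card * (A * ENNReal.ofReal ((k + 1 : ℝ) ^ γ))) := by
        gcongr
        linarith
      _ ≤ _ := by
        simp only [← mul_assoc]
        gcongr
        push_cast
        exact le_add_self

end Falconer

namespace Falconer

open MeasureTheory Metric Set Filter Topology Module
open scoped FourierTransform ENNReal NNReal Pointwise ComplexConjugate RealInnerProductSpace

set_option linter.unusedSectionVars false

lemma exists_tsum_le_of_sum_le {a b : ℝ} (ha : 0 ≤ a) (hab : b < a) : ∃ C' : ℝ≥0,
    ∀ (p : ℕ → ℝ≥0∞) (C : ℝ≥0∞), (∀ n : ℕ, 0 < n → ∑ k ∈ Finset.range n, p k ≤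
      C * ENNReal.ofReal ((n : ℝ) ^ b)) →
    ∑' k : ℕ, ENNReal.ofReal ((k + 1 : ℝ) ^ (-a)) * p k ≤ C' * C := by
  set q : ℝ := (2 : ℝ) ^ (b - a) with hq
  have hq0 : 0 < q := by positivity
  have hq1 : q < 1 := Real.rpow_lt_one_of_one_lt_of_neg one_lt_two (by linarith)
  have hfin : ENNReal.ofReal ((2 : ℝ) ^ b) * (1 - ENNReal.ofReal q)⁻¹ ≠ ∞ := by
    refine ENNReal.mul_ne_top ENNReal.ofReal_ne_top (ENNReal.inv_ne_top.2 ?_)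
    refine (tsub_pos_of_lt ?_).ne'
    simpa using hq1
  refine ⟨(ENNReal.ofReal ((2 : ℝ) ^ b) * (1 - ENNReal.ofReal q)⁻¹).toNNReal, fun p C hp => ?_⟩
  rw [ENNReal.coe_toNNReal hfin]
  have h1 : ∀ k : ℕ, ENNReal.ofReal ((k + 1 : ℝ) ^ (-a)) * p k ≤
      ∑' j : ℕ, ENNReal.ofReal (((2 : ℝ) ^ j) ^ (-a)) * if k < 2 ^ (j + 1) then p k else 0 :=
    fun k => by
      refine le_trans ?_ (ENNReal.le_tsum (Nat.log 2 (k + 1)))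
      have h2 : k < 2 ^ (Nat.log 2 (k + 1) + 1) :=
        (Nat.lt_succ_self k).trans (Nat.lt_pow_succ_log_self one_lt_two _)
      have h3 : ((2 : ℝ) ^ Nat.log 2 (k + 1)) ≤ k + 1 := by
        exact_mod_cast Nat.pow_log_le_self 2 (Nat.succ_ne_zero k)
      rw [if_pos h2]
      gcongr ENNReal.ofReal ?_ * _
      exact Real.rpow_le_rpow_of_nonpos (by positivity) h3 (by linarith)
  calc _ ≤ ∑' k : ℕ, ∑' j : ℕ, _ := ENNReal.tsum_le_tsum h1
    _ = ∑' j : ℕ, ENNReal.ofReal (((2 : ℝ) ^ j) ^ (-a)) *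
        ∑' k : ℕ, if k < 2 ^ (j + 1) then p k else 0 := by
      rw [ENNReal.tsum_comm]
      simp_rw [ENNReal.tsum_mul_left]
    _ ≤ ∑' j : ℕ, C * ENNReal.ofReal ((2 : ℝ) ^ b) * ENNReal.ofReal q ^ j := by
      refine ENNReal.tsum_le_tsum fun j => ?_
      have h4 : ∑' k : ℕ, (if k < 2 ^ (j + 1) then p k else 0) =
          ∑ k ∈ Finset.range (2 ^ (j + 1)), p k := by
        rw [tsum_eq_sum (s := Finset.range (2 ^ (j + 1)))
          fun k hk => if_neg (by simpa using hk)]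
        exact Finset.sum_congr rfl fun k hk => if_pos (by simpa using hk)
      rw [h4]
      refine (mul_le_mul_right (hp _ (by positivity)) _).trans_eq ?_
      rw [mul_left_comm, mul_assoc, ← ENNReal.ofReal_pow hq0.le,
        ← ENNReal.ofReal_mul (by positivity), ← ENNReal.ofReal_mul (by positivity)]
      congr 2
      push_cast
      rw [pow_succ, Real.mul_rpow (by positivity) (by positivity), hq, ← mul_assoc,
        ← Real.rpow_add (by positivity), mul_comm, ← Real.rpow_natCast 2 j, ← Real.rpow_mul two_pos.le,
        ← Real.rpow_natCast, ← Real.rpow_mul two_pos.le]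
      congr 2
      ring
    _ = _ := by
      rw [ENNReal.tsum_mul_left, ENNReal.tsum_geometric]
      ring

variable {E : Type*} [NormedAddCommGroup E] [InnerProductSpace ℝ E] [FiniteDimensional ℝ E]
  [MeasurableSpace E] [BorelSpace E]

lemma fourier_fourier_schwartz (H : SchwartzMap E ℂ) (x : E) :
    𝓕 (𝓕 (H : E → ℂ)) x = H (-x) := by
  have h := congrFun (H.continuous.fourierInv_fourier_eq H.integrable
    (by rw [← SchwartzMap.fourier_coe]; exact SchwartzMap.integrable _)) (-x)
  rwa [Real.fourierInv_eq_fourier_neg, neg_neg] at h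

lemma integrable_fourier_schwartz (H : SchwartzMap E ℂ) : Integrable (𝓕 (H : E → ℂ)) := by
  rw [← SchwartzMap.fourier_coe]
  exact SchwartzMap.integrable _

lemma fourier_modul_reflected (H : SchwartzMap E ℂ) (x y : E) :
    𝓕 (modul x fun ξ => 𝓕 (H : E → ℂ) (-ξ)) y = H (y - x) := by
  rw [fourier_modul, ← Real.fourierInv_eq_fourier_comp_neg, Real.fourierInv_eq_fourier_neg,
    fourier_fourier_schwartz, neg_neg]

lemma sq_integral_le_lintegral {f : E → ℝ} (hf : Continuous f) (hfc : HasCompactSupport f)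
    (H : SchwartzMap E ℂ) (hH : ∀ x y, f x ≠ 0 → f y ≠ 0 → H (y - x) = 1) :
    ‖∫ x, f x‖ₑ ^ 2 ≤
      ∫⁻ ξ, ‖𝓕 (H : E → ℂ) ξ‖ₑ * ‖𝓕 (fun x => (f x : ℂ)) ξ‖ₑ ^ 2 := by
  set ρ : E → ℂ := fun x => (f x : ℂ) with hρ
  have hρc : Continuous ρ := Complex.continuous_ofReal.comp hf
  have hρi : Integrable ρ := hρc.integrable_of_hasCompactSupport
    (hfc.comp_left (g := fun t : ℝ => (t : ℂ)) Complex.ofReal_zero)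
  set F := 𝓕 (H : E → ℂ) with hF
  have hFi : Integrable F := integrable_fourier_schwartz H
  have hconj : ∀ ξ, 𝓕 ρ (-ξ) = conj (𝓕 ρ ξ) := fun ξ => by
    have := fourier_conj ρ (-ξ)
    rw [neg_neg, show (fun x => conj (ρ x)) = ρ by ext; simp [ρ]] at this
    exact this
  have hg : Integrable fun ξ => F ξ * 𝓕 ρ (-ξ) := by
    refine hFi.mul_bdd (c := ∫ x, ‖ρ x‖)
      ((continuous_fourier hρi).comp continuous_neg).aestronglyMeasurable (ae_of_all _ fun ξ => ?_)
    exact VectorFourier.norm_fourierIntegral_le_integral_norm _ _ _ _ _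
  have h1 := integral_fourier_mul hρi hg
  have h2 : ∀ x, 𝓕 (fun ξ => F ξ * 𝓕 ρ (-ξ)) x = ∫ y, ρ y * H (y - x) := fun x => by
    have h3 := integral_fourier_mul hρi (v := modul x fun ξ => F (-ξ)) (integrable_modul hFi.comp_neg)
    simp_rw [hF, fourier_modul_reflected] at h3
    rw [← h3, Real.fourier_eq, ← integral_neg_eq_self]
    refine integral_congr_ae (ae_of_all _ fun ξ => ?_)
    simp only [modul, hF, neg_neg, inner_neg_left, Circle.smul_def, Real.fourierChar_apply, smul_eq_mul]
    push_cast
    ring_nf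
  have h4 : ∀ x, ρ x * ∫ y, ρ y * H (y - x) = ρ x * ∫ y, ρ y := fun x => by
    by_cases hx : f x = 0
    · simp [ρ, hx]
    · congr 1
      refine integral_congr_ae (ae_of_all _ fun y => ?_)
      by_cases hy : f y = 0
      · simp [ρ, hy]
      · simp only [hH x y hx hy, mul_one]
  simp_rw [h2, h4] at h1
  rw [integral_mul_const, integral_complex_ofReal, ← Complex.ofReal_mul] at h1
  calc ‖∫ x, f x‖ₑ ^ 2 = ‖(((∫ x, f x) * ∫ x, f x : ℝ) : ℂ)‖ₑ := by
        rw [← ofReal_norm (_ : ℂ), Complex.norm_real, ofReal_norm, enorm_mul, sq]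
    _ ≤ _ := by
      rw [← h1]
      refine (enorm_integral_le_lintegral_enorm _).trans_eq (lintegral_congr fun ξ => ?_)
      rw [enorm_mul, enorm_mul, hconj, sq, RCLike.enorm_conj]
      ring

lemma measurableSet_annulus (k : ℕ) : MeasurableSet (annulus E k) :=
  (isClosed_le continuous_const continuous_norm).measurableSet.inter
    (isOpen_lt continuous_norm continuous_const).measurableSet

lemma pairwise_disjoint_annulus : Pairwise (Function.onFun Disjoint (annulus E)) := by
  intro i j hij
  refine disjoint_left.2 fun ξ h1 h2 => hij ?_
  obtain ⟨a, b⟩ := h1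
  obtain ⟨c, e⟩ := h2
  have h3 : (i : ℝ) < j + 1 := a.trans_lt e
  have h4 : (j : ℝ) < i + 1 := c.trans_lt b
  have h5 : i < j + 1 := by exact_mod_cast h3
  have h6 : j < i + 1 := by exact_mod_cast h4
  omega

lemma iUnion_annulus : ⋃ k, annulus E k = univ :=
  eq_univ_of_forall fun ξ => mem_iUnion.2
    ⟨⌊‖ξ‖⌋₊, Nat.floor_le (norm_nonneg _), Nat.lt_floor_add_one _⟩

lemma volume_annulus_ge [Nontrivial E] (k : ℕ) :
    ENNReal.ofReal ((k + 1 : ℝ) ^ (finrank ℝ E - 1)) * volume (ball (0 : E) 1) ≤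
      volume (annulus E k) := by
  have hk : (0 : ℝ) ≤ k := k.cast_nonneg
  have h1 : annulus E k = ball 0 (k + 1) \ ball 0 k := by
    ext ξ
    simp [annulus, and_comm]
  rw [h1, measure_sdiff (ball_subset_ball (by linarith)) measurableSet_ball.nullMeasurableSet
    measure_ball_lt_top.ne, Measure.addHaar_ball _ _ (r := (k : ℝ) + 1) (by positivity),
    Measure.addHaar_ball _ _ hk,
    ← ENNReal.sub_mul fun _ _ => measure_ball_lt_top.ne, ← ENNReal.ofReal_sub _ (by positivity)]
  gcongr
  obtain ⟨n, hn⟩ := Nat.exists_eq_succ_of_ne_zero (finrank_pos (R := ℝ) (M := E)).ne'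
  rw [hn, Nat.succ_eq_add_one, Nat.add_sub_cancel, pow_succ, pow_succ]
  have : (k : ℝ) ^ n ≤ (k + 1) ^ n := by gcongr; linarith
  nlinarith

lemma lintegral_mul_dk_le {F : E → ℂ} (N : ℕ) (hrad : ∀ (L : E ≃ₗᵢ[ℝ] E) x, F (L x) = F x) (k : ℕ)
    {x x' : E} (hx : x ∈ annulus E k) (hx' : x' ∈ annulus E k) :
    ∫⁻ y, ‖F y‖ₑ ^ 2 * dk N (x - y) ≤ 2 ^ N * ∫⁻ y, ‖F y‖ₑ ^ 2 * dk N (x' - y) := by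
  obtain ⟨L, hL⟩ : ∃ L : E ≃ₗᵢ[ℝ] E, ‖x' - L x‖ ≤ 1 := by
    obtain ⟨h1, h2⟩ := hx
    obtain ⟨h3, h4⟩ := hx'
    rcases eq_or_ne x' 0 with h0 | h0
    · refine ⟨LinearIsometryEquiv.refl ℝ E, ?_⟩
      rw [h0, norm_zero] at h3 h4
      simp only [h0, LinearIsometryEquiv.coe_refl, id_eq, zero_sub, norm_neg]
      linarith
    · have hpos : 0 < ‖x'‖ := norm_pos_iff.2 h0
      have hn : ‖x‖ = ‖(‖x‖ / ‖x'‖) • x'‖ := by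
        rw [norm_smul, Real.norm_of_nonneg (by positivity), div_mul_cancel₀ _ hpos.ne']
      refine ⟨(Submodule.span ℝ {x - (‖x‖ / ‖x'‖) • x'})ᗮ.reflection, ?_⟩
      rw [Submodule.reflection_sub hn]
      have : x' - (‖x‖ / ‖x'‖) • x' = (1 - ‖x‖ / ‖x'‖) • x' := by module
      rw [this, norm_smul, Real.norm_eq_abs, ← abs_of_pos hpos, ← abs_mul, abs_of_pos hpos, sub_mul,
        div_mul_cancel₀ _ hpos.ne', one_mul, abs_le]
      constructor <;> linarith
  have h1 : ∫⁻ y, ‖F y‖ₑ ^ 2 * dk N (L x - y) = ∫⁻ y, ‖F y‖ₑ ^ 2 * dk N (x - y) := by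
    rw [← L.measurePreserving.lintegral_comp_emb L.toHomeomorph.measurableEmbedding]
    refine lintegral_congr fun y => ?_
    rw [hrad, ← map_sub]
    simp only [dk, wt, ← ofReal_norm, L.norm_map]
  rw [← h1, ← lintegral_const_mul' _ _ (by finiteness)]
  refine lintegral_mono fun y => ?_
  have h2 := dk_le N (L x - y) (x' - L x)
  rw [show L x - y + (x' - L x) = x' - y by abel] at h2
  have h3 : wt (x' - L x) ≤ 2 := by
    rw [wt_eq_ofReal]
    exact ENNReal.ofReal_le_of_le_toReal (by norm_num; linarith)
  calc ‖F y‖ₑ ^ 2 * dk N (L x - y) ≤ ‖F y‖ₑ ^ 2 * (2 ^ N * dk N (x' - y)) := by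
        gcongr
        exact h2.trans (by gcongr)
    _ = _ := by ring

end Falconer

namespace Falconer

open MeasureTheory Metric Set Filter Topology Module
open scoped FourierTransform ENNReal NNReal Pointwise ComplexConjugate RealInnerProductSpace

set_option linter.unusedSectionVars false

variable {E : Type*} [NormedAddCommGroup E] [InnerProductSpace ℝ E] [FiniteDimensional ℝ E]
  [MeasurableSpace E] [BorelSpace E]

lemma lintegral_eq_tsum_annulus (g : E → ℝ≥0∞) : ∫⁻ x, g x = ∑' k, ∫⁻ x in annulus E k, g x := by
  rw [← lintegral_iUnion measurableSet_annulus pairwise_disjoint_annulus, iUnion_annulus,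
    Measure.restrict_univ]

lemma sum_setLIntegral_annulus_le (g : E → ℝ≥0∞) (n : ℕ) :
    ∑ k ∈ Finset.range n, ∫⁻ x in annulus E k, g x ≤ ∫⁻ x in closedBall 0 n, g x := by
  rw [← lintegral_biUnion_finset (fun i _ j _ hij => pairwise_disjoint_annulus hij)
    fun k _ => measurableSet_annulus k]
  refine lintegral_mono_set (iUnion₂_subset fun k hk ξ hξ => ?_)
  have h1 : (k : ℝ) + 1 ≤ n := by exact_mod_cast Finset.mem_range.1 hk
  simpa using hξ.2.le.trans h1

lemma inv_volume_annulus_le [Nontrivial E] (k : ℕ) :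
    (volume (annulus E k))⁻¹ ≤
      (volume (ball (0 : E) 1))⁻¹ * ENNReal.ofReal ((k + 1 : ℝ) ^ (-(finrank ℝ E - 1 : ℝ))) := by
  have h := ENNReal.inv_le_inv.2 (volume_annulus_ge (E := E) k)
  refine h.trans_eq ?_
  rw [ENNReal.mul_inv (Or.inr measure_ball_lt_top.ne)
    (Or.inr (measure_ball_pos _ _ one_pos).ne'), mul_comm,
    ← ENNReal.ofReal_inv_of_pos (by positivity), Real.rpow_neg (by positivity), ← Real.rpow_natCast,
    Nat.cast_sub (Nat.one_le_iff_ne_zero.2 (finrank_pos (R := ℝ) (M := E)).ne'), Nat.cast_one]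

set_option maxHeartbeats 1000000 in
lemma exists_sq_integral_le [Nontrivial E] {α γ : ℝ} (hγ : 0 ≤ γ) {A : ℝ≥0}
    (hA : ShellBound E α γ A) (hαd : α ≤ finrank ℝ E)
    (hgap : finrank ℝ E - α < finrank ℝ E - 1 - γ) (r₀ : ℝ) {T : ℝ} (hT : 1 ≤ T) :
    ∃ C : ℝ≥0, ∀ f : E → ℝ, Continuous f → HasCompactSupport f → (∀ x, 0 ≤ f x) →
    (∀ x, f x ≠ 0 → ‖x‖ ≤ r₀) →
    HasPow α (volume.withDensity fun x => ENNReal.ofReal (f x)) →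
    ∀ H : SchwartzMap E ℂ, (∀ x, H x ≠ 0 → ‖x‖ ≤ T) → (∀ (L : E ≃ₗᵢ[ℝ] E) x, H (L x) = H x) →
    (∀ x y, f x ≠ 0 → f y ≠ 0 → H (y - x) = 1) → ∀ l : ℝ≥0, l ≠ 0 →
    ‖∫ x, f x‖ₑ ^ 2 ≤ C * (l * ∫⁻ x, ‖H x‖ₑ ^ 2) + C * (l⁻¹ : ℝ≥0) := by
  obtain ⟨C₀, hC₀⟩ := exists_energy_bounds hγ hA r₀
  set N := finrank ℝ E + 1 with hN
  obtain ⟨C₁, hC₁⟩ := exists_local_const (E := E) N (Nat.lt_succ_self _)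
  obtain ⟨C₂, hC₂⟩ := exists_tsum_le_of_sum_le (a := finrank ℝ E - 1 - γ) (b := finrank ℝ E - α)
    (by linarith) hgap
  have hDtop := (lintegral_dk_lt_top (E := E) (Nat.lt_succ_self _)).ne
  rw [Nat.succ_eq_add_one, ← hN] at hDtop
  set D := ∫⁻ x : E, dk N x with hD
  set v := volume (ball (0 : E) 1) with hv
  have hv0 : v⁻¹ ≠ ∞ := ENNReal.inv_ne_top.2 (measure_ball_pos _ _ one_pos).ne'
  set K₁ : ℝ≥0∞ := C₁ * ENNReal.ofReal (T ^ (finrank ℝ E - 1) * T) with hK₁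
  have hX : K₁ * 2 ^ N * 2 ^ N * D ≠ ∞ := by finiteness
  have hY : v⁻¹ * C₀ * (C₂ * C₀) ≠ ∞ := by finiteness
  obtain ⟨e, he⟩ : ∃ e : E, ‖e‖ = 1 := exists_norm_eq E zero_le_one
  refine ⟨(K₁ * 2 ^ N * 2 ^ N * D).toNNReal + (v⁻¹ * C₀ * (C₂ * C₀)).toNNReal,
    fun f hf hfc hf0 hfs hν H hHT hHL hH l hl => ?_⟩
  obtain ⟨hE1, hE2⟩ := hC₀ f hf hfc hf0 hfs hν
  set F := 𝓕 (H : E → ℂ) with hF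
  set ρ : E → ℂ := fun x => (f x : ℂ) with hρ
  have hρi : Integrable ρ := (Complex.continuous_ofReal.comp hf).integrable_of_hasCompactSupport
    (hfc.comp_left (g := fun t : ℝ => (t : ℂ)) Complex.ofReal_zero)
  have hPm : Measurable fun ξ => ‖𝓕 ρ ξ‖ₑ ^ 2 :=
    (continuous_fourier hρi).measurable.enorm.pow_const 2
  have hFPW : PW (closedBall 0 T) F := by
    refine ⟨continuous_fourier H.integrable, integrable_fourier_schwartz H, fun ξ hξ => ?_⟩
    rw [hF, fourier_fourier_schwartz]
    by_contra h
    exact hξ (by simpa using hHT _ h)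
  have hFL : ∀ (L : E ≃ₗᵢ[ℝ] E) x, F (L x) = F x := fun L x => by
    rw [hF, ← Real.fourier_comp_linearIsometry]
    rw [show (H : E → ℂ) ∘ L = H from funext (hHL L)]
  have hFH : ∫⁻ x, ‖F x‖ₑ ^ 2 = ∫⁻ x, ‖H x‖ₑ ^ 2 := by
    rw [← hFPW.lintegral_fourier_sq isBounded_closedBall, hF]
    simp_rw [fourier_fourier_schwartz]
    exact lintegral_neg_eq_self (fun x => ‖H x‖ₑ ^ 2)
  set Q : E → ℝ≥0∞ := fun x => ∫⁻ y, ‖F y‖ₑ ^ 2 * dk N (x - y) with hQ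
  have hFm : Measurable fun y => ‖F y‖ₑ ^ 2 := hFPW.cont.measurable.enorm.pow_const 2
  have hloc : ∀ x, ‖F x‖ₑ ^ 2 ≤ K₁ * Q x := fun x => by
    refine (hC₁ hFPW isBounded_closedBall he (a := T) (b := T) (ξ₀ := 0) (by linarith) (by linarith)
      (fun ξ hξ => ?_) x).trans ?_
    · rw [stretch_self, sub_zero, norm_smul, Real.norm_of_nonneg (by positivity),
        inv_mul_le_iff₀ (by linarith), mul_one]
      simpa using hξ
    · rw [hK₁, mul_assoc]
      gcongr
      refine lintegral_mono fun y => ?_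
      gcongr
      refine dk_anti ?_
      rw [stretch_self, norm_smul, Real.norm_of_nonneg (by linarith)]
      exact le_mul_of_one_le_left (norm_nonneg _) hT
  have hQint : ∫⁻ x, Q x = D * ∫⁻ x, ‖H x‖ₑ ^ 2 := by
    rw [hQ, lintegral_lintegral_swap]
    · rw [← hFH, ← lintegral_const_mul _ hFm]
      refine lintegral_congr fun y => ?_
      have hm : Measurable fun x : E => dk N (x - y) :=
        (measurable_dk N).comp (measurable_id.sub_const y)
      rw [lintegral_const_mul _ hm,
        lintegral_sub_right_eq_self (fun x => dk N x) y, mul_comm]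
    · exact ((hFm.comp measurable_snd).mul
        ((measurable_dk N).comp (measurable_fst.sub measurable_snd))).aemeasurable
  set z : ℕ → E := fun k => (k : ℝ) • e with hz
  have hzk : ∀ k, z k ∈ annulus E k := fun k => by
    have : ‖z k‖ = k := by simp [hz, norm_smul, he]
    exact ⟨this.ge, by rw [this]; linarith⟩
  set p : ℕ → ℝ≥0∞ := fun k => ∫⁻ ξ in annulus E k, ‖𝓕 ρ ξ‖ₑ ^ 2 with hp
  have hterm : ∀ k, ∫⁻ ξ in annulus E k, ‖F ξ‖ₑ * ‖𝓕 ρ ξ‖ₑ ^ 2 ≤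
      l * (K₁ * 2 ^ N * 2 ^ N) * (∫⁻ x in annulus E k, Q x) + (l⁻¹ : ℝ≥0) * (v⁻¹ * C₀) *
        (ENNReal.ofReal ((k + 1 : ℝ) ^ (-(finrank ℝ E - 1 - γ))) * p k) := fun k => by
    set m : ℝ≥0∞ := (K₁ * 2 ^ N * Q (z k)) ^ (1 / 2 : ℝ) with hm
    have hm2 : m ^ 2 = K₁ * 2 ^ N * Q (z k) := by
      rw [hm, ← ENNReal.rpow_natCast, ← ENNReal.rpow_mul]
      norm_num
    have hFm' : ∀ ξ ∈ annulus E k, ‖F ξ‖ₑ ≤ m := fun ξ hξ => by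
      rw [← ENNReal.pow_le_pow_left_iff two_ne_zero, hm2, mul_assoc]
      exact (hloc ξ).trans (by gcongr; exact lintegral_mul_dk_le N hFL k hξ (hzk k))
    set V := volume (annulus E k) with hV
    have hV0 : V ≠ 0 := fun h => by
      have := volume_annulus_ge (E := E) k
      rw [← hV, h, nonpos_iff_eq_zero, mul_eq_zero] at this
      rcases this with h | h
      · rw [ENNReal.ofReal_eq_zero] at h
        exact absurd h (by push Not; positivity)
      · exact (measure_ball_pos _ _ one_pos).ne' h
    have hVtop : V ≠ ∞ := by
      refine ((measure_mono (t := closedBall (0 : E) (k + 1)) fun ξ hξ => ?_).trans_lt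
        measure_closedBall_lt_top).ne
      simpa using hξ.2.le
    have hlV : l * V.toNNReal ≠ 0 :=
      mul_ne_zero hl (by simp [ENNReal.toNNReal_eq_zero_iff, hV0, hVtop])
    have hVQ : V * Q (z k) ≤ 2 ^ N * ∫⁻ x in annulus E k, Q x := by
      calc V * Q (z k) = ∫⁻ _ in annulus E k, Q (z k) := by rw [setLIntegral_const, mul_comm]
        _ ≤ ∫⁻ x in annulus E k, 2 ^ N * Q x :=
          setLIntegral_mono' (measurableSet_annulus k) fun x hx =>
            lintegral_mul_dk_le N hFL k (hzk k) hx
        _ = _ := lintegral_const_mul' _ _ (by finiteness)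
    calc _ ≤ ∫⁻ ξ in annulus E k, m * ‖𝓕 ρ ξ‖ₑ ^ 2 :=
          setLIntegral_mono' (measurableSet_annulus k) fun ξ hξ => by gcongr; exact hFm' ξ hξ
      _ = m * p k := lintegral_const_mul _ hPm
      _ ≤ _ := ennreal_mul_le_add_sq hlV _ _
      _ ≤ _ := by
        refine add_le_add ?_ ?_
        · rw [hm2, ENNReal.coe_mul, ENNReal.coe_toNNReal hVtop]
          calc _ = l * (K₁ * 2 ^ N) * (V * Q (z k)) := by ring
            _ ≤ l * (K₁ * 2 ^ N) * (2 ^ N * ∫⁻ x in annulus E k, Q x) := by gcongr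
            _ = _ := by ring
        · rw [mul_inv, ENNReal.coe_mul, ENNReal.coe_inv (r := V.toNNReal) (right_ne_zero_of_mul hlV),
            ENNReal.coe_toNNReal hVtop, sq]
          calc _ ≤ (l⁻¹ : ℝ≥0) * (v⁻¹ * ENNReal.ofReal ((k + 1 : ℝ) ^ (-(finrank ℝ E - 1 : ℝ)))) *
                (C₀ * ENNReal.ofReal ((k + 1 : ℝ) ^ γ) * p k) := by
                gcongr
                · exact inv_volume_annulus_le k
                · exact hE2 k
            _ = (l⁻¹ : ℝ≥0) * (v⁻¹ * C₀) * (ENNReal.ofReal ((k + 1 : ℝ) ^ (-(finrank ℝ E - 1 : ℝ))) *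
                ENNReal.ofReal ((k + 1 : ℝ) ^ γ) * p k) := by ring
            _ = _ := by
              rw [← ENNReal.ofReal_mul (by positivity), ← Real.rpow_add (by positivity)]
              congr 4
              ring
  have hsum : ∀ n : ℕ, 0 < n → ∑ k ∈ Finset.range n, p k ≤
      C₀ * ENNReal.ofReal ((n : ℝ) ^ (finrank ℝ E - α)) := fun n hn =>
    (sum_setLIntegral_annulus_le _ n).trans (hE1 n (by exact_mod_cast hn))
  calc ‖∫ x, f x‖ₑ ^ 2 ≤ _ := sq_integral_le_lintegral hf hfc H hH
    _ = ∑' k, ∫⁻ ξ in annulus E k, ‖F ξ‖ₑ * ‖𝓕 ρ ξ‖ₑ ^ 2 := lintegral_eq_tsum_annulus _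
    _ ≤ _ := ENNReal.tsum_le_tsum hterm
    _ = l * (K₁ * 2 ^ N * 2 ^ N) * (∫⁻ x, Q x) + (l⁻¹ : ℝ≥0) * (v⁻¹ * C₀) *
        ∑' k : ℕ, (ENNReal.ofReal ((k + 1 : ℝ) ^ (-(finrank ℝ E - 1 - γ))) * p k) := by
      rw [ENNReal.tsum_add, ENNReal.tsum_mul_left, ENNReal.tsum_mul_left, lintegral_eq_tsum_annulus]
    _ ≤ l * (K₁ * 2 ^ N * 2 ^ N) * (D * ∫⁻ x, ‖H x‖ₑ ^ 2) + (l⁻¹ : ℝ≥0) * (v⁻¹ * C₀) *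
        (C₂ * C₀) := by
      rw [hQint]
      gcongr
      exact hC₂ p C₀ hsum
    _ = K₁ * 2 ^ N * 2 ^ N * D * (l * ∫⁻ x, ‖H x‖ₑ ^ 2) + v⁻¹ * C₀ * (C₂ * C₀) * (l⁻¹ : ℝ≥0) := by
      ring
    _ ≤ _ := by
      rw [ENNReal.coe_add, ENNReal.coe_toNNReal hX, ENNReal.coe_toNNReal hY]
      gcongr
      · exact le_self_add
      · exact le_add_self

end Falconer

namespace Falconer

open MeasureTheory Metric Set Filter Topology Module
open scoped FourierTransform ENNReal NNReal Pointwise ComplexConjugate RealInnerProductSpace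

set_option linter.unusedSectionVars false

section Radial

variable {E : Type*} [NormedAddCommGroup E] [InnerProductSpace ℝ E] [FiniteDimensional ℝ E]
  [MeasurableSpace E] [BorelSpace E]

lemma volume_norm_preimage_eq_zero [Nontrivial E] {D : Set ℝ} (hD : IsCompact D)
    (h : volume D = 0) : volume {x : E | ‖x‖ ∈ D} = 0 := by
  have hm : MeasurableSet {x : E | ‖x‖ ∈ D} := measurable_norm hD.measurableSet
  obtain ⟨M, hM⟩ := hD.isBounded.subset_closedBall 0
  have hfin : volume {x : E | ‖x‖ ∈ D} ≠ ∞ :=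
    ((measure_mono fun x (hx : ‖x‖ ∈ D) => by simpa using hM hx).trans_lt
      (measure_closedBall_lt_top (x := (0 : E)) (r := M))).ne
  have h1 := integral_fun_norm_addHaar (volume : Measure E) (D.indicator fun _ => (1 : ℝ))
  have h2 : ∫ y in Ioi (0 : ℝ), y ^ (finrank ℝ E - 1) • D.indicator (fun _ => (1 : ℝ)) y = 0 := by
    refine (integral_congr_ae (ae_restrict_of_ae ?_)).trans (integral_zero _ _)
    filter_upwards [compl_mem_ae_iff.2 h] with y hy
    simp [indicator_of_notMem hy]
  have h3 : ∫ x : E, D.indicator (fun _ => (1 : ℝ)) ‖x‖ = volume.real {x : E | ‖x‖ ∈ D} := by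
    rw [← integral_indicator_one hm]
    rfl
  rw [h2, smul_zero, smul_zero, h3] at h1
  exact (measureReal_eq_zero_iff hfin).1 h1

lemma exists_radial_cutoff [Nontrivial E] {D : Set ℝ} (hD : IsCompact D) (h : volume D = 0)
    (hD0 : ∀ r ∈ D, 0 ≤ r) {M : ℝ} (hM : ∀ r ∈ D, r ≤ M) {κ : ℝ≥0∞} (hκ : κ ≠ 0) :
    ∃ ε > 0, ∃ H : SchwartzMap E ℂ, (∀ x, H x ≠ 0 → ‖x‖ ≤ M + 1) ∧
      (∀ (L : E ≃ₗᵢ[ℝ] E) x, H (L x) = H x) ∧ (∀ x, ∀ r ∈ D, |‖x‖ - r| ≤ ε → H x = 1) ∧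
      ∫⁻ x, ‖H x‖ₑ ^ 2 ≤ κ := by
  set G : Set E := {x | ‖x‖ ∈ D} with hG
  have hGc : IsCompact G := by
    refine (isCompact_closedBall (0 : E) M).of_isClosed_subset
      (hD.isClosed.preimage continuous_norm) fun x hx => ?_
    simpa using hM _ hx
  have hlim := tendsto_measure_cthickening_of_isCompact (μ := (volume : Measure E)) hGc
  rw [volume_norm_preimage_eq_zero hD h] at hlim
  have hev := (hlim.eventually (gt_mem_nhds (pos_iff_ne_zero.2 hκ))).filter_mono
    (nhdsWithin_le_nhds (s := Ioi 0))
  obtain ⟨ε, hε1, hε, hε2⟩ := (hev.and ((eventually_mem_nhdsWithin).and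
    (mem_nhdsWithin_of_mem_nhds (Iic_mem_nhds one_pos)))).exists
  have hε0 : 0 < ε := hε
  obtain ⟨η, hη, hη1, hη0, hη01⟩ := exists_smooth_cutoff
    (K := Real.sqrt ⁻¹' cthickening (ε / 2) D) (U := Real.sqrt ⁻¹' thickening ε D)
    (isClosed_cthickening.preimage Real.continuous_sqrt)
    (isOpen_thickening.preimage Real.continuous_sqrt)
    (preimage_mono (cthickening_subset_thickening' hε0 (half_lt_self hε0) _))
  set g : E → ℝ := fun x => η (‖x‖ ^ 2) with hg
  have hgs : ContDiff ℝ ((⊤ : ℕ∞) : WithTop ℕ∞) g := hη.comp (contDiff_norm_sq ℝ)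
  have hsupp : ∀ x, g x ≠ 0 → ∃ r ∈ D, |‖x‖ - r| < ε := fun x hx => by
    by_contra! hcon
    refine hx (hη0 _ fun hmem => ?_)
    rw [mem_preimage, Real.sqrt_sq (norm_nonneg x), mem_thickening_iff] at hmem
    obtain ⟨r, hr, hr'⟩ := hmem
    rw [Real.dist_eq] at hr'
    linarith [hcon r hr]
  have hbd : ∀ x, g x ≠ 0 → ‖x‖ ≤ M + 1 := fun x hx => by
    obtain ⟨r, hr, hr'⟩ := hsupp x hx
    have h2 : ε ≤ 1 := hε2
    linarith [hM r hr, (abs_lt.1 hr').2]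
  have hgc : HasCompactSupport fun x => (g x : ℂ) :=
    HasCompactSupport.of_support_subset_isCompact (isCompact_closedBall (0 : E) (M + 1)) fun x hx => by
      simpa using hbd x (by simpa using hx)
  refine ⟨ε / 2, half_pos hε0, hgc.toSchwartzMap (Complex.ofRealCLM.contDiff.comp hgs),
    fun x hx => ?_, fun L x => ?_, fun x r hr hxr => ?_, ?_⟩
  · exact hbd x fun h0 => hx (show ((g x : ℝ) : ℂ) = 0 by rw [h0, Complex.ofReal_zero])
  · show ((g (L x) : ℝ) : ℂ) = (g x : ℝ)
    simp only [hg, L.norm_map]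
  · show ((g x : ℝ) : ℂ) = 1
    rw [hg]
    simp only
    rw [hη1, Complex.ofReal_one]
    rw [mem_preimage, Real.sqrt_sq (norm_nonneg x)]
    exact mem_cthickening_of_dist_le _ r _ _ hr (by rwa [Real.dist_eq])
  · refine le_trans ?_ hε1.le
    rw [← lintegral_indicator_one isClosed_cthickening.measurableSet]
    refine lintegral_mono fun x => ?_
    show ‖((g x : ℝ) : ℂ)‖ₑ ^ 2 ≤ _
    by_cases hx : g x = 0
    · simp [hx]
    · obtain ⟨r, hr, hr'⟩ := hsupp x hx
      have hmem : x ∈ cthickening ε G := by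
        rcases eq_or_ne x 0 with h0 | h0
        · obtain ⟨y, hy⟩ := exists_norm_eq E (hD0 r hr)
          refine mem_cthickening_of_dist_le x y _ _ (by simpa [hG, hy] using hr) ?_
          rw [h0, dist_zero_left, hy]
          rw [h0, norm_zero, zero_sub, abs_neg] at hr'
          exact (le_abs_self r).trans hr'.le
        · have hpos : 0 < ‖x‖ := norm_pos_iff.2 h0
          refine mem_cthickening_of_dist_le x ((r / ‖x‖) • x) _ _ ?_ ?_
          · show ‖(r / ‖x‖) • x‖ ∈ D
            rwa [norm_smul, Real.norm_of_nonneg (div_nonneg (hD0 r hr) hpos.le),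
              div_mul_cancel₀ _ hpos.ne']
          · rw [dist_eq_norm, show x - (r / ‖x‖) • x = (1 - r / ‖x‖) • x by module, norm_smul,
              Real.norm_eq_abs, ← abs_of_pos hpos, ← abs_mul, abs_of_pos hpos, sub_mul,
              div_mul_cancel₀ _ hpos.ne', one_mul]
            exact hr'.le
      rw [indicator_of_mem hmem, Pi.one_apply, ← ofReal_norm, Complex.norm_real,
        Real.norm_of_nonneg (hη01 _).1]
      exact pow_le_one₀ zero_le (by simpa using (hη01 _).2)

end Radial

variable {d : ℕ}

lemma volume_distances_ne_zero {α γ : ℝ} (hd : 1 ≤ d) (hγ : 0 ≤ γ) (hα : 0 < α) (hαd : α ≤ d)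
    (hgap : d - α < d - 1 - γ) {S : ℝ≥0} (hS : ShellBound (EuclideanSpace ℝ (Fin d)) α γ S)
    {A : Set (EuclideanSpace ℝ (Fin d))} (hA : IsCompact A) (h : μH[α] A ≠ 0) :
    volume ((fun q : EuclideanSpace ℝ (Fin d) × EuclideanSpace ℝ (Fin d) => dist q.1 q.2) ''
      (A ×ˢ A)) ≠ 0 := by
  have : NeZero d := ⟨by omega⟩
  intro hzero
  set D := (fun q : EuclideanSpace ℝ (Fin d) × EuclideanSpace ℝ (Fin d) => dist q.1 q.2) ''
      (A ×ˢ A) with hD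
  have hDc : IsCompact D := (hA.prod hA).image continuous_dist
  obtain ⟨c, hc, hfr⟩ := exists_frostman hA hα hαd h
  obtain ⟨R, hR0, hR⟩ : ∃ R : ℝ, 0 ≤ R ∧ ∀ x ∈ A, ‖x‖ ≤ R := by
    obtain ⟨R, hR⟩ := hA.isBounded.exists_norm_le
    exact ⟨max R 0, le_max_right _ _, fun x hx => (hR x hx).trans (le_max_left _ _)⟩
  have hD0 : ∀ r ∈ D, 0 ≤ r := by
    rintro _ ⟨q, -, rfl⟩
    exact dist_nonneg
  have hDR : ∀ r ∈ D, r ≤ 2 * R := by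
    rintro _ ⟨q, ⟨h1, h2⟩, rfl⟩
    have := dist_le_norm_add_norm q.1 q.2
    linarith [hR _ h1, hR _ h2]
  obtain ⟨C, hC⟩ := exists_sq_integral_le hγ hS (by simpa using hαd) (by simpa using hgap) (R + 1)
    (T := 2 * R + 1) (by linarith)
  set l : ℝ≥0 := (2 * C + 1) / c.toNNReal ^ 2 with hl
  have hc' : c.toNNReal ≠ 0 := (Real.toNNReal_pos.2 hc).ne'
  have hl0 : l ≠ 0 := by positivity
  obtain ⟨ε, hε, H, hHT, hHL, hH1, hHκ⟩ := exists_radial_cutoff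
    (E := EuclideanSpace ℝ (Fin d)) hDc hzero hD0 hDR
    (κ := ((l⁻¹ * l⁻¹ : ℝ≥0) : ℝ≥0∞)) (by simpa using hl0)
  obtain ⟨f, hf, hfc, hf0, hfs, hfint, hfν⟩ := hfr (min 1 (ε / 2)) (lt_min one_pos (half_pos hε))
  have key := hC f hf.continuous hfc hf0 (fun x hx => by
    obtain ⟨a, ha, hxa⟩ := hfs x hx
    have h1 : ‖x‖ ≤ ‖x - a‖ + ‖a‖ := by simpa using norm_add_le (x - a) a
    rw [dist_eq_norm] at hxa
    linarith [hR a ha, hxa.trans (min_le_left _ _)]) hfν H hHT hHL (fun x y hx hy => by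
    obtain ⟨a, ha, hxa⟩ := hfs x hx
    obtain ⟨b, hb, hyb⟩ := hfs y hy
    refine hH1 _ (dist b a) ⟨(b, a), ⟨hb, ha⟩, rfl⟩ ?_
    rw [← dist_eq_norm, ← Real.dist_eq]
    refine (dist_dist_dist_le _ _ _ _).trans ?_
    linarith [hxa.trans (min_le_right _ _), hyb.trans (min_le_right _ _)]) l hl0
  have h1 : ((c.toNNReal ^ 2 : ℝ≥0) : ℝ≥0∞) ≤ ((C * l⁻¹ + C * l⁻¹ : ℝ≥0) : ℝ≥0∞) := by
    calc ((c.toNNReal ^ 2 : ℝ≥0) : ℝ≥0∞) ≤ ‖∫ x, f x‖ₑ ^ 2 := by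
          rw [ENNReal.coe_pow, Real.enorm_of_nonneg (integral_nonneg hf0)]
          gcongr
          exact ENNReal.ofReal_le_ofReal hfint
      _ ≤ _ := key
      _ ≤ C * (l * ((l⁻¹ * l⁻¹ : ℝ≥0) : ℝ≥0∞)) + C * (l⁻¹ : ℝ≥0) := by gcongr
      _ = _ := by
        rw [← ENNReal.coe_mul, mul_inv_cancel_left₀ hl0]
        push_cast
        rfl
  have h2 : c.toNNReal ^ 2 ≤ C * l⁻¹ + C * l⁻¹ := by exact_mod_cast h1
  have h3 : c.toNNReal ^ 2 * l ≤ 2 * C := by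
    calc c.toNNReal ^ 2 * l ≤ (C * l⁻¹ + C * l⁻¹) * l := by gcongr
      _ = 2 * C * (l⁻¹ * l) := by ring
      _ = 2 * C := by rw [inv_mul_cancel₀ hl0, mul_one]
  rw [hl, mul_div_cancel₀ _ (pow_ne_zero 2 hc')] at h3
  exact absurd h3 (not_le.2 (lt_add_one _))

end Falconer

open MeasureTheory Metric Set

theorem stmt5 (d : ℕ) (hd : 3 ≤ d) (A : Set (EuclideanSpace ℝ (Fin d)))
    (hA : IsCompact A) (hdim : ENNReal.ofReal ((d : ℝ) / 2 + 5 / 12) < dimH A) :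
    0 < volume {r : ℝ | ∃ x ∈ A, ∃ y ∈ A, dist x y = r} := by
  have hd3 : (3 : ℝ) ≤ d := by exact_mod_cast hd
  obtain ⟨β, hβ1, hβ2⟩ := ENNReal.lt_iff_exists_nnreal_btwn.1 hdim
  have hβ : (d : ℝ) / 2 + 5 / 12 < β := by
    rwa [← ENNReal.ofReal_coe_nnreal, ENNReal.ofReal_lt_ofReal_iff_of_nonneg (by positivity)] at hβ1
  set α : ℝ := min β (d / 2 + 11 / 24) with hαdef
  have hα1 : (d : ℝ) / 2 + 5 / 12 < α := lt_min hβ (by linarith)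
  have hα2 : α < d / 2 + 1 / 2 := (min_le_right _ _).trans_lt (by linarith)
  have hα0 : 0 ≤ α := by linarith
  have hμ : μH[α] A ≠ 0 := by
    have h1 := hausdorffMeasure_of_lt_dimH (s := A) (d := α.toNNReal) (lt_of_le_of_lt (by
      rw [ENNReal.coe_le_coe]
      exact Real.toNNReal_le_iff_le_coe.2 (min_le_left _ _)) hβ2)
    rw [Real.coe_toNNReal _ hα0] at h1
    rw [h1]
    exact ENNReal.top_ne_zero
  obtain ⟨S, hS⟩ := Falconer.exists_shellBound hd hα1 hα2
  have := Falconer.volume_distances_ne_zero (by omega) (by linarith) (by linarith) (by linarith)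
    (by linarith) hS hA hμ
  refine pos_iff_ne_zero.2 fun h0 => this ?_
  convert h0 using 2
  ext r
  simp only [mem_image, mem_prod, Prod.exists, Set.mem_ofPred_eq]
  constructor
  · rintro ⟨x, y, ⟨hx, hy⟩, h⟩
    exact ⟨x, hx, y, hy, h⟩
  · rintro ⟨x, hx, y, hy, h⟩
    exact ⟨x, y, ⟨hx, hy⟩, h⟩
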